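/- Let Y be a two-sided 2-connected ladder over a field k, with h ≥ 1 lower inside corners and k ≥ 1 upper inside corners, such that no lower inside corner equals an upper inside corner. Assume that for every 2-connected ladder Z with fewer than h+k inside corners, no two of which coincide, every semidualizing R_2(Z)-module is isomorphic either to R_2(Z) or to a semidualizing R_2(Z)-module of finite injective dimension. Then R_2(Y) has at most four semidualizing modules up to isomorphism: among any five semidualizing R_2(Y)-modules, two are isomorphic. -/

import Mathlib

set_option maxHeartbeats 1000000
set_option synthInstance.maxHeartbeats 1000000

open CategoryTheory

namespace LadderDet

/-- The position `p` lies in the `m × n` grid `{1,…,m} × {1,…,n}`. -/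
def InGrid (m n : ℕ) (p : ℕ × ℕ) : Prop :=
  1 ≤ p.1 ∧ p.1 ≤ m ∧ 1 ≤ p.2 ∧ p.2 ≤ n

/-- `Y` is a ladder in the `m × n` grid. -/
def IsLadder (m n : ℕ) (Y : Set (ℕ × ℕ)) : Prop :=
  (∀ p ∈ Y, InGrid m n p) ∧
  ∀ i j p q : ℕ, (i, j) ∈ Y → (p, q) ∈ Y → i ≤ p → j ≤ q → (i, q) ∈ Y ∧ (p, j) ∈ Y

/-- A ladder together with the standard nontriviality assumptions:
`(1,n), (m,1) ∈ Y` and every row and every column of the grid meets `Y`. -/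
def StdLadder (m n : ℕ) (Y : Set (ℕ × ℕ)) : Prop :=
  IsLadder m n Y ∧ (1, n) ∈ Y ∧ (m, 1) ∈ Y ∧
  (∀ i, 1 ≤ i → i ≤ m → ∃ j, (i, j) ∈ Y) ∧
  (∀ j, 1 ≤ j → j ≤ n → ∃ i, (i, j) ∈ Y)

/-- Two positions differ by exactly `1` in exactly one coordinate. -/
def AdjStep (p q : ℕ × ℕ) : Prop :=
  (p.1 = q.1 ∧ (p.2 + 1 = q.2 ∨ q.2 + 1 = p.2)) ∨
  (p.2 = q.2 ∧ (p.1 + 1 = q.1 ∨ q.1 + 1 = p.1))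

/-- There is a path in `Y` from `p` to `q`. -/
def HasPath (Y : Set (ℕ × ℕ)) (p q : ℕ × ℕ) : Prop :=
  p ∈ Y ∧ q ∈ Y ∧
    Relation.ReflTransGen (fun a b => a ∈ Y ∧ b ∈ Y ∧ AdjStep a b) p q

/-- `Y` is path-connected. -/
def PathConnected (Y : Set (ℕ × ℕ)) : Prop :=
  ∀ p ∈ Y, ∀ q ∈ Y, HasPath Y p q

/-- `M` is (the set of entries of) a `t × t` minor of `Y`. -/
def IsMinor (t : ℕ) (Y : Set (ℕ × ℕ)) (M : Set (ℕ × ℕ)) : Prop :=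
  ∃ r c : Fin t → ℕ, StrictMono r ∧ StrictMono c ∧
    (∀ u v, (r u, c v) ∈ Y) ∧ M = {p | ∃ u v, p = (r u, c v)}

/-- `Y` is `t`-disconnected. -/
def TDisconnected (m n t : ℕ) (Y : Set (ℕ × ℕ)) : Prop :=
  ∃ Z₁ Z₂ : Set (ℕ × ℕ), Z₁.Nonempty ∧ Z₂.Nonempty ∧
    IsLadder m n Z₁ ∧ IsLadder m n Z₂ ∧ Z₁ ∩ Z₂ = ∅ ∧ Z₁ ∪ Z₂ = Y ∧
    ∀ M, IsMinor t Y M → M ⊆ Z₁ ∨ M ⊆ Z₂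

/-- `Y` is `t`-connected. -/
def TConnected (m n t : ℕ) (Y : Set (ℕ × ℕ)) : Prop := ¬ TDisconnected m n t Y

/-- `p` is a lower inside corner of `Y`. -/
def IsLowerCorner (Y : Set (ℕ × ℕ)) (p : ℕ × ℕ) : Prop :=
  p ∈ Y ∧ (p.1 - 1, p.2) ∈ Y ∧ (p.1, p.2 - 1) ∈ Y ∧ (p.1 - 1, p.2 - 1) ∉ Y

/-- `p` is an upper inside corner of `Y`. -/
def IsUpperCorner (Y : Set (ℕ × ℕ)) (p : ℕ × ℕ) : Prop :=
  p ∈ Y ∧ (p.1 + 1, p.2) ∈ Y ∧ (p.1, p.2 + 1) ∈ Y ∧ (p.1 + 1, p.2 + 1) ∉ Y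

/-- `Y` is one-sided: path-connected and with no lower or no upper inside corners. -/
def OneSided (Y : Set (ℕ × ℕ)) : Prop :=
  PathConnected Y ∧
  ((∀ p, ¬ IsLowerCorner Y p) ∨ (∀ p, ¬ IsUpperCorner Y p))

/-- `Y` is two-sided: path-connected with at least one lower and one upper inside corner. -/
def TwoSided (Y : Set (ℕ × ℕ)) : Prop :=
  PathConnected Y ∧ (∃ p, IsLowerCorner Y p) ∧ (∃ p, IsUpperCorner Y p)

section Algebra

variable (k : Type) [Field k]

/-- The `t × t` minor of the generic matrix determined by rows `r` and columns `c`,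
as an element of the polynomial ring `k[Y]`. -/
noncomputable def minorPoly {t : ℕ} {Y : Set (ℕ × ℕ)} (r c : Fin t → ℕ)
    (h : ∀ u v, (r u, c v) ∈ Y) : MvPolynomial Y k :=
  (Matrix.of fun u v : Fin t =>
    (MvPolynomial.X ⟨(r u, c v), h u v⟩ : MvPolynomial Y k)).det

/-- The ideal `I_t(Y) ⊆ k[Y]` generated by all `t × t` minors of `X` lying in `Y`. -/
noncomputable def minorIdeal (t : ℕ) (Y : Set (ℕ × ℕ)) : Ideal (MvPolynomial Y k) :=
  Ideal.span {f | ∃ (r c : Fin t → ℕ) (_ : StrictMono r) (_ : StrictMono c)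
    (h : ∀ u v, (r u, c v) ∈ Y), f = minorPoly k r c h}

/-- The ladder determinantal ring `R_t(Y) = k[Y]/I_t(Y)`. -/
abbrev LadderRing (t : ℕ) (Y : Set (ℕ × ℕ)) : Type :=
  MvPolynomial Y k ⧸ minorIdeal k t Y

/-- The residue `x_{ij}` of the variable `X_{ij}` in `R_t(Y)`. -/
noncomputable def xres (t : ℕ) {Y : Set (ℕ × ℕ)} (p : ℕ × ℕ) (hp : p ∈ Y) :
    LadderRing k t Y :=
  Ideal.Quotient.mk (minorIdeal k t Y) (MvPolynomial.X ⟨p, hp⟩)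

/-- The ideal of `R_2(Y)` generated by the residues of the variables in row `r`
(an ideal of type `𝔮`). -/
noncomputable def rowIdeal (Y : Set (ℕ × ℕ)) (r : ℕ) : Ideal (LadderRing k 2 Y) :=
  Ideal.span {z | ∃ q, ∃ h : (r, q) ∈ Y, z = xres k 2 (r, q) h}

/-- The ideal of `R_2(Y)` generated by the residues of the variables in column `b`
(an ideal of type `𝔮'`). -/
noncomputable def colIdeal (Y : Set (ℕ × ℕ)) (b : ℕ) : Ideal (LadderRing k 2 Y) :=
  Ideal.span {z | ∃ p, ∃ h : (p, b) ∈ Y, z = xres k 2 (p, b) h}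

/-- The ideal `𝔭` of `R_2(Y)` generated by the residues of the variables weakly
northwest of the position `(c, d)`. -/
noncomputable def cornerIdeal (Y : Set (ℕ × ℕ)) (c d : ℕ) : Ideal (LadderRing k 2 Y) :=
  Ideal.span {z | ∃ p q, ∃ h : (p, q) ∈ Y, p ≤ c ∧ q ≤ d ∧ z = xres k 2 (p, q) h}

end Algebra

/-- An ideal of `k[Y]` is a monomial ideal if it is generated by monomials. -/
def IsMonomialIdeal {k : Type} [Field k] {Y : Set (ℕ × ℕ)}
    (M : Ideal (MvPolynomial Y k)) : Prop :=
  ∃ S : Set (Y →₀ ℕ), M = Ideal.span ((fun d => MvPolynomial.monomial d (1 : k)) '' S)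

/-- A finitely generated module `C` over a commutative ring `R` is semidualizing if
the natural homothety map `R → Hom_R(C, C)` is bijective and `Ext^i_R(C, C) = 0` for
all `i ≥ 1`. -/
def IsSemidualizing {R : Type} [CommRing R] (C : ModuleCat.{0} R) : Prop :=
  Module.Finite R C ∧
  Function.Bijective (LinearMap.lsmul R C) ∧
  ∀ i : ℕ, 1 ≤ i →
    Subsingleton (((Ext R (ModuleCat.{0} R) i).obj (Opposite.op C)).obj C)

/-- `C` has finite injective dimension: for some `n`, `Ext^i_R(M, C) = 0` for all
modules `M` and all `i > n`. -/
def HasFiniteInjDim {R : Type} [CommRing R] (C : ModuleCat.{0} R) : Prop :=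
  ∃ n : ℕ, ∀ i : ℕ, n < i → ∀ M : ModuleCat.{0} R,
    Subsingleton (((Ext R (ModuleCat.{0} R) i).obj (Opposite.op M)).obj C)


section

section EVsec
variable {R : Type} [CommRing R]

/-- Vanishing of `Ext^n_R(X,Y)`. -/
def EV (R : Type) [CommRing R] (n : ℕ) (X Y : Type) [AddCommGroup X] [Module R X]
    [AddCommGroup Y] [Module R Y] : Prop :=
  Subsingleton (Abelian.Ext (ModuleCat.of R X) (ModuleCat.of R Y) n)

lemma ev_iff_resolution {X Y : ModuleCat.{0} R} (P : ProjectiveResolution X) (n : ℕ) :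
    Subsingleton (Abelian.Ext X Y (n+1)) ↔
    ∀ f : P.complex.X (n+1) ⟶ Y, P.complex.d (n+2) (n+1) ≫ f = 0 →
      ∃ g : P.complex.X n ⟶ Y, P.complex.d (n+1) n ≫ g = f := by
  constructor
  · intro h f hf
    exact (P.extMk_eq_zero_iff f (n+2) rfl hf n rfl).1 (Subsingleton.elim _ _)
  · intro h
    refine ⟨fun a b => ?_⟩
    have : ∀ a : Abelian.Ext X Y (n+1), a = 0 := by
      intro a
      obtain ⟨f, hf, rfl⟩ := P.extMk_surjective a (n+2) rfl
      exact (P.extMk_eq_zero_iff f (n+2) rfl hf n rfl).2 (h f hf)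
    rw [this a, this b]

lemma oldExt_iff_resolution {X Y : ModuleCat.{0} R} (P : ProjectiveResolution X) (n : ℕ) :
    Subsingleton (((Ext R (ModuleCat.{0} R) (n+1)).obj (Opposite.op X)).obj Y) ↔
    ∀ f : P.complex.X (n+1) ⟶ Y, P.complex.d (n+2) (n+1) ≫ f = 0 →
      ∃ g : P.complex.X n ⟶ Y, P.complex.d (n+1) n ≫ g = f := by
  rw [← ModuleCat.isZero_iff_subsingleton, (P.isoExt (R := R) (n+1) Y).isZero_iff,
    ← HomologicalComplex.exactAt_iff_isZero_homology,
    HomologicalComplex.exactAt_iff' _ n (n+1) (n+2) (by simp) (by simp),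
    ShortComplex.moduleCat_exact_iff]
  rfl

lemma oldExt_iff_EV (C D : ModuleCat.{0} R) (i : ℕ) (hi : 1 ≤ i) :
    Subsingleton (((Ext R (ModuleCat.{0} R) i).obj (Opposite.op C)).obj D) ↔ EV R i C D := by
  obtain ⟨n, rfl⟩ : ∃ n, i = n + 1 := ⟨i - 1, by omega⟩
  have P := ProjectiveResolution.of C
  rw [oldExt_iff_resolution P n]
  exact (ev_iff_resolution (X := C) (Y := D) P n).symm

variable {A B C X Y : Type} [AddCommGroup A] [Module R A] [AddCommGroup B] [Module R B]
  [AddCommGroup C] [Module R C] [AddCommGroup X] [Module R X] [AddCommGroup Y] [Module R Y]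

/-- The short complex attached to an exact pair. -/
abbrev sesC (f : A →ₗ[R] B) (g : B →ₗ[R] C) (h : Function.Exact f g) :
    ShortComplex (ModuleCat.{0} R) :=
  ShortComplex.mk (ModuleCat.ofHom f) (ModuleCat.ofHom g) (by
    ext x; exact h.apply_apply_eq_zero x)

lemma ses_exact {f : A →ₗ[R] B} {g : B →ₗ[R] C} (hf : Function.Injective f)
    (h : Function.Exact f g) (hg : Function.Surjective g) : (sesC f g h).ShortExact :=
  ModuleCat.shortComplex_shortExact _ h hf hg

lemma EV.intro {n : ℕ} (h : ∀ a : Abelian.Ext (ModuleCat.of R X) (ModuleCat.of R Y) n, a = 0) :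
    EV R n X Y := ⟨fun a b => by rw [h a, h b]⟩

lemma EV.elim {n : ℕ} (h : EV R n X Y) (a : Abelian.Ext (ModuleCat.of R X) (ModuleCat.of R Y) n) :
    a = 0 := by
  unfold EV at h
  exact Subsingleton.elim _ _

lemma ev_proj [Module.Projective R X] (n : ℕ) (hn : 1 ≤ n) : EV R n X Y := by
  obtain ⟨n, rfl⟩ : ∃ k, n = k + 1 := ⟨n - 1, by omega⟩
  haveI : Projective (ModuleCat.of R X) := ModuleCat.projective_of_categoryTheory_projective _
  exact EV.intro fun a => a.eq_zero_of_projective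

lemma ev_zero_iff : EV R 0 X Y ↔ ∀ f : X →ₗ[R] Y, f = 0 := by
  constructor
  · intro h f
    have := h.elim (Abelian.Ext.mk₀ (ModuleCat.ofHom f))
    rw [Abelian.Ext.mk₀_eq_zero_iff] at this
    simpa using congrArg ModuleCat.Hom.hom this
  · intro h
    refine EV.intro fun a => ?_
    obtain ⟨f, rfl⟩ := Abelian.Ext.mk₀_bijective _ _ |>.2 a
    rw [Abelian.Ext.mk₀_eq_zero_iff]
    ext x
    rw [h f.hom]; rfl

section LES
variable {f : A →ₗ[R] B} {g : B →ₗ[R] C}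

lemma ev_cov_mid (hf : Function.Injective f)
    (h : Function.Exact f g) (hg : Function.Surjective g)
    (n : ℕ) (h1 : EV R n X A) (h3 : EV R n X C) : EV R n X B := by
  refine EV.intro fun a => ?_
  obtain ⟨b, rfl⟩ := Abelian.Ext.covariant_sequence_exact₂ _ (ses_exact hf h hg) a (h3.elim _)
  rw [h1.elim b, Abelian.Ext.zero_comp]

lemma ev_cov_left (hf : Function.Injective f)
    (h : Function.Exact f g) (hg : Function.Surjective g)
    (n : ℕ) (h1 : EV R n X C) (h3 : EV R (n+1) X B) : EV R (n+1) X A := by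
  refine EV.intro fun a => ?_
  obtain ⟨b, rfl⟩ := Abelian.Ext.covariant_sequence_exact₁ _ (ses_exact hf h hg) a (h3.elim _) rfl
  rw [h1.elim b, Abelian.Ext.zero_comp]

lemma ev_cov_right (hf : Function.Injective f)
    (h : Function.Exact f g) (hg : Function.Surjective g)
    (n : ℕ) (h1 : EV R n X B) (h3 : EV R (n+1) X A) : EV R n X C := by
  refine EV.intro fun a => ?_
  obtain ⟨b, rfl⟩ := Abelian.Ext.covariant_sequence_exact₃ _ (ses_exact hf h hg) a rfl (h3.elim _)
  rw [h1.elim b, Abelian.Ext.zero_comp]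

lemma ev_con_mid (hf : Function.Injective f)
    (h : Function.Exact f g) (hg : Function.Surjective g)
    (n : ℕ) (h1 : EV R n A Y) (h3 : EV R n C Y) : EV R n B Y := by
  refine EV.intro fun a => ?_
  obtain ⟨b, rfl⟩ := Abelian.Ext.contravariant_sequence_exact₂ (ses_exact hf h hg) _ a (h1.elim _)
  rw [h3.elim b, Abelian.Ext.comp_zero]

lemma ev_con_left (hf : Function.Injective f)
    (h : Function.Exact f g) (hg : Function.Surjective g)
    (n : ℕ) (h1 : EV R n B Y) (h3 : EV R (n+1) C Y) : EV R n A Y := by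
  refine EV.intro fun a => ?_
  obtain ⟨b, rfl⟩ := Abelian.Ext.contravariant_sequence_exact₁ (ses_exact hf h hg) _ a
    (Nat.add_comm 1 n) (h3.elim _)
  rw [h1.elim b, Abelian.Ext.comp_zero]

lemma ev_con_right (hf : Function.Injective f)
    (h : Function.Exact f g) (hg : Function.Surjective g)
    (n : ℕ) (h1 : EV R n A Y) (h3 : EV R (n+1) B Y) : EV R (n+1) C Y := by
  refine EV.intro fun a => ?_
  obtain ⟨b, rfl⟩ := Abelian.Ext.contravariant_sequence_exact₃ (ses_exact hf h hg) _ a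
    (h3.elim _) (Nat.add_comm 1 n)
  rw [h1.elim b, Abelian.Ext.comp_zero]

lemma ev_lift (hf : Function.Injective f)
    (h : Function.Exact f g) (hg : Function.Surjective g)
    (h1 : EV R 1 X A) (φ : X →ₗ[R] C) : ∃ ψ : X →ₗ[R] B, g ∘ₗ ψ = φ := by
  obtain ⟨b, hb⟩ := Abelian.Ext.covariant_sequence_exact₃ _ (ses_exact hf h hg)
    (Abelian.Ext.mk₀ (ModuleCat.ofHom φ)) (n₁ := 1) rfl (h1.elim _)
  obtain ⟨ψ, rfl⟩ := Abelian.Ext.mk₀_bijective _ _ |>.2 b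
  rw [Abelian.Ext.mk₀_comp_mk₀] at hb
  have := (Abelian.Ext.mk₀_bijective _ _).1 hb
  exact ⟨ψ.hom, by simpa using congrArg ModuleCat.Hom.hom this⟩

lemma ev_extend (hf : Function.Injective f)
    (h : Function.Exact f g) (hg : Function.Surjective g)
    (h1 : EV R 1 C Y) (φ : A →ₗ[R] Y) : ∃ ψ : B →ₗ[R] Y, ψ ∘ₗ f = φ := by
  obtain ⟨b, hb⟩ := Abelian.Ext.contravariant_sequence_exact₁ (ses_exact hf h hg) _
    (Abelian.Ext.mk₀ (ModuleCat.ofHom φ)) (n₁ := 1) rfl (h1.elim _)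
  obtain ⟨ψ, rfl⟩ := Abelian.Ext.mk₀_bijective _ _ |>.2 b
  rw [Abelian.Ext.mk₀_comp_mk₀] at hb
  have := (Abelian.Ext.mk₀_bijective _ _).1 hb
  exact ⟨ψ.hom, by simpa using congrArg ModuleCat.Hom.hom this⟩

lemma ev_one_of_extend (hf : Function.Injective f)
    (h : Function.Exact f g) (hg : Function.Surjective g)
    (hB : EV R 1 B Y) (he : ∀ φ : A →ₗ[R] Y, ∃ ψ : B →ₗ[R] Y, ψ ∘ₗ f = φ) :
    EV R 1 C Y := by
  refine EV.intro fun a => ?_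
  obtain ⟨b, rfl⟩ := Abelian.Ext.contravariant_sequence_exact₃ (ses_exact hf h hg) _ a
    (hB.elim _) (n₀ := 0) rfl
  obtain ⟨φ, rfl⟩ := Abelian.Ext.mk₀_bijective _ _ |>.2 b
  obtain ⟨ψ, hψ⟩ := he φ.hom
  have : φ = (sesC f g h).f ≫ ModuleCat.ofHom ψ := by
    ext x; exact (LinearMap.congr_fun hψ x).symm
  rw [this, ← Abelian.Ext.mk₀_comp_mk₀, ← Abelian.Ext.comp_assoc (h₁₂ := rfl) (h₂₃ := rfl) (h := rfl),
    (ses_exact hf h hg).extClass_comp, Abelian.Ext.zero_comp]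
end LES

lemma ev_retract_left {X' : Type} [AddCommGroup X'] [Module R X'] (i : X →ₗ[R] X')
    (r : X' →ₗ[R] X) (hr : r ∘ₗ i = LinearMap.id) (n : ℕ) (h : EV R n X' Y) : EV R n X Y := by
  refine EV.intro fun a => ?_
  have : (Abelian.Ext.mk₀ (ModuleCat.ofHom i)).comp
      ((Abelian.Ext.mk₀ (ModuleCat.ofHom r)).comp a (zero_add n)) (zero_add n) = a := by
    rw [Abelian.Ext.mk₀_comp_mk₀_assoc, ← ModuleCat.ofHom_comp, hr]
    exact Abelian.Ext.mk₀_id_comp a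
  rw [← this, h.elim ((Abelian.Ext.mk₀ (ModuleCat.ofHom r)).comp a (zero_add n)),
    Abelian.Ext.comp_zero]

lemma ev_retract_right {Y' : Type} [AddCommGroup Y'] [Module R Y'] (i : Y →ₗ[R] Y')
    (r : Y' →ₗ[R] Y) (hr : r ∘ₗ i = LinearMap.id) (n : ℕ) (h : EV R n X Y') : EV R n X Y := by
  refine EV.intro fun a => ?_
  have : (a.comp (Abelian.Ext.mk₀ (ModuleCat.ofHom i)) (add_zero n)).comp
      (Abelian.Ext.mk₀ (ModuleCat.ofHom r)) (add_zero n) = a := by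
    rw [Abelian.Ext.comp_assoc (h₂₃ := zero_add 0) (h := by simp), Abelian.Ext.mk₀_comp_mk₀, ← ModuleCat.ofHom_comp, hr]
    exact Abelian.Ext.comp_mk₀_id a
  rw [← this, h.elim (a.comp (Abelian.Ext.mk₀ (ModuleCat.ofHom i)) (add_zero n)),
    Abelian.Ext.zero_comp]

lemma ev_congr {X' Y' : Type} [AddCommGroup X'] [Module R X'] [AddCommGroup Y'] [Module R Y']
    (e : X ≃ₗ[R] X') (e' : Y ≃ₗ[R] Y') (n : ℕ) (h : EV R n X Y) : EV R n X' Y' := by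
  refine ev_retract_right e'.symm.toLinearMap e'.toLinearMap (by ext; simp) n ?_
  exact ev_retract_left e.symm.toLinearMap e.toLinearMap (by ext; simp) n h

/-- Dimension shifting. -/
lemma ev_shift {f : A →ₗ[R] B} {g : B →ₗ[R] C} (hf : Function.Injective f)
    (h : Function.Exact f g) (hg : Function.Surjective g) [Module.Projective R B] (n : ℕ) :
    EV R (n+2) C Y ↔ EV R (n+1) A Y :=
  ⟨fun H => ev_con_left hf h hg (n+1) (ev_proj _ (by omega)) H,
   fun H => ev_con_right hf h hg (n+1) H (ev_proj _ (by omega))⟩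

lemma ev_one_iff {f : A →ₗ[R] B} {g : B →ₗ[R] C} (hf : Function.Injective f)
    (h : Function.Exact f g) (hg : Function.Surjective g) [Module.Projective R B] :
    EV R 1 C Y ↔ ∀ φ : A →ₗ[R] Y, ∃ ψ : B →ₗ[R] Y, ψ ∘ₗ f = φ :=
  ⟨fun H => ev_extend hf h hg H, ev_one_of_extend hf h hg (ev_proj _ le_rfl)⟩

end EVsec

end

section

set_option linter.style.haveILetI false

section Loc
variable {A : Type} [CommRing A] [IsNoetherianRing A] (S : Submonoid A)
  {A' : Type} [CommRing A'] [Algebra A A'] [IsLocalization S A']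

lemma loc_hom_lift {X Y X' Y' : Type} [AddCommGroup X] [Module A X] [AddCommGroup Y] [Module A Y]
    [AddCommGroup X'] [Module A X'] [AddCommGroup Y'] [Module A Y']
    [Module.Finite A X]
    (lX : X →ₗ[A] X') (lY : Y →ₗ[A] Y') [IsLocalizedModule S lX] [IsLocalizedModule S lY]
    (φ : X' →ₗ[A] Y') : ∃ (ψ : X →ₗ[A] Y) (s : S), ∀ x, s • φ (lX x) = lY (ψ x) := by
  haveI : Module.FinitePresentation A X := Module.finitePresentation_of_finite A X
  obtain ⟨h', s, e⟩ := Module.FinitePresentation.exists_lift_of_isLocalizedModule S lY (φ ∘ₗ lX)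
  exact ⟨h', s, fun x => (LinearMap.congr_fun e x).symm⟩

lemma ev_loc (n : ℕ) : ∀ {X Y X' Y' : Type} [AddCommGroup X] [Module A X] [AddCommGroup Y]
    [Module A Y] [AddCommGroup X'] [Module A X'] [AddCommGroup Y'] [Module A Y']
    [Module A' X'] [Module A' Y'] [IsScalarTower A A' X'] [IsScalarTower A A' Y']
    [Module.Finite A X]
    (lX : X →ₗ[A] X') (lY : Y →ₗ[A] Y') [IsLocalizedModule S lX] [IsLocalizedModule S lY],
    EV A (n+1) X Y → EV A' (n+1) X' Y' := by
  induction n with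
  | zero =>
    intro X Y X' Y' _ _ _ _ _ _ _ _ _ _ _ _ _ lX lY _ _ h
    obtain ⟨k, p, hp⟩ := Module.Finite.exists_fin' A X
    let lF : (Fin k → A) →ₗ[A] (Fin k → A') :=
      LinearMap.pi fun i => (Algebra.linearMap A A') ∘ₗ LinearMap.proj i
    haveI : IsLocalizedModule S lF := IsLocalizedModule.pi S (fun _ : Fin k => Algebra.linearMap A A')
    let p' := (IsLocalizedModule.map S lF lX p).extendScalarsOfIsLocalization S A'
    have hp' : Function.Surjective p' := IsLocalizedModule.map_surjective S lF lX p hp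
    have hpe : ∀ x, p' (lF x) = lX (p x) := fun x => IsLocalizedModule.map_apply S lF lX p x
    haveI := LinearMap.toKerLocalized_isLocalizedModule A' S lF lX p
    rw [ev_one_iff (f := (LinearMap.ker p).subtype) (g := p) (Submodule.subtype_injective _)
      (LinearMap.exact_subtype_ker_map p) hp] at h
    rw [ev_one_iff (f := (LinearMap.ker p').subtype) (g := p') (Submodule.subtype_injective _)
      (LinearMap.exact_subtype_ker_map p') hp']
    intro φ
    obtain ⟨ψ, s, hs⟩ := loc_hom_lift S (LinearMap.toKerIsLocalized S lF lX p) lY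
      (φ.restrictScalars A)
    obtain ⟨Ψ, hΨ⟩ := h ψ
    have hu := IsLocalization.map_units A' s
    obtain ⟨u, hu⟩ := hu
    let Ψ' := (IsLocalizedModule.map S lF lY Ψ).extendScalarsOfIsLocalization S A'
    refine ⟨(↑u⁻¹ : A') • Ψ', ?_⟩
    have key : (Ψ' ∘ₗ (LinearMap.ker p').subtype) = (u : A') • φ := by
      have : ((Ψ' ∘ₗ (LinearMap.ker p').subtype).restrictScalars A) = ((u : A') • φ).restrictScalars A := by
        refine IsLocalizedModule.ext S (LinearMap.toKerIsLocalized S lF lX p)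
          (IsLocalizedModule.map_units lY) ?_
        ext x
        have h1 : Ψ' (lF x) = lY (Ψ x) := IsLocalizedModule.map_apply S lF lY Ψ x
        have h2 := hs x
        have h3 : Ψ x = ψ x := LinearMap.congr_fun hΨ x
        calc Ψ' (lF x) = lY (ψ x) := by rw [h1, h3]
          _ = _ := by
            rw [← h2]
            change s • φ _ = (u : A') • φ _
            rw [hu]
            exact (algebraMap_smul A' (s : A) _).symm
      ext x
      exact LinearMap.congr_fun this x
    rw [LinearMap.smul_comp, key, smul_smul]
    simp
  | succ n ih =>
    intro X Y X' Y' _ _ _ _ _ _ _ _ _ _ _ _ _ lX lY _ _ h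
    obtain ⟨k, p, hp⟩ := Module.Finite.exists_fin' A X
    let lF : (Fin k → A) →ₗ[A] (Fin k → A') :=
      LinearMap.pi fun i => (Algebra.linearMap A A') ∘ₗ LinearMap.proj i
    haveI : IsLocalizedModule S lF := IsLocalizedModule.pi S (fun _ : Fin k => Algebra.linearMap A A')
    let p' := (IsLocalizedModule.map S lF lX p).extendScalarsOfIsLocalization S A'
    have hp' : Function.Surjective p' := IsLocalizedModule.map_surjective S lF lX p hp
    let lK : LinearMap.ker p →ₗ[A] LinearMap.ker p' := LinearMap.toKerIsLocalized S lF lX p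
    haveI : IsLocalizedModule S lK := LinearMap.toKerLocalized_isLocalizedModule A' S lF lX p
    rw [ev_shift (f := (LinearMap.ker p).subtype) (g := p) (Submodule.subtype_injective _)
      (LinearMap.exact_subtype_ker_map p) hp] at h
    rw [ev_shift (f := (LinearMap.ker p').subtype) (g := p') (Submodule.subtype_injective _)
      (LinearMap.exact_subtype_ker_map p') hp']
    exact ih lK lY h
end Loc

lemma exists_free_cover (A : Type) [CommRing A] (X : Type) [AddCommGroup X] [Module A X] :
    ∃ (F : Type) (_ : AddCommGroup F) (_ : Module A F) (_ : Module.Free A F) (p : F →ₗ[A] X),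
      Function.Surjective p :=
  ⟨X →₀ A, inferInstance, inferInstance, inferInstance, Finsupp.linearCombination A (id : X → X),
    Finsupp.linearCombination_id_surjective A X⟩

section Flat
open TensorProduct
variable {A : Type} [CommRing A] {B : Type} [CommRing B] [Algebra A B] [Module.Flat A B]

lemma ev_flat (n : ℕ) : ∀ {X N : Type} [AddCommGroup X] [Module A X] [AddCommGroup N]
    [Module A N] [Module B N] [IsScalarTower A B N],
    EV B (n+1) (B ⊗[A] X) N → EV A (n+1) X N := by
  induction n with
  | zero =>
    intro X N _ _ _ _ _ _ h
    obtain ⟨F, _, _, _, p, hp⟩ := exists_free_cover A X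
    have ex := LinearMap.exact_subtype_ker_map p
    rw [ev_one_iff (Submodule.subtype_injective (LinearMap.ker p)) ex hp]
    have i1 : Function.Injective ((LinearMap.ker p).subtype.baseChange B) :=
      Module.Flat.lTensor_preserves_injective_linearMap _ (Submodule.subtype_injective _)
    rw [ev_one_iff (f := (LinearMap.ker p).subtype.baseChange B) (g := p.baseChange B) i1
      (lTensor_exact B ex hp) (LinearMap.lTensor_surjective B hp)] at h
    intro φ
    obtain ⟨ψ, hψ⟩ := h (φ.liftBaseChange B)
    refine ⟨(ψ.restrictScalars A) ∘ₗ (TensorProduct.mk A B F 1), ?_⟩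
    refine LinearMap.ext fun x => ?_
    have := LinearMap.congr_fun hψ (1 ⊗ₜ x)
    simpa using this
  | succ n ih =>
    intro X N _ _ _ _ _ _ h
    obtain ⟨F, _, _, _, p, hp⟩ := exists_free_cover A X
    have ex := LinearMap.exact_subtype_ker_map p
    rw [ev_shift (Submodule.subtype_injective (LinearMap.ker p)) ex hp]
    have i1 : Function.Injective ((LinearMap.ker p).subtype.baseChange B) :=
      Module.Flat.lTensor_preserves_injective_linearMap _ (Submodule.subtype_injective _)
    rw [ev_shift (f := (LinearMap.ker p).subtype.baseChange B) (g := p.baseChange B) i1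
      (lTensor_exact B ex hp) (LinearMap.lTensor_surjective B hp)] at h
    exact ih h
end Flat

/-- Semidualizing, in terms of `EV`. -/
def SD (R : Type) [CommRing R] (C : Type) [AddCommGroup C] [Module R C] : Prop :=
  Module.Finite R C ∧ Function.Bijective (LinearMap.lsmul R C) ∧ ∀ i : ℕ, EV R (i+1) C C

/-- Finite injective dimension tested on f.g. modules. -/
def FID (R : Type) [CommRing R] (C : Type) [AddCommGroup C] [Module R C] : Prop :=
  ∃ n : ℕ, ∀ i : ℕ, n ≤ i → ∀ (X : Type) [AddCommGroup X] [Module R X] [Module.Finite R X],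
    EV R (i+1) X C

lemma sd_of_isSemi {R : Type} [CommRing R] (C : ModuleCat.{0} R) (h : IsSemidualizing C) :
    SD R C := ⟨h.1, h.2.1, fun i => (oldExt_iff_EV C C _ (by omega)).1 (h.2.2 (i+1) (by omega))⟩

lemma isSemi_of_sd {R : Type} [CommRing R] {C : Type} [AddCommGroup C] [Module R C] (h : SD R C) :
    IsSemidualizing (ModuleCat.of R C) := by
  refine ⟨h.1, h.2.1, fun i hi => ?_⟩
  obtain ⟨n, rfl⟩ : ∃ n, i = n + 1 := ⟨i - 1, by omega⟩
  exact (oldExt_iff_EV (ModuleCat.of R C) (ModuleCat.of R C) _ hi).2 (h.2.2 n)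

lemma fid_of_hasFID {R : Type} [CommRing R] (C : ModuleCat.{0} R) (h : HasFiniteInjDim C) :
    FID R C := by
  obtain ⟨n, hn⟩ := h
  exact ⟨n, fun i hi X _ _ _ => (oldExt_iff_EV (ModuleCat.of R X) C _ (by omega)).1
    (hn (i+1) (by omega) (ModuleCat.of R X))⟩

section
variable {R : Type} [CommRing R] {C D : Type} [AddCommGroup C] [Module R C]
  [AddCommGroup D] [Module R D]

lemma SD.congr (e : C ≃ₗ[R] D) (h : SD R C) : SD R D := by
  obtain ⟨h1, h2, h3⟩ := h
  refine ⟨Module.Finite.equiv e, ⟨?_, ?_⟩, fun i => ev_congr e e _ (h3 i)⟩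
  · intro a b hab
    refine h2.1 (LinearMap.ext fun c => ?_)
    have := LinearMap.congr_fun hab (e c)
    simp only [LinearMap.lsmul_apply, ← map_smul] at this
    exact e.injective this
  · intro φ
    obtain ⟨r, hr⟩ := h2.2 (e.symm.toLinearMap ∘ₗ φ ∘ₗ e.toLinearMap)
    refine ⟨r, LinearMap.ext fun d => ?_⟩
    have := LinearMap.congr_fun hr (e.symm d)
    simp only [LinearMap.lsmul_apply, LinearMap.comp_apply, LinearEquiv.coe_coe, LinearEquiv.apply_symm_apply] at this
    rw [← map_smul] at this
    exact e.symm.injective this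

lemma FID.congr (e : C ≃ₗ[R] D) (h : FID R C) : FID R D := by
  obtain ⟨n, hn⟩ := h
  exact ⟨n, fun i hi X _ _ _ => ev_congr (LinearEquiv.refl R X) e _ (hn i hi X)⟩

lemma SD.scalar (h : SD R C) (φ : C →ₗ[R] C) : ∃ r : R, ∀ c, φ c = r • c := by
  obtain ⟨r, hr⟩ := h.2.1.2 φ
  exact ⟨r, fun c => by rw [← hr]; rfl⟩

lemma SD.faithful (h : SD R C) (r : R) (hr : ∀ c : C, r • c = 0) : r = 0 :=
  h.2.1.1 (LinearMap.ext fun c => by simpa using hr c)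

end

section Loc2
variable {A : Type} [CommRing A] [IsNoetherianRing A]
  {A' : Type} [CommRing A'] [Algebra A A']
  {C C' : Type} [AddCommGroup C] [Module A C] [AddCommGroup C'] [Module A C'] [Module A' C']
  [IsScalarTower A A' C']

lemma SD.loc (S : Submonoid A)
    (l : C →ₗ[A] C') [IsLocalization S A'] [IsLocalizedModule S l] (h : SD A C) : SD A' C' := by
  have fC := h.1
  have ff : Module.Finite A' C' := Module.Finite.of_isLocalizedModule S l
  refine ⟨ff, ⟨?_, ?_⟩, fun i => ev_loc S i l l (h.2.2 i)⟩
  · rw [injective_iff_map_eq_zero]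
    intro a ha
    obtain ⟨⟨r, s⟩, rfl⟩ := IsLocalization.mk'_surjective S a |>.imp fun x hx => hx
    rw [IsLocalization.mk'_eq_zero_iff]
    have h0 : ∀ c : C, ∃ t : S, t • (r • c) = 0 := by
      intro c
      have h1 : r • l c = 0 := by
        have := LinearMap.congr_fun ha (l c)
        simp only [LinearMap.lsmul_apply, LinearMap.zero_apply, Function.uncurry_apply_pair] at this
        have h2 := congrArg (fun z => s • z) this
        simp only [smul_zero] at h2
        rw [Submonoid.smul_def, ← algebraMap_smul A' (s : A), smul_smul, IsLocalization.mk'_spec' , algebraMap_smul] at h2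
        exact h2
      rw [← map_smul] at h1
      exact (IsLocalizedModule.eq_zero_iff S l).1 h1
    obtain ⟨t, ht⟩ : ∃ t : S, ∀ c : C, (t : A) • (r • c) = 0 := by
      obtain ⟨t, ht⟩ := (Module.Finite.exists_smul_of_comp_eq_of_isLocalizedModule S l
        (LinearMap.lsmul A C r) 0 (by
          ext c
          obtain ⟨t, ht⟩ := h0 c
          simpa using (IsLocalizedModule.eq_zero_iff S l).2 ⟨t, ht⟩))
      exact ⟨t, fun c => (LinearMap.congr_fun ht c).trans (smul_zero (t : A))⟩
    refine ⟨t, h.faithful _ fun c => ?_⟩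
    rw [mul_smul]; exact ht c
  · intro φ
    obtain ⟨ψ, s, hs⟩ := loc_hom_lift S l l (φ.restrictScalars A)
    obtain ⟨r, hr⟩ := h.scalar ψ
    refine ⟨IsLocalization.mk' A' r s, ?_⟩
    have : (LinearMap.lsmul A' C' (IsLocalization.mk' A' r s)).restrictScalars A = φ.restrictScalars A := by
      refine IsLocalizedModule.ext S l (IsLocalizedModule.map_units l) ?_
      ext c
      have h1 := hs c
      rw [hr, map_smul] at h1
      obtain ⟨u, hu⟩ := IsLocalization.map_units A' s
      have h2 : (u : A') • φ (l c) = (u : A') • ((IsLocalization.mk' A' r s) • l c) := by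
        rw [smul_smul, hu, IsLocalization.mk'_spec', algebraMap_smul, algebraMap_smul, ← h1]
        rfl
      have h3 := congrArg (fun z => (↑u⁻¹ : A') • z) h2
      simp only [smul_smul, Units.inv_mul, one_smul] at h3
      simpa using h3.symm
    exact LinearMap.ext fun c => LinearMap.congr_fun this c

lemma FID.loc (S : Submonoid A)
    (l : C →ₗ[A] C') [IsLocalization S A'] [IsLocalizedModule S l] (h : FID A C) : FID A' C' := by
  obtain ⟨n, hn⟩ := h
  refine ⟨n, fun i hi X _ _ _ => ?_⟩
  letI : Module A X := Module.compHom X (algebraMap A A')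
  haveI : IsScalarTower A A' X := ⟨fun a b x => by
    rw [Algebra.smul_def, mul_smul]; rfl⟩
  obtain ⟨k, g, hg⟩ := Module.Finite.exists_fin (R := A') (M := X)
  let X0 : Submodule A X := Submodule.span A (Set.range g)
  haveI : Module.Finite A X0 := Module.Finite.span_of_finite A (Set.finite_range g)
  haveI : IsLocalizedModule S X0.subtype := by
    constructor
    · intro s
      rw [Module.End.isUnit_iff]
      obtain ⟨u, hu⟩ := IsLocalization.map_units A' s
      constructor
      · intro a b hab
        have hab : (u : A') • a = (u : A') • b := by rw [hu]; exact hab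
        have h3 := congrArg (fun z => (↑u⁻¹ : A') • z) hab
        simpa only [smul_smul, Units.inv_mul, one_smul] using h3
      · intro b
        refine ⟨(↑u⁻¹ : A') • b, ?_⟩
        change algebraMap A A' s • (↑u⁻¹ : A') • b = b
        rw [← hu, smul_smul]; simp
    · intro y
      have : y ∈ Submodule.span A' (Set.range g) := by rw [hg]; trivial
      induction this using Submodule.span_induction with
      | mem x hx => exact ⟨(⟨x, Submodule.subset_span hx⟩, 1), by simp⟩
      | zero => exact ⟨(0, 1), by simp⟩
      | add x y _ _ hx hy =>
        obtain ⟨⟨a, s⟩, ha⟩ := hx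
        obtain ⟨⟨b, t⟩, hb⟩ := hy
        refine ⟨(t • a + s • b, s * t), ?_⟩
        simp only [Submonoid.smul_def, Submonoid.coe_mul, map_add, map_smul] at *
        rw [smul_add, ← ha, ← hb, mul_smul, mul_smul, smul_comm (t : A)  (s : A) x]
      | smul r x _ hx =>
        obtain ⟨⟨a, s⟩, ha⟩ := hx
        obtain ⟨⟨c, t⟩, hc⟩ := IsLocalization.mk'_surjective S r |>.imp fun x hx => hx
        refine ⟨(c • a, t * s), ?_⟩
        simp only [Submonoid.smul_def, Submonoid.coe_mul, map_smul, Function.uncurry_apply_pair] at *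
        rw [← hc, ← ha, mul_smul, smul_comm (s : A), ← algebraMap_smul A' (t : A), smul_smul,
          IsLocalization.mk'_spec', algebraMap_smul]
    · intro a b hab
      exact ⟨1, by rw [Subtype.ext hab]⟩
  exact ev_loc S i X0.subtype l (hn i hi X0)
end Loc2

end

section

lemma exists_hom_ne_zero {R : Type} [CommRing R] [IsNoetherianRing R] {C T : Type}
    [AddCommGroup C] [Module R C] [AddCommGroup T] [Module R T] [Module.Finite R C]
    [Module.Finite R T] (hC : ∀ r : R, (∀ c : C, r • c = 0) → r = 0)
    (h : ∀ φ : C →ₗ[R] T, φ = 0) : ∀ t : T, t = 0 := by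
  have : Subsingleton (C →ₗ[R] T) := ⟨fun a b => by rw [h a, h b]⟩
  obtain ⟨r, hr, hr'⟩ := (IsSMulRegular.subsingleton_linearMap_iff (R := R) (M := T) (N := C)).1 this
  have hr0 : r = 0 := hC r fun c => Module.mem_annihilator.1 hr c
  subst hr0
  intro t
  exact hr' (by simp)

section PJsec
variable {R : Type} [CommRing R] {C : Type} [AddCommGroup C] [Module R C]

/-- The package of properties of `C/JC` for semidualizing `C`. -/
structure PJ (C : Type) [AddCommGroup C] [Module R C] (J : Ideal R) : Prop where
  ev : ∀ i, EV R (i+1) C (C ⧸ (J • ⊤ : Submodule R C))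
  sc : ∀ φ : C →ₗ[R] (C ⧸ (J • ⊤ : Submodule R C)), ∃ r : R, ∀ c,
    φ c = Submodule.Quotient.mk (r • c)
  mem : ∀ s : R, (∀ c : C, s • c ∈ (J • ⊤ : Submodule R C)) → s ∈ J

lemma PJ.bot (h : SD R C) : PJ C (⊥ : Ideal R) := by
  have hb : ((⊥ : Ideal R) • ⊤ : Submodule R C) = ⊥ := by simp
  let e : C ≃ₗ[R] (C ⧸ ((⊥ : Ideal R) • ⊤ : Submodule R C)) :=
    (Submodule.quotEquivOfEqBot _ hb).symm
  have he : ∀ c, e c = Submodule.Quotient.mk c := fun c => rfl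
  refine ⟨fun i => ev_congr (LinearEquiv.refl R C) e _ (h.2.2 i), fun φ => ?_, fun s hs => ?_⟩
  · obtain ⟨r, hr⟩ := h.scalar (e.symm.toLinearMap ∘ₗ φ)
    refine ⟨r, fun c => ?_⟩
    rw [← he, ← hr]; simp
  · rw [hb] at hs
    exact h.faithful s fun c => by simpa using hs c

lemma PJ.reg [IsNoetherianRing R] (h : SD R C) {J : Ideal R} (hJ : PJ C J) (x : R)
    (hx : ∀ r, x * r ∈ J → r ∈ J) (c : C) (hc : x • c ∈ (J • ⊤ : Submodule R C)) :
    c ∈ (J • ⊤ : Submodule R C) := by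
  have := h.1
  let T : Submodule R (C ⧸ (J • ⊤ : Submodule R C)) := LinearMap.ker (LinearMap.lsmul R _ x)
  have hT : ∀ t : T, t = 0 := by
    refine exists_hom_ne_zero (C := C) h.faithful fun φ => ?_
    obtain ⟨r, hr⟩ := hJ.sc (T.subtype ∘ₗ φ)
    have hrJ : r ∈ J := by
      refine hx r (hJ.mem _ fun c => ?_)
      have h1 : x • (φ c : C ⧸ (J • ⊤ : Submodule R C)) = 0 := (φ c).2
      have h2 := hr c
      simp only [LinearMap.comp_apply, Submodule.subtype_apply] at h2
      rw [h2, ← Submodule.Quotient.mk_smul, Submodule.Quotient.mk_eq_zero] at h1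
      rwa [mul_smul]
    ext c
    have h2 := hr c
    simp only [LinearMap.comp_apply, Submodule.subtype_apply] at h2
    rw [h2]
    exact (Submodule.Quotient.mk_eq_zero _).2 (Submodule.smul_mem_smul hrJ (Submodule.mem_top (x := c)))
  have h1 : (Submodule.Quotient.mk c : C ⧸ (J • ⊤ : Submodule R C)) ∈ T := by
    change x • (Submodule.Quotient.mk c : C ⧸ (J • ⊤ : Submodule R C)) = 0
    rwa [← Submodule.Quotient.mk_smul, Submodule.Quotient.mk_eq_zero]
  have h2 := hT ⟨_, h1⟩
  exact (Submodule.Quotient.mk_eq_zero _).1 (congrArg Subtype.val h2)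

lemma sup_smul_top (J : Ideal R) (x : R) (c : C) :
    c ∈ ((J ⊔ Ideal.span {x}) • ⊤ : Submodule R C) ↔
      ∃ d, c - x • d ∈ (J • ⊤ : Submodule R C) := by
  rw [Submodule.sup_smul, Submodule.ideal_span_singleton_smul, Submodule.mem_sup]
  constructor
  · rintro ⟨y, hy, z, hz, rfl⟩
    obtain ⟨d, -, rfl⟩ := (Submodule.mem_smul_pointwise_iff_exists _ _ _).1 hz
    exact ⟨d, by simpa⟩
  · rintro ⟨d, hd⟩
    exact ⟨_, hd, x • d, Submodule.smul_mem_pointwise_smul _ _ _ trivial, by simp⟩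

lemma PJ.step [IsNoetherianRing R] (h : SD R C) {J : Ideal R} (hJ : PJ C J) (x : R)
    (hx : ∀ r, x * r ∈ J → r ∈ J) : PJ C (J ⊔ Ideal.span {x}) := by
  have hreg := hJ.reg h x hx
  let N : Submodule R C := J • ⊤
  let N' : Submodule R C := (J ⊔ Ideal.span {x}) • ⊤
  have hN' : ∀ c, c ∈ N' ↔ ∃ d, c - x • d ∈ N := fun c => sup_smul_top J x c
  have hle : N ≤ N' := fun c hc => (hN' c).2 ⟨0, by simpa using hc⟩
  let f : (C ⧸ N) →ₗ[R] (C ⧸ N) := LinearMap.lsmul R _ x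
  let g : (C ⧸ N) →ₗ[R] (C ⧸ N') := Submodule.mapQ N N' LinearMap.id hle
  have hf : Function.Injective f := by
    rw [injective_iff_map_eq_zero]
    intro y hy
    obtain ⟨c, rfl⟩ := Submodule.Quotient.mk_surjective N y
    rw [Submodule.Quotient.mk_eq_zero]
    apply hreg
    have : x • (Submodule.Quotient.mk c : C ⧸ N) = 0 := hy
    rwa [← Submodule.Quotient.mk_smul, Submodule.Quotient.mk_eq_zero] at this
  have hg : Function.Surjective g := by
    intro y
    obtain ⟨c, rfl⟩ := Submodule.Quotient.mk_surjective N' y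
    exact ⟨Submodule.Quotient.mk c, rfl⟩
  have ex : Function.Exact f g := by
    intro y
    obtain ⟨c, rfl⟩ := Submodule.Quotient.mk_surjective N y
    have h1 : g (Submodule.Quotient.mk c) = Submodule.Quotient.mk c := rfl
    rw [h1, Submodule.Quotient.mk_eq_zero, hN']
    constructor
    · rintro ⟨d, hd⟩
      refine ⟨Submodule.Quotient.mk d, ?_⟩
      change x • (Submodule.Quotient.mk d : C ⧸ N) = _
      rw [← Submodule.Quotient.mk_smul]
      exact ((Submodule.Quotient.eq N).2 hd).symm
    · rintro ⟨y, hy⟩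
      obtain ⟨d, rfl⟩ := Submodule.Quotient.mk_surjective N y
      change x • (Submodule.Quotient.mk d : C ⧸ N) = _ at hy
      rw [← Submodule.Quotient.mk_smul] at hy
      exact ⟨d, (Submodule.Quotient.eq N).1 hy.symm⟩
  refine ⟨fun i => ev_cov_right hf ex hg (i+1) (hJ.ev i) (hJ.ev (i+1)), fun φ => ?_, fun s hs => ?_⟩
  · obtain ⟨ψ, hψ⟩ := ev_lift hf ex hg (hJ.ev 0) φ
    obtain ⟨r, hr⟩ := hJ.sc ψ
    refine ⟨r, fun c => ?_⟩
    rw [← hψ, LinearMap.comp_apply, hr]; rfl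
  · have hs' : ∀ c, ∃ d, s • c - x • d ∈ N := fun c => (hN' _).1 (hs c)
    let φ : C →ₗ[R] (C ⧸ N) := N.mkQ ∘ₗ LinearMap.lsmul R C s
    have hφ : ∀ c, φ c ∈ LinearMap.range f := by
      intro c
      obtain ⟨d, hd⟩ := hs' c
      refine ⟨Submodule.Quotient.mk d, ?_⟩
      change x • (Submodule.Quotient.mk d : C ⧸ N) = Submodule.Quotient.mk (s • c)
      rw [← Submodule.Quotient.mk_smul]
      exact ((Submodule.Quotient.eq N).2 hd).symm
    let e := LinearEquiv.ofInjective f hf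
    let ψ : C →ₗ[R] (C ⧸ N) := e.symm.toLinearMap ∘ₗ φ.codRestrict _ hφ
    have hψ : ∀ c, f (ψ c) = φ c := by
      intro c
      have := e.apply_symm_apply (φ.codRestrict _ hφ c)
      exact congrArg Subtype.val this
    obtain ⟨r, hr⟩ := hJ.sc ψ
    have h1 : s - x * r ∈ J := by
      refine hJ.mem _ fun c => ?_
      have h2 := hψ c
      rw [hr c] at h2
      change x • (Submodule.Quotient.mk (r • c) : C ⧸ N) = Submodule.Quotient.mk (s • c) at h2
      rw [← Submodule.Quotient.mk_smul] at h2
      rw [sub_smul, mul_smul]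
      exact (Submodule.Quotient.eq N).1 h2.symm
    rw [show s = (s - x * r) + x * r by ring]
    exact add_mem (Ideal.mem_sup_left h1)
      (Ideal.mem_sup_right (Ideal.mul_mem_right _ _ (Ideal.mem_span_singleton_self x)))

/-- Regular sequences modulo `J`. -/
def RegI : Ideal R → List R → Prop
  | _, [] => True
  | J, x :: l => (∀ r, x * r ∈ J → r ∈ J) ∧ RegI (J ⊔ Ideal.span {x}) l

/-- `J` extended by a list. -/
def extI : Ideal R → List R → Ideal R
  | J, [] => J
  | J, x :: l => extI (J ⊔ Ideal.span {x}) l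

lemma PJ.list [IsNoetherianRing R] (h : SD R C) (l : List R) : ∀ {J : Ideal R}, PJ C J →
    RegI J l → PJ C (extI J l) := by
  induction l with
  | nil => intro J hJ _; exact hJ
  | cons x l ih => intro J hJ hr; exact ih (hJ.step h x hr.1) hr.2

lemma SD.torsionFree [IsNoetherianRing R] [IsDomain R] (h : SD R C) (f : R) (hf : f ≠ 0) (c : C)
    (hc : f • c = 0) : c = 0 := by
  have := (PJ.bot h).reg h f (by simp [hf]) c (by simpa using hc)
  simpa using this

/-- The key lemma ★. -/
lemma SD.star [IsNoetherianRing R] [IsDomain R] (h : SD R C) (f : R) (hf : f ≠ 0) (a : C)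
    (ha : ∀ c : C, f • c ≠ a) :
    ∃ b : R, ¬ f ∣ b ∧ ∀ t : R, (∃ c : C, t • a = f • c) → f ∣ t * b := by
  have := h.1
  have hP := (PJ.bot h).step h f (by simp [hf])
  rw [bot_sup_eq] at hP
  let N : Submodule R C := (Ideal.span {f}) • ⊤
  have hN : ∀ c, c ∈ N ↔ ∃ d, c = f • d := by
    intro c
    have := sup_smul_top (C := C) ⊥ f c
    rw [bot_sup_eq] at this
    simpa [sub_eq_zero] using this
  let T : Submodule R (C ⧸ N) :=
    { carrier := {y | ∀ t : R, (∃ c : C, t • a = f • c) → t • y = 0}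
      add_mem' := fun {y z} hy hz t ht => by rw [smul_add, hy t ht, hz t ht, add_zero]
      zero_mem' := fun t _ => smul_zero t
      smul_mem' := fun r y hy t ht => by rw [smul_comm, hy t ht, smul_zero] }
  have haT : (Submodule.Quotient.mk a : C ⧸ N) ∈ T := by
    intro t ht
    rw [← Submodule.Quotient.mk_smul, Submodule.Quotient.mk_eq_zero]
    exact (hN _).2 ht
  have ha0 : (⟨_, haT⟩ : T) ≠ 0 := by
    intro h0
    have h1 := (Submodule.Quotient.mk_eq_zero N).1 (congrArg Subtype.val h0)
    obtain ⟨d, hd⟩ := (hN _).1 h1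
    exact ha d hd.symm
  by_contra hcon
  push Not at hcon
  refine ha0 (exists_hom_ne_zero (C := C) (T := T) h.faithful (fun φ => ?_) _)
  obtain ⟨b, hb⟩ := hP.sc (T.subtype ∘ₗ φ)
  have hb' : ∀ c, (φ c : C ⧸ N) = Submodule.Quotient.mk (b • c) := hb
  by_cases hfb : f ∣ b
  · ext c
    rw [hb' c]
    obtain ⟨e, rfl⟩ := hfb
    simp only [ZeroMemClass.coe_zero, LinearMap.zero_apply]
    rw [Submodule.Quotient.mk_eq_zero, hN]
    exact ⟨e • c, mul_smul _ _ _⟩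
  · exfalso
    obtain ⟨t, ht, ht'⟩ := hcon b hfb
    apply ht'
    rw [← Ideal.mem_span_singleton]
    refine hP.mem _ fun c => ?_
    have := (φ c).2 t ht
    rw [hb' c, ← Submodule.Quotient.mk_smul, Submodule.Quotient.mk_eq_zero] at this
    rwa [mul_smul]
end PJsec

end

section

section FIDR
variable {R : Type} [CommRing R]

lemma ext_kill {X Y : Type} [AddCommGroup X] [Module R X] [AddCommGroup Y] [Module R Y] (x : R)
    (hX : ∀ y : X, x • y = 0) (n : ℕ) (a : Abelian.Ext (ModuleCat.of R X) (ModuleCat.of R Y) n) :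
    a.comp (Abelian.Ext.mk₀ (ModuleCat.ofHom (LinearMap.lsmul R Y x))) (add_zero n) = 0 := by
  have h := Abelian.Ext.postcomp_smul_id_eq_zero_of_mem_annihilator (R := R)
    (M := ModuleCat.of R Y) (N := ModuleCat.of R X) (r := x) (Module.mem_annihilator.2 hX) n
  have h2 : ModuleCat.ofHom (LinearMap.lsmul R Y x) = x • 𝟙 (ModuleCat.of R Y) := by
    ext y; rfl
  rw [h2]
  exact congrArg (fun z => z.hom a) h

/-- The surjection `R/J → R/(J+x)`. -/
def qg (J : Ideal R) (x : R) : (R ⧸ J) →ₗ[R] (R ⧸ (J ⊔ Ideal.span {x})) :=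
  Submodule.mapQ J (J ⊔ Ideal.span {x}) LinearMap.id le_sup_left

lemma qg_surj (J : Ideal R) (x : R) : Function.Surjective (qg J x) := by
  intro y
  obtain ⟨c, rfl⟩ := Submodule.Quotient.mk_surjective _ y
  exact ⟨Submodule.Quotient.mk c, rfl⟩

lemma qf_inj (J : Ideal R) (x : R) (hx : ∀ r, x * r ∈ J → r ∈ J) :
    Function.Injective (LinearMap.lsmul R (R ⧸ J) x) := by
  rw [injective_iff_map_eq_zero]
  intro y hy
  obtain ⟨c, rfl⟩ := Submodule.Quotient.mk_surjective J y
  rw [Submodule.Quotient.mk_eq_zero]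
  apply hx
  have : x • (Submodule.Quotient.mk c : R ⧸ J) = 0 := hy
  rwa [← Submodule.Quotient.mk_smul, Submodule.Quotient.mk_eq_zero] at this

lemma q_exact (J : Ideal R) (x : R) :
    Function.Exact (LinearMap.lsmul R (R ⧸ J) x) (qg J x) := by
  intro y
  obtain ⟨c, rfl⟩ := Submodule.Quotient.mk_surjective J y
  have h1 : qg J x (Submodule.Quotient.mk c) = Submodule.Quotient.mk c := rfl
  rw [h1, Submodule.Quotient.mk_eq_zero, Submodule.mem_sup]
  constructor
  · rintro ⟨y, hy, z, hz, rfl⟩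
    obtain ⟨d, rfl⟩ := Ideal.mem_span_singleton'.1 hz
    refine ⟨Submodule.Quotient.mk d, ?_⟩
    change x • (Submodule.Quotient.mk d : R ⧸ J) = _
    rw [← Submodule.Quotient.mk_smul]
    refine (Submodule.Quotient.eq J).2 ?_
    rw [smul_eq_mul, show x * d - (y + d * x) = - y by ring]
    exact neg_mem hy
  · rintro ⟨y, hy⟩
    obtain ⟨d, rfl⟩ := Submodule.Quotient.mk_surjective J y
    change x • (Submodule.Quotient.mk d : R ⧸ J) = _ at hy
    rw [← Submodule.Quotient.mk_smul] at hy
    exact ⟨c - x • d, (Submodule.Quotient.eq J).1 hy.symm, d * x,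
      Ideal.mem_span_singleton'.2 ⟨d, rfl⟩, by rw [smul_eq_mul]; ring⟩

lemma ev_rees (l : List R) : ∀ (J : Ideal R), RegI J l → ∀ (X : Type) [AddCommGroup X] [Module R X],
    (∀ x ∈ l, ∀ y : X, x • y = 0) → ∀ i < l.length, EV R i X (R ⧸ J) := by
  induction l with
  | nil => intro J _ X _ _ _ i hi; simp at hi
  | cons x l ih =>
    intro J hJ X _ _ hX i hi
    have hx := hX x (by simp)
    have hf := qf_inj J x hJ.1
    cases i with
    | zero =>
      rw [ev_zero_iff]
      intro φ
      ext y
      apply hf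
      have : x • φ y = 0 := by rw [← map_smul, hx, map_zero]
      rw [LinearMap.zero_apply, map_zero]
      exact this
    | succ i =>
      refine EV.intro fun a => ?_
      have h1 : EV R i X (R ⧸ (J ⊔ Ideal.span {x})) :=
        ih _ hJ.2 X (fun y hy => hX y (by simp [hy])) i (by simp at hi; omega)
      obtain ⟨b, rfl⟩ := Abelian.Ext.covariant_sequence_exact₁ _
        (ses_exact hf (q_exact J x) (qg_surj J x)) a (ext_kill x hx _ a) rfl
      rw [h1.elim b, Abelian.Ext.zero_comp]

lemma ext_surj (l : List R) : ∀ (J : Ideal R), RegI J l → ∀ {X' X : Type} [AddCommGroup X]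
    [Module R X] [AddCommGroup X'] [Module R X'] (f : X' →ₗ[R] X),
    (∀ x ∈ l, ∀ y : X, x • y = 0) → (∀ x ∈ l, ∀ y : X', x • y = 0) →
    (∀ b : Abelian.Ext (ModuleCat.of R X') (ModuleCat.of R (R ⧸ J)) l.length,
      ∃ c : Abelian.Ext (ModuleCat.of R X) (ModuleCat.of R (R ⧸ J)) l.length,
      (Abelian.Ext.mk₀ (ModuleCat.ofHom f)).comp c (zero_add _) = b) →
    ∀ b : X' →ₗ[R] (R ⧸ extI J l), ∃ c : X →ₗ[R] (R ⧸ extI J l), c ∘ₗ f = b := by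
  induction l with
  | nil =>
    intro J _ X' X _ _ _ _ f _ _ h b
    obtain ⟨c, hc⟩ := h (Abelian.Ext.mk₀ (ModuleCat.ofHom b))
    obtain ⟨ψ, rfl⟩ := Abelian.Ext.mk₀_bijective _ _ |>.2 c
    rw [Abelian.Ext.mk₀_comp_mk₀] at hc
    have := (Abelian.Ext.mk₀_bijective _ _).1 hc
    exact ⟨ψ.hom, congrArg ModuleCat.Hom.hom this⟩
  | cons x l ih =>
    intro J hJ X' X _ _ _ _ f hX hX' h
    refine ih _ hJ.2 f (fun y hy => hX y (by simp [hy])) (fun y hy => hX' y (by simp [hy])) ?_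
    intro b
    have hses := ses_exact (qf_inj J x hJ.1) (q_exact J x) (qg_surj J x)
    obtain ⟨c, hc⟩ := h (b.comp hses.extClass rfl)
    obtain ⟨b', hb'⟩ := Abelian.Ext.covariant_sequence_exact₁ _ hses c
      (ext_kill x (hX x (by simp)) _ c) rfl
    have h0 : (b - (Abelian.Ext.mk₀ (ModuleCat.ofHom f)).comp b' (zero_add _)).comp
        hses.extClass rfl = 0 := by
      rw [sub_eq_add_neg, Abelian.Ext.add_comp, Abelian.Ext.neg_comp, Abelian.Ext.comp_assoc _ _ _ (zero_add _) rfl (by simp), hb', hc]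
      simp
    obtain ⟨d, hd⟩ := Abelian.Ext.covariant_sequence_exact₃ _ hses _ rfl h0
    have hd0 : d = 0 := (ev_rees (x :: l) J hJ X' hX' l.length (by simp)).elim d
    rw [hd0, Abelian.Ext.zero_comp] at hd
    exact ⟨b', (sub_eq_zero.1 hd.symm).symm⟩

lemma ev_pd (l : List R) : ∀ (J : Ideal R), RegI J l → ∀ k, (∀ j, k < j → EV R j (R ⧸ J) R) →
    ∀ j, k + l.length < j → EV R j (R ⧸ extI J l) R := by
  induction l with
  | nil => intro J _ k h j hj; exact h j (by simpa using hj)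
  | cons x l ih =>
    intro J hJ k h j hj
    refine ih _ hJ.2 (k+1) (fun j hj => ?_) j (by simp at hj; omega)
    obtain ⟨j, rfl⟩ : ∃ i, j = i + 1 := ⟨j - 1, by omega⟩
    exact ev_con_right (qf_inj J x hJ.1) (q_exact J x) (qg_surj J x) j (h j (by omega))
      (h (j+1) (by omega))

/-- The map `R/m → R/I`, `1 ↦ s`. -/
def sg (m I : Ideal R) (s : R) (h : ∀ r ∈ m, r * s ∈ I) : (R ⧸ m) →ₗ[R] (R ⧸ I) :=
  Submodule.mapQ m I (LinearMap.mulRight R s) h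

lemma sg_inj (m I : Ideal R) (s : R) (h : ∀ r ∈ m, r * s ∈ I) (hm : m.IsMaximal) (hs : s ∉ I) :
    Function.Injective (sg m I s h) := by
  rw [injective_iff_map_eq_zero]
  intro y hy
  obtain ⟨c, rfl⟩ := Submodule.Quotient.mk_surjective _ y
  rw [Submodule.Quotient.mk_eq_zero]
  change Submodule.Quotient.mk (c * s) = 0 at hy
  rw [Submodule.Quotient.mk_eq_zero] at hy
  by_contra hc
  have h1 : m ⊔ Ideal.span {c} = ⊤ := hm.1.2 _ (by
    refine lt_of_le_of_ne le_sup_left fun h => hc ?_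
    rw [h]; exact Ideal.mem_sup_right (Ideal.mem_span_singleton_self c))
  have h2 : (1 : R) ∈ m ⊔ Ideal.span {c} := by rw [h1]; trivial
  obtain ⟨a, ha, b, hb, hab⟩ := Submodule.mem_sup.1 h2
  obtain ⟨d, rfl⟩ := Ideal.mem_span_singleton'.1 hb
  apply hs
  rw [← one_mul s, ← hab, add_mul, mul_assoc]
  exact add_mem (h a ha) (Ideal.mul_mem_left _ _ hy)

lemma sg_exact (m I : Ideal R) (s : R) (h : ∀ r ∈ m, r * s ∈ I) :
    Function.Exact (sg m I s h) (qg I s) := by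
  intro y
  obtain ⟨c, rfl⟩ := Submodule.Quotient.mk_surjective _ y
  have h1 : qg I s (Submodule.Quotient.mk c) = Submodule.Quotient.mk c := rfl
  rw [h1, Submodule.Quotient.mk_eq_zero, Submodule.mem_sup]
  constructor
  · rintro ⟨y, hy, z, hz, rfl⟩
    obtain ⟨d, rfl⟩ := Ideal.mem_span_singleton'.1 hz
    refine ⟨Submodule.Quotient.mk d, ?_⟩
    change (Submodule.Quotient.mk (d * s) : R ⧸ I) = _
    refine (Submodule.Quotient.eq I).2 ?_
    rw [show d * s - (y + d * s) = - y by ring]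
    exact neg_mem hy
  · rintro ⟨y, hy⟩
    obtain ⟨d, rfl⟩ := Submodule.Quotient.mk_surjective _ y
    change (Submodule.Quotient.mk (d * s) : R ⧸ I) = _ at hy
    exact ⟨c - d * s, (Submodule.Quotient.eq I).1 hy.symm, d * s,
      Ideal.mem_span_singleton'.2 ⟨d, rfl⟩, by ring⟩

lemma fidR [IsNoetherianRing R] (hR : FID R R) (l : List R) (hl : RegI ⊥ l) (m : Ideal R)
    (hm : m.IsMaximal) (N : ℕ) (hN : m ^ N ≤ extI ⊥ l) (u v : R) (hu : u ∉ extI ⊥ l)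
    (hmu : ∀ r ∈ m, r * u ∈ extI ⊥ l) (hmv : ∀ r ∈ m, r * v ∈ extI ⊥ l)
    (hlm : ∀ x ∈ l, x ∈ m) (hlJ : ∀ x ∈ l, x ∈ extI ⊥ l) :
    ∃ a, v - a * u ∈ extI ⊥ l := by
  set θ := extI ⊥ l with hθ
  have hpd : ∀ j, l.length < j → EV R j (R ⧸ θ) R := by
    intro j hj
    refine ev_pd l ⊥ hl 0 (fun j hj => ?_) j (by omega)
    have : Module.Projective R (R ⧸ (⊥ : Ideal R)) :=
      Module.Projective.of_equiv (Submodule.quotEquivOfEqBot (⊥ : Ideal R) rfl).symm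
    exact ev_proj j (by omega)
  -- vanishing
  have hV : ∀ (d : ℕ) (j : ℕ), l.length < j → (∀ I : Ideal R, θ ≤ I → EV R (j+d) (R ⧸ I) R) →
      ∀ I : Ideal R, θ ≤ I → EV R j (R ⧸ I) R := by
    intro d
    induction d with
    | zero => intro j _ h; exact h
    | succ d ih =>
      intro j hj h
      have h' : ∀ I : Ideal R, θ ≤ I → EV R (j+1) (R ⧸ I) R :=
        ih (j+1) (by omega) (fun I hI => by
          have := h I hI
          rwa [show j + 1 + d = j + (d+1) by ring])
      have hmj : EV R j (R ⧸ m) R :=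
        ev_con_left (sg_inj m θ u hmu hm hu) (sg_exact m θ u hmu) (qg_surj θ u) j
          (hpd j hj) (h' _ le_sup_left)
      intro I
      induction I using IsNoetherian.induction with
      | hgt I ihI =>
        intro hI
        by_cases hI1 : I = ⊤
        · subst hI1
          obtain ⟨j, rfl⟩ : ∃ i, j = i + 1 := ⟨j - 1, by omega⟩
          have : Subsingleton (R ⧸ (⊤ : Ideal R)) := Submodule.Quotient.subsingleton_iff.2 rfl
          exact ev_proj _ (by omega)
        obtain ⟨s, hs, hms⟩ : ∃ s, s ∉ I ∧ ∀ r ∈ m, r * s ∈ I := by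
          have hex : ∃ t, m ^ t ≤ I := ⟨N, hN.trans hI⟩
          classical
          obtain ⟨t, ht⟩ : ∃ t, Nat.find hex = t + 1 := by
            refine Nat.exists_eq_succ_of_ne_zero fun h0 => ?_
            have := Nat.find_spec hex
            rw [h0, pow_zero, Ideal.one_eq_top] at this
            exact hI1 (top_le_iff.1 this)
          have h1 := Nat.find_min hex (m := t) (by omega)
          have h2 := Nat.find_spec hex
          rw [ht] at h2
          obtain ⟨s, hs, hsI⟩ := SetLike.not_le_iff_exists.1 h1
          exact ⟨s, hsI, fun r hr => h2 (by rw [pow_succ']; exact Ideal.mul_mem_mul hr hs)⟩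
        have hlt : I < I ⊔ Ideal.span {s} := lt_of_le_of_ne le_sup_left fun h => hs (by
          rw [h]; exact Ideal.mem_sup_right (Ideal.mem_span_singleton_self s))
        exact ev_con_mid (sg_inj m I s hms hm hs) (sg_exact m I s hms) (qg_surj I s) j hmj
          (ihI _ hlt (hI.trans le_sup_left))
  have hV' : EV R (l.length + 1) (R ⧸ (θ ⊔ Ideal.span {u})) R := by
    obtain ⟨n, hn⟩ := hR
    refine hV n (l.length + 1) (by omega) (fun I _ => ?_) _ le_sup_left
    rw [show l.length + 1 + n = (l.length + n) + 1 by ring]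
    exact hn _ (by omega) _
  have hkill : ∀ x ∈ l, ∀ y : R ⧸ θ, x • y = 0 := by
    intro x hx y
    obtain ⟨c, rfl⟩ := Submodule.Quotient.mk_surjective _ y
    rw [← Submodule.Quotient.mk_smul, Submodule.Quotient.mk_eq_zero]
    exact Ideal.mul_mem_right _ _ (hlJ x hx)
  have hkill' : ∀ x ∈ l, ∀ y : R ⧸ m, x • y = 0 := by
    intro x hx y
    obtain ⟨c, rfl⟩ := Submodule.Quotient.mk_surjective _ y
    rw [← Submodule.Quotient.mk_smul, Submodule.Quotient.mk_eq_zero]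
    exact Ideal.mul_mem_right _ _ (hlm x hx)
  obtain ⟨c, hc⟩ := ext_surj l ⊥ hl (sg m θ u hmu) hkill hkill' (fun b => by
    have e : R ≃ₗ[R] (R ⧸ (⊥ : Ideal R)) := (Submodule.quotEquivOfEqBot (⊥ : Ideal R) rfl).symm
    have := ev_congr (LinearEquiv.refl R (R ⧸ (θ ⊔ Ideal.span {u}))) e _ hV'
    obtain ⟨c, hc⟩ := Abelian.Ext.contravariant_sequence_exact₁
      (ses_exact (sg_inj m θ u hmu hm hu) (sg_exact m θ u hmu) (qg_surj θ u)) _ b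
      (Nat.add_comm 1 l.length) (this.elim _)
    exact ⟨c, hc⟩) (sg m θ v hmv)
  obtain ⟨a, ha⟩ := Submodule.Quotient.mk_surjective _ (c (Submodule.Quotient.mk 1))
  refine ⟨a, (Submodule.Quotient.eq θ).1 ?_⟩
  have h1 := LinearMap.congr_fun hc (Submodule.Quotient.mk 1)
  have h2 : sg m θ u hmu (Submodule.Quotient.mk 1) = u • (Submodule.Quotient.mk 1 : R ⧸ θ) := by
    rw [← Submodule.Quotient.mk_smul]
    change Submodule.Quotient.mk (1 * u) = _
    simp
  have h3 : sg m θ v hmv (Submodule.Quotient.mk 1) = Submodule.Quotient.mk (1 * v) := rfl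
  rw [LinearMap.comp_apply, h2, h3, map_smul, ← ha, ← Submodule.Quotient.mk_smul] at h1
  rw [one_mul] at h1
  rw [← h1, mul_comm a u]; rfl
end FIDR

end

section

section UFD
variable (K : Type) [Field K]

lemma ufd_fin (r : ℕ) : UniqueFactorizationMonoid (AddMonoidAlgebra K (Fin r → ℤ)) := by
  induction r with
  | zero =>
    exact (AddMonoidAlgebra.uniqueRingEquiv (R := K) (Fin 0 → ℤ)).symm.toMulEquiv.uniqueFactorizationMonoid
      inferInstance
  | succ r ih =>
    let e1 : (ℤ × (Fin r → ℤ)) ≃+ (Fin (r+1) → ℤ) :=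
      (Fin.consLinearEquiv ℤ (fun _ : Fin (r+1) => ℤ)).toAddEquiv
    let e2 := AddMonoidAlgebra.mapDomainRingEquiv K e1
    let e3 : AddMonoidAlgebra K (ℤ × (Fin r → ℤ)) ≃+* LaurentPolynomial (AddMonoidAlgebra K (Fin r → ℤ)) :=
      AddMonoidAlgebra.curryRingEquiv
    have h1 : UniqueFactorizationMonoid (Polynomial (AddMonoidAlgebra K (Fin r → ℤ))) := inferInstance
    have h2 : UniqueFactorizationMonoid (LaurentPolynomial (AddMonoidAlgebra K (Fin r → ℤ))) :=
      UniqueFactorizationMonoid.of_isLocalization (Submonoid.powers (Polynomial.X (R := AddMonoidAlgebra K (Fin r → ℤ)))) _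
    exact (e3.symm.trans e2).toMulEquiv.uniqueFactorizationMonoid h2

variable (M : Type) [AddCommGroup M] [Module.Free ℤ M] [Module.Finite ℤ M]

lemma ufd_L : UniqueFactorizationMonoid (AddMonoidAlgebra K M) := by
  let b := Module.finBasis ℤ M
  let e : (Fin (Module.finrank ℤ M) → ℤ) ≃+ M := b.equivFun.symm.toAddEquiv
  exact (AddMonoidAlgebra.mapDomainRingEquiv K e).toMulEquiv.uniqueFactorizationMonoid (ufd_fin K _)

lemma dom_L : IsDomain (AddMonoidAlgebra K M) := by
  let b := Module.finBasis ℤ M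
  let e : M ≃+ (Fin (Module.finrank ℤ M) → ℤ) := b.equivFun.toAddEquiv
  exact (AddMonoidAlgebra.mapDomainRingEquiv K e).toMulEquiv.isDomain _

end UFD

section Mon
variable {K : Type} [Field K] {M : Type} [AddCommGroup M]

local notation "L" => AddMonoidAlgebra K M

/-- support condition -/
def SuppIn (f : AddMonoidAlgebra K M) (I : Set M) : Prop := ∀ m, f.coeff m ≠ 0 → m ∈ I

lemma SuppIn.zero (I : Set M) : SuppIn (0 : L) I := fun m h => absurd rfl h
lemma SuppIn.add {f g : L} {I : Set M} (hf : SuppIn f I) (hg : SuppIn g I) : SuppIn (f + g) I := by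
  intro m h
  by_contra hm
  have h1 : f.coeff m = 0 := by by_contra h'; exact hm (hf m h')
  have h2 : g.coeff m = 0 := by by_contra h'; exact hm (hg m h')
  exact h (by simp [h1, h2])
lemma SuppIn.neg {f : L} {I : Set M} (hf : SuppIn f I) : SuppIn (-f) I := by
  intro m h
  exact hf m (by simpa using h)
lemma SuppIn.sub {f g : L} {I : Set M} (hf : SuppIn f I) (hg : SuppIn g I) : SuppIn (f - g) I := by
  rw [sub_eq_add_neg]; exact hf.add hg.neg
lemma SuppIn.sum {ι : Type*} (s : Finset ι) (f : ι → L) {I : Set M} (hf : ∀ i ∈ s, SuppIn (f i) I) :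
    SuppIn (∑ i ∈ s, f i) I := by
  classical
  induction s using Finset.induction_on with
  | empty => simpa using SuppIn.zero I
  | insert a s ha ih =>
    rw [Finset.sum_insert ha]
    exact (hf a (by simp)).add (ih fun i hi => hf i (by simp [hi]))
lemma SuppIn.mul {f g : L} {I J H : Set M} (hf : SuppIn f I) (hg : SuppIn g J)
    (h : ∀ a ∈ I, ∀ b ∈ J, a + b ∈ H) : SuppIn (f * g) H := by
  classical
  intro m hm
  have := AddMonoidAlgebra.support_coeff_mul_subset f g (Finsupp.mem_support_iff.2 hm)
  obtain ⟨a, ha, b, hb, rfl⟩ := Finset.mem_add.1 this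
  exact h a (hf a (Finsupp.mem_support_iff.1 ha)) b (hg b (Finsupp.mem_support_iff.1 hb))
lemma SuppIn.smul {f : L} {I : Set M} (c : K) (hf : SuppIn f I) : SuppIn (c • f) I := by
  intro m h
  exact hf m (by rintro h'; exact h (by simp [h']))
lemma SuppIn.mono {f : L} {I J : Set M} (hf : SuppIn f I) (h : I ⊆ J) : SuppIn f J :=
  fun m hm => h (hf m hm)
lemma SuppIn.single {m : M} {c : K} {I : Set M} (h : m ∈ I) :
    SuppIn (AddMonoidAlgebra.single m c : L) I := by
  classical
  intro m' h'
  rw [AddMonoidAlgebra.coeff_single, Finsupp.single_apply] at h'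
  split_ifs at h' with e
  · exact e ▸ h
  · exact absurd rfl h'
lemma SuppIn.single_iff {m : M} {I : Set M} :
    SuppIn (AddMonoidAlgebra.single m (1:K) : L) I ↔ m ∈ I := by
  classical
  refine ⟨fun h => h m (by simp [AddMonoidAlgebra.coeff_single]), SuppIn.single⟩
lemma SuppIn.one {I : Set M} (h : (0:M) ∈ I) : SuppIn (1 : L) I := SuppIn.single h

/-- monomial -/
noncomputable def chi (m : M) : AddMonoidAlgebra K M := AddMonoidAlgebra.single m 1

lemma chi_mul (a b : M) : (chi a : L) * chi b = chi (a + b) := by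
  simp [chi, AddMonoidAlgebra.single_mul_single]
lemma chi_zero : (chi 0 : L) = 1 := rfl
lemma chi_coeff (a : M) (f : L) (m : M) : (chi a * f).coeff m = f.coeff (m - a) := by
  have := AddMonoidAlgebra.coeff_single_mul_add f (1:K) a (m - a)
  simpa [chi] using this
lemma chi_supp {a : M} {f : L} {I : Set M} : SuppIn (chi a * f) I ↔ ∀ m, f.coeff m ≠ 0 → a + m ∈ I := by
  constructor
  · intro h m hm
    refine h _ ?_
    rw [chi_coeff]; simpa using hm
  · intro h m hm
    rw [chi_coeff] at hm
    simpa using h _ hm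
lemma chi_ne [Nontrivial K] (a : M) : (chi a : L) ≠ 0 := by simp [chi]
lemma chi_unit (a : M) : IsUnit (chi a : L) :=
  IsUnit.of_mul_eq_one (chi (-a)) (by rw [chi_mul]; simp [chi_zero])

lemma L_sum (f : L) : f = ∑ m ∈ f.coeff.support, f.coeff m • chi m := by
  conv_lhs => rw [← AddMonoidAlgebra.sum_coeff_single f]
  refine Finset.sum_congr rfl fun m _ => ?_
  simp [chi]

/-- homogeneous component -/
noncomputable def comp (w : M →+ ℤ) (k : ℤ) : AddMonoidAlgebra K M →ₗ[K] AddMonoidAlgebra K M :=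
  open Classical in
  ((AddMonoidAlgebra.coeffLinearEquiv K).symm.toLinearMap ∘ₗ
    ((Finsupp.supported K K {m | w m = k}).subtype ∘ₗ Finsupp.restrictDom K K {m | w m = k})) ∘ₗ
    (AddMonoidAlgebra.coeffLinearEquiv K).toLinearMap

open Classical in
lemma comp_coeff (w : M →+ ℤ) (k : ℤ) (f : L) (m : M) :
    (comp w k f).coeff m = if w m = k then f.coeff m else 0 := by
  simp only [comp, LinearMap.comp_apply, Finsupp.restrictDom_apply, Submodule.subtype_apply]
  change (Finsupp.filter _ _) m = _
  rw [Finsupp.filter_apply]; rfl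

lemma comp_supp (w : M →+ ℤ) (k : ℤ) (f : L) : SuppIn (comp w k f) {m | w m = k} := by
  classical
  intro m hm
  rw [comp_coeff] at hm
  by_contra h
  exact hm (if_neg h)
lemma comp_suppIn (w : M →+ ℤ) (k : ℤ) {f : L} {I} (h : SuppIn f I) : SuppIn (comp w k f) I := by
  classical
  intro m hm
  rw [comp_coeff] at hm
  split_ifs at hm with h1
  · exact h m hm
  · exact absurd rfl hm
lemma comp_self (w : M →+ ℤ) (k : ℤ) {f : L} (h : SuppIn f {m | w m = k}) : comp w k f = f := by
  classical
  ext m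
  rw [comp_coeff]
  split_ifs with h1
  · rfl
  · by_contra h2
    exact h1 (h m (Ne.symm h2))
lemma comp_other (w : M →+ ℤ) {k k' : ℤ} {f : L} (h : SuppIn f {m | w m = k}) (hk : k ≠ k') :
    comp w k' f = 0 := by
  classical
  ext m
  rw [comp_coeff]
  split_ifs with h1
  · by_contra h2
    exact hk ((h m h2).symm.trans h1)
  · rfl
lemma comp_sum (w : M →+ ℤ) (f : L) :
    f = ∑ k ∈ f.coeff.support.image w, comp w k f := by
  classical
  ext m
  rw [AddMonoidAlgebra.coeff_sum, Finsupp.finsetSum_apply]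
  by_cases hm : f.coeff m = 0
  · rw [hm, Finset.sum_eq_zero]
    intro k _
    rw [comp_coeff, hm, ite_self]
  · rw [Finset.sum_eq_single (w m)]
    · simp [comp_coeff]
    · intro k _ hk
      rw [comp_coeff, if_neg (Ne.symm hk)]
    · intro h
      exact absurd (Finset.mem_image_of_mem w (Finsupp.mem_support_iff.2 hm)) h
lemma comp_mul (w : M →+ ℤ) (e k : ℤ) {f : L} (g : L) (hf : SuppIn f {m | w m = e}) :
    comp w (e + k) (f * g) = f * comp w k g := by
  classical
  conv_lhs => rw [comp_sum w g]
  rw [Finset.mul_sum, map_sum]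
  by_cases hk : k ∈ g.coeff.support.image w
  · rw [Finset.sum_eq_single_of_mem k hk]
    · exact comp_self w _ (hf.mul (comp_supp w k g) (by rintro a ha b hb; simp_all))
    · intro j _ hj
      exact comp_other w (k := e + j) (hf.mul (comp_supp w j g) (by rintro a ha b hb; simp_all))
        (by omega)
  · have : comp w k g = 0 := by
      ext m
      rw [comp_coeff]
      split_ifs with h1
      · by_contra h2
        exact hk (Finset.mem_image.2 ⟨m, Finsupp.mem_support_iff.2 h2, h1⟩)
      · rfl
    rw [this, mul_zero]
    refine Finset.sum_eq_zero fun j hj => ?_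
    exact comp_other w (k := e + j) (hf.mul (comp_supp w j g) (by rintro a ha b hb; simp_all))
        (by rintro h; have : j = k := by omega
            exact hk (this ▸ hj))
lemma comp_mul' (w : M →+ ℤ) (e k : ℤ) {f : L} (g : L) (hf : SuppIn f {m | w m = e}) :
    comp w k (f * g) = f * comp w (k - e) g := by
  rw [← comp_mul w e _ g hf]; congr 2; omega
end Mon

end

section

section MR
variable {K : Type} [Field K] {M : Type} [AddCommGroup M]
local notation "L" => AddMonoidAlgebra K M

/-- box of exponents -/
def box {ι : Type} (w : ι → M →+ ℤ) (a : ι → ℤ) : Set M := {m | ∀ i, a i ≤ w i m}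

lemma L_cancel [IsDomain L] {a b c : L} (ha : a ≠ 0) (h : a * b = a * c) : b = c :=
  mul_left_cancel₀ ha h

variable (K M) in
/-- `R` is the monoid ring of the cone `w ≥ 0`. -/
structure MR (R : Type) [CommRing R] [Algebra R (AddMonoidAlgebra K M)] {ι : Type}
    (w : ι → M →+ ℤ) : Prop where
  inj : Function.Injective (algebraMap R (AddMonoidAlgebra K M))
  range : ∀ f : AddMonoidAlgebra K M, (∃ r, algebraMap R (AddMonoidAlgebra K M) r = f) ↔
    SuppIn f (box w 0)
  sh : ∀ i c B, ∃ μ : M, w i μ = c ∧ ∀ j, j ≠ i → B ≤ w j μ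

variable {R : Type} [CommRing R] [Algebra R (AddMonoidAlgebra K M)] {ι : Type}
    {w : ι → M →+ ℤ}

variable (K R) in
/-- monomial module -/
noncomputable def Mon (I : Set M) : Submodule R (AddMonoidAlgebra K M) :=
  Submodule.span R (chi '' I)

lemma MR.supp (h : MR K M R w) (r : R) : SuppIn (algebraMap R L r) (box w 0) :=
  (h.range _).1 ⟨r, rfl⟩

lemma MR.mem_Mon (h : MR K M R w) {I : Set M} (hI : ∀ a ∈ I, ∀ q ∈ box w 0, a + q ∈ I) (f : L) :
    f ∈ Mon K R I ↔ SuppIn f I := by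
  constructor
  · intro hf
    induction hf using Submodule.span_induction with
    | mem x hx =>
      obtain ⟨m, hm, rfl⟩ := hx
      exact SuppIn.single hm
    | zero => exact SuppIn.zero _
    | add x y _ _ hx hy => exact hx.add hy
    | smul r x _ hx =>
      rw [Algebra.smul_def]
      exact (h.supp r).mul hx fun a ha b hb => by rw [add_comm]; exact hI b hb a ha
  · intro hf
    rw [L_sum f]
    refine Submodule.sum_mem _ fun m hm => ?_
    obtain ⟨r, hr⟩ := (h.range (f.coeff m • 1)).2 ((SuppIn.one (I := box w 0) (by simp [box])).smul _)
    have : f.coeff m • (chi m : L) = r • chi m := by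
      rw [Algebra.smul_def r, hr]; simp
    rw [this]
    exact Submodule.smul_mem _ _ (Submodule.subset_span ⟨m, hf m (Finsupp.mem_support_iff.1 hm), rfl⟩)

lemma box_add {a : ι → ℤ} : ∀ m ∈ box w a, ∀ q ∈ box w 0, m + q ∈ box w a := by
  intro m hm q hq i
  have h1 := hm i
  have h2 := hq i
  simp only [Pi.zero_apply] at h2
  rw [map_add]; omega

lemma MR.mem_box (h : MR K M R w) {a : ι → ℤ} (f : L) :
    f ∈ Mon K R (box w a) ↔ SuppIn f (box w a) := h.mem_Mon box_add f

lemma MR.big (h : MR K M R w) (B : ℤ) : ∃ μ : M, ∀ j, B ≤ w j μ := by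
  by_cases hι : Nonempty ι
  · obtain ⟨i⟩ := hι
    obtain ⟨μ, h1, h2⟩ := h.sh i B B
    exact ⟨μ, fun j => by
      by_cases hj : j = i
      · subst hj; omega
      · exact h2 j hj⟩
  · exact ⟨0, fun j => absurd ⟨j⟩ hι⟩

lemma MR.att [Finite ι] (h : MR K M R w) (a : ι → ℤ) (i : ι) : ∃ m ∈ box w a, w i m = a i := by
  obtain ⟨B, hB⟩ := (Set.finite_range a).bddAbove
  obtain ⟨μ, h1, h2⟩ := h.sh i (a i) B
  refine ⟨μ, fun j => ?_, h1⟩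
  by_cases hj : j = i
  · subst hj; omega
  · exact (hB ⟨j, rfl⟩).trans (h2 j hj)

lemma supp_bdd [Finite ι] (w : ι → M →+ ℤ) (f : L) : ∃ B : ℤ, ∀ m, f.coeff m ≠ 0 → ∀ i, -B ≤ w i m := by
  have hf : (Set.range fun x : f.coeff.support × ι => w x.2 x.1).Finite := Set.finite_range _
  obtain ⟨B, hB⟩ := hf.bddBelow
  refine ⟨-B, fun m hm i => ?_⟩
  have := hB ⟨(⟨m, Finsupp.mem_support_iff.2 hm⟩, i), rfl⟩
  simpa using this

lemma comp_zero_of (u : M →+ ℤ) (k : ℤ) {f : L} (h : ∀ m, f.coeff m ≠ 0 → u m ≠ k) : comp u k f = 0 := by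
  classical
  ext m
  rw [comp_coeff]
  split_ifs with h1
  · by_contra h2; exact h m h2 h1
  · rfl

/-- lowest components multiply -/
lemma comp_low (u : M →+ ℤ) (a b : ℤ) {f g : L} (hf : SuppIn f {m | a ≤ u m}) (hg : SuppIn g {m | b ≤ u m}) :
    comp u (a + b) (f * g) = comp u a f * comp u b g := by
  classical
  have h1 : f * g = comp u a f * g + (f - comp u a f) * g := by ring
  rw [h1, map_add, comp_mul u a b _ (comp_supp u a f)]
  rw [comp_zero_of u (a + b) (f := (f - comp u a f) * g), add_zero]
  have h2 : SuppIn (f - comp u a f) {m | a + 1 ≤ u m} := by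
    intro m hm
    have h3 := hm
    have e : (f - comp u a f).coeff m = f.coeff m - (comp u a f).coeff m := by simp
    rw [e, comp_coeff] at hm
    split_ifs at hm with h4
    · simp at hm
    · have := hf m (by simpa using hm)
      simp only [Set.mem_setOf_eq] at this ⊢
      omega
  have h3 : SuppIn ((f - comp u a f) * g) {m | a + b + 1 ≤ u m} := by
    refine h2.mul hg ?_
    intro x hx y hy
    simp only [Set.mem_setOf_eq, map_add] at *
    omega
  intro m hm
  have := h3 m hm
  simp only [Set.mem_setOf_eq] at this
  omega

lemma comp_ne (u : M →+ ℤ) {f : L} {m : M} (h : f.coeff m ≠ 0) : comp u (u m) f ≠ 0 := by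
  classical
  intro h0
  have : (comp u (u m) f).coeff m = 0 := by rw [h0]; rfl
  rw [comp_coeff, if_pos rfl] at this
  exact h this

/-- if `t` has minimal `u`-value exactly 0 and `t*l` is ≥ 0, then `l` is ≥ 0 -/
lemma val_nonneg [IsDomain L] (u : M →+ ℤ) {t l : L} (ht : SuppIn t {m | 0 ≤ u m})
    (ht0 : ∃ m, t.coeff m ≠ 0 ∧ u m = 0) (htl : SuppIn (t * l) {m | 0 ≤ u m}) :
    SuppIn l {m | 0 ≤ u m} := by
  classical
  by_contra hl
  simp only [SuppIn, not_forall] at hl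
  obtain ⟨m1, hm1, hm1'⟩ := hl
  obtain ⟨m2, hm2, hmin⟩ := Finset.exists_min_image l.coeff.support u ⟨m1, Finsupp.mem_support_iff.2 hm1⟩
  have hneg : u m2 < 0 := by
    have := hmin m1 (Finsupp.mem_support_iff.2 hm1)
    simp only [Set.mem_setOf_eq] at hm1'
    omega
  have h1 := comp_low u 0 (u m2) ht (g := l) (fun m hm => hmin m (Finsupp.mem_support_iff.2 hm))
  have h2 : comp u (0 + u m2) (t * l) = 0 := comp_zero_of u _ fun m hm => by
    have := htl m hm
    simp only [Set.mem_setOf_eq] at this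
    omega
  obtain ⟨m0, hm0, hm0'⟩ := ht0
  have h3 : comp u 0 t ≠ 0 := hm0' ▸ comp_ne u hm0
  have h4 : comp u (u m2) l ≠ 0 := comp_ne u (Finsupp.mem_support_iff.1 hm2)
  rw [h2] at h1
  exact mul_ne_zero h3 h4 h1.symm

lemma MR.isDomain [IsDomain L] (h : MR K M R w) : IsDomain R := h.inj.isDomain (algebraMap R L)

variable {C : Type} [AddCommGroup C] [Module R C]

lemma MR.embed [Finite ι] [IsNoetherianRing R] [IsDomain L] [UniqueFactorizationMonoid L] (h : MR K M R w) (hC : SD R C) :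
    ∃ ψ : C →ₗ[R] L, Function.Injective ψ ∧ ∃ s : Finset L,
      LinearMap.range ψ = Submodule.span R (s : Set L) ∧
      ∀ u b : L, (∀ g ∈ s, u ∣ g * b) → u ∣ b := by
  classical
  have := h.isDomain
  have := hC.1
  have hex : ∃ φ : C →ₗ[R] R, φ ≠ 0 := by
    by_contra hno
    push Not at hno
    exact one_ne_zero (exists_hom_ne_zero hC.faithful hno (1:R))
  obtain ⟨φ, hφ⟩ := hex
  have hφi : Function.Injective φ := by
    rw [injective_iff_map_eq_zero]
    intro c hc
    by_contra hc0
    obtain ⟨r, hr⟩ := hC.scalar (LinearMap.toSpanSingleton R C c ∘ₗ φ)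
    have h1 : r = 0 := by
      by_contra hr0
      have h2 := hr c
      simp only [LinearMap.comp_apply, hc, map_zero] at h2
      exact hc0 (hC.torsionFree r hr0 c h2.symm)
    apply hφ
    ext x
    by_contra hx
    have h2 := hr x
    simp only [LinearMap.comp_apply, h1, zero_smul, LinearMap.toSpanSingleton_apply] at h2
    exact hc0 (hC.torsionFree _ hx c h2)
  let ψ1 : C →ₗ[R] L := Algebra.linearMap R L ∘ₗ φ
  have hψ1 : Function.Injective ψ1 := h.inj.comp hφi
  obtain ⟨sC, hsC⟩ := (Module.finite_def (R := R) (M := C)).1 inferInstance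
  let s1 : Finset L := sC.image ψ1
  have hs1 : LinearMap.range ψ1 = Submodule.span R (s1 : Set L) := by
    rw [LinearMap.range_eq_map, ← hsC, Submodule.map_span]; simp [s1]
  have hs1n : s1.Nonempty := by
    by_contra hne
    rw [Finset.not_nonempty_iff_eq_empty] at hne
    rw [hne] at hs1
    apply hφ
    ext x
    have : ψ1 x ∈ LinearMap.range ψ1 := ⟨x, rfl⟩
    rw [hs1] at this
    simp only [Finset.coe_empty, Submodule.span_empty, Submodule.mem_bot] at this
    exact h.inj (by simpa [ψ1] using this)
  let _ : StrongNormalizationMonoid L := UniqueFactorizationMonoid.normalizationMonoid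
  let _ := UniqueFactorizationMonoid.toNormalizedGCDMonoid L
  obtain ⟨g, hg, hg1⟩ := Finset.extract_gcd (s := s1) id hs1n
  set d := s1.gcd id with hd
  have hd0 : d ≠ 0 := by
    intro h0
    rw [hd, Finset.gcd_eq_zero_iff] at h0
    apply hφ
    ext x
    have : ψ1 x ∈ LinearMap.range ψ1 := ⟨x, rfl⟩
    rw [hs1] at this
    have h2 : Submodule.span R (s1 : Set L) ≤ ⊥ := Submodule.span_le.2 fun y hy => h0 y hy
    have := h2 this
    exact h.inj (by simpa [ψ1] using this)
  let md : L →ₗ[R] L := LinearMap.mulLeft R d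
  have hmd : Function.Injective md := fun a b hab => L_cancel hd0 hab
  have hle : ∀ c, ∃ y, md y = ψ1 c := by
    intro c
    have h1 : LinearMap.range ψ1 ≤ LinearMap.range md := by
      rw [hs1, Submodule.span_le]
      intro y hy
      exact ⟨g y, (hg y hy).symm⟩
    exact h1 ⟨c, rfl⟩
  choose ψ hψ using hle
  let Ψ : C →ₗ[R] L :=
    { toFun := ψ
      map_add' := fun a b => hmd (by rw [map_add, hψ, hψ, hψ, map_add])
      map_smul' := fun r a => hmd (by rw [RingHom.id_apply, map_smul, hψ, hψ, map_smul]) }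
  refine ⟨Ψ, fun a b hab => hψ1 (by rw [← hψ, ← hψ]; exact congrArg md hab), s1.image g, ?_, ?_⟩
  · have h1 : md ∘ₗ Ψ = ψ1 := LinearMap.ext hψ
    apply Submodule.map_injective_of_injective hmd
    rw [← LinearMap.range_comp, h1, hs1, Submodule.map_span]
    congr 1
    ext y
    simp only [Finset.coe_image, Set.mem_image, Finset.mem_coe]
    constructor
    · intro hy; exact ⟨g y, ⟨y, hy, rfl⟩, (hg y hy).symm⟩
    · rintro ⟨_, ⟨z, hz, rfl⟩, rfl⟩
      have h5 := hg z hz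
      simp only [id] at h5
      change d * g z ∈ s1
      rwa [← h5]
  · intro u b hub
    have h1 : u ∣ s1.gcd fun x => g x * b := Finset.dvd_gcd fun x hx => hub _ (Finset.mem_image_of_mem g hx)
    have h2 := h1.trans (Finset.gcd_mul_right' s1 g b).dvd
    rwa [hg1, one_mul] at h2

theorem MR.thm1 [Finite ι] [IsNoetherianRing R] [IsDomain L] [UniqueFactorizationMonoid L] (h : MR K M R w) (hC : SD R C) :
    ∃ a : ι → ℤ, Nonempty (C ≃ₗ[R] Mon K R (box w a)) := by
  classical
  have := h.isDomain
  obtain ⟨ψ, hψ, s, hs, hgcd⟩ := h.embed hC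
  -- nonzero generator
  have hg0 : ∃ g ∈ s, g ≠ 0 := by
    by_contra hno
    push Not at hno
    have := hgcd 0 1 fun g hg => by rw [hno g hg]; simp
    simp at this
  -- minimum values
  let S : Finset M := s.biUnion fun g => g.coeff.support
  have hS : S.Nonempty := by
    obtain ⟨g, hg, h0⟩ := hg0
    have : g.coeff.support.Nonempty := by
      rw [Finsupp.support_nonempty_iff]
      intro h1; apply h0; ext m; rw [h1]; rfl
    obtain ⟨m, hm⟩ := this
    exact ⟨m, Finset.mem_biUnion.2 ⟨g, hg, hm⟩⟩
  have hmin : ∀ i, ∃ a : ℤ, (∀ g ∈ s, ∀ m, g.coeff m ≠ 0 → a ≤ w i m) ∧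
      ∃ g ∈ s, ∃ m, g.coeff m ≠ 0 ∧ w i m = a := by
    intro i
    obtain ⟨m, hm, hmm⟩ := Finset.exists_min_image S (w i) hS
    obtain ⟨g, hg, hgm⟩ := Finset.mem_biUnion.1 hm
    exact ⟨w i m, fun g' hg' m' hm' => hmm m' (Finset.mem_biUnion.2 ⟨g', hg', Finsupp.mem_support_iff.2 hm'⟩),
      g, hg, m, Finsupp.mem_support_iff.1 hgm, rfl⟩
  choose a ha ha' using hmin
  have hrange : LinearMap.range ψ = Mon K R (box w a) := by
    apply le_antisymm
    · rw [hs, Submodule.span_le]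
      intro g hg
      exact (h.mem_box g).2 fun m hm i => ha i g hg m hm
    · intro f hf
      rw [h.mem_box] at hf
      by_contra hfn
      have hsr : ∀ g ∈ s, g ∈ LinearMap.range ψ := fun g hg => hs ▸ Submodule.subset_span hg
      -- multiplication trick
      have htr : ∀ (μ : M) (g : L), g ∈ s → (∀ m, f.coeff m ≠ 0 → μ + m ∈ box w 0) →
          chi μ * g * f ∈ LinearMap.range ψ := by
        intro μ g hg hμ
        obtain ⟨r, hr⟩ := (h.range (chi μ * f)).2 (chi_supp.2 hμ)
        have : chi μ * g * f = r • g := by rw [Algebra.smul_def, hr]; ring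
        rw [this]
        exact Submodule.smul_mem _ _ (hsr g hg)
      have hbnd : ∃ B : ℤ, (∀ m, f.coeff m ≠ 0 → ∀ i, -B ≤ w i m) ∧
          ∀ g ∈ s, ∀ m, g.coeff m ≠ 0 → ∀ i, -B ≤ w i m := by
        choose Bf hBf using supp_bdd (K := K) w
        obtain ⟨B, hB⟩ := ((insert f s).image Bf).exists_le
        refine ⟨B, fun m hm i => ?_, fun g hg m hm i => ?_⟩
        · have := hBf f m hm i
          have := hB (Bf f) (Finset.mem_image_of_mem _ (by simp))
          omega
        · have := hBf g m hm i
          have := hB (Bf g) (Finset.mem_image_of_mem _ (by simp [hg]))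
          omega
      obtain ⟨B, hBf, hBg⟩ := hbnd
      obtain ⟨μ, hμ⟩ := h.big B
      have hμf : ∀ m, f.coeff m ≠ 0 → μ + m ∈ box w 0 := fun m hm i => by
        have h1 := hBf m hm i; have h2 := hμ i
        rw [map_add, Pi.zero_apply]; omega
      have hμg : ∀ g ∈ s, ∀ m, g.coeff m ≠ 0 → μ + m ∈ box w 0 := fun g hg m hm i => by
        have h1 := hBg g hg m hm i; have h2 := hμ i
        rw [map_add, Pi.zero_apply]; omega
      obtain ⟨g0, hg0s, hg0⟩ := hg0
      obtain ⟨f0, hf0⟩ := (h.range (chi μ * g0)).2 (chi_supp.2 (hμg g0 hg0s))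
      obtain ⟨a0, ha0⟩ := htr μ g0 hg0s hμf
      have hf0L : algebraMap R L f0 ≠ 0 := by rw [hf0]; exact mul_ne_zero (chi_ne μ) hg0
      have hf00 : f0 ≠ 0 := fun h0 => hf0L (by rw [h0, map_zero])
      rw [← hf0] at ha0
      obtain ⟨b, hb1, hb2⟩ := hC.star f0 hf00 a0 (by
        intro c hc
        apply hfn
        refine ⟨c, ?_⟩
        rw [← hc, map_smul, Algebra.smul_def] at ha0
        exact L_cancel hf0L ha0)
      have hb3 : ∀ t : R, algebraMap R L t * f ∈ LinearMap.range ψ → f0 ∣ t * b := by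
        rintro t ⟨c, hc⟩
        refine hb2 t ⟨c, hψ ?_⟩
        rw [map_smul, map_smul, Algebra.smul_def, Algebra.smul_def, ha0, hc]; ring
      have hdv : algebraMap R L f0 ∣ algebraMap R L b := by
        apply hgcd
        intro g hg
        obtain ⟨t, ht⟩ := (h.range (chi μ * g)).2 (chi_supp.2 (hμg g hg))
        have h1 := map_dvd (algebraMap R L) (hb3 t (by rw [ht]; exact htr μ g hg hμf))
        rw [map_mul, ht, mul_assoc] at h1
        exact (IsUnit.dvd_mul_left (chi_unit μ)).1 h1
      obtain ⟨l, hl⟩ := hdv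
      have hlR : ∃ r, algebraMap R L r = l := by
        rw [h.range]
        intro m hm i
        obtain ⟨g, hg, m0, hm0, hm0'⟩ := ha' i
        obtain ⟨ν, hν1, hν2⟩ := h.sh i (- a i) B
        have k1 : ∀ m, g.coeff m ≠ 0 → ν + m ∈ box w 0 := by
          intro m hm j
          rw [map_add, Pi.zero_apply]
          by_cases hj : j = i
          · subst hj
            have := ha j g hg m hm
            omega
          · have := hν2 j hj
            have := hBg g hg m hm j
            omega
        have k2 : ∀ m, f.coeff m ≠ 0 → ν + m ∈ box w 0 := by
          intro m hm j
          rw [map_add, Pi.zero_apply]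
          by_cases hj : j = i
          · subst hj
            have := hf m hm j
            omega
          · have := hν2 j hj
            have := hBf m hm j
            omega
        obtain ⟨t, ht⟩ := (h.range (chi ν * g)).2 (chi_supp.2 k1)
        obtain ⟨r, hr⟩ := hb3 t (by rw [ht]; exact htr ν g hg k2)
        have h2 : algebraMap R L t * l = algebraMap R L r := by
          have := congrArg (algebraMap R L) hr
          rw [map_mul, map_mul, hl] at this
          apply L_cancel hf0L
          rw [← this]; ring
        have h3 := val_nonneg (w i) (t := algebraMap R L t) (l := l)
          (fun m hm => h.supp t m hm i) ⟨ν + m0, by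
            rw [ht, chi_coeff]; simpa using hm0, by rw [map_add, hν1, hm0']; omega⟩
          (by rw [h2]; exact fun m hm => h.supp r m hm i)
        exact h3 m hm
      obtain ⟨r, hr⟩ := hlR
      apply hb1
      refine ⟨r, h.inj ?_⟩
      rw [map_mul, hl, hr]
  exact ⟨a, ⟨(LinearEquiv.ofInjective ψ hψ).trans (LinearEquiv.ofEq _ _ hrange)⟩⟩

lemma MR.hcross [Finite ι] [IsDomain L] (h : MR K M R w) : ∀ {a b : ι → ℤ} (θ : Mon K R (box w a) →ₗ[R] Mon K R (box w b)) (x y : Mon K R (box w a)),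
      (x : L) * (θ y : L) = (y : L) * (θ x : L) := by
    intro a b θ x y
    obtain ⟨B1, hB1⟩ := supp_bdd w (x : L)
    obtain ⟨B2, hB2⟩ := supp_bdd w (y : L)
    obtain ⟨μ, hμ⟩ := h.big (max B1 B2)
    obtain ⟨r1, hr1⟩ := (h.range (chi μ * (x : L))).2 (chi_supp.2 fun m hm i => by
      have := hB1 m hm i; have := hμ i; have := le_max_left B1 B2
      rw [map_add, Pi.zero_apply]; omega)
    obtain ⟨r2, hr2⟩ := (h.range (chi μ * (y : L))).2 (chi_supp.2 fun m hm i => by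
      have := hB2 m hm i; have := hμ i; have := le_max_right B1 B2
      rw [map_add, Pi.zero_apply]; omega)
    have e : r1 • y = r2 • x := by
      apply Subtype.ext
      rw [Submodule.coe_smul, Submodule.coe_smul, Algebra.smul_def, Algebra.smul_def, hr1, hr2]; ring
    have e2 := congrArg (fun z => ((θ z : Mon K R (box w b)) : L)) e
    simp only [map_smul, Submodule.coe_smul, Algebra.smul_def, hr1, hr2] at e2
    apply L_cancel (chi_ne μ)
    rw [← mul_assoc, ← mul_assoc]; exact e2

lemma MR.hmul [Finite ι] [IsDomain L] (h : MR K M R w) : ∀ {a b : ι → ℤ} (θ : Mon K R (box w a) →ₗ[R] Mon K R (box w b)), ∃ l : L,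
      ∀ x : Mon K R (box w a), (θ x : L) = l * (x : L) := by
    intro a b θ
    obtain ⟨B, hB⟩ := (Set.finite_range a).bddAbove
    obtain ⟨m, hm⟩ := h.big B
    let e : Mon K R (box w a) := ⟨chi m, (h.mem_box _).2 (SuppIn.single fun i => (hB ⟨i, rfl⟩).trans (hm i))⟩
    refine ⟨chi (-m) * (θ e : L), fun x => ?_⟩
    apply L_cancel (chi_ne m)
    have := h.hcross θ x e
    change (x : L) * (θ e : L) = chi m * _ at this
    rw [← this]
    have h1 : (chi m : L) * chi (-m) = 1 := by rw [chi_mul]; simp [chi_zero]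
    calc (x : L) * (θ e : L) = (chi m * chi (-m)) * ((θ e : L) * (x : L)) := by rw [h1]; ring
      _ = _ := by ring

lemma MR.hbd [Finite ι] (h : MR K M R w) : ∀ {a b : ι → ℤ} (θ : Mon K R (box w a) →ₗ[R] Mon K R (box w b)) (l : L)
      (hl : ∀ x : Mon K R (box w a), (θ x : L) = l * (x : L)) (m : M), l.coeff m ≠ 0 → ∀ i, b i ≤ a i + w i m := by
    intro a b θ l hl m hm i
    obtain ⟨v, hv, hvi⟩ := h.att a i
    have h1 := hl ⟨chi v, (h.mem_box _).2 (SuppIn.single hv)⟩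
    have h2 := (h.mem_box _).1 (θ ⟨chi v, (h.mem_box _).2 (SuppIn.single hv)⟩).2
    rw [h1, mul_comm] at h2
    have := chi_supp.1 h2 m hm i
    rw [map_add, hvi] at this
    exact this

/-- An iso between monomial modules is a translation. -/
theorem MR.iso [Finite ι] [IsDomain L] (h : MR K M R w) {a b : ι → ℤ}
    (θ : Mon K R (box w a) ≃ₗ[R] Mon K R (box w b)) : ∃ μ : M, ∀ i, b i = a i + w i μ := by
  classical
  obtain ⟨l, hl⟩ := h.hmul θ.toLinearMap
  obtain ⟨l', hl'⟩ := h.hmul θ.symm.toLinearMap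
  obtain ⟨v, hv⟩ : ∃ v, v ∈ box w a := by
    obtain ⟨B, hB⟩ := (Set.finite_range a).bddAbove
    obtain ⟨m, hm⟩ := h.big B
    exact ⟨m, fun i => (hB ⟨i, rfl⟩).trans (hm i)⟩
  have hll : l' * l = 1 := by
    let e : Mon K R (box w a) := ⟨chi v, (h.mem_box _).2 (SuppIn.single hv)⟩
    have h1 : ((θ.symm (θ e) : Mon K R (box w a)) : L) = l' * (l * (e : L)) := by
      have := hl' (θ e)
      have h2 := hl e
      simp only [LinearEquiv.coe_coe] at this h2
      rw [this, h2]
    rw [θ.symm_apply_apply] at h1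
    apply L_cancel (chi_ne v)
    change chi v = l' * (l * chi v) at h1
    rw [mul_one]; conv_rhs => rw [h1]
    ring
  have h0 : (l' * l).coeff 0 ≠ 0 := by rw [hll]; simp [AddMonoidAlgebra.one_def]
  have := AddMonoidAlgebra.support_coeff_mul_subset l' l (Finsupp.mem_support_iff.2 h0)
  obtain ⟨p, hp, q, hq, hpq⟩ := Finset.mem_add.1 this
  refine ⟨q, fun i => ?_⟩
  have h1 := h.hbd _ l hl q (Finsupp.mem_support_iff.1 hq) i
  have h2 := h.hbd _ l' hl' p (Finsupp.mem_support_iff.1 hp) i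
  have h3 : w i p + w i q = 0 := by rw [← map_add, hpq, map_zero]
  omega

/-- translations give isomorphisms -/
noncomputable def MR.trans (h : MR K M R w) {a b : ι → ℤ} (μ : M) (hμ : ∀ i, b i = a i + w i μ) :
    Mon K R (box w a) ≃ₗ[R] Mon K R (box w b) := by
  have key : ∀ {a b : ι → ℤ} (μ : M), (∀ i, b i = a i + w i μ) → ∀ f ∈ Mon K R (box w a),
      (chi μ : L) * f ∈ Mon K R (box w b) := by
    intro a b μ hμ f hf
    rw [h.mem_box] at hf ⊢
    refine chi_supp.2 fun m hm i => ?_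
    have := hf m hm i
    rw [hμ i, map_add]; omega
  have inv : ∀ (μ : M) (f : L), (chi μ : L) * (chi (-μ) * f) = f := by
    intro μ f
    rw [← mul_assoc, chi_mul]; simp [chi_zero]
  exact
  { toFun := fun f => ⟨chi μ * (f : L), key μ hμ f f.2⟩
    map_add' := fun x y => Subtype.ext (by simp [mul_add])
    map_smul' := fun r x => Subtype.ext (by simp)
    invFun := fun f => ⟨chi (-μ) * (f : L), key (-μ) (fun i => by rw [hμ i, map_neg]; omega) f f.2⟩
    left_inv := fun f => Subtype.ext (by have := inv (-μ) (f : L); simpa using this)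
    right_inv := fun f => Subtype.ext (inv μ f) }

/-- `R` itself. -/
noncomputable def MR.self (h : MR K M R w) : R ≃ₗ[R] Mon K R (box w 0) := by
  refine LinearEquiv.ofBijective ((Algebra.linearMap R L).codRestrict (Mon K R (box w 0))
    fun r => (h.mem_box _).2 (h.supp r)) ⟨?_, ?_⟩
  · intro x y hxy
    exact h.inj (congrArg Subtype.val hxy)
  · rintro ⟨f, hf⟩
    obtain ⟨r, hr⟩ := (h.range f).2 ((h.mem_box f).1 hf)
    exact ⟨r, Subtype.ext hr⟩
end MR

end

section

open scoped TensorProduct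

section A
variable {K : Type} [Field K] {M : Type} [AddCommGroup M]
local notation "L" => AddMonoidAlgebra K M
variable {R : Type} [CommRing R] [Algebra R (AddMonoidAlgebra K M)] {ι : Type}
    {w : ι → M →+ ℤ}

lemma MR.exists_mem [Finite ι] (h : MR K M R w) (a : ι → ℤ) : ∃ v, v ∈ box w a := by
  obtain ⟨B, hB⟩ := (Set.finite_range a).bddAbove
  obtain ⟨m, hm⟩ := h.big B
  exact ⟨m, fun i => (hB ⟨i, rfl⟩).trans (hm i)⟩

lemma MR.finite [Finite ι] [IsNoetherianRing R] (h : MR K M R w) (a : ι → ℤ) :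
    Module.Finite R (Mon K R (box w a)) := by
  obtain ⟨v, hv⟩ := h.exists_mem (fun i => - a i)
  let b : ι → ℤ := fun i => a i + w i v
  have hb : ∀ i, 0 ≤ b i := fun i => by have h9 : -a i ≤ w i v := hv i; simp only [b]; omega
  have hle : Mon K R (box w b) ≤ Mon K R (box w 0) := by
    refine Submodule.span_mono (Set.image_mono fun m hm i => ?_)
    have := hm i
    have := hb i
    rw [Pi.zero_apply]; omega
  have : Module.Finite R (Mon K R (box w 0)) := Module.Finite.equiv h.self
  have : Module.Finite R (Mon K R (box w b)) :=
    Module.Finite.of_injective (Submodule.inclusion hle) (Submodule.inclusion_injective hle)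
  exact Module.Finite.equiv (h.trans v (fun _ => rfl) : Mon K R (box w a) ≃ₗ[R] Mon K R (box w b)).symm

lemma MR.sd_of_ev [Finite ι] [IsNoetherianRing R] [IsDomain L] (h : MR K M R w) (a : ι → ℤ)
    (hev : ∀ i, EV R (i+1) (Mon K R (box w a)) (Mon K R (box w a))) : SD R (Mon K R (box w a)) := by
  refine ⟨h.finite a, ⟨?_, ?_⟩, hev⟩
  · intro r s hrs
    obtain ⟨v, hv⟩ := h.exists_mem a
    have := congrArg Subtype.val (LinearMap.congr_fun hrs ⟨chi v, (h.mem_box _).2 (SuppIn.single hv)⟩)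
    simp only [LinearMap.lsmul_apply, Submodule.coe_smul, Algebra.smul_def] at this
    exact h.inj (mul_right_cancel₀ (chi_ne v) this)
  · intro φ
    obtain ⟨l, hl⟩ := h.hmul φ
    have hb := h.hbd φ l hl
    obtain ⟨r, hr⟩ := (h.range l).2 fun m hm i => by
      have := hb m hm i
      rw [Pi.zero_apply]; omega
    refine ⟨r, LinearMap.ext fun x => Subtype.ext ?_⟩
    rw [hl x, LinearMap.lsmul_apply, Submodule.coe_smul, Algebra.smul_def, hr]

/-- Step 1: localization. -/
lemma MR.step1 [Finite ι] [IsNoetherianRing R] [IsDomain L] (h : MR K M R w) {ι' : Type} (τ : ι' → ι)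
    {T : Type} [CommRing T] [Algebra T (AddMonoidAlgebra K M)] [Algebra R T] [IsScalarTower R T L]
    (hT : MR K M T (fun i => w (τ i))) (x : M) (hx0 : ∀ i, w (τ i) x = 0)
    (hx : ∀ j, (∀ i, τ i ≠ j) → 0 < w j x) (a : ι → ℤ) :
    (SD R (Mon K R (box w a)) → SD T (Mon K T (box (fun i => w (τ i)) (fun i => a (τ i))))) ∧
    (FID R (Mon K R (box w a)) → FID T (Mon K T (box (fun i => w (τ i)) (fun i => a (τ i))))) := by
  have hxQ : x ∈ box w 0 := fun j => by
    rw [Pi.zero_apply]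
    by_cases hj : ∃ i, τ i = j
    · obtain ⟨i, rfl⟩ := hj; rw [hx0]
    · push Not at hj; exact (hx j hj).le
  obtain ⟨rx, hrx⟩ := (h.range (chi x)).2 (SuppIn.single hxQ)
  have hpow : ∀ N : ℕ, algebraMap R L (rx ^ N) = chi (N • x) := by
    intro N
    induction N with
    | zero => simp [chi_zero]
    | succ N ih => rw [pow_succ, map_mul, ih, hrx, chi_mul, succ_nsmul]
  -- absorbing
  have habs : ∀ (c : ι → ℤ) (f : L), SuppIn f (box (fun i => w (τ i)) (fun i => c (τ i))) →
      ∃ N : ℕ, SuppIn (chi (N • x) * f) (box w c) := by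
    intro c f hf
    obtain ⟨B, hB⟩ := supp_bdd w f
    obtain ⟨B', hB'⟩ := (Set.finite_range c).bddAbove
    refine ⟨(B + B').toNat, chi_supp.2 fun m hm j => ?_⟩
    rw [map_add, map_nsmul]
    by_cases hj : ∃ i, τ i = j
    · obtain ⟨i, rfl⟩ := hj
      rw [hx0]; simpa using hf m hm i
    · push Not at hj
      have h1 := hx j hj
      have h2 := hB m hm j
      have h3 : c j ≤ B' := hB' ⟨j, rfl⟩
      have h4 := Int.self_le_toNat (B + B')
      rw [nsmul_eq_mul]
      have h5 : ((B + B').toNat : ℤ) * 1 ≤ ((B + B').toNat : ℤ) * w j x :=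
        mul_le_mul_of_nonneg_left (by omega) (by omega)
      omega
  let Sx := Submonoid.powers rx
  obtain ⟨tx, htx⟩ := (hT.range (chi (-x))).2 (SuppIn.single fun i => by simp [hx0])
  have hinvT : ∀ N : ℕ, algebraMap R T (rx ^ N) * tx ^ N = 1 := by
    intro N
    rw [map_pow, ← mul_pow]
    have : algebraMap R T rx * tx = 1 := by
      apply hT.inj
      rw [map_mul, ← IsScalarTower.algebraMap_apply, hrx, htx, chi_mul]; simp [chi_zero]
    rw [this, one_pow]
  have hloc : IsLocalization Sx T := by
    rw [isLocalization_iff]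
    refine ⟨?_, ?_, ?_⟩
    · rintro ⟨_, N, rfl⟩
      exact IsUnit.of_mul_eq_one _ (hinvT N)
    · intro z
      obtain ⟨N, hN⟩ := habs 0 (algebraMap T L z) (hT.supp z)
      obtain ⟨r, hr⟩ := (h.range _).2 hN
      refine ⟨⟨r, ⟨rx ^ N, N, rfl⟩⟩, hT.inj ?_⟩
      rw [map_mul, ← IsScalarTower.algebraMap_apply, ← IsScalarTower.algebraMap_apply, hr, hpow, mul_comm]
    · intro y z hyz
      refine ⟨1, ?_⟩
      have : y = z := h.inj (by
        rw [IsScalarTower.algebraMap_apply R T L, hyz, ← IsScalarTower.algebraMap_apply])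
      rw [this]
  let l : Mon K R (box w a) →ₗ[R] Mon K T (box (fun i => w (τ i)) (fun i => a (τ i))) :=
    { toFun := fun f => ⟨f, (hT.mem_box _).2 (((h.mem_box _).1 f.2).mono fun m hm i => hm (τ i))⟩
      map_add' := fun _ _ => rfl
      map_smul' := fun _ _ => rfl }
  have hl : IsLocalizedModule Sx l := by
    refine ⟨?_, ?_, ?_⟩
    · rintro ⟨_, N, rfl⟩
      have h1 : IsUnit (algebraMap R T (rx ^ N)) := IsUnit.of_mul_eq_one _ (hinvT N)
      rw [Module.End.isUnit_iff]
      constructor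
      · intro y z hyz
        have := congrArg (fun v => tx ^ N • v) hyz
        simp only [Module.algebraMap_end_apply] at this
        rw [← algebraMap_smul T (rx ^ N) y, ← algebraMap_smul T (rx ^ N) z, smul_smul, smul_smul,
          mul_comm, hinvT, one_smul, one_smul] at this
        exact this
      · intro y
        refine ⟨tx ^ N • y, ?_⟩
        simp only [Module.algebraMap_end_apply]
        rw [← algebraMap_smul T (rx ^ N), smul_smul, hinvT, one_smul]
    · rintro ⟨f, hf⟩
      obtain ⟨N, hN⟩ := habs a f ((hT.mem_box _).1 hf)
      refine ⟨⟨⟨_, (h.mem_box _).2 hN⟩, ⟨rx ^ N, N, rfl⟩⟩, Subtype.ext ?_⟩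
      change (rx ^ N) • f = chi (N • x) * f
      rw [Algebra.smul_def, hpow]
    · intro y z hyz
      have h9 : (y : L) = z := congrArg (fun v : Mon K T (box (fun i => w (τ i)) (fun i => a (τ i))) => (v : L)) hyz
      exact ⟨1, by rw [Subtype.ext h9]⟩
  exact ⟨fun hs => hs.loc Sx l, fun hs => hs.loc Sx l⟩
end A

section B
variable {K : Type} [Field K] {M M' : Type} [AddCommGroup M] [AddCommGroup M']
local notation "L" => AddMonoidAlgebra K M

variable (K) in
/-- extension map along a section -/
noncomputable def exm (sec : M' →+ M) : AddMonoidAlgebra K M' →+* AddMonoidAlgebra K M :=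
  AddMonoidAlgebra.mapDomainRingHom K sec

lemma exm_chi (sec : M' →+ M) (m : M') : exm K sec (chi m) = chi (sec m) := by
  simp [exm, chi, AddMonoidAlgebra.mapDomainRingHom]

lemma exm_smul (sec : M' →+ M) (c : K) (f : (AddMonoidAlgebra K M')) : exm K sec (c • f) = c • exm K sec f := by
  rw [Algebra.smul_def, map_mul, Algebra.smul_def]
  congr 1
  simp [exm, AddMonoidAlgebra.mapDomainRingHom, AddMonoidAlgebra.algebraMap_def]

open Classical in
lemma exm_coeff (π : M →+ M') (sec : M' →+ M) (hs : ∀ m, π (sec m) = m) (l : M) (hl : π l = 0) (f : (AddMonoidAlgebra K M')) (m : M) :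
    (chi l * exm K sec f).coeff m = if m - sec (π m) = l then f.coeff (π m) else 0 := by
  conv_lhs => rw [L_sum f]
  rw [map_sum, Finset.mul_sum, AddMonoidAlgebra.coeff_sum, Finsupp.finsetSum_apply]
  have h1 : ∀ y, (chi l * exm K sec (f.coeff y • chi y)).coeff m =
      if l + sec y = m then f.coeff y else 0 := by
    intro y
    rw [exm_smul, exm_chi, mul_smul_comm, chi_mul, AddMonoidAlgebra.coeff_smul, Finsupp.smul_apply, chi,
      AddMonoidAlgebra.coeff_single, Finsupp.single_apply]
    simp
  simp_rw [h1]
  split_ifs with h2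
  · by_cases h3 : f.coeff (π m) = 0
    · rw [h3]
      refine Finset.sum_eq_zero fun y _ => ?_
      split_ifs with h4
      · rw [← h4] at h3
        simpa [hl, hs] using h3
      · rfl
    · rw [Finset.sum_eq_single_of_mem (π m) (Finsupp.mem_support_iff.2 h3)]
      · rw [if_pos]; rw [← h2]; abel
      · intro y _ hy
        rw [if_neg]
        rintro h4
        apply hy
        rw [← h4]; simp [hl, hs]
  · refine Finset.sum_eq_zero fun y _ => ?_
    rw [if_neg]
    rintro h4
    apply h2
    rw [← h4]; simp [hl, hs]

variable {S T : Type} [CommRing S] [CommRing T] [Algebra S (AddMonoidAlgebra K M')] [Algebra T (AddMonoidAlgebra K M)] [Algebra S T] [Algebra S (AddMonoidAlgebra K M)]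
  [IsScalarTower S T (AddMonoidAlgebra K M)]

/-- Step 2: descent. -/
lemma MR.step2 {ι : Type} [Finite ι] [IsNoetherianRing S] [IsDomain (AddMonoidAlgebra K M')] {w : ι → M →+ ℤ} {w' : ι → M' →+ ℤ}
    (hT : MR K M T w) (hS : MR K M' S w') (π : M →+ M') (sec : M' →+ M) (hs : ∀ m, π (sec m) = m)
    (hw : ∀ i m, w' i (π m) = w i m)
    (hST : ∀ s : S, algebraMap S L s = exm K sec (algebraMap S (AddMonoidAlgebra K M') s)) (a : ι → ℤ) :
    (SD T (Mon K T (box w a)) → SD S (Mon K S (box w' a))) ∧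
    (FID T (Mon K T (box w a)) → FID S (Mon K S (box w' a))) := by
  classical
  let Λ := π.ker
  let E (D : Submodule S (AddMonoidAlgebra K M')) : (Λ →₀ D) →ₗ[S] L := Finsupp.lsum S fun l : Λ =>
    { toFun := fun d : D => chi (l : M) * exm K sec (d : (AddMonoidAlgebra K M'))
      map_add' := fun x y => by rw [Submodule.coe_add, map_add, mul_add]
      map_smul' := fun r x => by
        rw [Submodule.coe_smul, Algebra.smul_def, map_mul, RingHom.id_apply, Algebra.smul_def, hST]; ring }
  have hEs : ∀ D l d, E D (Finsupp.single l d) = chi (l : M) * exm K sec (d : (AddMonoidAlgebra K M')) := by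
    intro D l d
    simp [E]
  have hlm : ∀ m, m - sec (π m) ∈ π.ker := fun m => by rw [AddMonoidHom.mem_ker]; simp [hs]
  have hE : ∀ D f m, (E D f).coeff m = ((f ⟨m - sec (π m), hlm m⟩ : D) : (AddMonoidAlgebra K M')).coeff (π m) := by
    intro D f m
    induction f using Finsupp.induction_linear with
    | zero => simp
    | add f g hf hg => rw [map_add, AddMonoidAlgebra.coeff_add, Finsupp.add_apply, hf, hg]; simp
    | single l d =>
      rw [hEs, exm_coeff π sec hs _ (AddMonoidHom.mem_ker.1 l.2), Finsupp.single_apply]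
      by_cases h1 : m - sec (π m) = l
      · rw [if_pos h1, if_pos (Subtype.ext h1.symm)]
      · rw [if_neg h1, if_neg (fun h => h1 (by rw [h]))]; simp
  have hEinj : ∀ D, Function.Injective (E D) := by
    intro D f g hfg
    ext l m'
    have h1 := congrArg (fun z => z.coeff (sec m' + l)) hfg
    simp only [hE] at h1
    have h2 : π (sec m' + l) = m' := by rw [map_add, hs, AddMonoidHom.mem_ker.1 l.2, add_zero]
    have h3 : (⟨sec m' + l - sec (π (sec m' + l)), hlm _⟩ : Λ) = l := Subtype.ext (by
      change sec m' + (l : M) - sec (π (sec m' + l)) = l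
      rw [h2]; simp)
    rw [h3, h2] at h1
    exact h1
  have hbox : ∀ a : ι → ℤ, ∀ m, π m ∈ box w' a ↔ m ∈ box w a := by
    intro a m
    simp only [box, Set.mem_setOf_eq, hw]
  have hEr1 : ∀ (a : ι → ℤ) f, E (Mon K S (box w' a)) f ∈ Mon K T (box w a) := by
    intro a f
    rw [hT.mem_box]
    intro m hm
    rw [hE] at hm
    exact (hbox a m).1 ((hS.mem_box _).1 (f ⟨m - sec (π m), hlm m⟩).2 _ hm)
  have hEr2 : ∀ (a : ι → ℤ) g, g ∈ Mon K T (box w a) → ∃ f, E (Mon K S (box w' a)) f = g := by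
    intro a g hg
    change g ∈ LinearMap.range (E (Mon K S (box w' a)))
    rw [hT.mem_box] at hg
    rw [L_sum g]
    refine Submodule.sum_mem _ fun m hm => ?_
    have h1 := (hbox a m).2 (hg m (Finsupp.mem_support_iff.1 hm))
    refine ⟨Finsupp.single ⟨m - sec (π m), hlm m⟩ ⟨g.coeff m • chi (π m), (hS.mem_box _).2
      ((SuppIn.single h1).smul _)⟩, ?_⟩
    rw [hEs]
    simp only
    rw [exm_smul, exm_chi, mul_smul_comm, chi_mul]; simp
  let Ee (a : ι → ℤ) : (Λ →₀ Mon K S (box w' a)) ≃ₗ[S] Mon K T (box w a) :=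
    LinearEquiv.ofBijective
      ({ toFun := fun f => ⟨E _ f, hEr1 a f⟩
         map_add' := fun x y => Subtype.ext (by simp)
         map_smul' := fun r x => Subtype.ext (by simp) } :
        (Λ →₀ Mon K S (box w' a)) →ₗ[S] Mon K T (box w a))
      ⟨fun f g hfg => hEinj _ (congrArg Subtype.val hfg),
       fun ⟨g, hg⟩ => by obtain ⟨f, hf⟩ := hEr2 a g hg; exact ⟨f, Subtype.ext hf⟩⟩
  have hEe : ∀ a f, ((Ee a f : Mon K T (box w a)) : L) = E _ f := fun a f => rfl
  let eT : (Λ →₀ S) ≃ₗ[S] T :=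
    (Finsupp.mapRange.linearEquiv hS.self).trans ((Ee 0).trans (hT.self.symm.restrictScalars S))
  let b : Module.Basis Λ S T := Module.Basis.ofRepr eT.symm
  have hb : ∀ l : Λ, algebraMap T L (b l) = chi (l : M) := by
    intro l
    have h1 : b l = eT (Finsupp.single l 1) := by simp [b]
    have h2 : ∀ t : T, algebraMap T L t = ((hT.self t : Mon K T (box w 0)) : L) := fun t => rfl
    rw [h1, h2]
    simp only [eT, LinearEquiv.trans_apply, LinearEquiv.restrictScalars_apply, LinearEquiv.apply_symm_apply]
    rw [hEe]
    have h3 : (Finsupp.mapRange.linearEquiv hS.self) (Finsupp.single l (1:S)) = Finsupp.single l (hS.self 1) := by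
      simp
    rw [h3, hEs]
    have h4 : ((hS.self 1 : Mon K S (box w' 0)) : (AddMonoidAlgebra K M')) = 1 := (map_one (algebraMap S (AddMonoidAlgebra K M')))
    rw [h4, map_one, mul_one]
  have : Module.Free S T := Module.Free.of_basis b
  -- the inclusion D → I_T
  let inc (a : ι → ℤ) : Mon K S (box w' a) →ₗ[S] Mon K T (box w a) := (Ee a).toLinearMap ∘ₗ Finsupp.lsingle 0
  let ret (a : ι → ℤ) : Mon K T (box w a) →ₗ[S] Mon K S (box w' a) :=
    Finsupp.lapply 0 ∘ₗ (Ee a).symm.toLinearMap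
  have hret : ∀ a, ret a ∘ₗ inc a = LinearMap.id := by
    intro a; ext d : 1; simp [ret, inc]
  have hincv : ∀ a d, ((inc a d : Mon K T (box w a)) : L) = exm K sec (d : (AddMonoidAlgebra K M')) := by
    intro a d
    simp only [inc, LinearMap.comp_apply, LinearEquiv.coe_coe, Finsupp.lsingle_apply]
    rw [hEe, hEs]
    simp [chi_zero]
  let μ : T ⊗[S] (Mon K S (box w' a)) →ₗ[T] Mon K T (box w a) := (inc a).liftBaseChange T
  have hμ : Function.Bijective μ := by
    have h1 : ∀ f, μ ((TensorProduct.equivFinsuppOfBasisLeft b).symm f) = Ee a f := by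
      intro f
      induction f using Finsupp.induction_linear with
      | zero => simp
      | add f g hf hg => rw [map_add, map_add, map_add, hf, hg]
      | single l d =>
        rw [TensorProduct.equivFinsuppOfBasisLeft_symm_apply, Finsupp.sum_single_index (by simp)]
        apply Subtype.ext
        rw [hEe, hEs]
        simp only [μ, LinearMap.liftBaseChange_tmul, Submodule.coe_smul]
        rw [hincv, Algebra.smul_def, hb]
    have h2 : (μ : _ → _) = (Ee a) ∘ (TensorProduct.equivFinsuppOfBasisLeft b) := by
      funext z
      have := h1 (TensorProduct.equivFinsuppOfBasisLeft b z)
      rwa [LinearEquiv.symm_apply_apply] at this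
    rw [h2]
    exact (Ee a).bijective.comp (LinearEquiv.bijective _)
  let eμ := LinearEquiv.ofBijective μ hμ
  constructor
  · intro hsd
    refine hS.sd_of_ev a fun i => ?_
    refine ev_retract_right (inc a) (ret a) (hret a) _ ?_
    refine ev_flat (B := T) i ?_
    exact ev_congr eμ.symm (LinearEquiv.refl T _) _ (hsd.2.2 i)
  · rintro ⟨n, hn⟩
    refine ⟨n, fun i hi X _ _ _ => ?_⟩
    refine ev_retract_right (inc a) (ret a) (hret a) _ ?_
    refine ev_flat (B := T) i ?_
    exact hn i hi (T ⊗[S] X)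
end B

section C
variable {K : Type} [Field K] {M M' : Type} [AddCommGroup M] [AddCommGroup M']
local notation "L" => AddMonoidAlgebra K M

variable (K) in
/-- the subring of elements supported in a cone -/
noncomputable def Tr {ι : Type} (w : ι → M →+ ℤ) : Subring (AddMonoidAlgebra K M) where
  carrier := {f | SuppIn f (box w 0)}
  mul_mem' := fun ha hb => SuppIn.mul ha hb box_add
  one_mem' := SuppIn.one (by simp [box])
  add_mem' := fun ha hb => SuppIn.add ha hb
  zero_mem' := SuppIn.zero _
  neg_mem' := fun ha => SuppIn.neg ha

variable {R S : Type} [CommRing R] [Algebra R (AddMonoidAlgebra K M)] [CommRing S] [Algebra S (AddMonoidAlgebra K M')] [IsNoetherianRing R] [IsNoetherianRing S]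

theorem MR.piece {ι ι' : Type} [Finite ι] [Finite ι'] {w : ι → M →+ ℤ} {w' : ι' → M' →+ ℤ} [IsDomain L] [IsDomain (AddMonoidAlgebra K M')]
    (h : MR K M R w) (hS : MR K M' S w') (π : M →+ M') (sec : M' →+ M) (hs : ∀ m, π (sec m) = m)
    (τ : ι' → ι) (hw : ∀ i m, w' i (π m) = w (τ i) m) (x : M) (hx0 : π x = 0)
    (hx : ∀ j, (∀ i, τ i ≠ j) → 0 < w j x) (a : ι → ℤ) :
    (SD R (Mon K R (box w a)) → SD S (Mon K S (box w' fun i => a (τ i)))) ∧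
    (FID R (Mon K R (box w a)) → FID S (Mon K S (box w' fun i => a (τ i)))) := by
  let T := Tr K (fun i => w (τ i))
  have hT : MR K M T (fun i => w (τ i)) := by
    refine ⟨Subtype.val_injective, fun f => ⟨?_, fun hf => ⟨⟨f, hf⟩, rfl⟩⟩, ?_⟩
    · rintro ⟨r, rfl⟩; exact r.2
    · intro i c B
      obtain ⟨μ, h1, h2⟩ := hS.sh i c B
      refine ⟨sec μ, ?_, fun j hj => ?_⟩
      · rw [← hw, hs, h1]
      · rw [← hw, hs]; exact h2 j hj
  letI : Algebra R T := ((algebraMap R L).codRestrict T (fun r m hm i => h.supp r m hm (τ i))).toAlgebra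
  haveI : IsScalarTower R T L := IsScalarTower.of_algebraMap_eq fun r => rfl
  have hx0' : ∀ i, w (τ i) x = 0 := fun i => by rw [← hw, hx0, map_zero]
  have s1 := h.step1 τ hT x hx0' hx a
  clear * - s1 hT hS hs hw
  letI : Algebra S L := ((exm K sec).comp (algebraMap S (AddMonoidAlgebra K M'))).toAlgebra
  have hsup : ∀ s : S, (exm K sec) (algebraMap S (AddMonoidAlgebra K M') s) ∈ T := by
    intro s
    change SuppIn _ _
    have := hS.supp s
    rw [L_sum (algebraMap S (AddMonoidAlgebra K M') s), map_sum]
    refine SuppIn.sum _ _ fun m hm => ?_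
    rw [exm_smul, exm_chi]
    refine (SuppIn.single fun i => ?_).smul _
    rw [← hw, hs]
    exact this m (Finsupp.mem_support_iff.1 hm) i
  letI : Algebra S T := (((exm K sec).comp (algebraMap S (AddMonoidAlgebra K M'))).codRestrict T hsup).toAlgebra
  haveI : IsScalarTower S T L := IsScalarTower.of_algebraMap_eq fun r => rfl
  have s2 := hT.step2 hS π sec hs hw (fun s => rfl) (fun i => a (τ i))
  exact ⟨fun z => s2.1 (s1.1 z), fun z => s2.2 (s1.2 z)⟩
end C

end

section

section A
variable {K : Type} [Field K] {M : Type} [AddCommGroup M]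
local notation "L" => AddMonoidAlgebra K M
variable {R : Type} [CommRing R] [Algebra R (AddMonoidAlgebra K M)] {ι : Type}
    {w : ι → M →+ ℤ}

lemma MR.exists_scalar (h : MR K M R w) (c : K) : ∃ r : R, ∀ f : L, r • f = c • f := by
  obtain ⟨r, hr⟩ := (h.range (AddMonoidAlgebra.single 0 c)).2 (SuppIn.single (by simp [box]))
  refine ⟨r, fun f => ?_⟩
  rw [Algebra.smul_def, hr, Algebra.smul_def]
  rfl

/-- graded piece -/
noncomputable def MR.gr (h : MR K M R w) (deg : M →+ ℤ) (N : Submodule R (AddMonoidAlgebra K M)) (d : ℤ) :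
    Submodule K (AddMonoidAlgebra K M) where
  carrier := {f | f ∈ N ∧ SuppIn f {m | deg m = d}}
  add_mem' := fun ha hb => ⟨N.add_mem ha.1 hb.1, ha.2.add hb.2⟩
  zero_mem' := ⟨N.zero_mem, SuppIn.zero _⟩
  smul_mem' := fun c f hf => by
    obtain ⟨r, hr⟩ := h.exists_scalar c
    exact ⟨hr f ▸ N.smul_mem r hf.1, hf.2.smul c⟩

lemma MR.mem_gr (h : MR K M R w) {deg : M →+ ℤ} {N : Submodule R (AddMonoidAlgebra K M)} {d : ℤ} {f : L} :
    f ∈ h.gr deg N d ↔ f ∈ N ∧ SuppIn f {m | deg m = d} := Iff.rfl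

/-- homogeneous submodule -/
def Hg (deg : M →+ ℤ) (N : Submodule R (AddMonoidAlgebra K M)) : Prop :=
  ∀ f ∈ N, ∀ k, comp deg k f ∈ N

lemma MR.hg_box (h : MR K M R w) (deg : M →+ ℤ) (a : ι → ℤ) : Hg deg (Mon K R (box w a)) := by
  intro f hf k
  rw [h.mem_box] at hf ⊢
  exact comp_suppIn _ _ hf

lemma Hg.bot (deg : M →+ ℤ) : Hg (K := K) (R := R) deg ⊥ := by
  intro f hf k
  rw [Submodule.mem_bot] at hf ⊢
  rw [hf, map_zero]

/-- `N + xC` -/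
noncomputable def ex (C N : Submodule R (AddMonoidAlgebra K M)) (x : R) : Submodule R (AddMonoidAlgebra K M) :=
  N ⊔ C.map (LinearMap.lsmul R (AddMonoidAlgebra K M) x)

lemma mem_ex {C N : Submodule R L} {x : R} {f : L} : f ∈ ex C N x ↔ ∃ n ∈ N, ∃ c ∈ C, n + x • c = f := by
  simp [ex, Submodule.mem_sup]

lemma Hg.ex {deg : M →+ ℤ} {C N : Submodule R L} (hC : Hg deg C) (hN : Hg deg N) {x : R}
    (hx : SuppIn (algebraMap R L x) {m | deg m = 1}) : Hg deg (ex C N x) := by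
  intro f hf k
  obtain ⟨n, hn, c, hc, rfl⟩ := mem_ex.1 hf
  rw [map_add, Algebra.smul_def, comp_mul' deg 1 k c hx, ← Algebra.smul_def]
  exact mem_ex.2 ⟨_, hN _ hn _, _, hC _ hc _, rfl⟩

/-- iterated -/
noncomputable def exl (C : Submodule R (AddMonoidAlgebra K M)) : Submodule R (AddMonoidAlgebra K M) → List R →
    Submodule R (AddMonoidAlgebra K M)
  | N, [] => N
  | N, x :: l => exl C (ex C N x) l

lemma extI_smul (C : Submodule R L) (l : List R) : ∀ J : Ideal R, (extI J l) • C = exl C (J • C) l := by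
  induction l with
  | nil => intro J; rfl
  | cons x l ih =>
    intro J
    change extI (J ⊔ Ideal.span {x}) l • C = exl C (ex C (J • C) x) l
    rw [ih]
    congr 1
    rw [ex, Submodule.sup_smul, Submodule.ideal_span_singleton_smul]
    rfl

lemma mem_smul_top_iff (C : Submodule R L) (J : Ideal R) (c : C) :
    c ∈ (J • ⊤ : Submodule R C) ↔ (c : L) ∈ J • C := by
  have h1 : Submodule.map C.subtype (J • ⊤ : Submodule R C) = J • C := by
    rw [Submodule.map_smul'', Submodule.map_top, Submodule.range_subtype]
  rw [← h1]
  constructor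
  · intro hc; exact ⟨c, hc, rfl⟩
  · rintro ⟨c', hc', h2⟩
    rwa [← Subtype.ext h2]

lemma Hg.exl {deg : M →+ ℤ} {C : Submodule R L} (hC : Hg deg C) (l : List R) :
    ∀ {N : Submodule R L}, Hg deg N → (∀ x ∈ l, SuppIn (algebraMap R L x) {m | deg m = 1}) →
    Hg deg (exl C N l) := by
  induction l with
  | nil => intro N hN _; exact hN
  | cons x l ih => 
    intro N hN hx
    exact ih (hC.ex hN (hx x (by simp))) fun y hy => hx y (by simp [hy])

lemma MR.gr_box (h : MR K M R w) (deg : M →+ ℤ) (a : ι → ℤ) (d : ℤ) (f : L) :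
    f ∈ h.gr deg (Mon K R (box w a)) d ↔ SuppIn f {m | m ∈ box w a ∧ deg m = d} := by
  rw [h.mem_gr, h.mem_box]
  exact ⟨fun hf m hm => ⟨hf.1 m hm, hf.2 m hm⟩, fun hf => ⟨fun m hm => (hf m hm).1, fun m hm => (hf m hm).2⟩⟩

lemma MR.gr_box_equiv (h : MR K M R w) (deg : M →+ ℤ) (a : ι → ℤ) (d : ℤ) :
    Nonempty (h.gr deg (Mon K R (box w a)) d ≃ₗ[K] ({m | m ∈ box w a ∧ deg m = d} →₀ K)) := by
  set S := {m | m ∈ box w a ∧ deg m = d}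
  have h1 : (h.gr deg (Mon K R (box w a)) d).map (AddMonoidAlgebra.coeffLinearEquiv K).toLinearMap =
      Finsupp.supported K K S := by
    ext f
    rw [Submodule.mem_map]
    constructor
    · rintro ⟨g, hg, rfl⟩
      rw [Finsupp.mem_supported]
      intro m hm
      exact (h.gr_box deg a d g).1 hg m (Finsupp.mem_support_iff.1 hm)
    · intro hf
      rw [Finsupp.mem_supported] at hf
      refine ⟨AddMonoidAlgebra.ofCoeff f, (h.gr_box deg a d _).2 fun m hm => hf (Finsupp.mem_support_iff.2 hm), rfl⟩
  exact ⟨((AddMonoidAlgebra.coeffLinearEquiv K).submoduleMap _).trans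
    ((LinearEquiv.ofEq _ _ h1).trans (Finsupp.supportedEquivFinsupp S))⟩

lemma MR.gr_finite (h : MR K M R w) (deg : M →+ ℤ) (a : ι → ℤ) (d : ℤ)
    (hf : {m | m ∈ box w a ∧ deg m = d}.Finite) : Module.Finite K (h.gr deg (Mon K R (box w a)) d) := by
  obtain ⟨e⟩ := h.gr_box_equiv deg a d
  have := hf.to_subtype
  exact Module.Finite.equiv e.symm

lemma MR.gr_finrank (h : MR K M R w) (deg : M →+ ℤ) (a : ι → ℤ) (d : ℤ)
    (hf : {m | m ∈ box w a ∧ deg m = d}.Finite) :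
    Module.finrank K (h.gr deg (Mon K R (box w a)) d) = {m | m ∈ box w a ∧ deg m = d}.ncard := by
  obtain ⟨e⟩ := h.gr_box_equiv deg a d
  have := hf.to_subtype
  have := Fintype.ofFinite {m | m ∈ box w a ∧ deg m = d}
  rw [e.finrank_eq, Module.finrank_finsupp_self, Set.ncard_eq_toFinset_card', Set.toFinset_card]

/-- dimension step -/
lemma MR.dim_step [IsDomain L] (h : MR K M R w) (deg : M →+ ℤ) {C N : Submodule R L} (hC : Hg deg C) (hN : Hg deg N)
    (hNC : N ≤ C)
    (hfin : ∀ d, Module.Finite K (h.gr deg C d)) {x : R} (hx : SuppIn (algebraMap R L x) {m | deg m = 1})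
    (hx0 : algebraMap R L x ≠ 0)
    (hreg : ∀ f ∈ C, x • f ∈ N → f ∈ N) (d : ℤ) :
    (Module.finrank K (h.gr deg (ex C N x) d) : ℤ) = Module.finrank K (h.gr deg N d)
      + Module.finrank K (h.gr deg C (d-1)) - Module.finrank K (h.gr deg N (d-1)) := by
  have hgle : ∀ (N' : Submodule R L) (d : ℤ), N' ≤ C → h.gr deg N' d ≤ h.gr deg C d :=
    fun N' d hN' f hf => ⟨hN' hf.1, hf.2⟩
  have hfin' : ∀ (N' : Submodule R L) (d : ℤ), N' ≤ C → Module.Finite K (h.gr deg N' d) := fun N' d hN' =>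
    Submodule.finiteDimensional_of_le (hgle N' d hN')
  let μ : L →ₗ[K] L := LinearMap.mulLeft K (algebraMap R L x)
  have hμ : Function.Injective μ := mul_right_injective₀ hx0
  have hμs : ∀ f, μ f = x • f := fun f => (Algebra.smul_def x f).symm
  have hμd : ∀ f d, SuppIn f {m | deg m = d} → SuppIn (μ f) {m | deg m = d + 1} := by
    intro f d hf
    refine SuppIn.mul hx hf fun a ha b hb => ?_
    change deg (a + b) = d + 1
    rw [map_add, show deg a = 1 from ha, show deg b = d from hb]; ring
  have e1 : h.gr deg (ex C N x) d = h.gr deg N d ⊔ (h.gr deg C (d-1)).map μ := by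
    apply le_antisymm
    · intro f hf
      obtain ⟨n, hn, c, hc, rfl⟩ := mem_ex.1 hf.1
      rw [← comp_self deg d hf.2, map_add, Algebra.smul_def, comp_mul' deg 1 d c hx]
      refine Submodule.add_mem_sup ⟨hN _ hn _, comp_supp _ _ _⟩ ⟨_, ⟨hC _ hc _, comp_supp _ _ _⟩, rfl⟩
    · refine sup_le ?_ ?_
      · intro f hf
        exact ⟨mem_ex.2 ⟨f, hf.1, 0, C.zero_mem, by simp⟩, hf.2⟩
      · rintro _ ⟨f, hf, rfl⟩
        refine ⟨mem_ex.2 ⟨0, N.zero_mem, f, hf.1, by rw [hμs, zero_add]⟩, ?_⟩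
        have := hμd f _ hf.2
        rwa [sub_add_cancel] at this
  have e2 : h.gr deg N d ⊓ (h.gr deg C (d-1)).map μ = (h.gr deg N (d-1)).map μ := by
    apply le_antisymm
    · rintro _ ⟨h1, f, hf, rfl⟩
      refine ⟨f, ⟨hreg f hf.1 ?_, hf.2⟩, rfl⟩
      rw [← hμs]; exact h1.1
    · rintro _ ⟨f, hf, rfl⟩
      refine ⟨⟨?_, ?_⟩, f, hgle _ _ hNC hf, rfl⟩
      · rw [hμs]; exact N.smul_mem _ hf.1
      · have := hμd f _ hf.2
        rwa [sub_add_cancel] at this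
  have := hfin (d-1)
  have := hfin' N d hNC
  have := hfin' N (d-1) hNC
  have h3 := Submodule.finrank_sup_add_finrank_inf_eq (h.gr deg N d) ((h.gr deg C (d-1)).map μ)
  rw [← e1, e2, ← (Submodule.equivMapOfInjective μ hμ _).finrank_eq,
    ← (Submodule.equivMapOfInjective μ hμ _).finrank_eq] at h3
  omega
end A

end

section

section A
variable {K : Type} [Field K] {M : Type} [AddCommGroup M]
local notation "L" => AddMonoidAlgebra K M
variable {R : Type} [CommRing R] [Algebra R (AddMonoidAlgebra K M)] {ι : Type}
    {w : ι → M →+ ℤ}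

/-- Hilbert series of `C/N` shifted -/
noncomputable def MR.hs (h : MR K M R w) (deg : M →+ ℤ) (C N : Submodule R (AddMonoidAlgebra K M)) (δ : ℤ) :
    PowerSeries ℤ :=
  PowerSeries.mk fun d => (Module.finrank K (h.gr deg C (δ + d)) : ℤ) - Module.finrank K (h.gr deg N (δ + d))

lemma MR.hs_step [IsDomain L] (h : MR K M R w) (deg : M →+ ℤ) {C N : Submodule R L} (hC : Hg deg C) (hN : Hg deg N)
    (hNC : N ≤ C) (δ : ℤ) (hδ : ∀ f ∈ h.gr deg C (δ - 1), f = 0)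
    (hfin : ∀ d, Module.Finite K (h.gr deg C d)) {x : R} (hx : SuppIn (algebraMap R L x) {m | deg m = 1})
    (hx0 : algebraMap R L x ≠ 0)
    (hreg : ∀ f ∈ C, x • f ∈ N → f ∈ N) :
    h.hs deg C (ex C N x) δ = h.hs deg C N δ * (1 - PowerSeries.X) := by
  have key := h.dim_step deg hC hN hNC hfin hx hx0 hreg
  ext d
  rw [mul_sub, mul_one, map_sub]
  cases d with
  | zero =>
    simp only [MR.hs, PowerSeries.coeff_mk, PowerSeries.coeff_zero_mul_X, Nat.cast_zero, add_zero, sub_zero]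
    have h1 : h.gr deg C (δ - 1) = ⊥ := (Submodule.eq_bot_iff _).2 hδ
    have h2 : h.gr deg N (δ - 1) = ⊥ := (Submodule.eq_bot_iff _).2 fun f hf => hδ f ⟨hNC hf.1, hf.2⟩
    have := key (δ + (0 : ℕ))
    rw [show δ + (0 : ℕ) - 1 = δ - 1 by simp, h1, h2] at this
    omega
  | succ d =>
    rw [PowerSeries.coeff_succ_mul_X]
    simp only [MR.hs, PowerSeries.coeff_mk]
    have := key (δ + (d+1 : ℕ))
    rw [show δ + (d+1 : ℕ) - 1 = δ + d by push_cast; ring] at this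
    omega

lemma ex_le {C N : Submodule R L} (hNC : N ≤ C) (x : R) : ex C N x ≤ C := by
  intro f hf
  obtain ⟨n, hn, c, hc, rfl⟩ := mem_ex.1 hf
  exact C.add_mem (hNC hn) (C.smul_mem _ hc)

lemma exl_le {C : Submodule R L} (l : List R) : ∀ {N : Submodule R L}, N ≤ C → exl C N l ≤ C := by
  induction l with
  | nil => intro N hN; exact hN
  | cons x l ih => intro N hN; exact ih (ex_le hN x)

/-- regular list on C/N -/
def RegL (C : Submodule R (AddMonoidAlgebra K M)) : Submodule R (AddMonoidAlgebra K M) → List R → Prop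
  | _, [] => True
  | N, x :: l => (∀ f ∈ C, x • f ∈ N → f ∈ N) ∧ RegL C (ex C N x) l

lemma MR.hs_list [IsDomain L] (h : MR K M R w) (deg : M →+ ℤ) {C : Submodule R L} (hC : Hg deg C) 
    (δ : ℤ) (hδ : ∀ f ∈ h.gr deg C (δ - 1), f = 0)
    (hfin : ∀ d, Module.Finite K (h.gr deg C d)) (l : List R) : ∀ {N : Submodule R L}, Hg deg N → N ≤ C →
    (∀ x ∈ l, SuppIn (algebraMap R L x) {m | deg m = 1} ∧ algebraMap R L x ≠ 0) → RegL C N l →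
    h.hs deg C (exl C N l) δ = h.hs deg C N δ * (1 - PowerSeries.X) ^ l.length := by
  induction l with
  | nil => intro N _ _ _ _; simp [exl]
  | cons x l ih =>
    intro N hN hNC hx hr
    have hx1 := hx x (by simp)
    change h.hs deg C (exl C (ex C N x) l) δ = _
    rw [ih (hC.ex hN hx1.1) (ex_le hNC x) (fun y hy => hx y (by simp [hy])) hr.2,
      h.hs_step deg hC hN hNC δ hδ hfin hx1.1 hx1.2 hr.1, List.length_cons, pow_succ]
    ring

lemma PJ.regL [IsNoetherianRing R] {C : Submodule R L} (h : SD R C) (l : List R) : ∀ {J : Ideal R}, PJ C J →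
    RegI J l → RegL C (J • C) l := by
  induction l with
  | nil => intro J hJ _; trivial
  | cons x l ih =>
    intro J hJ hr
    refine ⟨fun f hf hxf => ?_, ?_⟩
    · have := hJ.reg h x hr.1 ⟨f, hf⟩ ((mem_smul_top_iff C J _).2 hxf)
      exact (mem_smul_top_iff C J _).1 this
    · have := ih (hJ.step h x hr.1) hr.2
      rw [Submodule.sup_smul, Submodule.ideal_span_singleton_smul] at this
      exact this

lemma MR.mem_J (h : MR K M R w) (J : Ideal R) (r : R) : algebraMap R L r ∈ J • Mon K R (box w 0) ↔ r ∈ J := by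
  have := mem_smul_top_iff (Mon K R (box w 0)) J (h.self r)
  change _ ↔ algebraMap R L r ∈ _ at this
  rw [← this]
  have h2 : (J • ⊤ : Submodule R (Mon K R (box w 0))) = Submodule.map h.self.toLinearMap (J • ⊤) := by
    rw [Submodule.map_smul'', Submodule.map_top, LinearEquiv.range]
  rw [h2]
  rw [Submodule.mem_map_equiv, LinearEquiv.symm_apply_apply]; simp

lemma RegI.regL (h : MR K M R w) (l : List R) : ∀ {J : Ideal R}, 
    RegI J l → RegL (Mon K R (box w 0)) (J • Mon K R (box w 0)) l := by
  have hm := h.mem_J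
  induction l with
  | nil => intro J _; trivial
  | cons x l ih =>
    intro J hr
    refine ⟨fun f hf hxf => ?_, ?_⟩
    · obtain ⟨r, rfl⟩ := (h.range f).2 ((h.mem_box _).1 hf)
      rw [hm]
      apply hr.1
      rwa [Algebra.smul_def, ← map_mul, hm] at hxf
    · have := ih hr.2
      rw [Submodule.sup_smul, Submodule.ideal_span_singleton_smul] at this
      exact this

end A

end

section

section A
variable {K : Type} [Field K] {M : Type} [AddCommGroup M]
local notation "L" => AddMonoidAlgebra K M
variable {R : Type} [CommRing R] [Algebra R (AddMonoidAlgebra K M)] {ι : Type}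
    {w : ι → M →+ ℤ}

/-- homogeneous components of a ring element. -/
lemma MR.rcomp (h : MR K M R w) (deg : M →+ ℤ) (r : R) (k : ℤ) :
    ∃ s : R, algebraMap R L s = comp deg k (algebraMap R L r) :=
  (h.range _).2 (comp_suppIn _ _ (h.supp r))

/-- grading hypotheses -/
structure Gd (w : ι → M →+ ℤ) (deg : M →+ ℤ) : Prop where
  nonneg : ∀ q ∈ box w 0, 0 ≤ deg q
  zero : ∀ q ∈ box w 0, deg q = 0 → q = 0
  fin : ∀ a d, {m | m ∈ box w a ∧ deg m = d}.Finite

lemma mem_of_comps {deg : M →+ ℤ} {N : Submodule R L} {f : L} (hf : ∀ k, comp deg k f ∈ N) : f ∈ N := by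
  rw [comp_sum deg f]
  exact N.sum_mem fun k _ => hf k

/-- constant coefficient part. -/
lemma MR.const (h : MR K M R w) {deg : M →+ ℤ} (hd : Gd w deg) (r : R) :
    comp deg 0 (algebraMap R L r) = AddMonoidAlgebra.single 0 ((algebraMap R L r).coeff 0) := by
  classical
  ext m
  rw [comp_coeff, AddMonoidAlgebra.coeff_single, Finsupp.single_apply]
  split_ifs with h1 h2 h2
  · rw [h2]
  · by_contra h3
    exact h2 (hd.zero m (h.supp r m h3) h1).symm
  · subst h2; simp at h1
  · rfl

/-- top degree bound -/
lemma MR.top (h : MR K M R w) {deg : M →+ ℤ} (C : Submodule R L) [Module.Finite R C] 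
    (J : Ideal R) (σ : ℤ) (hσ : ∀ j > σ, ∀ r : R, SuppIn (algebraMap R L r) {m | deg m = j} → r ∈ J)
    (hC : Hg deg C) :
    ∃ T : ℤ, ∀ d > T, ∀ f ∈ C, SuppIn f {m | deg m = d} → f ∈ J • C := by
  classical
  obtain ⟨s, hs⟩ := (Module.Finite.iff_fg.1 ‹Module.Finite R C›)
  obtain ⟨B, hB⟩ : ∃ B : ℤ, ∀ g ∈ s, ∀ m ∈ (g : L).coeff.support, deg m ≤ B := by
    have : ((s.biUnion fun g => (g : L).coeff.support).image deg : Set ℤ).Finite := Finset.finite_toSet _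
    obtain ⟨B, hB⟩ := this.bddAbove
    refine ⟨B, fun g hg m hm => hB ?_⟩
    rw [Finset.mem_coe]
    exact Finset.mem_image_of_mem _ (Finset.mem_biUnion.2 ⟨g, hg, hm⟩)
  refine ⟨B + σ, fun d hd f hf hfd => ?_⟩
  rw [← comp_self deg d hfd]
  clear hfd
  have key : ∀ f ∈ C, ∀ r : R, comp deg d (r • f) ∈ J • C := by
    intro f hf
    rw [← hs] at hf
    refine Submodule.span_induction (p := fun f _ => ∀ r : R, comp deg d (r • f) ∈ J • C) ?_ ?_ ?_ ?_ hf
    · intro g hg r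
      have hgC : g ∈ C := by rw [← hs]; exact Submodule.subset_span hg
      rw [Algebra.smul_def]
      conv => 
        arg 2
        rw [comp_sum deg g]
      rw [Finset.mul_sum, map_sum]
      refine Submodule.sum_mem _ fun k hk => ?_
      rw [mul_comm, comp_mul' deg k d _ (comp_supp deg k g)]
      obtain ⟨m, hm, rfl⟩ := Finset.mem_image.1 hk
      have := hB g hg m hm
      obtain ⟨t, ht⟩ := h.rcomp deg r (d - deg m)
      rw [← ht, mul_comm, ← Algebra.smul_def]
      refine Submodule.smul_mem_smul (hσ (d - deg m) (by omega) t ?_) (hC _ hgC _)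
      rw [ht]; exact comp_supp _ _ _
    · intro r; simp
    · intro x y _ _ hx hy r
      rw [smul_add, map_add]; exact Submodule.add_mem _ (hx r) (hy r)
    · intro t x _ hx r
      rw [smul_smul]; exact hx _
  have := key f hf 1
  rwa [one_smul] at this

/-- The scalar lemma. -/
lemma MR.lemX (h : MR K M R w) {deg : M →+ ℤ} (hd : Gd w deg) (C : Submodule R L) (hC : Hg deg C)
    (J : Ideal R) (hN : Hg deg (J • C)) (hP : PJ C J) (δ τ : ℤ)
    (hlow : ∀ f ∈ C, SuppIn f {m | δ ≤ deg m})
    (hτ : ∀ d > τ, ∀ f ∈ C, SuppIn f {m | deg m = d} → f ∈ J • C)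
    (Λ : L →ₗ[K] L) (hΛ : ∀ f ∈ h.gr deg C δ, Λ f ∈ h.gr deg C τ) :
    ∃ b : R, SuppIn (algebraMap R L b) {m | deg m = τ - δ} ∧
      ∀ f ∈ h.gr deg C δ, Λ f - b • f ∈ J • C := by
  have hcg : ∀ f ∈ C, comp deg δ f ∈ h.gr deg C δ := fun f hf => ⟨hC f hf δ, comp_supp _ _ _⟩
  have hR : ∀ r : R, SuppIn (algebraMap R L r) {m | 0 ≤ deg m} := fun r =>
    (h.supp r).mono fun q hq => hd.nonneg q hq
  have hmul : ∀ (r : R), ∀ f ∈ C, comp deg δ (r • f) = (algebraMap R L r).coeff 0 • comp deg δ f := by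
    intro r f hf
    have := comp_low deg 0 δ (hR r) (hlow f hf)
    rw [zero_add] at this
    rw [Algebra.smul_def, this, h.const hd, Algebra.smul_def]
    rfl
  have hmul2 : ∀ (r : R), ∀ g ∈ h.gr deg C τ, r • g - (algebraMap R L r).coeff 0 • g ∈ J • C := by
    intro r g hg
    have h0 : r • g - (algebraMap R L r).coeff 0 • g ∈ C := by
      refine C.sub_mem (C.smul_mem _ hg.1) ?_
      obtain ⟨t, ht⟩ := h.exists_scalar (R := R) ((algebraMap R L r).coeff 0)
      rw [← ht]; exact C.smul_mem _ hg.1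
    refine mem_of_comps (deg := deg) fun k => ?_
    by_cases hk : k > τ
    · exact hτ k hk _ (hC _ h0 _) (comp_supp _ _ _)
    · have e1 : comp deg k (r • g) = comp deg (k - τ) (algebraMap R L r) * g := by
        rw [Algebra.smul_def, mul_comm, comp_mul' deg τ k _ hg.2, mul_comm]
      rw [map_sub, e1, map_smul]
      rcases (not_lt.1 hk).lt_or_eq with hk' | rfl
      · rw [comp_other deg hg.2 (by omega), comp_zero_of deg (k - τ)]
        · simp
        · intro m hm; have : 0 ≤ deg m := hR r m hm
          omega
      · rw [sub_self, h.const hd, comp_self deg k hg.2, Algebra.smul_def ((algebraMap R L r).coeff 0)]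
        have : (AddMonoidAlgebra.single 0 ((algebraMap R L r).coeff 0) : L) = algebraMap K L ((algebraMap R L r).coeff 0) := rfl
        rw [this, sub_self]; exact Submodule.zero_mem _
  let φ : C →ₗ[R] (C ⧸ (J • ⊤ : Submodule R C)) :=
    { toFun := fun f => Submodule.Quotient.mk ⟨Λ (comp deg δ (f : L)), (hΛ _ (hcg f f.2)).1⟩
      map_add' := fun f g => by
        rw [← Submodule.Quotient.mk_add]
        congr 1
        apply Subtype.ext
        simp
      map_smul' := fun r f => by
        rw [RingHom.id_apply, ← Submodule.Quotient.mk_smul, Submodule.Quotient.eq, mem_smul_top_iff]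
        have h1 := hmul2 r _ (hΛ _ (hcg f f.2))
        have h2 := hmul r f f.2
        change Λ (comp deg δ (r • (f : L))) - r • Λ (comp deg δ (f : L)) ∈ _
        rw [h2, map_smul, ← neg_sub]
        exact Submodule.neg_mem _ h1 }
  obtain ⟨b, hb⟩ := hP.sc φ
  obtain ⟨t, ht⟩ := h.rcomp deg b (τ - δ)
  refine ⟨t, by rw [ht]; exact comp_supp _ _ _, fun f hf => ?_⟩
  have h1 := hb ⟨f, hf.1⟩
  change Submodule.Quotient.mk _ = _ at h1
  rw [Submodule.Quotient.eq, mem_smul_top_iff] at h1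
  change Λ (comp deg δ f) - b • f ∈ _ at h1
  have h2 := hN _ h1 τ
  rw [map_sub, comp_self deg δ hf.2, comp_self deg τ (hΛ f hf).2, Algebra.smul_def, mul_comm,
    comp_mul' deg δ τ _ hf.2, ← ht, mul_comm, ← Algebra.smul_def] at h2
  exact h2
end A

end

section

section A
variable {K : Type} [Field K] {M : Type} [AddCommGroup M]
local notation "L" => AddMonoidAlgebra K M
variable {R : Type} [CommRing R] [Algebra R (AddMonoidAlgebra K M)] {ι : Type}
    {w : ι → M →+ ℤ}

lemma mem_subOf {V : Type} [AddCommGroup V] [Module K V] (A B : Submodule K V) (x : B) :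
    x ∈ A.submoduleOf B ↔ (B.subtype x) ∈ A := Iff.rfl

/-- counting series of a box -/
noncomputable def cs (w : ι → M →+ ℤ) (deg : M →+ ℤ) (a : ι → ℤ) (δ : ℤ) : PowerSeries ℤ :=
  PowerSeries.mk fun d => ({m | m ∈ box w a ∧ deg m = δ + d}.ncard : ℤ)

lemma MR.hs_bot (h : MR K M R w) {deg : M →+ ℤ} (hd : Gd w deg) (a : ι → ℤ) (δ : ℤ) :
    h.hs deg (Mon K R (box w a)) ⊥ δ = cs w deg a δ := by
  ext d
  simp only [MR.hs, cs, PowerSeries.coeff_mk]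
  rw [h.gr_finrank deg a _ (hd.fin a _)]
  have : h.gr deg (⊥ : Submodule R L) (δ + d) = ⊥ := by
    rw [Submodule.eq_bot_iff]
    intro f hf
    exact (Submodule.mem_bot R).1 hf.1
  rw [this]; simp

theorem MR.V [IsDomain L] [Finite ι] [IsNoetherianRing R] (h : MR K M R w) {deg : M →+ ℤ} (hd : Gd w deg)
    (a : ι → ℤ) (hs : SD R (Mon K R (box w a))) (l : List R) (hl : RegI ⊥ l)
    (hl1 : ∀ x ∈ l, SuppIn (algebraMap R L x) {m | deg m = 1} ∧ algebraMap R L x ≠ 0)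
    (δ : ℤ) (hδ : ∀ m ∈ box w a, δ ≤ deg m) (hδ' : ∃ m ∈ box w a, deg m = δ) (σ : ℕ)
    (hσ : ∀ j > σ, PowerSeries.coeff (R := ℤ) j
      (cs w deg 0 0 * (1 - PowerSeries.X : PowerSeries ℤ) ^ l.length) = 0) :
    (∀ j > σ, PowerSeries.coeff (R := ℤ) j
      (cs w deg a δ * (1 - PowerSeries.X : PowerSeries ℤ) ^ l.length) = 0) ∧
    PowerSeries.coeff (R := ℤ) σ (cs w deg 0 0 * (1 - PowerSeries.X : PowerSeries ℤ) ^ l.length) =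
      ({m | m ∈ box w a ∧ deg m = δ}.ncard : ℤ) *
        PowerSeries.coeff (R := ℤ) σ (cs w deg a δ * (1 - PowerSeries.X : PowerSeries ℤ) ^ l.length) := by
  set C := Mon K R (box w a) with hCdef
  set R0 := Mon K R (box w 0) with hR0
  set J := extI ⊥ l with hJ
  have hP : PJ C J := PJ.list hs l (PJ.bot hs) hl
  have hfinC : ∀ d, Module.Finite K (h.gr deg C d) := fun d => h.gr_finite deg a d (hd.fin a d)
  have hfinR : ∀ d, Module.Finite K (h.gr deg R0 d) := fun d => h.gr_finite deg 0 d (hd.fin 0 d)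
  have hCg : Hg deg C := h.hg_box deg a
  have hRg : Hg deg R0 := h.hg_box deg 0
  have hx1 : ∀ x ∈ l, SuppIn (algebraMap R L x) {m | deg m = 1} := fun x hx => (hl1 x hx).1
  have hlow : ∀ f ∈ C, SuppIn f {m | δ ≤ deg m} := fun f hf => ((h.mem_box f).1 hf).mono hδ
  have eC : J • C = exl C ⊥ l := by rw [hJ, extI_smul, Submodule.bot_smul]
  have eR : J • R0 = exl R0 ⊥ l := by rw [hJ, extI_smul, Submodule.bot_smul]
  have hNg : Hg deg (J • C) := by rw [eC]; exact hCg.exl l (Hg.bot deg) hx1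
  have hNRg : Hg deg (J • R0) := by rw [eR]; exact hRg.exl l (Hg.bot deg) hx1
  have sC : h.hs deg C (J • C) δ = cs w deg a δ * (1 - PowerSeries.X) ^ l.length := by
    rw [eC, h.hs_list deg hCg δ ?_ hfinC l (Hg.bot deg) bot_le hl1 ?_, h.hs_bot hd]
    · intro f hf
      ext m
      by_contra hm
      have h1 : δ ≤ deg m := hlow f hf.1 m hm
      have h2 : deg m = δ - 1 := hf.2 m hm
      omega
    · have := PJ.regL hs l (PJ.bot hs) hl
      rwa [Submodule.bot_smul] at this
  have sR : h.hs deg R0 (J • R0) 0 = cs w deg 0 0 * (1 - PowerSeries.X) ^ l.length := by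
    rw [eR, h.hs_list deg hRg 0 ?_ hfinR l (Hg.bot deg) bot_le hl1 ?_, h.hs_bot hd]
    · intro f hf
      ext m
      by_contra hm
      have h1 : 0 ≤ deg m := hd.nonneg m ((h.mem_box f).1 hf.1 m hm)
      have h2 : deg m = 0 - 1 := hf.2 m hm
      omega
    · have := RegI.regL h l hl
      rwa [Submodule.bot_smul] at this
  rw [← sC, ← sR]
  rw [← sR] at hσ
  have fz : ∀ (X : Submodule R L) (d : ℤ), Module.finrank K (h.gr deg X (0 + d)) =
      Module.finrank K (h.gr deg X d) := fun X d => by rw [zero_add]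
  simp only [MR.hs, PowerSeries.coeff_mk, fz] at hσ ⊢
  have gle : ∀ (X : Submodule R L) (d : ℤ), h.gr deg (J • X) d ≤ h.gr deg X d :=
    fun X d f hf => ⟨Submodule.smul_le_right hf.1, hf.2⟩
  -- R_j ⊂ J for j > σ
  have hA : ∀ j > (σ : ℤ), ∀ r : R, SuppIn (algebraMap R L r) {m | deg m = j} → r ∈ J := by
    intro j hj r hr
    have h1 := hσ j.toNat (by omega)
    rw [Int.toNat_of_nonneg (by omega)] at h1
    have h2 : h.gr deg (J • R0) j = h.gr deg R0 j := by
      have := hfinR j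
      exact Submodule.eq_of_le_of_finrank_eq (gle _ _) (by omega)
    have h3 : algebraMap R L r ∈ h.gr deg R0 j := ⟨(h.mem_box _).2 (h.supp r), hr⟩
    rw [← h2] at h3
    exact (h.mem_J J r).1 h3.1
  have := hs.1
  obtain ⟨T, hT⟩ := h.top C J σ hA hCg
  -- claim A
  have clA : ∀ d > δ + σ, ∀ f ∈ C, SuppIn f {m | deg m = d} → f ∈ J • C := by
    by_contra hcon
    push Not at hcon
    obtain ⟨d0, hd0, f0, hf0, hf0d, hf0J⟩ := hcon
    let P : ℤ → Prop := fun d => ∃ f ∈ C, SuppIn f {m | deg m = d} ∧ f ∉ J • C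
    obtain ⟨τ, ⟨g, hg, hgd, hgJ⟩, hmax⟩ := Int.exists_greatest_of_bdd (P := P)
      ⟨T, fun z ⟨f, h1, h2, h3⟩ => by
        by_contra hz
        exact h3 (hT z (by omega) f h1 h2)⟩ ⟨d0, f0, hf0, hf0d, hf0J⟩
    have hτd : d0 ≤ τ := hmax d0 ⟨f0, hf0, hf0d, hf0J⟩
    obtain ⟨m0, hm0, hm0d⟩ := hδ'
    let Λ : L →ₗ[K] L := 
      (LinearMap.toSpanSingleton K L g) ∘ₗ (Finsupp.lapply m0) ∘ₗ (AddMonoidAlgebra.coeffLinearEquiv K).toLinearMap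
    have hΛ : ∀ f, Λ f = f.coeff m0 • g := fun f => rfl
    obtain ⟨b, hb, hb2⟩ := h.lemX hd C hCg J hNg hP δ τ hlow (fun d hdτ f hf hfd => by
      by_contra hfJ
      have := hmax d ⟨f, hf, hfd, hfJ⟩
      omega) Λ (fun f hf => by
        rw [hΛ]; exact (h.gr deg C τ).smul_mem _ ⟨hg, hgd⟩)
    have h1 : chi m0 ∈ h.gr deg C δ := ⟨(h.mem_box _).2 (SuppIn.single hm0), SuppIn.single hm0d⟩
    have h2 := hb2 _ h1
    rw [hΛ] at h2
    have h3 : (chi m0 : L).coeff m0 = 1 := by simp [chi, AddMonoidAlgebra.coeff_single]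
    rw [h3, one_smul] at h2
    have h4 : b • (chi m0 : L) ∈ J • C := Submodule.smul_mem_smul (hA (τ - δ) (by omega) b hb) h1.1
    exact hgJ (by have := Submodule.add_mem _ h2 h4; simpa using this)
  refine ⟨fun j hj => ?_, ?_⟩
  · have : h.gr deg (J • C) (δ + j) = h.gr deg C (δ + j) :=
      le_antisymm (gle _ _) fun f hf => ⟨clA _ (by omega) f hf.1 hf.2, hf.2⟩
    rw [this, sub_self]
  -- main dimension count
  set τ : ℤ := δ + σ with hτ
  let Q := (h.gr deg C τ) ⧸ (h.gr deg (J • C) τ).submoduleOf (h.gr deg C τ)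
  let Φ : h.gr deg R0 σ →ₗ[K] (h.gr deg C δ →ₗ[K] Q) :=
    LinearMap.mk₂ K (fun r f => Submodule.Quotient.mk ⟨(r : L) * (f : L), by
        obtain ⟨t, ht⟩ := (h.range r).2 ((h.mem_box _).1 r.2.1)
        refine ⟨?_, SuppIn.mul r.2.2 f.2.2 fun x hx y hy => ?_⟩
        · rw [← ht, ← Algebra.smul_def]; exact C.smul_mem _ f.2.1
        · change deg (x + y) = τ
          rw [map_add, show deg x = σ from hx, show deg y = δ from hy]; omega⟩)
      (fun r r' f => by rw [← Submodule.Quotient.mk_add]; congr 1; apply Subtype.ext; simp [add_mul])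
      (fun c r f => by rw [← Submodule.Quotient.mk_smul]; congr 1; apply Subtype.ext; simp)
      (fun r f f' => by rw [← Submodule.Quotient.mk_add]; congr 1; apply Subtype.ext; simp [mul_add])
      (fun c r f => by rw [← Submodule.Quotient.mk_smul]; congr 1; apply Subtype.ext; simp)
  have hΦ : ∀ r f, Φ r f = 0 ↔ (r : L) * (f : L) ∈ J • C := by
    intro r f
    change Submodule.Quotient.mk _ = 0 ↔ _
    rw [Submodule.Quotient.mk_eq_zero, mem_subOf]
    refine ⟨fun h1 => h1.1, fun h1 => ⟨h1, ?_⟩⟩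
    refine SuppIn.mul r.2.2 f.2.2 fun x hx y hy => ?_
    change deg (x + y) = τ
    rw [map_add, show deg x = σ from hx, show deg y = δ from hy]; omega
  have hker : LinearMap.ker Φ = (h.gr deg (J • R0) σ).submoduleOf (h.gr deg R0 σ) := by
    ext r
    rw [LinearMap.mem_ker, mem_subOf]
    obtain ⟨t, ht⟩ := (h.range r).2 ((h.mem_box _).1 r.2.1)
    constructor
    · intro hr
      refine ⟨?_, r.2.2⟩
      rw [Submodule.subtype_apply, ← ht, h.mem_J]
      apply hP.mem
      intro c
      rw [mem_smul_top_iff, Submodule.coe_smul]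
      refine mem_of_comps (deg := deg) fun k => ?_
      rw [Algebra.smul_def, ht, comp_mul' deg σ k _ r.2.2]
      have hck : comp deg (k - σ) (c : L) ∈ C := hCg _ c.2 _
      rcases lt_trichotomy (k - σ) δ with h1 | h1 | h1
      · rw [comp_zero_of deg]
        · simp
        · intro m hm; have : δ ≤ deg m := hlow _ c.2 m hm
          omega
      · rw [h1] at hck ⊢
        have := (hΦ r ⟨comp deg δ (c : L), hck, comp_supp _ _ _⟩).1 (by rw [hr]; rfl)
        exact this
      · have h2 : (r : L) * comp deg (k - σ) (c : L) ∈ C := by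
          rw [← ht, ← Algebra.smul_def]; exact C.smul_mem _ hck
        refine clA k (by omega) _ h2 (SuppIn.mul r.2.2 (comp_supp deg (k - σ) (c : L)) fun x hx y hy => ?_)
        change deg (x + y) = k
        rw [map_add, show deg x = σ from hx, show deg y = k - σ from hy]; omega
    · intro hr
      ext f
      change Φ r f = 0
      rw [hΦ]
      have h1 := hr.1
      rw [Submodule.subtype_apply, ← ht, h.mem_J] at h1
      rw [← ht, ← Algebra.smul_def]
      exact Submodule.smul_mem_smul h1 f.2.1
  have hsurj : Function.Surjective Φ := by
    intro ψ
    obtain ⟨ψ', hψ'⟩ := Module.projective_lifting_property (Submodule.mkQ ((h.gr deg (J • C) τ).submoduleOf (h.gr deg C τ)))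
      ψ (Submodule.mkQ_surjective _)
    obtain ⟨Λ, hΛ⟩ := LinearMap.exists_extend ((h.gr deg C τ).subtype ∘ₗ ψ')
    have hΛ' : ∀ f : h.gr deg C δ, Λ f = ψ' f := fun f => LinearMap.congr_fun hΛ f
    obtain ⟨b, hb, hb2⟩ := h.lemX hd C hCg J hNg hP δ τ hlow clA Λ (fun f hf => by
      have := hΛ' ⟨f, hf⟩
      simp only at this
      rw [this]; exact (ψ' _).2)
    have hbσ : SuppIn (algebraMap R L b) {m | deg m = σ} := by
      rwa [show τ - δ = σ by omega] at hb
    refine ⟨⟨algebraMap R L b, (h.mem_box _).2 (h.supp b), hbσ⟩, ?_⟩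
    ext f : 1
    rw [← hψ']
    change Submodule.Quotient.mk _ = Submodule.Quotient.mk _
    rw [eq_comm, Submodule.Quotient.eq, mem_subOf]
    have h1 := hb2 f f.2
    rw [hΛ', Algebra.smul_def] at h1
    refine ⟨h1, ?_⟩
    refine (ψ' f).2.2.sub (SuppIn.mul hbσ f.2.2 fun x hx y hy => ?_)
    change deg (x + y) = τ
    rw [map_add, show deg x = σ from hx, show deg y = δ from hy]; omega
  have i1 := hfinR σ
  have i2 := hfinC δ
  have i3 := hfinC τ
  have d1 := LinearMap.finrank_range_add_finrank_ker Φ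
  rw [hker, LinearMap.range_eq_top.2 hsurj, finrank_top, Module.finrank_linearMap,
    (Submodule.submoduleOfEquivOfLe (gle R0 σ)).finrank_eq] at d1
  have d2 := Submodule.finrank_quotient_add_finrank ((h.gr deg (J • C) τ).submoduleOf (h.gr deg C τ))
  rw [(Submodule.submoduleOfEquivOfLe (gle C τ)).finrank_eq] at d2
  rw [h.gr_finrank deg a δ (hd.fin a δ)] at d1
  rw [← d1, ← d2]
  push_cast
  ring
end A

end

section

/-- working form of a 2-connected ladder with at least two rows and columns -/
structure Lad (m n : ℕ) (Y : Set (ℕ × ℕ)) : Prop where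
  hm : 2 ≤ m
  hn : 2 ≤ n
  std : StdLadder m n Y
  c1 : ∀ i, 1 ≤ i → i < m → ∃ j j', j < j' ∧ (i, j) ∈ Y ∧ (i, j') ∈ Y ∧ (i+1, j) ∈ Y ∧ (i+1, j') ∈ Y
  c2 : ∀ j, 1 ≤ j → j < n → ∃ i i', i < i' ∧ (i, j) ∈ Y ∧ (i', j) ∈ Y ∧ (i, j+1) ∈ Y ∧ (i', j+1) ∈ Y

lemma mem_cast {Y : Set (ℕ × ℕ)} {i j i' j' : ℕ} (h : (i, j) ∈ Y) (hi : i = i') (hj : j = j') :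
    (i', j') ∈ Y := by subst hi; subst hj; exact h

lemma std_row {m n : ℕ} {Y : Set (ℕ × ℕ)} (h : StdLadder m n Y) {i j t j' : ℕ} (h1 : (i, j) ∈ Y)
    (h2 : (i, j') ∈ Y) (h3 : j ≤ t) (h4 : t ≤ j') : (i, t) ∈ Y := by
  obtain ⟨⟨hg, hl⟩, -, -, -, hc⟩ := h
  have g1 := hg _ h1
  have g2 := hg _ h2
  simp only [InGrid] at g1 g2
  obtain ⟨r, hr⟩ := hc t (by omega) (by omega)
  rcases le_total i r with h | h
  · exact (hl i j r t h1 hr h h3).1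
  · exact (hl r t i j' hr h2 h h4).2

lemma std_col {m n : ℕ} {Y : Set (ℕ × ℕ)} (h : StdLadder m n Y) {i j t i' : ℕ} (h1 : (i, j) ∈ Y)
    (h2 : (i', j) ∈ Y) (h3 : i ≤ t) (h4 : t ≤ i') : (t, j) ∈ Y := by
  obtain ⟨⟨hg, hl⟩, -, -, hc, -⟩ := h
  have g1 := hg _ h1
  have g2 := hg _ h2
  simp only [InGrid] at g1 g2
  obtain ⟨r, hr⟩ := hc t (by omega) (by omega)
  rcases le_total j r with h | h
  · exact (hl i j t r h1 hr h3 h).2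
  · exact (hl t r i' j hr h2 h4 h).1

section
variable {m n : ℕ} {Y : Set (ℕ × ℕ)}

lemma Lad.grid (h : Lad m n Y) {i j : ℕ} (hij : (i, j) ∈ Y) : 1 ≤ i ∧ i ≤ m ∧ 1 ≤ j ∧ j ≤ n :=
  h.std.1.1 _ hij

lemma Lad.sq (h : Lad m n Y) {i j p q : ℕ} (h1 : (i, j) ∈ Y) (h2 : (p, q) ∈ Y) (h3 : i ≤ p) (h4 : j ≤ q) :
    (i, q) ∈ Y ∧ (p, j) ∈ Y := h.std.1.2 i j p q h1 h2 h3 h4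

lemma Lad.row (h : Lad m n Y) {i j t j' : ℕ} (h1 : (i, j) ∈ Y)
    (h2 : (i, j') ∈ Y) (h3 : j ≤ t) (h4 : t ≤ j') : (i, t) ∈ Y := std_row h.std h1 h2 h3 h4

lemma Lad.col (h : Lad m n Y) {i j t i' : ℕ} (h1 : (i, j) ∈ Y)
    (h2 : (i', j) ∈ Y) (h3 : i ≤ t) (h4 : t ≤ i') : (t, j) ∈ Y := std_col h.std h1 h2 h3 h4

lemma Lad.ne (h : Lad m n Y) : (1, n) ∈ Y := h.std.2.1
lemma Lad.sw (h : Lad m n Y) : (m, 1) ∈ Y := h.std.2.2.1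
lemma Lad.rows (h : Lad m n Y) {i : ℕ} (h1 : 1 ≤ i) (h2 : i ≤ m) : ∃ j, (i, j) ∈ Y := h.std.2.2.2.1 i h1 h2
lemma Lad.cols (h : Lad m n Y) {i : ℕ} (h1 : 1 ≤ i) (h2 : i ≤ n) : ∃ j, (j, i) ∈ Y := h.std.2.2.2.2 i h1 h2

lemma Lad.up_no (h : Lad m n Y) {c d : ℕ} (hu : IsUpperCorner Y (c, d)) {i j : ℕ} (hij : (i, j) ∈ Y) :
    i ≤ c ∨ j ≤ d := by
  obtain ⟨h0, h1, h2, h3⟩ := hu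
  by_contra hcon
  push Not at hcon
  have := (h.sq h1 hij (by simp; omega) (by simp; omega)).1
  exact h3 (h.row h1 this (by simp) (by omega))

lemma Lad.lo_no (h : Lad m n Y) {a b : ℕ} (hu : IsLowerCorner Y (a, b)) {i j : ℕ} (hij : (i, j) ∈ Y) :
    a ≤ i ∨ b ≤ j := by
  obtain ⟨h0, h1, h2, h3⟩ := hu
  by_contra hcon
  push Not at hcon
  have := (h.sq hij h1 (by simp; omega) (by simp; omega)).2
  exact h3 (h.row this h1 (by simp; omega) (by simp))

/-- transpose -/
def tr (Y : Set (ℕ × ℕ)) : Set (ℕ × ℕ) := {p | (p.2, p.1) ∈ Y}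
/-- rotation -/
def rot (m n : ℕ) (Y : Set (ℕ × ℕ)) : Set (ℕ × ℕ) :=
  {p | (1 ≤ p.1 ∧ p.1 ≤ m ∧ 1 ≤ p.2 ∧ p.2 ≤ n) ∧ (m + 1 - p.1, n + 1 - p.2) ∈ Y}

lemma mem_tr {i j : ℕ} : (i, j) ∈ tr Y ↔ (j, i) ∈ Y := Iff.rfl
lemma mem_rot {i j : ℕ} : (i, j) ∈ rot m n Y ↔ (1 ≤ i ∧ i ≤ m ∧ 1 ≤ j ∧ j ≤ n) ∧ (m + 1 - i, n + 1 - j) ∈ Y := Iff.rfl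

lemma Lad.tr (h : Lad m n Y) : Lad n m (tr Y) where
  hm := h.hn
  hn := h.hm
  std := by
    refine ⟨⟨?_, ?_⟩, h.sw, h.ne, ?_, ?_⟩
    · rintro ⟨i, j⟩ hij
      have := h.grid (mem_tr.1 hij)
      simp only [InGrid]; omega
    · intro i j p q h1 h2 h3 h4
      exact (h.sq (mem_tr.1 h1) (mem_tr.1 h2) h4 h3).symm
    · intro i h1 h2; exact h.cols h1 h2
    · intro i h1 h2; exact h.rows h1 h2
  c1 := fun i h1 h2 => by
    obtain ⟨j, j', h0, h1, h2, h3, h4⟩ := h.c2 i h1 h2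
    exact ⟨j, j', h0, h1, h2, h3, h4⟩
  c2 := fun i h1 h2 => by
    obtain ⟨j, j', h0, h1, h2, h3, h4⟩ := h.c1 i h1 h2
    exact ⟨j, j', h0, h1, h2, h3, h4⟩

lemma Lad.rot_of (h : Lad m n Y) {i j : ℕ} (hij : (i, j) ∈ Y) : (m + 1 - i, n + 1 - j) ∈ rot m n Y := by
  have := h.grid hij
  exact ⟨by simp only; omega, mem_cast hij (by simp only; omega) (by simp only; omega)⟩

lemma Lad.rot (h : Lad m n Y) : Lad m n (rot m n Y) where
  hm := h.hm
  hn := h.hn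
  std := by
    have := h.hm
    have := h.hn
    refine ⟨⟨?_, ?_⟩, ?_, ?_, ?_, ?_⟩
    · rintro ⟨i, j⟩ hij
      exact hij.1
    · intro i j p q h1 h2 h3 h4
      have := h1.1
      have := h2.1
      simp only at *
      obtain ⟨a, b⟩ := h.sq h2.2 h1.2 (by simp only; omega) (by simp only; omega)
      exact ⟨⟨by simp only; omega, b⟩, ⟨by simp only; omega, a⟩⟩
    · exact mem_cast (h.rot_of h.sw) (by omega) (by omega)
    · exact mem_cast (h.rot_of h.ne) (by omega) (by omega)
    · intro i h1 h2
      obtain ⟨j, hj⟩ := h.rows (i := m + 1 - i) (by omega) (by omega)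
      exact ⟨_, mem_cast (h.rot_of hj) (by omega) rfl⟩
    · intro i h1 h2
      obtain ⟨j, hj⟩ := h.cols (i := n + 1 - i) (by omega) (by omega)
      exact ⟨_, mem_cast (h.rot_of hj) rfl (by omega)⟩
  c1 := fun i h1 h2 => by
    obtain ⟨j, j', h0, h1, h2, h3, h4⟩ := h.c1 (m - i) (by omega) (by omega)
    have := h.grid h2
    exact ⟨n + 1 - j', n + 1 - j, by omega, mem_cast (h.rot_of h4) (by omega) rfl,
      mem_cast (h.rot_of h3) (by omega) rfl, mem_cast (h.rot_of h2) (by omega) rfl, mem_cast (h.rot_of h1) (by omega) rfl⟩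
  c2 := fun i h1 h2 => by
    obtain ⟨j, j', h0, h1, h2, h3, h4⟩ := h.c2 (n - i) (by omega) (by omega)
    have := h.grid h2
    exact ⟨m + 1 - j', m + 1 - j, by omega, mem_cast (h.rot_of h4) rfl (by omega),
      mem_cast (h.rot_of h3) rfl (by omega), mem_cast (h.rot_of h2) rfl (by omega), mem_cast (h.rot_of h1) rfl (by omega)⟩

lemma up_tr {c d : ℕ} : IsUpperCorner (LadderDet.tr Y) (c, d) ↔ IsUpperCorner Y (d, c) := by
  simp only [IsUpperCorner, mem_tr]; tauto
lemma lo_tr {c d : ℕ} : IsLowerCorner (LadderDet.tr Y) (c, d) ↔ IsLowerCorner Y (d, c) := by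
  simp only [IsLowerCorner, mem_tr]; tauto

lemma Lad.up_grid (h : Lad m n Y) {c d : ℕ} (hu : IsUpperCorner Y (c, d)) : 2 ≤ c ∧ c < m ∧ 2 ≤ d ∧ d < n := by
  have h0 := hu
  obtain ⟨h1, h2, h3, h4⟩ := hu
  have g2 := h.grid h2
  have g3 := h.grid h3
  simp only at *
  obtain ⟨i, i', hi, e1, e2, e3, e4⟩ := h.c2 d (by omega) (by omega)
  obtain ⟨j, j', hj, f1, f2, f3, f4⟩ := h.c1 c (by omega) (by omega)
  have := h.up_no h0 e4
  have := h.up_no h0 f4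
  have := h.grid e3
  have := h.grid f3
  omega

lemma Lad.rot_up (h : Lad m n Y) {c d : ℕ} : IsUpperCorner (LadderDet.rot m n Y) (c, d) ↔
    (1 ≤ c ∧ c ≤ m ∧ 1 ≤ d ∧ d ≤ n) ∧ IsLowerCorner Y (m + 1 - c, n + 1 - d) := by
  constructor
  · rintro ⟨h1, h2, h3, h4⟩
    have g1 := h1.1
    have g2 := h2.1
    have g3 := h3.1
    simp only at *
    refine ⟨g1, h1.2, mem_cast h2.2 (by simp only; omega) (by simp only), mem_cast h3.2 (by simp only) (by simp only; omega), fun hh => h4 ⟨by simp only; omega, mem_cast hh (by simp only; omega) (by simp only; omega)⟩⟩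
  · rintro ⟨g, h1, h2, h3, h4⟩
    have g1 := h.grid h1
    have g2 := h.grid h2
    have g3 := h.grid h3
    simp only at *
    refine ⟨mem_cast (h.rot_of h1) (by omega) (by omega), mem_cast (h.rot_of h2) (by simp only; omega) (by simp only; omega), mem_cast (h.rot_of h3) (by simp only; omega) (by simp only; omega), fun hh => h4 (mem_cast hh.2 (by simp only; omega) (by simp only; omega))⟩

lemma Lad.rot_rot (h : Lad m n Y) : LadderDet.rot m n (LadderDet.rot m n Y) = Y := by
  ext ⟨i, j⟩
  constructor
  · rintro ⟨h1, h2, h3⟩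
    simp only at *
    exact mem_cast h3 (by omega) (by omega)
  · intro hh
    have := h.grid hh
    exact mem_cast (h.rot.rot_of (h.rot_of hh)) (by omega) (by omega)

lemma Lad.rot_lo (h : Lad m n Y) {c d : ℕ} : IsLowerCorner (LadderDet.rot m n Y) (c, d) ↔
    (1 ≤ c ∧ c ≤ m ∧ 1 ≤ d ∧ d ≤ n) ∧ IsUpperCorner Y (m + 1 - c, n + 1 - d) := by
  have h1 := h.rot.rot_up (c := m + 1 - c) (d := n + 1 - d)
  rw [h.rot_rot] at h1
  rw [h1]
  constructor
  · intro hh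
    have := h.rot.grid hh.1
    refine ⟨this, by omega, ?_⟩
    rw [show m + 1 - (m + 1 - c) = c by omega, show n + 1 - (n + 1 - d) = d by omega]; exact hh
  · rintro ⟨g, -, hh⟩
    rwa [show m + 1 - (m + 1 - c) = c by omega, show n + 1 - (n + 1 - d) = d by omega] at hh

lemma Lad.lo_grid (h : Lad m n Y) {c d : ℕ} (hu : IsLowerCorner Y (c, d)) : 2 ≤ c ∧ c < m ∧ 2 ≤ d ∧ d < n := by
  have g := h.grid hu.1
  have := h.rot.up_grid (c := m + 1 - c) (d := n + 1 - d) (h.rot_up.2 ⟨by omega, by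
    rwa [show m + 1 - (m + 1 - c) = c by omega, show n + 1 - (n + 1 - d) = d by omega]⟩)
  omega

lemma Lad.miss1 (h : Lad m n Y) {p q r : ℕ} (hp : p ≤ m) (hpq : (p, q) ∉ Y) (hr : (r, q) ∈ Y) (hrp : r < p) :
    ∃ c d, IsUpperCorner Y (c, d) ∧ c < p ∧ d < q := by
  classical
  let c := Nat.findGreatest (fun i => (i, q) ∈ Y) m
  have hc : (c, q) ∈ Y := Nat.findGreatest_spec (P := fun i => (i, q) ∈ Y) (h.grid hr).2.1 hr
  have hcm : ∀ i, (i, q) ∈ Y → i ≤ c := fun i hi => Nat.le_findGreatest (h.grid hi).2.1 hi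
  have hcp : c < p := by
    by_contra hh
    exact hpq (h.col hr hc hrp.le (by omega))
  have gc := h.grid hc
  obtain ⟨j, j', hj, f1, f2, f3, f4⟩ := h.c1 c (by omega) (by omega)
  let d := Nat.findGreatest (fun j => (c+1, j) ∈ Y) n
  have hd : (c+1, d) ∈ Y := Nat.findGreatest_spec (P := fun j => (c+1, j) ∈ Y) (h.grid f3).2.2.2 f3
  have hdm : ∀ j, (c+1, j) ∈ Y → j ≤ d := fun i hi => Nat.le_findGreatest (h.grid hi).2.2.2 hi
  have hdq : d < q := by
    by_contra hh
    have := hcm _ (h.sq hc hd (by omega) (by omega)).2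
    omega
  have := hdm _ f3
  refine ⟨c, d, ⟨h.row f1 hc this hdq.le, hd, h.row f1 hc (by simp only; omega) (by simp only; omega), fun hh => ?_⟩, hcp, hdq⟩
  have := hdm _ hh
  omega

lemma Lad.miss (h : Lad m n Y) {p q : ℕ} (g : 1 ≤ p ∧ p ≤ m ∧ 1 ≤ q ∧ q ≤ n) (hpq : (p, q) ∉ Y) :
    (∃ c d, IsUpperCorner Y (c, d) ∧ c < p ∧ d < q) ∨ (∃ a b, IsLowerCorner Y (a, b) ∧ p < a ∧ q < b) := by
  obtain ⟨r, hr⟩ := h.cols (i := q) (by omega) (by omega)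
  rcases lt_trichotomy r p with h1 | h1 | h1
  · exact Or.inl (h.miss1 (by omega) hpq hr h1)
  · subst h1; exact absurd hr hpq
  · right
    have g1 := h.grid hr
    obtain ⟨c, d, hu, hc, hd⟩ := h.rot.miss1 (p := m + 1 - p) (q := n + 1 - q) (r := m + 1 - r) (by omega)
      (fun hh => hpq (mem_cast hh.2 (by simp only; omega) (by simp only; omega))) (h.rot_of hr) (by omega)
    have h2 := h.rot_up.1 hu
    exact ⟨_, _, h2.2, by omega, by omega⟩

end

end

section

lemma minor_two {m n : ℕ} {Y : Set (ℕ × ℕ)} (Z₁ Z₂ : Set (ℕ × ℕ)) (h : StdLadder m n Y)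
    (hc : TConnected m n 2 Y) (n1 : Z₁.Nonempty) (n2 : Z₂.Nonempty) (l1 : IsLadder m n Z₁)
    (l2 : IsLadder m n Z₂) (hd : Z₁ ∩ Z₂ = ∅) (hu : Z₁ ∪ Z₂ = Y) :
    ∃ r r' c c', r < r' ∧ c < c' ∧ (r, c) ∈ Y ∧ (r, c') ∈ Y ∧ (r', c) ∈ Y ∧ (r', c') ∈ Y ∧
      ¬ ((r, c) ∈ Z₁ ∧ (r, c') ∈ Z₁ ∧ (r', c) ∈ Z₁ ∧ (r', c') ∈ Z₁) ∧
      ¬ ((r, c) ∈ Z₂ ∧ (r, c') ∈ Z₂ ∧ (r', c) ∈ Z₂ ∧ (r', c') ∈ Z₂) := by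
  by_contra hcon
  push Not at hcon
  apply hc
  refine ⟨Z₁, Z₂, n1, n2, l1, l2, hd, hu, ?_⟩
  rintro M ⟨r, c, hr, hc, hM, rfl⟩
  by_contra hno
  push Not at hno
  obtain ⟨a1, a2⟩ := hno
  have key := hcon (r 0) (r 1) (c 0) (c 1) (hr (by decide)) (hc (by decide)) (hM _ _) (hM _ _) (hM _ _) (hM _ _)
  by_cases b1 : (r 0, c 0) ∈ Z₁ ∧ (r 0, c 1) ∈ Z₁ ∧ (r 1, c 0) ∈ Z₁ ∧ (r 1, c 1) ∈ Z₁
  · apply a1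
    rintro p ⟨u, v, rfl⟩
    fin_cases u <;> fin_cases v <;> simp [b1]
  · have b2 := key (by tauto)
    apply a2
    rintro p ⟨u, v, rfl⟩
    fin_cases u <;> fin_cases v <;> simp [b2]

lemma lad_of {m n : ℕ} {Y : Set (ℕ × ℕ)} (hm : 2 ≤ m) (hn : 2 ≤ n) (h : StdLadder m n Y)
    (hc : TConnected m n 2 Y) : Lad m n Y where
  hm := hm
  hn := hn
  std := h
  c1 := by
    intro i hi him
    obtain ⟨j1, hj1⟩ := h.2.2.2.1 i hi (by omega)
    obtain ⟨j2, hj2⟩ := h.2.2.2.1 (i+1) (by omega) (by omega)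
    obtain ⟨r, r', c, c', hr, hcc, m1, m2, m3, m4, a, b⟩ := minor_two {p | p ∈ Y ∧ p.1 ≤ i} {p | p ∈ Y ∧ i < p.1} h hc
      ⟨_, hj1, le_refl _⟩ ⟨_, hj2, by simp⟩
      ⟨fun p hp => h.1.1 p hp.1, fun a b p q h1 h2 h3 h4 => ⟨⟨(h.1.2 a b p q h1.1 h2.1 h3 h4).1, h1.2⟩,
        ⟨(h.1.2 a b p q h1.1 h2.1 h3 h4).2, h2.2⟩⟩⟩
      ⟨fun p hp => h.1.1 p hp.1, fun a b p q h1 h2 h3 h4 => ⟨⟨(h.1.2 a b p q h1.1 h2.1 h3 h4).1, h1.2⟩,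
        ⟨(h.1.2 a b p q h1.1 h2.1 h3 h4).2, h2.2⟩⟩⟩
      (by ext p; simp; intro _ _ _; omega) (by ext p; simp; constructor
                                               · tauto
                                               · intro h; rcases le_or_gt p.1 i with h1 | h1 <;> tauto)
    have h1 : r ≤ i := by
      by_contra hh
      exact b ⟨⟨m1, by simp; omega⟩, ⟨m2, by simp; omega⟩, ⟨m3, by simp; omega⟩, ⟨m4, by simp; omega⟩⟩
    have h2 : i < r' := by
      by_contra hh
      exact a ⟨⟨m1, by simp; omega⟩, ⟨m2, by simp; omega⟩, ⟨m3, by simp; omega⟩, ⟨m4, by simp; omega⟩⟩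
    exact ⟨c, c', hcc, std_col h m1 m3 (by omega) (by omega), std_col h m2 m4 (by omega) (by omega),
      std_col h m1 m3 (by omega) (by omega), std_col h m2 m4 (by omega) (by omega)⟩
  c2 := by
    intro i hi him
    obtain ⟨j1, hj1⟩ := h.2.2.2.2 i hi (by omega)
    obtain ⟨j2, hj2⟩ := h.2.2.2.2 (i+1) (by omega) (by omega)
    obtain ⟨r, r', c, c', hr, hcc, m1, m2, m3, m4, a, b⟩ := minor_two {p | p ∈ Y ∧ p.2 ≤ i} {p | p ∈ Y ∧ i < p.2} h hc
      ⟨_, hj1, le_refl _⟩ ⟨_, hj2, by simp⟩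
      ⟨fun p hp => h.1.1 p hp.1, fun a b p q h1 h2 h3 h4 => ⟨⟨(h.1.2 a b p q h1.1 h2.1 h3 h4).1, h2.2⟩,
        ⟨(h.1.2 a b p q h1.1 h2.1 h3 h4).2, h1.2⟩⟩⟩
      ⟨fun p hp => h.1.1 p hp.1, fun a b p q h1 h2 h3 h4 => ⟨⟨(h.1.2 a b p q h1.1 h2.1 h3 h4).1, h2.2⟩,
        ⟨(h.1.2 a b p q h1.1 h2.1 h3 h4).2, h1.2⟩⟩⟩
      (by ext p; simp; intro _ _ _; omega) (by ext p; simp; constructor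
                                               · tauto
                                               · intro h; rcases le_or_gt p.2 i with h1 | h1 <;> tauto)
    have h1 : c ≤ i := by
      by_contra hh
      exact b ⟨⟨m1, by simp; omega⟩, ⟨m2, by simp; omega⟩, ⟨m3, by simp; omega⟩, ⟨m4, by simp; omega⟩⟩
    have h2 : i < c' := by
      by_contra hh
      exact a ⟨⟨m1, by simp; omega⟩, ⟨m2, by simp; omega⟩, ⟨m3, by simp; omega⟩, ⟨m4, by simp; omega⟩⟩
    exact ⟨r, r', hr, std_row h m1 m2 (by omega) (by omega), std_row h m3 m4 (by omega) (by omega),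
      std_row h m1 m2 (by omega) (by omega), std_row h m3 m4 (by omega) (by omega)⟩

lemma Lad.tconn {m n : ℕ} {Y : Set (ℕ × ℕ)} (h : Lad m n Y) : TConnected m n 2 Y := by
  rintro ⟨Z₁, Z₂, n1, n2, l1, l2, hd, hu, hM⟩
  have hx : ∀ p, p ∈ Z₁ → p ∈ Z₂ → False := fun p h1 h2 => by
    have : p ∈ Z₁ ∩ Z₂ := ⟨h1, h2⟩
    rw [hd] at this; exact this
  have four : ∀ {r r' c c'}, r < r' → c < c' → (r, c) ∈ Y → (r, c') ∈ Y → (r', c) ∈ Y → (r', c') ∈ Y →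
      (((r, c) ∈ Z₁ ↔ (r, c') ∈ Z₁) ∧ ((r', c) ∈ Z₁ ↔ (r', c') ∈ Z₁) ∧ ((r, c) ∈ Z₁ ↔ (r', c) ∈ Z₁)) := by
    intro r r' c c' hr hc h1 h2 h3 h4
    have := hM {p | ∃ u v, p = ((![r, r'] : Fin 2 → ℕ) u, (![c, c'] : Fin 2 → ℕ) v)} ⟨![r, r'], ![c, c'], by
      intro a b hab; fin_cases a <;> fin_cases b <;> simp_all, by
      intro a b hab; fin_cases a <;> fin_cases b <;> simp_all, by
      intro a b; fin_cases a <;> fin_cases b <;> simp_all, rfl⟩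
    have e1 : (r, c) ∈ {p : ℕ × ℕ | ∃ u v, p = ((![r, r'] : Fin 2 → ℕ) u, (![c, c'] : Fin 2 → ℕ) v)} := ⟨0, 0, rfl⟩
    have e2 : (r, c') ∈ {p : ℕ × ℕ | ∃ u v, p = ((![r, r'] : Fin 2 → ℕ) u, (![c, c'] : Fin 2 → ℕ) v)} := ⟨0, 1, rfl⟩
    have e3 : (r', c) ∈ {p : ℕ × ℕ | ∃ u v, p = ((![r, r'] : Fin 2 → ℕ) u, (![c, c'] : Fin 2 → ℕ) v)} := ⟨1, 0, rfl⟩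
    have e4 : (r', c') ∈ {p : ℕ × ℕ | ∃ u v, p = ((![r, r'] : Fin 2 → ℕ) u, (![c, c'] : Fin 2 → ℕ) v)} := ⟨1, 1, rfl⟩
    rcases this with t | t
    · have := t e1; have := t e2; have := t e3; have := t e4
      tauto
    · have := (hx _ · (t e1)); have := (hx _ · (t e2)); have := (hx _ · (t e3)); have := (hx _ · (t e4))
      tauto
  have step : ∀ i j, (i, j) ∈ Y → (i, j+1) ∈ Y → ((i, j) ∈ Z₁ ↔ (i, j+1) ∈ Z₁) := by
    intro i j h1 h2
    have g1 := h.grid h1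
    have g2 := h.grid h2
    obtain ⟨r, r', hr, e1, e2, e3, e4⟩ := h.c2 j (by omega) (by omega)
    by_cases hri : r < i
    · exact (four hri (Nat.lt_succ_self j) e1 e3 h1 h2).2.1
    · exact (four (by omega : i < r') (Nat.lt_succ_self j) h1 h2 e2 e4).1
  have rw1 : ∀ i j t, (i, j) ∈ Y → (i, j + t) ∈ Y → ((i, j) ∈ Z₁ ↔ (i, j + t) ∈ Z₁) := by
    intro i j t h1
    induction t with
    | zero => simp
    | succ t ih =>
      intro h2
      have h3 : (i, j + t) ∈ Y := h.row h1 h2 (by omega) (by omega)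
      rw [ih h3]
      exact step i (j+t) h3 h2
  have rw2 : ∀ i j j', (i, j) ∈ Y → (i, j') ∈ Y → ((i, j) ∈ Z₁ ↔ (i, j') ∈ Z₁) := by
    intro i j j' h1 h2
    rcases le_total j j' with hh | hh
    · obtain ⟨t, rfl⟩ := Nat.exists_eq_add_of_le hh
      exact rw1 i j t h1 h2
    · obtain ⟨t, rfl⟩ := Nat.exists_eq_add_of_le hh
      exact (rw1 i j' t h2 h1).symm
  have all : ∀ i, 1 ≤ i → ∀ j, (i, j) ∈ Y → ((i, j) ∈ Z₁ ↔ (1, n) ∈ Z₁) := by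
    intro i hi
    induction i, hi using Nat.le_induction with
    | base => intro j hj; exact rw2 1 j n hj h.ne
    | succ i hi ih =>
      intro j hj
      have g := h.grid hj
      obtain ⟨a, b, hab, e1, e2, e3, e4⟩ := h.c1 i hi (by omega)
      rw [rw2 _ _ _ hj e3, ← ih a e1]
      exact (four (Nat.lt_succ_self i) hab e1 e2 e3 e4).2.2.symm
  obtain ⟨⟨i, j⟩, h1⟩ := n1
  obtain ⟨⟨i', j'⟩, h2⟩ := n2
  have y1 : (i, j) ∈ Y := hu ▸ Or.inl h1
  have y2 : (i', j') ∈ Y := hu ▸ Or.inr h2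
  exact hx _ ((all i' (h.grid y2).1 j' y2).2 ((all i (h.grid y1).1 j y1).1 h1)) h2

end

section

/-- prefix-sum lattice -/
def lmSub (m n : ℕ) : AddSubgroup ((ℕ → ℤ) × (ℕ → ℤ)) where
  carrier := {x | x.1 0 = 0 ∧ x.2 0 = 0 ∧ (∀ r ≥ m, x.1 r = x.1 m) ∧ (∀ s ≥ n, x.2 s = x.2 n) ∧ x.1 m = x.2 n}
  zero_mem' := by simp
  add_mem' := by
    rintro x y ⟨a1, a2, a3, a4, a5⟩ ⟨b1, b2, b3, b4, b5⟩
    refine ⟨by simp [a1, b1], by simp [a2, b2], fun r hr => by simp [a3 r hr, b3 r hr], fun r hr => by simp [a4 r hr, b4 r hr], by simp [a5, b5]⟩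
  neg_mem' := by
    rintro x ⟨a1, a2, a3, a4, a5⟩
    refine ⟨by simp [a1], by simp [a2], fun r hr => by simp [a3 r hr], fun r hr => by simp [a4 r hr], by simp [a5]⟩

/-- the lattice -/
abbrev LM (m n : ℕ) : Type := lmSub m n

variable {m n : ℕ}

/-- row prefix -/
def eA (m n r : ℕ) : LM m n →+ ℤ where
  toFun x := x.1.1 r
  map_zero' := rfl
  map_add' _ _ := rfl
/-- column prefix -/
def eB (m n r : ℕ) : LM m n →+ ℤ where
  toFun x := x.1.2 r
  map_zero' := rfl
  map_add' _ _ := rfl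

lemma eA_zero (x : LM m n) : eA m n 0 x = 0 := x.2.1
lemma eB_zero (x : LM m n) : eB m n 0 x = 0 := x.2.2.1
lemma eA_ge (x : LM m n) {r : ℕ} (h : m ≤ r) : eA m n r x = eA m n m x := x.2.2.2.1 r h
lemma eB_ge' (x : LM m n) {r : ℕ} (h : n ≤ r) : eB m n r x = eB m n n x := x.2.2.2.2.1 r h
lemma eAB (x : LM m n) : eB m n n x = eA m n m x := x.2.2.2.2.2.symm
lemma eB_ge (x : LM m n) {r : ℕ} (h : n ≤ r) : eB m n r x = eA m n m x := by rw [eB_ge' x h, eAB]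

lemma lm_ext {x y : LM m n} (h1 : ∀ r, r ≤ m → eA m n r x = eA m n r y) (h2 : ∀ r, r ≤ n → eB m n r x = eB m n r y) : x = y := by
  apply Subtype.ext
  apply Prod.ext
  · funext r
    rcases le_total r m with h | h
    · exact h1 r h
    · have := eA_ge x h; have := eA_ge y h; have := h1 m le_rfl
      change eA m n r x = eA m n r y
      omega
  · funext r
    rcases le_total r n with h | h
    · exact h2 r h
    · have := eB_ge' x h; have := eB_ge' y h; have := h2 n le_rfl
      change eB m n r x = eB m n r y
      omega

instance lm_finite : Module.Finite ℤ (LM m n) := by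
  let f : LM m n →+ ((Fin (m+1) → ℤ) × (Fin (n+1) → ℤ)) :=
    { toFun := fun x => (fun i => eA m n i x, fun i => eB m n i x)
      map_zero' := rfl
      map_add' := fun _ _ => rfl }
  refine Module.Finite.of_injective f.toIntLinearMap ?_
  intro x y hxy
  have h1 := congrArg Prod.fst hxy
  have h2 := congrArg Prod.snd hxy
  exact lm_ext (fun r hr => congrFun h1 ⟨r, by omega⟩) (fun r hr => congrFun h2 ⟨r, by omega⟩)

instance lm_tf : Module.IsTorsionFree ℤ (LM m n) := inferInstance
instance lm_free : Module.Free ℤ (LM m n) := inferInstance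

/-- raw facets -/
inductive Fac : Type
  | row (i : ℕ) | col (j : ℕ) | up (c d : ℕ) | lo (a b : ℕ)

/-- weight of a facet -/
def wt (m n : ℕ) : Fac → LM m n →+ ℤ
  | .row i => eA m n i - eA m n (i-1)
  | .col j => eB m n j - eB m n (j-1)
  | .up c d => eA m n c + eB m n d - eA m n m
  | .lo a b => eA m n m - eA m n (a-1) - eB m n (b-1)

/-- validity of a facet -/
def Val (m n : ℕ) (Y : Set (ℕ × ℕ)) : Fac → Prop
  | .row i => 1 ≤ i ∧ i ≤ m
  | .col j => 1 ≤ j ∧ j ≤ n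
  | .up c d => IsUpperCorner Y (c, d)
  | .lo a b => IsLowerCorner Y (a, b)

/-- facets -/
abbrev Fct (m n : ℕ) (Y : Set (ℕ × ℕ)) : Type := {f : Fac // Val m n Y f}

/-- weights on valid facets -/
def wY (m n : ℕ) (Y : Set (ℕ × ℕ)) (f : Fct m n Y) : LM m n →+ ℤ := wt m n f.1

variable {Y : Set (ℕ × ℕ)}

lemma Lad.finFct (h : Lad m n Y) : Finite (Fct m n Y) := by
  let g : Fac → ℕ × ℕ × ℕ := fun f => match f with
    | .row i => (0, i, 0) | .col j => (1, 0, j) | .up c d => (2, c, d) | .lo a b => (3, a, b)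
  have hf : Set.Finite ((Set.Iic 3 : Set ℕ) ×ˢ ((Set.Iic m : Set ℕ) ×ˢ (Set.Iic n : Set ℕ))) :=
    (Set.finite_Iic 3).prod ((Set.finite_Iic m).prod (Set.finite_Iic n))
  have : Set.Finite {f | Val m n Y f} := by
    refine Set.Finite.of_injOn (f := g) ?_ ?_ hf
    · intro f hf
      have h1 : ∀ c d, IsUpperCorner Y (c, d) → _ := fun c d hu => h.up_grid hu
      have h2 : ∀ c d, IsLowerCorner Y (c, d) → _ := fun c d hu => h.lo_grid hu
      cases f with
      | row i => simp only [Val, Set.mem_setOf_eq] at hf; simp [g]; omega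
      | col i => simp only [Val, Set.mem_setOf_eq] at hf; simp [g]; omega
      | up c d => have := h1 c d hf; simp [g]; omega
      | lo c d => have := h2 c d hf; simp [g]; omega
    · intro x _ y _ hxy
      cases x <;> cases y <;> simp_all [g]
  exact this.to_subtype

/-- edges -/
noncomputable def edge (m n : ℕ) (p : ℕ × ℕ) : LM m n := by
  classical
  exact if h : InGrid m n p then ⟨(fun r => if p.1 ≤ r then 1 else 0, fun s => if p.2 ≤ s then 1 else 0), by
    obtain ⟨h1, h2, h3, h4⟩ := h
    refine ⟨?_, ?_, ?_, ?_, ?_⟩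
    · simp; omega
    · simp; omega
    · intro r hr; simp only [ge_iff_le] at hr; simp only; rw [if_pos (by omega), if_pos (by omega)]
    · intro r hr; simp only [ge_iff_le] at hr; simp only; rw [if_pos (by omega), if_pos (by omega)]
    · simp only; rw [if_pos (by omega), if_pos (by omega)]⟩ else 0

lemma eA_edge {i j : ℕ} (h : 1 ≤ i ∧ i ≤ m ∧ 1 ≤ j ∧ j ≤ n) (r : ℕ) : eA m n r (edge m n (i, j)) = if i ≤ r then 1 else 0 := by
  rw [edge, dif_pos (show InGrid m n (i, j) from h)]; rfl
lemma eB_edge {i j : ℕ} (h : 1 ≤ i ∧ i ≤ m ∧ 1 ≤ j ∧ j ≤ n) (r : ℕ) : eB m n r (edge m n (i, j)) = if j ≤ r then 1 else 0 := by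
  rw [edge, dif_pos (show InGrid m n (i, j) from h)]; rfl

/-- the cone -/
def Cone (m n : ℕ) (Y : Set (ℕ × ℕ)) : Set (LM m n) := box (wY m n Y) 0

lemma mem_cone {x : LM m n} : x ∈ Cone m n Y ↔ ((∀ i, 1 ≤ i → i ≤ m → eA m n (i-1) x ≤ eA m n i x) ∧
    (∀ i, 1 ≤ i → i ≤ n → eB m n (i-1) x ≤ eB m n i x) ∧
    (∀ c d, IsUpperCorner Y (c, d) → eA m n m x ≤ eA m n c x + eB m n d x) ∧
    (∀ a b, IsLowerCorner Y (a, b) → eA m n (a-1) x + eB m n (b-1) x ≤ eA m n m x)) := by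
  constructor
  · intro h
    refine ⟨fun i h1 h2 => ?_, fun i h1 h2 => ?_, fun c d hu => ?_, fun a b hl => ?_⟩
    · have := h ⟨.row i, h1, h2⟩; simp [wY, wt] at this; omega
    · have := h ⟨.col i, h1, h2⟩; simp [wY, wt] at this; omega
    · have := h ⟨.up c d, hu⟩; simp [wY, wt] at this; omega
    · have := h ⟨.lo a b, hl⟩; simp [wY, wt] at this; omega
  · rintro ⟨h1, h2, h3, h4⟩ ⟨f, hf⟩
    cases f with
    | row i => have := h1 i hf.1 hf.2; simp [wY, wt]; omega
    | col i => have := h2 i hf.1 hf.2; simp [wY, wt]; omega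
    | up c d => have := h3 c d hf; simp [wY, wt]; omega
    | lo c d => have := h4 c d hf; simp [wY, wt]; omega

lemma cone_monoA {x : LM m n} (h : x ∈ Cone m n Y) : Monotone fun r => eA m n r x := by
  refine monotone_nat_of_le_succ fun r => ?_
  rcases lt_or_ge r m with h1 | h1
  · exact (mem_cone.1 h).1 (r+1) (by omega) (by omega)
  · simp only [eA_ge x h1, eA_ge x (show m ≤ r+1 by omega), le_refl]
lemma cone_monoB {x : LM m n} (h : x ∈ Cone m n Y) : Monotone fun r => eB m n r x := by
  refine monotone_nat_of_le_succ fun r => ?_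
  rcases lt_or_ge r n with h1 | h1
  · exact (mem_cone.1 h).2.1 (r+1) (by omega) (by omega)
  · simp only [eB_ge x h1, eB_ge x (show n ≤ r+1 by omega), le_refl]
lemma cone_A {x : LM m n} (h : x ∈ Cone m n Y) (r : ℕ) : 0 ≤ eA m n r x ∧ eA m n r x ≤ eA m n m x := by
  constructor
  · have := cone_monoA h (Nat.zero_le r); simp only [eA_zero] at this; exact this
  · rcases le_total r m with h1 | h1
    · exact cone_monoA h h1
    · exact (eA_ge x h1).le
lemma cone_B {x : LM m n} (h : x ∈ Cone m n Y) (r : ℕ) : 0 ≤ eB m n r x ∧ eB m n r x ≤ eA m n m x := by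
  constructor
  · have := cone_monoB h (Nat.zero_le r); simp only [eB_zero] at this; exact this
  · rcases le_total r n with h1 | h1
    · rw [← eAB]; exact cone_monoB h h1
    · exact (eB_ge x h1).le

lemma cone_zero {x : LM m n} (h : x ∈ Cone m n Y) (h0 : eA m n m x = 0) : x = 0 := by
  refine lm_ext (fun r _ => ?_) (fun r _ => ?_)
  · have := cone_A h r; rw [map_zero]; omega
  · have := cone_B h r; rw [map_zero]; omega

lemma Lad.edge_cone (h : Lad m n Y) {i j : ℕ} (hij : (i, j) ∈ Y) : edge m n (i, j) ∈ Cone m n Y := by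
  have g := h.grid hij
  simp only [mem_cone, eA_edge g, eB_edge g]
  refine ⟨fun r _ _ => ?_, fun r _ _ => ?_, fun c d hu => ?_, fun a b hl => ?_⟩
  · split_ifs <;> omega
  · split_ifs <;> omega
  · have := h.up_no hu hij
    split_ifs <;> omega
  · have := h.lo_no hl hij
    have := h.lo_grid hl
    split_ifs <;> omega

/-- first row and last column of an element -/
structure FL (x : LM m n) (p q : ℕ) : Prop where
  p1 : 1 ≤ p
  pm : p ≤ m
  q1 : 1 ≤ q
  qn : q ≤ n
  a0 : eA m n (p-1) x = 0
  a1 : 0 < eA m n p x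
  b0 : eB m n q x = eA m n m x
  b1 : eB m n (q-1) x < eA m n m x

lemma exists_FL {x : LM m n} (hx : x ∈ Cone m n Y) (h0 : eA m n m x ≠ 0) : ∃ p q, FL x p q := by
  classical
  have hS : 0 < eA m n m x := lt_of_le_of_ne (cone_A hx m).1 (Ne.symm h0)
  have e1 : ∃ r, 0 < eA m n r x := ⟨m, hS⟩
  have e2 : ∃ r, eB m n r x = eA m n m x := ⟨n, eAB x⟩
  have p1 : 1 ≤ Nat.find e1 := by
    by_contra hh
    have := Nat.find_spec e1
    rw [show Nat.find e1 = 0 by omega, eA_zero] at this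
    omega
  have q1 : 1 ≤ Nat.find e2 := by
    by_contra hh
    have := Nat.find_spec e2
    rw [show Nat.find e2 = 0 by omega, eB_zero] at this
    omega
  refine ⟨Nat.find e1, Nat.find e2, p1, Nat.find_le hS, q1, Nat.find_le (eAB x), ?_, Nat.find_spec e1, Nat.find_spec e2, ?_⟩
  · have := Nat.find_min e1 (show Nat.find e1 - 1 < Nat.find e1 by omega)
    have := cone_A hx (Nat.find e1 - 1)
    omega
  · have := Nat.find_min e2 (show Nat.find e2 - 1 < Nat.find e2 by omega)
    have := cone_B hx (Nat.find e2 - 1)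
    omega

lemma Lad.FL_mem (h : Lad m n Y) {x : LM m n} (hx : x ∈ Cone m n Y) {p q : ℕ} (hf : FL x p q) :
    (p, q) ∈ Y := by
  by_contra hno
  obtain ⟨p1, pm, q1, qn, a0, a1, b0, b1⟩ := hf
  obtain ⟨-, -, h3, h4⟩ := mem_cone.1 hx
  rcases h.miss ⟨p1, pm, q1, qn⟩ hno with ⟨c, d, hu, hc, hd⟩ | ⟨a, b, hl, ha, hb⟩
  · have := h3 c d hu
    have : eA m n c x ≤ eA m n (p-1) x := cone_monoA hx (by omega)
    have : eB m n d x ≤ eB m n (q-1) x := cone_monoB hx (by omega)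
    omega
  · have := h4 a b hl
    have : eA m n p x ≤ eA m n (a-1) x := cone_monoA hx (by omega)
    have : eB m n q x ≤ eB m n (b-1) x := cone_monoB hx (by omega)
    omega

lemma Lad.FL_sub (h : Lad m n Y) {x : LM m n} (hx : x ∈ Cone m n Y) {p q : ℕ} (hf : FL x p q) :
    x - edge m n (p, q) ∈ Cone m n Y := by
  obtain ⟨p1, pm, q1, qn, a0, a1, b0, b1⟩ := hf
  have g : 1 ≤ p ∧ p ≤ m ∧ 1 ≤ q ∧ q ≤ n := ⟨p1, pm, q1, qn⟩
  obtain ⟨h1, h2, h3, h4⟩ := mem_cone.1 hx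
  simp only [mem_cone, map_sub, eA_edge g, eB_edge g, pm, if_true]
  have lA : ∀ r, r < p → eA m n r x = 0 := fun r hr => by
    have : eA m n r x ≤ eA m n (p-1) x := cone_monoA hx (by omega)
    have := cone_A hx r; omega
  have gA : ∀ r, p ≤ r → eA m n p x ≤ eA m n r x := fun r hr => cone_monoA hx hr
  have gB : ∀ r, q ≤ r → eB m n r x = eA m n m x := fun r hr => by
    have : eB m n q x ≤ eB m n r x := cone_monoB hx hr
    have := cone_B hx r; omega
  have lB : ∀ r, r < q → eB m n r x < eA m n m x := fun r hr => by
    have : eB m n r x ≤ eB m n (q-1) x := cone_monoB hx (by omega)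
    omega
  refine ⟨fun r i1 i2 => ?_, fun r i1 i2 => ?_, fun c d hu => ?_, fun a b hl => ?_⟩
  · have := h1 r i1 i2
    have := lA (r-1); have := gA r
    split_ifs <;> omega
  · have := h2 r i1 i2
    have := lB (r-1); have := gB r
    split_ifs <;> omega
  · have := h3 c d hu
    have := gA c; have := gB d
    split_ifs <;> omega
  · have := h4 a b hl
    have := lA (a-1); have := lB (b-1)
    split_ifs <;> omega

/-- weight of an exponent vector -/
noncomputable def ew (m n : ℕ) (Y : Set (ℕ × ℕ)) : (Y →₀ ℕ) →+ LM m n :=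
  Finsupp.liftAddHom fun y => (multiplesHom _ (edge m n y.1))

lemma ew_single (y : Y) (k : ℕ) : ew m n Y (Finsupp.single y k) = k • edge m n y.1 := by
  simp [ew]

lemma Lad.ew_cone (h : Lad m n Y) (s : Y →₀ ℕ) : ew m n Y s ∈ Cone m n Y := by
  induction s using Finsupp.induction_linear with
  | zero => simp [Cone, box]
  | add f g hf hg =>
    rw [map_add]; intro i
    have := hf i; have := hg i
    rw [map_add]; simp at *; omega
  | single a b =>
    rw [ew_single]; intro i
    have := h.edge_cone a.2 i
    rw [map_nsmul]; simp at *; positivity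

lemma Lad.ew_surj (h : Lad m n Y) {x : LM m n} (hx : x ∈ Cone m n Y) : ∃ s, ew m n Y s = x := by
  generalize hN : (eA m n m x).toNat = N
  induction N generalizing x with
  | zero =>
    have := cone_zero hx (by have := (cone_A hx m).1; omega)
    exact ⟨0, by rw [map_zero, this]⟩
  | succ N ih =>
    obtain ⟨p, q, hf⟩ := exists_FL hx (by omega)
    obtain ⟨s, hs⟩ := ih (h.FL_sub hx hf) (by
      rw [map_sub, eA_edge ⟨hf.p1, hf.pm, hf.q1, hf.qn⟩, if_pos hf.pm]; omega)
    refine ⟨s + Finsupp.single ⟨(p, q), h.FL_mem hx hf⟩ 1, ?_⟩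
    rw [map_add, hs, ew_single]; simp

end

section

section
variable {m n : ℕ} {Y : Set (ℕ × ℕ)}

variable (K : Type) [Field K]

/-- the toric parametrization -/
noncomputable def phi0 (m n : ℕ) (Y : Set (ℕ × ℕ)) : MvPolynomial Y K →ₐ[K] AddMonoidAlgebra K (LM m n) :=
  MvPolynomial.aeval fun y => chi (edge m n y.1)

lemma chi_pow {M : Type} [AddCommGroup M] (x : M) (k : ℕ) : (chi x : AddMonoidAlgebra K M) ^ k = chi (k • x) := by
  induction k with
  | zero => simp [chi_zero]
  | succ k ih => rw [pow_succ, ih, chi_mul, succ_nsmul]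

lemma phi0_mon (s : Y →₀ ℕ) : phi0 K m n Y (MvPolynomial.monomial s 1) = chi (ew m n Y s) := by
  induction s using Finsupp.induction_linear with
  | zero => rw [map_zero, chi_zero]; exact map_one _
  | add f g hf hg =>
    rw [map_add, ← chi_mul, ← hf, ← hg, ← map_mul, MvPolynomial.monomial_mul, one_mul]
  | single a b =>
    rw [ew_single, phi0, MvPolynomial.aeval_monomial, map_one, one_mul, Finsupp.prod_single_index (by simp), chi_pow]

lemma edge_swap {r r' c c' : ℕ} (h1 : 1 ≤ r ∧ r ≤ m ∧ 1 ≤ c ∧ c ≤ n) (h2 : 1 ≤ r' ∧ r' ≤ m ∧ 1 ≤ c' ∧ c' ≤ n) :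
    edge m n (r, c) + edge m n (r', c') = edge m n (r, c') + edge m n (r', c) := by
  have h3 : 1 ≤ r ∧ r ≤ m ∧ 1 ≤ c' ∧ c' ≤ n := by omega
  have h4 : 1 ≤ r' ∧ r' ≤ m ∧ 1 ≤ c ∧ c ≤ n := by omega
  refine lm_ext (fun t _ => ?_) (fun t _ => ?_)
  · simp only [map_add, eA_edge h1, eA_edge h2, eA_edge h3, eA_edge h4]
  · simp only [map_add, eB_edge h1, eB_edge h2, eB_edge h3, eB_edge h4]; omega

lemma Lad.phi0_minor (h : Lad m n Y) (f : MvPolynomial Y K) (hf : f ∈ minorIdeal K 2 Y) : phi0 K m n Y f = 0 := by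
  have : minorIdeal K 2 Y ≤ RingHom.ker (phi0 K m n Y).toRingHom := by
    rw [minorIdeal, Ideal.span_le]
    rintro f ⟨r, c, hr, hc, hm, rfl⟩
    change phi0 K m n Y _ = 0
    rw [minorPoly, Matrix.det_fin_two]
    simp only [Matrix.of_apply, map_sub, map_mul, phi0, MvPolynomial.aeval_X, chi_mul]
    rw [edge_swap (h.grid (hm 0 0)) (h.grid (hm 1 1)), sub_self]
  exact this hf

/-- the map from the ladder ring -/
noncomputable def phi (h : Lad m n Y) : LadderRing K 2 Y →+* AddMonoidAlgebra K (LM m n) :=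
  Ideal.Quotient.lift _ (phi0 K m n Y).toRingHom (h.phi0_minor K)

noncomputable instance ladAlg [h : Fact (Lad m n Y)] : Algebra (LadderRing K 2 Y) (AddMonoidAlgebra K (LM m n)) :=
  (phi K h.1).toAlgebra

/-- residue of a monomial -/
noncomputable def rm (s : Y →₀ ℕ) : LadderRing K 2 Y :=
  Ideal.Quotient.mk (minorIdeal K 2 Y) (MvPolynomial.monomial s 1)

lemma rm_add (s t : Y →₀ ℕ) : rm K (s + t) = rm K s * rm K t := by
  rw [rm, rm, rm, ← map_mul, MvPolynomial.monomial_mul, one_mul]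

lemma rm_swap {i j p q : ℕ} (hip : i < p) (hjq : j < q) (h1 : (i, j) ∈ Y) (h2 : (i, q) ∈ Y) (h3 : (p, j) ∈ Y) (h4 : (p, q) ∈ Y) :
    rm K (Finsupp.single (⟨(i, j), h1⟩ : Y) 1 + Finsupp.single ⟨(p, q), h4⟩ 1) =
    rm K (Finsupp.single (⟨(i, q), h2⟩ : Y) 1 + Finsupp.single ⟨(p, j), h3⟩ 1) := by
  rw [rm, rm, Ideal.Quotient.eq]
  apply Ideal.subset_span
  refine ⟨![i, p], ![j, q], ?_, ?_, ?_, ?_⟩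
  · intro a b hab; fin_cases a <;> fin_cases b <;> simp_all
  · intro a b hab; fin_cases a <;> fin_cases b <;> simp_all
  · intro a b; fin_cases a <;> fin_cases b <;> simp_all
  · rw [minorPoly, Matrix.det_fin_two]
    simp only [Matrix.of_apply, MvPolynomial.X, MvPolynomial.monomial_mul, one_mul]
    rfl

lemma ew_supp (s : Y →₀ ℕ) (y : Y) (hy : s y ≠ 0) : ∃ s', s = s' + Finsupp.single y 1 := by
  refine ⟨s - Finsupp.single y 1, ?_⟩
  rw [tsub_add_cancel_of_le]
  rw [Finsupp.single_le_iff]; omega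

lemma ew_pos {P : LM m n →+ ℤ} (s : Y →₀ ℕ) (h : P (ew m n Y s) ≠ 0) : ∃ y, s y ≠ 0 ∧ P (edge m n y.1) ≠ 0 := by
  by_contra hcon
  push Not at hcon
  apply h
  have : P (ew m n Y s) = s.sum fun y k => k • P (edge m n y.1) := by
    rw [ew, Finsupp.liftAddHom_apply, map_finsuppSum]
    simp
  rw [this]
  refine Finset.sum_eq_zero fun y hy => ?_
  simp only
  rw [hcon y (Finsupp.mem_support_iff.1 hy), smul_zero]

lemma Lad.rm_uniq (h : Lad m n Y) : ∀ (N : ℕ) (s t : Y →₀ ℕ), (eA m n m (ew m n Y s)) = N → ew m n Y s = ew m n Y t →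
    rm K s = rm K t := by
  have key : ∀ (x : LM m n) (hx : x ∈ Cone m n Y) (p q : ℕ) (hf : FL x p q) (s : Y →₀ ℕ), ew m n Y s = x →
      ∃ s', rm K s = rm K (s' + Finsupp.single ⟨(p, q), h.FL_mem hx hf⟩ 1) ∧
        ew m n Y s = ew m n Y (s' + Finsupp.single ⟨(p, q), h.FL_mem hx hf⟩ 1) := by
    intro x hx p q hf s hs
    have hpq := h.FL_mem hx hf
    obtain ⟨p1, pm, q1, qn, a0, a1, b0, b1⟩ := hf
    have lo : ∀ y : Y, s y ≠ 0 → p ≤ y.1.1 ∧ y.1.2 ≤ q := by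
      rintro ⟨⟨i, j⟩, hij⟩ hy
      obtain ⟨s', rfl⟩ := ew_supp s _ hy
      have g := h.grid hij
      have e1 := h.ew_cone s'
      have e2 := h.edge_cone hij
      rw [map_add, ew_single, one_smul] at hs
      constructor
      · by_contra hlt
        simp only [not_le] at hlt
        have := congrArg (eA m n (p-1)) hs
        rw [map_add, eA_edge g, a0] at this
        have := (cone_A e1 (p-1)).1
        rw [if_pos (by omega)] at *
        omega
      · by_contra hlt
        simp only [not_le] at hlt
        have h1 := congrArg (eB m n q) hs
        have h2 := congrArg (eA m n m) hs
        rw [map_add, eB_edge g, b0] at h1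
        rw [map_add, eA_edge g] at h2
        have := (cone_B e1 q).2
        rw [if_neg (by omega)] at h1
        rw [if_pos (by omega)] at h2
        omega
    obtain ⟨⟨⟨i, j⟩, hij⟩, hy, hye⟩ := ew_pos (P := eA m n p) s (by rw [hs]; omega)
    obtain ⟨⟨⟨i', j'⟩, hij'⟩, hy', hye'⟩ := ew_pos (P := eA m n m - eB m n (q-1)) s (by
      rw [hs, AddMonoidHom.sub_apply]; omega)
    have g := h.grid hij
    have g' := h.grid hij'
    have l1 := lo _ hy
    have l2 := lo _ hy'
    simp only at l1 l2
    simp only [eA_edge g, AddMonoidHom.sub_apply, eA_edge g', eB_edge g'] at hye hye'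
    have hi : i = p := by by_contra hh; exact hye (if_neg (by omega))
    have hj : j' = q := by
      by_contra hh; apply hye'; rw [if_pos (by omega), if_pos (by omega)]; rfl
    subst hi hj
    by_cases hjq : j = j'
    · subst hjq
      obtain ⟨s', rfl⟩ := ew_supp s _ hy
      exact ⟨s', rfl, rfl⟩
    by_cases hip : i = i'
    · subst hip
      obtain ⟨s', rfl⟩ := ew_supp s _ hy'
      exact ⟨s', rfl, rfl⟩
    obtain ⟨s1, rfl⟩ := ew_supp s _ hy
    have : s1 ⟨(i', j'), hij'⟩ ≠ 0 := by
      intro h0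
      apply hy'
      rw [Finsupp.add_apply, h0, Finsupp.single_apply, if_neg, add_zero]
      intro he
      have := congrArg (fun z : Y => z.1.1) he
      exact hip this
    obtain ⟨s2, rfl⟩ := ew_supp s1 _ this
    have m4 := (h.sq hij hij' (by omega) (by omega)).2
    refine ⟨s2 + Finsupp.single ⟨(i', j), m4⟩ 1, ?_, ?_⟩
    · have := rm_swap K (show i < i' by omega) (show j < j' by omega) hij hpq m4 hij'
      rw [rm_add, rm_add] at this
      simp only [rm_add]
      linear_combination (rm K s2) * this
    · simp only [map_add, ew_single, one_smul]
      have := edge_swap g g'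
      rw [add_assoc, add_assoc, add_comm (edge m n (i', j')), this, add_comm (edge m n (i, j'))]
  intro N
  induction N with
  | zero =>
    intro s t hN hst
    have z : ∀ s : Y →₀ ℕ, eA m n m (ew m n Y s) = 0 → s = 0 := by
      intro s hs
      by_contra hne
      obtain ⟨⟨⟨i, j⟩, hij⟩, hy⟩ := Finsupp.ne_iff.1 hne
      obtain ⟨s', rfl⟩ := ew_supp s _ hy
      rw [map_add, map_add, ew_single, one_smul, eA_edge (h.grid hij), if_pos (h.grid hij).2.1] at hs
      have := (cone_A (h.ew_cone s') m).1
      omega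
    rw [z s hN, z t (by rw [← hst]; exact hN)]
  | succ N ih =>
    intro s t hN hst
    have hx := h.ew_cone s
    obtain ⟨p, q, hf⟩ := exists_FL hx (by omega)
    obtain ⟨s', e1, e2⟩ := key _ hx p q hf s rfl
    obtain ⟨t', e3, e4⟩ := key _ hx p q hf t hst.symm
    rw [e1, e3, rm_add, rm_add, ih s' t']
    · rw [e2, map_add, map_add, ew_single, one_smul, eA_edge ⟨hf.p1, hf.pm, hf.q1, hf.qn⟩, if_pos hf.pm] at hN
      push_cast at hN; omega
    · rw [e2, e4, map_add, map_add] at hst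
      exact add_right_cancel hst

lemma Lad.phi_inj (h : Lad m n Y) : Function.Injective (phi K h) := by
  classical
  let g : LM m n → LadderRing K 2 Y := fun x => if hx : ∃ s, ew m n Y s = x then rm K hx.choose else 0
  let ψ : AddMonoidAlgebra K (LM m n) →ₗ[K] LadderRing K 2 Y :=
    (Finsupp.linearCombination K g) ∘ₗ (AddMonoidAlgebra.coeffLinearEquiv K).toLinearMap
  have hψ : ∀ x, ψ (chi x) = g x := fun x => by
    change Finsupp.linearCombination K g (Finsupp.single x 1) = _
    simp
  have hg : ∀ s, g (ew m n Y s) = rm K s := fun s => by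
    have hx : ∃ s', ew m n Y s' = ew m n Y s := ⟨s, rfl⟩
    simp only [g]
    rw [dif_pos hx]
    exact h.rm_uniq K _ _ _ (Int.toNat_of_nonneg (cone_A (h.ew_cone _) m).1).symm hx.choose_spec
  have hl : ∀ f, ψ (phi0 K m n Y f) = Ideal.Quotient.mk (minorIdeal K 2 Y) f := by
    intro f
    have : ψ ∘ₗ (phi0 K m n Y).toLinearMap = (Ideal.Quotient.mkₐ K (minorIdeal K 2 Y)).toLinearMap := by
      refine MvPolynomial.linearMap_ext fun s => ?_
      ext
      simp only [LinearMap.comp_apply, AlgHom.toLinearMap_apply]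
      rw [phi0_mon, hψ, hg]
      rfl
    exact LinearMap.congr_fun this f
  rw [injective_iff_map_eq_zero]
  intro r hr
  obtain ⟨f, rfl⟩ := Ideal.Quotient.mk_surjective r
  rw [← hl]
  have : phi0 K m n Y f = 0 := hr
  rw [this, map_zero]

lemma Lad.phi_range (h : Lad m n Y) (f : AddMonoidAlgebra K (LM m n)) : (∃ r, phi K h r = f) ↔ SuppIn f (Cone m n Y) := by
  constructor
  · rintro ⟨r, rfl⟩
    obtain ⟨f, rfl⟩ := Ideal.Quotient.mk_surjective r
    change SuppIn (phi0 K m n Y f) _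
    induction f using MvPolynomial.induction_on'' with
    | C a => 
      rw [← mul_one (MvPolynomial.C a), ← MvPolynomial.smul_eq_C_mul, map_smul, map_one]
      exact (SuppIn.one (by simp [Cone, box])).smul a
    | monomial_add s b f _ _ hf hm => rw [map_add]; exact hm.add hf
    | mul_X p y hp =>
      rw [map_mul]
      refine SuppIn.mul hp (J := Cone m n Y) ?_ ?_
      · rw [phi0, MvPolynomial.aeval_X]; exact SuppIn.single (h.edge_cone y.2)
      · intro a ha b hb i
        have := ha i; have := hb i
        rw [map_add]; simp at *; omega
  · intro hf
    rw [L_sum f]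
    change _ ∈ (phi K h).range
    apply Subring.sum_mem
    intro x hx
    obtain ⟨s, hs⟩ := h.ew_surj (hf x (Finsupp.mem_support_iff.1 hx))
    refine ⟨Ideal.Quotient.mk _ (MvPolynomial.monomial s (f.coeff x)), ?_⟩
    change phi0 K m n Y _ = _
    rw [show MvPolynomial.monomial s (f.coeff x) = f.coeff x • MvPolynomial.monomial s 1 by
      rw [MvPolynomial.smul_monomial]; simp]
    rw [map_smul, phi0_mon, hs]

lemma Lad.finY (h : Lad m n Y) : Finite Y := by
  refine Set.Finite.to_subtype (Set.Finite.subset ((Set.finite_Iic m).prod (Set.finite_Iic n)) ?_)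
  rintro ⟨i, j⟩ hij
  have := h.grid hij
  simp; omega

lemma Lad.noeth (h : Lad m n Y) : IsNoetherianRing (LadderRing K 2 Y) := by
  have := h.finY
  infer_instance

end

end

section

section
variable {m n : ℕ} {Y : Set (ℕ × ℕ)}

lemma wt_row {i j r : ℕ} (h : 1 ≤ i ∧ i ≤ m ∧ 1 ≤ j ∧ j ≤ n) (hr : 1 ≤ r) :
    wt m n (.row r) (edge m n (i, j)) = if i = r then 1 else 0 := by
  simp only [wt, AddMonoidHom.sub_apply, eA_edge h]
  split_ifs <;> omega
lemma wt_col {i j r : ℕ} (h : 1 ≤ i ∧ i ≤ m ∧ 1 ≤ j ∧ j ≤ n) (hr : 1 ≤ r) :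
    wt m n (.col r) (edge m n (i, j)) = if j = r then 1 else 0 := by
  simp only [wt, AddMonoidHom.sub_apply, eB_edge h]
  split_ifs <;> omega
lemma wt_up {i j c d : ℕ} (h : 1 ≤ i ∧ i ≤ m ∧ 1 ≤ j ∧ j ≤ n) :
    wt m n (.up c d) (edge m n (i, j)) = (if i ≤ c then 1 else 0) + (if j ≤ d then 1 else 0) - 1 := by
  simp only [wt, AddMonoidHom.sub_apply, AddMonoidHom.add_apply, eA_edge h, eB_edge h, h.2.1, if_true]
lemma wt_lo {i j c d : ℕ} (h : 1 ≤ i ∧ i ≤ m ∧ 1 ≤ j ∧ j ≤ n) (hc : 1 ≤ c) (hd : 1 ≤ d) :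
    wt m n (.lo c d) (edge m n (i, j)) = 1 - (if i < c then 1 else 0) - (if j < d then 1 else 0) := by
  simp only [wt, AddMonoidHom.sub_apply, eA_edge h, eB_edge h, h.2.1, if_true]
  split_ifs <;> omega

lemma Lad.two_col (h : Lad m n Y) {s : ℕ} (h1 : 1 ≤ s) (h2 : s ≤ n) (r : ℕ) : ∃ i, i ≠ r ∧ (i, s) ∈ Y := by
  have := h.hn
  rcases lt_or_eq_of_le h2 with h3 | h3
  · obtain ⟨i, i', hi, e1, e2, -, -⟩ := h.c2 s h1 h3
    by_cases hh : i = r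
    · exact ⟨i', by omega, e2⟩
    · exact ⟨i, hh, e1⟩
  · obtain ⟨i, i', hi, -, -, e1, e2⟩ := h.c2 (s-1) (by omega) (by omega)
    rw [show s - 1 + 1 = s by omega] at e1 e2
    by_cases hh : i = r
    · exact ⟨i', by omega, e2⟩
    · exact ⟨i, hh, e1⟩

lemma Lad.two_row (h : Lad m n Y) {s : ℕ} (h1 : 1 ≤ s) (h2 : s ≤ m) (r : ℕ) : ∃ i, i ≠ r ∧ (s, i) ∈ Y :=
  h.tr.two_col h1 h2 r

lemma Lad.up_ne (h : Lad m n Y) {c d : ℕ} (hu : IsUpperCorner Y (c, d)) {r : ℕ} (h1 : 1 ≤ r) (h2 : r ≤ c) :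
    ∃ j, d < j ∧ (r, j) ∈ Y := by
  have g := h.up_grid hu
  obtain ⟨j, hj⟩ := h.rows (i := r) h1 (by omega)
  rcases lt_or_ge d j with h3 | h3
  · exact ⟨j, h3, hj⟩
  · exact ⟨d+1, by omega, (h.sq hj hu.2.2.1 h2 (by simp only; omega)).1⟩

lemma Lad.up_sw (h : Lad m n Y) {c d : ℕ} (hu : IsUpperCorner Y (c, d)) {r : ℕ} (h1 : 1 ≤ r) (h2 : r ≤ d) :
    ∃ i, c < i ∧ (i, r) ∈ Y := h.tr.up_ne (up_tr.2 hu) h1 h2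

lemma Lad.lo_sw (h : Lad m n Y) {a b : ℕ} (hl : IsLowerCorner Y (a, b)) {r : ℕ} (h1 : a ≤ r) (h2 : r ≤ m) :
    ∃ j, j < b ∧ (r, j) ∈ Y := by
  have g := h.lo_grid hl
  obtain ⟨j, hj⟩ := h.rows (i := r) (by omega) (by omega)
  rcases lt_or_ge j b with h3 | h3
  · exact ⟨j, h3, hj⟩
  · exact ⟨b-1, by omega, (h.sq hl.2.2.1 hj h1 (by simp only; omega)).2⟩

lemma Lad.lo_ne (h : Lad m n Y) {a b : ℕ} (hl : IsLowerCorner Y (a, b)) {r : ℕ} (h1 : b ≤ r) (h2 : r ≤ n) :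
    ∃ i, i < a ∧ (i, r) ∈ Y := h.tr.lo_sw (lo_tr.2 hl) h1 h2

lemma Lad.one (h : Lad m n Y) {f : Fac} (hf : Val m n Y f) : ∃ i j, (i, j) ∈ Y ∧ wt m n f (edge m n (i, j)) = 1 := by
  cases f with
  | row r =>
    obtain ⟨j, hj⟩ := h.rows hf.1 hf.2
    exact ⟨r, j, hj, by rw [wt_row (h.grid hj) hf.1, if_pos rfl]⟩
  | col r =>
    obtain ⟨j, hj⟩ := h.cols hf.1 hf.2
    exact ⟨j, r, hj, by rw [wt_col (h.grid hj) hf.1, if_pos rfl]⟩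
  | up c d => exact ⟨c, d, hf.1, by rw [wt_up (h.grid hf.1)]; simp⟩
  | lo c d => 
    have := h.lo_grid hf
    exact ⟨c, d, hf.1, by rw [wt_lo (h.grid hf.1) (by omega) (by omega)]; simp⟩

lemma Lad.sep_row (h : Lad m n Y) {r : ℕ} {g : Fac} (hr1 : 1 ≤ r) (hr2 : r ≤ m) (hg : Val m n Y g) (hne : Fac.row r ≠ g) :
    ∃ i j, (i, j) ∈ Y ∧ wt m n (.row r) (edge m n (i, j)) = 0 ∧ wt m n g (edge m n (i, j)) = 1 := by
  cases g with
  | row s =>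
    obtain ⟨j, hj⟩ := h.rows hg.1 hg.2
    refine ⟨s, j, hj, ?_, ?_⟩
    · rw [wt_row (h.grid hj) hr1, if_neg]; rintro rfl; exact hne rfl
    · rw [wt_row (h.grid hj) hg.1, if_pos rfl]
  | col s =>
    obtain ⟨i, hi, hj⟩ := h.two_col hg.1 hg.2 r
    refine ⟨i, s, hj, ?_, ?_⟩
    · rw [wt_row (h.grid hj) hr1, if_neg hi]
    · rw [wt_col (h.grid hj) hg.1, if_pos rfl]
  | up c d =>
    have gg := h.up_grid hg
    obtain ⟨i, i', hi, e1, e2, e3, e4⟩ := h.c2 d (by omega) (by omega)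
    have := h.up_no hg e3; have := h.up_no hg e4
    by_cases hh : i = r
    · refine ⟨i', d, e2, ?_, ?_⟩
      · rw [wt_row (h.grid e2) hr1, if_neg (by omega)]
      · rw [wt_up (h.grid e2), if_pos (by omega), if_pos (by omega)]; rfl
    · refine ⟨i, d, e1, ?_, ?_⟩
      · rw [wt_row (h.grid e1) hr1, if_neg (by omega)]
      · rw [wt_up (h.grid e1), if_pos (by omega), if_pos (by omega)]; rfl
  | lo a b =>
    have gg := h.lo_grid hg
    obtain ⟨i, i', hi, e1, e2, e3, e4⟩ := h.c2 (b-1) (by omega) (by omega)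
    rw [show b - 1 + 1 = b by omega] at e3 e4
    have := h.lo_no hg e1; have := h.lo_no hg e2
    by_cases hh : i = r
    · refine ⟨i', b, e4, ?_, ?_⟩
      · rw [wt_row (h.grid e4) hr1, if_neg (by omega)]
      · rw [wt_lo (h.grid e4) (by omega) (by omega), if_neg (by omega), if_neg (by omega)]; rfl
    · refine ⟨i, b, e3, ?_, ?_⟩
      · rw [wt_row (h.grid e3) hr1, if_neg (by omega)]
      · rw [wt_lo (h.grid e3) (by omega) (by omega), if_neg (by omega), if_neg (by omega)]; rfl

lemma Lad.sep_col (h : Lad m n Y) {r : ℕ} {g : Fac} (hr1 : 1 ≤ r) (hr2 : r ≤ n) (hg : Val m n Y g) (hne : Fac.col r ≠ g) :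
    ∃ i j, (i, j) ∈ Y ∧ wt m n (.col r) (edge m n (i, j)) = 0 ∧ wt m n g (edge m n (i, j)) = 1 := by
  cases g with
  | col s =>
    obtain ⟨j, hj⟩ := h.cols hg.1 hg.2
    refine ⟨j, s, hj, ?_, ?_⟩
    · rw [wt_col (h.grid hj) hr1, if_neg]; rintro rfl; exact hne rfl
    · rw [wt_col (h.grid hj) hg.1, if_pos rfl]
  | row s =>
    obtain ⟨i, hi, hj⟩ := h.two_row hg.1 hg.2 r
    refine ⟨s, i, hj, ?_, ?_⟩
    · rw [wt_col (h.grid hj) hr1, if_neg hi]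
    · rw [wt_row (h.grid hj) hg.1, if_pos rfl]
  | up c d =>
    have gg := h.up_grid hg
    obtain ⟨i, i', hi, e1, e2, e3, e4⟩ := h.c1 c (by omega) (by omega)
    have := h.up_no hg e3; have := h.up_no hg e4
    by_cases hh : i = r
    · refine ⟨c, i', e2, ?_, ?_⟩
      · rw [wt_col (h.grid e2) hr1, if_neg (by omega)]
      · rw [wt_up (h.grid e2), if_pos (by omega), if_pos (by omega)]; rfl
    · refine ⟨c, i, e1, ?_, ?_⟩
      · rw [wt_col (h.grid e1) hr1, if_neg (by omega)]
      · rw [wt_up (h.grid e1), if_pos (by omega), if_pos (by omega)]; rfl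
  | lo a b =>
    have gg := h.lo_grid hg
    obtain ⟨i, i', hi, e1, e2, e3, e4⟩ := h.c1 (a-1) (by omega) (by omega)
    rw [show a - 1 + 1 = a by omega] at e3 e4
    have := h.lo_no hg e1; have := h.lo_no hg e2
    by_cases hh : i = r
    · refine ⟨a, i', e4, ?_, ?_⟩
      · rw [wt_col (h.grid e4) hr1, if_neg (by omega)]
      · rw [wt_lo (h.grid e4) (by omega) (by omega), if_neg (by omega), if_neg (by omega)]; rfl
    · refine ⟨a, i, e3, ?_, ?_⟩
      · rw [wt_col (h.grid e3) hr1, if_neg (by omega)]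
      · rw [wt_lo (h.grid e3) (by omega) (by omega), if_neg (by omega), if_neg (by omega)]; rfl

lemma Lad.sep_up (h : Lad m n Y) {c d : ℕ} {g : Fac} (hu : IsUpperCorner Y (c, d)) (hg : Val m n Y g) (hne : Fac.up c d ≠ g) :
    ∃ i j, (i, j) ∈ Y ∧ wt m n (.up c d) (edge m n (i, j)) = 0 ∧ wt m n g (edge m n (i, j)) = 1 := by
  have gu := h.up_grid hu
  cases g with
  | row r =>
    rcases lt_or_ge c r with h1 | h1
    · obtain ⟨j, hj⟩ := h.rows hg.1 hg.2
      have := h.up_no hu hj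
      refine ⟨r, j, hj, ?_, ?_⟩
      · rw [wt_up (h.grid hj), if_neg (by omega), if_pos (by omega)]; rfl
      · rw [wt_row (h.grid hj) hg.1, if_pos rfl]
    · obtain ⟨j, hjd, hj⟩ := h.up_ne hu hg.1 h1
      refine ⟨r, j, hj, ?_, ?_⟩
      · rw [wt_up (h.grid hj), if_pos (by omega), if_neg (by omega)]; rfl
      · rw [wt_row (h.grid hj) hg.1, if_pos rfl]
  | col r =>
    rcases lt_or_ge d r with h1 | h1
    · obtain ⟨j, hj⟩ := h.cols hg.1 hg.2
      have := h.up_no hu hj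
      refine ⟨j, r, hj, ?_, ?_⟩
      · rw [wt_up (h.grid hj), if_pos (by omega), if_neg (by omega)]; rfl
      · rw [wt_col (h.grid hj) hg.1, if_pos rfl]
    · obtain ⟨j, hjd, hj⟩ := h.up_sw hu hg.1 h1
      refine ⟨j, r, hj, ?_, ?_⟩
      · rw [wt_up (h.grid hj), if_neg (by omega), if_pos (by omega)]; rfl
      · rw [wt_col (h.grid hj) hg.1, if_pos rfl]
  | up c' d' =>
    have hne' : ¬ (c = c' ∧ d = d') := by rintro ⟨rfl, rfl⟩; exact hne rfl
    have a1 := h.up_no hu hg.1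
    have a2 := h.up_no hg hu.2.1
    have a3 := h.up_no hg hu.2.2.1
    simp only at a1 a2 a3
    refine ⟨c', d', hg.1, ?_, ?_⟩
    · rw [wt_up (h.grid hg.1)]; split_ifs <;> omega
    · rw [wt_up (h.grid hg.1)]; simp
  | lo a b =>
    have gg := h.lo_grid hg
    have := h.up_no hu hg.1
    by_cases hh : a ≤ c ∧ b ≤ d
    · refine ⟨c, d+1, hu.2.2.1, ?_, ?_⟩
      · rw [wt_up (h.grid hu.2.2.1)]; simp
      · rw [wt_lo (h.grid hu.2.2.1) (by omega) (by omega), if_neg (by omega), if_neg (by omega)]; rfl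
    · refine ⟨a, b, hg.1, ?_, ?_⟩
      · rw [wt_up (h.grid hg.1)]; split_ifs <;> omega
      · rw [wt_lo (h.grid hg.1) (by omega) (by omega)]; simp

lemma Lad.sep_lo (h : Lad m n Y) {a b : ℕ} {g : Fac} (hu : IsLowerCorner Y (a, b)) (hg : Val m n Y g) (hne : Fac.lo a b ≠ g) :
    ∃ i j, (i, j) ∈ Y ∧ wt m n (.lo a b) (edge m n (i, j)) = 0 ∧ wt m n g (edge m n (i, j)) = 1 := by
  have gu := h.lo_grid hu
  have w1 : ∀ {i j}, 1 ≤ i ∧ i ≤ m ∧ 1 ≤ j ∧ j ≤ n → _ := fun {i j} hh => wt_lo (m := m) (n := n) (i := i) (j := j) (c := a) (d := b) hh (by omega) (by omega)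
  cases g with
  | row r =>
    rcases lt_or_ge r a with h1 | h1
    · obtain ⟨j, hj⟩ := h.rows hg.1 hg.2
      have := h.lo_no hu hj
      refine ⟨r, j, hj, ?_, ?_⟩
      · rw [w1 (h.grid hj), if_pos (by omega), if_neg (by omega)]; rfl
      · rw [wt_row (h.grid hj) hg.1, if_pos rfl]
    · obtain ⟨j, hjd, hj⟩ := h.lo_sw hu h1 hg.2
      refine ⟨r, j, hj, ?_, ?_⟩
      · rw [w1 (h.grid hj), if_neg (by omega), if_pos (by omega)]; rfl
      · rw [wt_row (h.grid hj) hg.1, if_pos rfl]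
  | col r =>
    rcases lt_or_ge r b with h1 | h1
    · obtain ⟨j, hj⟩ := h.cols hg.1 hg.2
      have := h.lo_no hu hj
      refine ⟨j, r, hj, ?_, ?_⟩
      · rw [w1 (h.grid hj), if_neg (by omega), if_pos (by omega)]; rfl
      · rw [wt_col (h.grid hj) hg.1, if_pos rfl]
    · obtain ⟨j, hjd, hj⟩ := h.lo_ne hu h1 hg.2
      refine ⟨j, r, hj, ?_, ?_⟩
      · rw [w1 (h.grid hj), if_pos (by omega), if_neg (by omega)]; rfl
      · rw [wt_col (h.grid hj) hg.1, if_pos rfl]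
  | lo c' d' =>
    have gg := h.lo_grid hg
    have hne' : ¬ (a = c' ∧ b = d') := by rintro ⟨rfl, rfl⟩; exact hne rfl
    have a1 := h.lo_no hu hg.1
    have a2 := h.lo_no hg hu.2.1
    have a3 := h.lo_no hg hu.2.2.1
    simp only at a1 a2 a3
    refine ⟨c', d', hg.1, ?_, ?_⟩
    · rw [w1 (h.grid hg.1)]; split_ifs <;> omega
    · rw [wt_lo (h.grid hg.1) (by omega) (by omega)]; simp
  | up c d =>
    have gg := h.up_grid hg
    have := h.up_no hg hu.1
    have := h.lo_no hu hg.1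
    by_cases hh : a ≤ c ∧ b ≤ d
    · refine ⟨a, b-1, hu.2.2.1, ?_, ?_⟩
      · rw [w1 (h.grid hu.2.2.1), if_neg (by omega), if_pos (by omega)]; simp
      · rw [wt_up (h.grid hu.2.2.1), if_pos (by omega), if_pos (by omega)]; rfl
    · refine ⟨c, d, hg.1, ?_, ?_⟩
      · rw [w1 (h.grid hg.1)]; split_ifs <;> omega
      · rw [wt_up (h.grid hg.1)]; simp

lemma Lad.sep (h : Lad m n Y) {f g : Fac} (hf : Val m n Y f) (hg : Val m n Y g) (hne : f ≠ g) :
    ∃ i j, (i, j) ∈ Y ∧ wt m n f (edge m n (i, j)) = 0 ∧ wt m n g (edge m n (i, j)) = 1 := by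
  cases f with
  | row r => exact h.sep_row hf.1 hf.2 hg hne
  | col r => exact h.sep_col hf.1 hf.2 hg hne
  | up c d => exact h.sep_up hf hg hne
  | lo c d => exact h.sep_lo hf hg hne

/-- sum of positive test elements -/
lemma pos_sum {M ι : Type} [AddCommGroup M] [Finite ι] (w : ι → M →+ ℤ) (S : Set ι) (P : AddSubgroup M)
    (h : ∀ j ∈ S, ∃ u ∈ box w 0, u ∈ P ∧ 0 < w j u) : ∃ u ∈ box w 0, u ∈ P ∧ ∀ j ∈ S, 0 < w j u := by
  classical
  have := Fintype.ofFinite ι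
  have : ∀ j, ∃ u ∈ box w 0, u ∈ P ∧ (j ∈ S → 0 < w j u) := fun j => by
    by_cases hj : j ∈ S
    · obtain ⟨u, h1, h2, h3⟩ := h j hj; exact ⟨u, h1, h2, fun _ => h3⟩
    · exact ⟨0, by simp [box], P.zero_mem, fun h => absurd h hj⟩
  choose u h1 h2 h3 using this
  refine ⟨∑ j, u j, fun i => ?_, P.sum_mem fun j _ => h2 j, fun j hj => ?_⟩
  · rw [map_sum]; exact Finset.sum_nonneg fun j _ => h1 j i
  · rw [map_sum]; exact Finset.sum_pos' (fun i _ => h1 i j) ⟨j, Finset.mem_univ _, h3 j hj⟩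

theorem Lad.mr (K : Type) [Field K] (h : Lad m n Y) [Fact (Lad m n Y)] : MR K (LM m n) (LadderRing K 2 Y) (wY m n Y) where
  inj := h.phi_inj K
  range := h.phi_range K
  sh := by
    intro f c B
    have := h.finFct
    have := Fintype.ofFinite (Fct m n Y)
    obtain ⟨u, hu, hu0, hup⟩ := pos_sum (wY m n Y) {g | g ≠ f} (wY m n Y f).ker (fun g hg => by
      obtain ⟨i, j, hij, e1, e2⟩ := h.sep f.2 g.2 (fun he => hg (Subtype.ext he.symm))
      exact ⟨_, h.edge_cone hij, e1, by rw [wY, e2]; exact one_pos⟩)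
    obtain ⟨i, j, hij, e1⟩ := h.one f.2
    set v := edge m n (i, j)
    obtain ⟨N, hN⟩ : ∃ N : ℕ, ∀ g : Fct m n Y, B - c * wY m n Y g v ≤ N := by
      refine ⟨∑ g : Fct m n Y, (B - c * wY m n Y g v).toNat, fun g => ?_⟩
      have := Finset.single_le_sum (f := fun g : Fct m n Y => (B - c * wY m n Y g v).toNat) (fun _ _ => Nat.zero_le _) (Finset.mem_univ g)
      omega
    refine ⟨c • v + (N : ℤ) • u, ?_, fun g hg => ?_⟩
    · rw [map_add, map_zsmul, map_zsmul, show wY m n Y f u = 0 from hu0, show wY m n Y f v = 1 from e1]; simp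
    · rw [map_add, map_zsmul, map_zsmul, smul_eq_mul, smul_eq_mul]
      have h1 := hup g hg
      have h2 := hN g
      nlinarith

lemma bd_aux {X : Set (LM m n)} (F : ℕ → LM m n →+ ℤ) (l : ℕ) (d : ℤ) (h0 : ∀ x, F 0 x = 0) (hd : ∀ x ∈ X, F l x = d)
    (hb : ∀ i, 1 ≤ i → i ≤ l → ∃ b, ∀ x ∈ X, b ≤ F i x - F (i-1) x) :
    ∀ r, r ≤ l → ∃ b c, ∀ x ∈ X, b ≤ F r x ∧ F r x ≤ c := by
  have lo : ∀ r, r ≤ l → ∃ b, ∀ x ∈ X, b ≤ F r x := by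
    intro r
    induction r with
    | zero => intro _; exact ⟨0, fun x _ => (h0 x).ge⟩
    | succ r ih =>
      intro hr
      obtain ⟨b, hb1⟩ := ih (by omega)
      obtain ⟨b', hb'⟩ := hb (r+1) (by omega) hr
      exact ⟨b + b', fun x hx => by have := hb1 x hx; have := hb' x hx; simp at *; omega⟩
  have hi : ∀ k, k ≤ l → ∃ b, ∀ x ∈ X, F (l - k) x ≤ b := by
    intro r
    induction r with
    | zero => intro _; exact ⟨d, fun x hx => (hd x hx).le⟩
    | succ r ih =>
      intro hr
      obtain ⟨b, hb1⟩ := ih (by omega)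
      obtain ⟨b', hb'⟩ := hb (l - r) (by omega) (by omega)
      refine ⟨b - b', fun x hx => ?_⟩
      have := hb1 x hx; have := hb' x hx
      rw [show l - (r+1) = l - r - 1 by omega]; omega
  intro r hr
  obtain ⟨b, h1⟩ := lo r hr
  obtain ⟨c, h2⟩ := hi (l - r) (by omega)
  rw [show l - (l - r) = r by omega] at h2
  exact ⟨b, c, fun x hx => ⟨h1 x hx, h2 x hx⟩⟩

lemma Lad.gd (h : Lad m n Y) : Gd (wY m n Y) (eA m n m) where
  nonneg := fun q hq => (cone_A (Y := Y) hq m).1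
  zero := fun q hq h0 => cone_zero (Y := Y) hq h0
  fin := by
    intro a d
    set X := {x | x ∈ box (wY m n Y) a ∧ eA m n m x = d} with hX
    have hA := bd_aux (X := X) (eA m n) m d eA_zero (fun x hx => hx.2) (fun i h1 h2 => ⟨a ⟨.row i, h1, h2⟩, fun x hx => hx.1 ⟨.row i, h1, h2⟩⟩)
    have hB := bd_aux (X := X) (eB m n) n d eB_zero (fun x hx => by rw [eAB]; exact hx.2) (fun i h1 h2 => ⟨a ⟨.col i, h1, h2⟩, fun x hx => hx.1 ⟨.col i, h1, h2⟩⟩)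
    choose! b c hbc using hA
    choose! b' c' hbc' using hB
    let f : LM m n → ((Fin (m+1) → ℤ) × (Fin (n+1) → ℤ)) := fun x => (fun i => eA m n i x, fun i => eB m n i x)
    refine Set.Finite.of_injOn (f := f) (t := Set.Icc (fun i : Fin (m+1) => b i) (fun i => c i) ×ˢ Set.Icc (fun i : Fin (n+1) => b' i) (fun i => c' i)) ?_ ?_ ((Set.finite_Icc _ _).prod (Set.finite_Icc _ _))
    · intro x hx
      refine ⟨⟨fun i => (hbc i (by omega) x hx).1, fun i => (hbc i (by omega) x hx).2⟩, ⟨fun i => (hbc' i (by omega) x hx).1, fun i => (hbc' i (by omega) x hx).2⟩⟩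
    · intro x _ y _ hxy
      have h1 := congrArg Prod.fst hxy
      have h2 := congrArg Prod.snd hxy
      exact lm_ext (fun r hr => congrFun h1 ⟨r, by omega⟩) (fun r hr => congrFun h2 ⟨r, by omega⟩)

end

end

section

section
variable {m n m' n' : ℕ} {Y Z : Set (ℕ × ℕ)} (K : Type) [Field K]

/-- the monomial module attached to `a` is semidualizing -/
def Sd (h : Lad m n Y) (a : Fac → ℤ) : Prop :=
  haveI : Fact (Lad m n Y) := ⟨h⟩
  SD (LadderRing K 2 Y) (Mon K (LadderRing K 2 Y) (box (wY m n Y) fun f => a f.1))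

/-- the monomial module attached to `a` has finite injective dimension -/
def Fi (h : Lad m n Y) (a : Fac → ℤ) : Prop :=
  haveI : Fact (Lad m n Y) := ⟨h⟩
  FID (LadderRing K 2 Y) (Mon K (LadderRing K 2 Y) (box (wY m n Y) fun f => a f.1))

/-- homomorphisms into the lattice -/
def lmk {M : Type} [AddCommGroup M] (FA FB : ℕ → M →+ ℤ) (h : ∀ x, FA 0 x = 0 ∧ FB 0 x = 0 ∧ (∀ r ≥ m, FA r x = FA m x) ∧
    (∀ s ≥ n, FB s x = FB n x) ∧ FA m x = FB n x) : M →+ LM m n where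
  toFun x := ⟨(fun r => FA r x, fun s => FB s x), h x⟩
  map_zero' := by apply Subtype.ext; apply Prod.ext <;> funext r <;> exact map_zero _
  map_add' x y := by apply Subtype.ext; apply Prod.ext <;> funext r <;> exact map_add _ _ _

section
variable {M : Type} [AddCommGroup M] (FA FB : ℕ → M →+ ℤ) (h : ∀ x, FA 0 x = 0 ∧ FB 0 x = 0 ∧ (∀ r ≥ m, FA r x = FA m x) ∧
    (∀ s ≥ n, FB s x = FB n x) ∧ FA m x = FB n x)
lemma eA_lmk (r : ℕ) (x : M) : eA m n r (lmk FA FB h x) = FA r x := rfl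
lemma eB_lmk (r : ℕ) (x : M) : eB m n r (lmk FA FB h x) = FB r x := rfl
end

lemma Lad.piece (h : Lad m n Y) (h' : Lad m' n' Z) (π : LM m n →+ LM m' n') (sec : LM m' n' →+ LM m n)
    (hs : ∀ x, π (sec x) = x) (τ : Fac → Fac) (hτ : ∀ f, Val m' n' Z f → Val m n Y (τ f))
    (hw : ∀ f, Val m' n' Z f → ∀ x, wt m' n' f (π x) = wt m n (τ f) x)
    (hx : ∀ g, Val m n Y g → (∀ f, Val m' n' Z f → τ f ≠ g) → ∃ p, p ∈ Y ∧ π (edge m n p) = 0 ∧ 0 < wt m n g (edge m n p))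
    (a : Fac → ℤ) : (Sd K h a → Sd K h' (a ∘ τ)) ∧ (Fi K h a → Fi K h' (a ∘ τ)) := by
  haveI i1 : Fact (Lad m n Y) := ⟨h⟩
  haveI i2 : Fact (Lad m' n' Z) := ⟨h'⟩
  haveI := h.noeth K
  haveI := h'.noeth K
  haveI := h.finFct
  haveI := h'.finFct
  haveI : IsDomain (AddMonoidAlgebra K (LM m n)) := dom_L _ _
  haveI : IsDomain (AddMonoidAlgebra K (LM m' n')) := dom_L _ _
  obtain ⟨u, hu, hu0, hup⟩ := pos_sum (wY m n Y) {g | ∀ f, Val m' n' Z f → τ f ≠ g.1} π.ker (fun g hg => by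
    obtain ⟨p, hp, h1, h2⟩ := hx g.1 g.2 hg
    exact ⟨_, h.edge_cone hp, h1, h2⟩)
  exact MR.piece (h.mr K) (h'.mr K) π sec hs (fun f => ⟨τ f.1, hτ f.1 f.2⟩) (fun i x => hw i.1 i.2 x) u hu0
    (fun g hg => hup g (fun f hf he => hg ⟨f, hf⟩ (Subtype.ext he))) (fun f => a f.1)

/-- transposition of facets -/
def tT : Fac → Fac
  | .row i => .col i
  | .col i => .row i
  | .up c d => .up d c
  | .lo c d => .lo d c

/-- transposition -/
def piT (m n : ℕ) : LM m n →+ LM n m := lmk (eB m n) (eA m n)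
  (fun x => ⟨eB_zero x, eA_zero x, fun _ hr => eB_ge' x hr, fun _ hr => eA_ge x hr, eAB x⟩)

lemma tT_val {f : Fac} (hf : Val n m (tr Y) f) : Val m n Y (tT f) := by
  cases f with
  | row i => exact hf
  | col i => exact hf
  | up c d => exact up_tr.1 hf
  | lo c d => exact lo_tr.1 hf

lemma tT_tT (f : Fac) : tT (tT f) = f := by cases f <;> rfl

lemma tr_tr : tr (tr Y) = Y := rfl

lemma tT_val' {f : Fac} (hf : Val m n Y f) : Val n m (tr Y) (tT f) := tT_val (Y := tr Y) hf

lemma Lad.pieceT (h : Lad m n Y) (a : Fac → ℤ) : (Sd K h a → Sd K h.tr (a ∘ tT)) ∧ (Fi K h a → Fi K h.tr (a ∘ tT)) := by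
  refine h.piece K h.tr (piT m n) (piT n m) (fun x => rfl) tT (fun f hf => tT_val hf) ?_ ?_ a
  · intro f hf x
    have := eAB x
    cases f <;> simp only [wt, tT, AddMonoidHom.sub_apply, AddMonoidHom.add_apply, piT, eA_lmk, eB_lmk] <;> omega
  · intro g hg hn
    exact absurd (tT_tT g) (hn _ (tT_val' hg))

/-- rotation of facets -/
def tR (m n : ℕ) : Fac → Fac
  | .row i => .row (m + 1 - i)
  | .col i => .col (n + 1 - i)
  | .up c d => .lo (m + 1 - c) (n + 1 - d)
  | .lo c d => .up (m + 1 - c) (n + 1 - d)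

/-- rotation -/
def piR (m n : ℕ) : LM m n →+ LM m n := lmk (fun r => eA m n m - eA m n (m - r)) (fun r => eA m n m - eB m n (n - r))
  (fun x => by
    have h1 := eA_zero x
    have h2 := eB_zero x
    have h3 := eAB x
    refine ⟨?_, ?_, fun r hr => ?_, fun r hr => ?_, ?_⟩
    · simp
    · simp [h3]
    · simp [Nat.sub_eq_zero_of_le hr]
    · simp [Nat.sub_eq_zero_of_le hr]
    · simp [h1, h2])

lemma Lad.tR_val (h : Lad m n Y) {f : Fac} (hf : Val m n (LadderDet.rot m n Y) f) : Val m n Y (tR m n f) := by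
  cases f with
  | row i => simp only [Val, tR] at *; omega
  | col i => simp only [Val, tR] at *; omega
  | up c d => exact (h.rot_up.1 hf).2
  | lo c d => exact (h.rot_lo.1 hf).2

lemma Lad.val_grid (h : Lad m n Y) {f : Fac} (hf : Val m n Y f) : tR m n (tR m n f) = f := by
  cases f with
  | row i => simp only [Val, tR] at *; congr 1; omega
  | col i => simp only [Val, tR] at *; congr 1; omega
  | up c d => have := h.up_grid hf; simp only [tR]; congr 1 <;> omega
  | lo c d => have := h.lo_grid hf; simp only [tR]; congr 1 <;> omega

lemma Lad.tR_val' (h : Lad m n Y) {f : Fac} (hf : Val m n Y f) : Val m n (LadderDet.rot m n Y) (tR m n f) := by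
  apply h.rot.tR_val
  rwa [h.rot_rot]

lemma Lad.pieceR (h : Lad m n Y) (a : Fac → ℤ) : (Sd K h a → Sd K h.rot (a ∘ tR m n)) ∧ (Fi K h a → Fi K h.rot (a ∘ tR m n)) := by
  refine h.piece K h.rot (piR m n) (piR m n) (fun x => ?_) (tR m n) (fun f hf => h.tR_val hf) ?_ ?_ a
  · apply lm_ext
    · intro r hr
      have := eA_zero x
      simp only [piR, eA_lmk, AddMonoidHom.sub_apply, Nat.sub_self, show m - (m - r) = r by omega]
      omega
    · intro r hr
      have := eA_zero x
      simp only [piR, eA_lmk, eB_lmk, AddMonoidHom.sub_apply, Nat.sub_self, show n - (n - r) = r by omega]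
      omega
  · intro f hf x
    have := eA_zero x
    cases f with
    | row i =>
      simp only [Val] at hf
      simp only [wt, tR, AddMonoidHom.sub_apply, piR, eA_lmk, show m + 1 - i - 1 = m - i by omega, show m - (i - 1) = m + 1 - i by omega]; omega
    | col i =>
      simp only [Val] at hf
      simp only [wt, tR, AddMonoidHom.sub_apply, piR, eB_lmk, show n + 1 - i - 1 = n - i by omega, show n - (i - 1) = n + 1 - i by omega]; omega
    | up c d =>
      have := h.rot.up_grid hf
      simp only [wt, tR, AddMonoidHom.sub_apply, AddMonoidHom.add_apply, piR, eA_lmk, eB_lmk, show m + 1 - c - 1 = m - c by omega, show n + 1 - d - 1 = n - d by omega, Nat.sub_self]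
      omega
    | lo c d =>
      have := h.rot.lo_grid hf
      simp only [wt, tR, AddMonoidHom.sub_apply, AddMonoidHom.add_apply, piR, eA_lmk, eB_lmk, show m - (c - 1) = m + 1 - c by omega, show n - (d - 1) = n + 1 - d by omega, Nat.sub_self]
      omega
  · intro g hg hn
    exact absurd (h.val_grid hg) (hn _ (h.tR_val' hg))

/-- SW part at an upper corner -/
def swZ (Y : Set (ℕ × ℕ)) (c d : ℕ) : Set (ℕ × ℕ) := {p | 1 ≤ p.1 ∧ p.2 ≤ d ∧ (p.1 + (c - 1), p.2) ∈ Y}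

/-- facets of the SW part -/
def tS (c d : ℕ) : Fac → Fac
  | .row i => if i = 1 then .up c d else .row (i + (c - 1))
  | .col i => .col i
  | .up p q => .up (p + (c - 1)) q
  | .lo p q => .lo (p + (c - 1)) q

lemma mem_sw {c d i j : ℕ} : (i, j) ∈ swZ Y c d ↔ 1 ≤ i ∧ j ≤ d ∧ (i + (c - 1), j) ∈ Y := Iff.rfl

lemma Lad.swL (h : Lad m n Y) {c d : ℕ} (hu : IsUpperCorner Y (c, d)) : Lad (m + 1 - c) d (swZ Y c d) := by
  have g := h.up_grid hu
  refine ⟨by omega, by omega, ⟨⟨?_, ?_⟩, ?_, ?_, ?_, ?_⟩, ?_, ?_⟩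
  · rintro ⟨i, j⟩ ⟨h1, h2, h3⟩
    have := h.grid h3
    simp only [InGrid] at *
    omega
  · rintro i j p q ⟨h1, h2, h3⟩ ⟨k1, k2, k3⟩ l1 l2
    simp only at *
    have := h.sq h3 k3 (by omega) l2
    exact ⟨⟨h1, k2, this.1⟩, ⟨k1, h2, this.2⟩⟩
  · exact ⟨le_rfl, le_rfl, mem_cast hu.1 (by simp only; omega) rfl⟩
  · exact ⟨by simp only; omega, by simp only; omega, mem_cast h.sw (by simp only; omega) rfl⟩
  · intro i h1 h2
    rcases Nat.lt_or_ge 1 i with h3 | h3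
    · obtain ⟨j, hj⟩ := h.rows (i := i + (c - 1)) (by omega) (by omega)
      exact ⟨j, h1, by have := h.up_no hu hj; simp only; omega, hj⟩
    · exact ⟨d, h1, le_rfl, mem_cast hu.1 (by simp only; omega) rfl⟩
  · intro j h1 h2
    obtain ⟨i, hi, hij⟩ := h.up_sw hu h1 h2
    exact ⟨i - (c - 1), by simp only; omega, h2, mem_cast hij (by simp only; omega) rfl⟩
  · intro i h1 h2
    obtain ⟨j, j', h0, e1, e2, e3, e4⟩ := h.c1 (i + (c - 1)) (by omega) (by omega)
    have := h.up_no hu e4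
    exact ⟨j, j', h0, ⟨h1, by simp only; omega, e1⟩, ⟨h1, by simp only; omega, e2⟩,
      ⟨by simp only; omega, by simp only; omega, mem_cast e3 (by simp only; omega) rfl⟩,
      ⟨by simp only; omega, by simp only; omega, mem_cast e4 (by simp only; omega) rfl⟩⟩
  · intro j h1 h2
    obtain ⟨i, i', h0, e1, e2, e3, e4⟩ := h.c2 j (by omega) (by omega)
    rcases Nat.lt_or_ge i c with hc | hc
    · have key : ∀ i', i' = 1 ∨ i' = 2 → ∀ j', (i, j') ∈ Y → j' ≤ d → (i', j') ∈ swZ Y c d := by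
        rintro i' (rfl | rfl) j' e hj'
        · exact ⟨le_rfl, hj', mem_cast (h.sq e hu.1 hc.le hj').2 (by omega) rfl⟩
        · exact ⟨by simp, hj', mem_cast (h.sq e hu.2.1 (by simp only; omega) hj').2 (by simp only; omega) rfl⟩
      exact ⟨1, 2, by omega, key _ (by simp) _ e1 (by omega), key _ (by simp) _ e1 (by omega), key _ (by simp) _ e3 (by omega), key _ (by simp) _ e3 (by omega)⟩
    · have key : ∀ i' j', c ≤ i' → (i', j') ∈ Y → j' ≤ d → (i' - (c - 1), j') ∈ swZ Y c d :=
        fun i' j' hi e hj => ⟨by simp only; omega, hj, mem_cast e (by simp only; omega) rfl⟩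
      exact ⟨i - (c - 1), i' - (c - 1), by omega, key _ _ (by omega) e1 (by omega), key _ _ (by omega) e2 (by omega),
        key _ _ (by omega) e3 (by omega), key _ _ (by omega) e4 (by omega)⟩

end

end

section

section
variable {m n m' n' : ℕ} {Y Z : Set (ℕ × ℕ)} (K : Type) [Field K]

lemma Lad.sw_up (h : Lad m n Y) {c d p q : ℕ} (hu : IsUpperCorner Y (c, d)) :
    IsUpperCorner (swZ Y c d) (p, q) ↔ 1 ≤ p ∧ q < d ∧ IsUpperCorner Y (p + (c - 1), q) := by
  have e : p + 1 + (c - 1) = p + (c - 1) + 1 := by omega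
  simp only [IsUpperCorner, mem_sw, e]
  constructor
  · rintro ⟨⟨h1, h2, h3⟩, ⟨k1, k2, k3⟩, ⟨l1, l2, l3⟩, h4⟩
    exact ⟨h1, l2, h3, k3, l3, fun h' => h4 ⟨by omega, l2, h'⟩⟩
  · rintro ⟨h1, h2, h3, h4, h5, h6⟩
    exact ⟨⟨h1, h2.le, h3⟩, ⟨by omega, h2.le, h4⟩, ⟨h1, h2, h5⟩, fun h' => h6 h'.2.2⟩

lemma Lad.sw_lo (h : Lad m n Y) {c d p q : ℕ} (hu : IsUpperCorner Y (c, d)) :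
    IsLowerCorner (swZ Y c d) (p, q) ↔ 2 ≤ p ∧ IsLowerCorner Y (p + (c - 1), q) := by
  have g := h.up_grid hu
  constructor
  · intro hl
    have g2 := (h.swL hu).lo_grid hl
    obtain ⟨⟨h1, h2, h3⟩, ⟨k1, k2, k3⟩, ⟨l1, l2, l3⟩, h4⟩ := hl
    simp only at *
    refine ⟨by omega, h3, mem_cast k3 (by omega) rfl, l3, fun h' => h4 ⟨k1, l2, mem_cast h' (by simp only; omega) rfl⟩⟩
  · rintro ⟨h1, hl⟩
    obtain ⟨h3, h4, h5, h6⟩ := hl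
    have := h.up_no hu h3
    simp only at *
    refine ⟨⟨by simp only; omega, by simp only; omega, h3⟩, ⟨by simp only; omega, by simp only; omega, mem_cast h4 (by simp only; omega) rfl⟩,
      ⟨by simp only; omega, by simp only; omega, h5⟩, fun h' => h6 (mem_cast h'.2.2 (by simp only; omega) rfl)⟩

lemma Lad.up_up (h : Lad m n Y) {c d p q : ℕ} (hu : IsUpperCorner Y (c, d)) (hv : IsUpperCorner Y (p, q)) :
    (c < p ∧ q < d) ∨ (p < c ∧ d < q) ∨ (c = p ∧ d = q) := by
  have a1 := h.up_no hu hv.2.1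
  have a2 := h.up_no hu hv.2.2.1
  have a3 := h.up_no hv hu.2.1
  have a4 := h.up_no hv hu.2.2.1
  simp only at *
  omega

lemma Lad.lo_lo (h : Lad m n Y) {c d p q : ℕ} (hu : IsLowerCorner Y (c, d)) (hv : IsLowerCorner Y (p, q)) :
    (c < p ∧ q < d) ∨ (p < c ∧ d < q) ∨ (c = p ∧ d = q) := by
  have a1 := h.lo_no hu hv.2.1
  have a2 := h.lo_no hu hv.2.2.1
  have a3 := h.lo_no hv hu.2.1
  have a4 := h.lo_no hv hu.2.2.1
  have := h.lo_grid hu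
  have := h.lo_grid hv
  simp only at *
  omega

lemma Lad.tS_val (h : Lad m n Y) {c d : ℕ} (hu : IsUpperCorner Y (c, d)) {f : Fac} (hf : Val (m + 1 - c) d (swZ Y c d) f) :
    Val m n Y (tS c d f) := by
  have g := h.up_grid hu
  cases f with
  | row i =>
    simp only [Val, tS] at *
    split_ifs with h1
    · exact hu
    · simp only; omega
  | col i => simp only [Val, tS] at *; omega
  | up p q => exact ((h.sw_up hu).1 hf).2.2
  | lo p q => exact ((h.sw_lo hu).1 hf).2

/-- projection to the SW part -/
def piS (m n c d : ℕ) (hc : 1 ≤ c ∧ c < m ∧ d < n) : LM m n →+ LM (m + 1 - c) d :=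
  lmk (fun r => if r = 0 then 0 else eA m n (r + (c - 1)) + eB m n d - eA m n m) (fun s => eB m n (min s d))
  (fun x => by
    have h2 := eB_zero x
    refine ⟨by simp, by simpa using h2, fun r hr => ?_, fun r hr => by simp [hr], ?_⟩
    · rw [if_neg (by omega), if_neg (by omega), show m + 1 - c + (c - 1) = m by omega]
      simp [eA_ge x (show m ≤ r + (c - 1) by omega)]
    · rw [if_neg (by omega), show m + 1 - c + (c - 1) = m by omega]
      simp)

/-- section for the SW part -/
def scS (m n c d : ℕ) (hc : 1 ≤ c ∧ c < m ∧ d < n) : LM (m + 1 - c) d →+ LM m n :=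
  lmk (fun r => if r < c then 0 else eA (m + 1 - c) d (r - (c - 1))) (fun s => eB (m + 1 - c) d s)
  (fun x => by
    refine ⟨by simp [show 0 < c by omega], eB_zero x, fun r hr => ?_, fun r hr => ?_, ?_⟩
    · rw [if_neg (by omega), if_neg (by omega), show m - (c - 1) = m + 1 - c by omega]
      exact eA_ge x (by omega)
    · rw [eB_ge x (by omega), eB_ge x (by omega)]
    · rw [if_neg (by omega), eB_ge x (by omega), show m - (c - 1) = m + 1 - c by omega])

lemma Lad.pieceS (h : Lad m n Y) {c d : ℕ} (hu : IsUpperCorner Y (c, d)) (a : Fac → ℤ) :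
    (Sd K h a → Sd K (h.swL hu) (a ∘ tS c d)) ∧ (Fi K h a → Fi K (h.swL hu) (a ∘ tS c d)) := by
  have g := h.up_grid hu
  have hc : 1 ≤ c ∧ c < m ∧ d < n := by omega
  refine h.piece K (h.swL hu) (piS m n c d hc) (scS m n c d hc) (fun x => ?_) (tS c d) (fun f hf => h.tS_val hu hf) ?_ ?_ a
  · apply lm_ext
    · intro r hr
      simp only [piS, eA_lmk]
      split_ifs with h0
      · rw [h0, eA_zero]; rfl
      · simp only [AddMonoidHom.sub_apply, AddMonoidHom.add_apply, scS, eA_lmk, eB_lmk]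
        rw [if_neg (by omega), if_neg (by omega), eB_ge x le_rfl, show m - (c - 1) = m + 1 - c by omega, show r + (c - 1) - (c - 1) = r by omega]
        ring
    · intro r hr
      simp only [piS, eB_lmk, scS]
      rw [min_eq_left hr]
  · intro f hf x
    have e0 := eB_zero x
    cases f with
    | row i =>
      simp only [Val] at hf
      simp only [wt, tS, AddMonoidHom.sub_apply, piS, eA_lmk]
      rw [if_neg (by omega)]
      split_ifs with h1 h2 h2
      · simp [wt, h2, show 1 + (c - 1) = c by omega]
      · omega
      · omega
      · simp only [wt, AddMonoidHom.sub_apply, AddMonoidHom.add_apply, show i + (c - 1) - 1 = i - 1 + (c - 1) by omega]; omega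
    | col i =>
      simp only [Val] at hf
      simp only [wt, tS, AddMonoidHom.sub_apply, piS, eB_lmk, min_eq_left hf.2, min_eq_left (show i - 1 ≤ d by omega)]
    | up p q =>
      have := (h.swL hu).up_grid hf
      simp only [wt, tS, AddMonoidHom.sub_apply, AddMonoidHom.add_apply, piS, eB_lmk, eA_lmk]
      rw [if_neg (by omega), if_neg (by omega), min_eq_left (by omega), show m + 1 - c + (c - 1) = m by omega]
      simp only [AddMonoidHom.sub_apply, AddMonoidHom.add_apply]
      omega
    | lo p q =>
      have := (h.swL hu).lo_grid hf
      simp only [wt, tS, AddMonoidHom.sub_apply, AddMonoidHom.add_apply, piS, eB_lmk, eA_lmk]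
      rw [if_neg (by omega), if_neg (by omega), min_eq_left (by omega), show m + 1 - c + (c - 1) = m by omega,
        show p + (c - 1) - 1 = p - 1 + (c - 1) by omega]
      simp only [AddMonoidHom.sub_apply, AddMonoidHom.add_apply]
      omega
  · intro f hf hn
    have ker : ∀ i j, (i, j) ∈ Y → i ≤ c → d < j → piS m n c d hc (edge m n (i, j)) = 0 := by
      intro i j hij h1 h2
      have g' := h.grid hij
      apply lm_ext
      · intro r hr
        simp only [piS, eA_lmk, map_zero]
        split_ifs with h0
        · rfl
        · simp only [AddMonoidHom.sub_apply, AddMonoidHom.add_apply, eA_edge g', eB_edge g']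
          rw [if_pos (by omega), if_neg (by omega), if_pos (by omega)]; rfl
      · intro r hr
        simp only [piS, eB_lmk, map_zero, eB_edge g']
        rw [if_neg (by omega)]
    cases f with
    | row i =>
      simp only [Val] at hf
      have : i ≤ c := by
        by_contra hic
        refine hn (.row (i - (c - 1))) (by simp only [Val]; omega) ?_
        simp only [tS]; rw [if_neg (by omega)]; congr 1; omega
      obtain ⟨j, hj, hij⟩ := h.up_ne hu hf.1 this
      exact ⟨(i, j), hij, ker i j hij this hj, by rw [wt_row (h.grid hij) hf.1, if_pos rfl]; exact one_pos⟩
    | col j =>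
      simp only [Val] at hf
      have : d < j := by
        by_contra hic
        exact hn (.col j) (by simp only [Val]; omega) rfl
      obtain ⟨i, hij⟩ := h.cols hf.1 hf.2
      exact ⟨(i, j), hij, ker i j hij (by have := h.up_no hu hij; omega) this, by rw [wt_col (h.grid hij) hf.1, if_pos rfl]; exact one_pos⟩
    | up p q =>
      rcases h.up_up hu hf with ⟨h1, h2⟩ | ⟨h1, h2⟩ | ⟨rfl, rfl⟩
      · refine absurd ?_ (hn (.up (p - (c - 1)) q) ((h.sw_up hu).2 ⟨by omega, h2, ?_⟩))
        · simp only [tS]; congr 1; omega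
        · rw [show p - (c - 1) + (c - 1) = p by omega]; exact hf
      · exact ⟨(p, q), hf.1, ker p q hf.1 h1.le h2, by rw [wt_up (h.grid hf.1)]; simp⟩
      · exact absurd (by simp [tS]) (hn (.row 1) (by simp only [Val]; omega))
    | lo p q =>
      have g3 := h.lo_grid hf
      have : p ≤ c := by
        by_contra hic
        refine hn (.lo (p - (c - 1)) q) ((h.sw_lo hu).2 ⟨by omega, ?_⟩) ?_
        · rw [show p - (c - 1) + (c - 1) = p by omega]; exact hf
        · simp only [tS]; congr 1; omega
      rcases Nat.lt_or_ge d q with hq | hq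
      · exact ⟨(p, q), hf.1, ker p q hf.1 this hq, by rw [wt_lo (h.grid hf.1) (by omega) (by omega)]; simp⟩
      · refine ⟨(c, d + 1), hu.2.2.1, ker _ _ hu.2.2.1 le_rfl (by omega), ?_⟩
        rw [wt_lo (h.grid hu.2.2.1) (by omega) (by omega), if_neg (by omega), if_neg (by omega)]; simp

/-- number of corners -/
noncomputable def cnt (Y : Set (ℕ × ℕ)) : ℕ := {p | IsLowerCorner Y p}.ncard + {p | IsUpperCorner Y p}.ncard

/-- no coincident corners -/
def NC (Y : Set (ℕ × ℕ)) : Prop := ∀ p, ¬ (IsLowerCorner Y p ∧ IsUpperCorner Y p)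

lemma Lad.fin_lo (h : Lad m n Y) : {p | IsLowerCorner Y p}.Finite :=
  (Set.finite_coe_iff.1 h.finY).subset fun _ hp => hp.1
lemma Lad.fin_up (h : Lad m n Y) : {p | IsUpperCorner Y p}.Finite :=
  (Set.finite_coe_iff.1 h.finY).subset fun _ hp => hp.1

lemma Lad.sw_cnt (h : Lad m n Y) {c d : ℕ} (hu : IsUpperCorner Y (c, d)) : cnt (swZ Y c d) < cnt Y := by
  have inj : ∀ S : Set (ℕ × ℕ), Set.InjOn (fun p : ℕ × ℕ => (p.1 + (c - 1), p.2)) S := by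
    rintro S ⟨a, b⟩ _ ⟨a', b'⟩ _ he
    simp only [Prod.mk.injEq] at he ⊢
    omega
  have h1 : {p | IsLowerCorner (swZ Y c d) p}.ncard ≤ {p | IsLowerCorner Y p}.ncard :=
    Set.ncard_le_ncard_of_injOn (fun p => (p.1 + (c - 1), p.2)) (fun p hp => ((h.sw_lo hu).1 hp).2) (inj _) h.fin_lo
  have h2 : {p | IsUpperCorner (swZ Y c d) p}.ncard ≤ ({p | IsUpperCorner Y p} \ {(c, d)}).ncard :=
    Set.ncard_le_ncard_of_injOn (fun p => (p.1 + (c - 1), p.2)) (fun p hp => by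
      have := (h.sw_up hu).1 hp
      refine ⟨this.2.2, fun he => ?_⟩
      simp only [Set.mem_singleton_iff, Prod.mk.injEq] at he
      omega) (inj _) (h.fin_up.subset Set.sdiff_subset)
  have h3 : ({p | IsUpperCorner Y p} \ {(c, d)}).ncard < {p | IsUpperCorner Y p}.ncard :=
    Set.ncard_sdiff_singleton_lt_of_mem hu h.fin_up
  simp only [cnt]
  omega

lemma Lad.sw_nc (h : Lad m n Y) {c d : ℕ} (hu : IsUpperCorner Y (c, d)) (hn : NC Y) : NC (swZ Y c d) := by
  rintro ⟨p, q⟩ ⟨h1, h2⟩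
  exact hn _ ⟨((h.sw_lo hu).1 h1).2, ((h.sw_up hu).1 h2).2.2⟩

lemma tr_nc (hn : NC Y) : NC (tr Y) := fun ⟨p, q⟩ ⟨h1, h2⟩ => hn (q, p) ⟨lo_tr.1 h1, up_tr.1 h2⟩
lemma Lad.rot_nc (h : Lad m n Y) (hn : NC Y) : NC (LadderDet.rot m n Y) :=
  fun ⟨p, q⟩ ⟨h1, h2⟩ => hn _ ⟨(h.rot_up.1 h2).2, (h.rot_lo.1 h1).2⟩

lemma Lad.tr_cnt_le (h : Lad m n Y) : cnt (LadderDet.tr Y) ≤ cnt Y := by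
  have h1 : {p | IsLowerCorner (LadderDet.tr Y) p}.ncard ≤ {p | IsLowerCorner Y p}.ncard :=
    Set.ncard_le_ncard_of_injOn Prod.swap (fun p hp => lo_tr.1 hp) Prod.swap_injective.injOn h.fin_lo
  have h2 : {p | IsUpperCorner (LadderDet.tr Y) p}.ncard ≤ {p | IsUpperCorner Y p}.ncard :=
    Set.ncard_le_ncard_of_injOn Prod.swap (fun p hp => up_tr.1 hp) Prod.swap_injective.injOn h.fin_up
  simp only [cnt]; omega

lemma Lad.rot_cnt_le (h : Lad m n Y) : cnt (LadderDet.rot m n Y) ≤ cnt Y := by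
  have inj : Set.InjOn (fun p : ℕ × ℕ => (m + 1 - p.1, n + 1 - p.2)) (LadderDet.rot m n Y) := by
    rintro ⟨a, b⟩ h1 ⟨a', b'⟩ h2 he
    have := h.rot.grid h1
    have := h.rot.grid h2
    simp only [Prod.mk.injEq] at he ⊢
    omega
  have h1 : {p | IsLowerCorner (LadderDet.rot m n Y) p}.ncard ≤ {p | IsUpperCorner Y p}.ncard :=
    Set.ncard_le_ncard_of_injOn (fun p => (m + 1 - p.1, n + 1 - p.2)) (fun p hp => (h.rot_lo.1 hp).2) (inj.mono fun p hp => hp.1) h.fin_up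
  have h2 : {p | IsUpperCorner (LadderDet.rot m n Y) p}.ncard ≤ {p | IsLowerCorner Y p}.ncard :=
    Set.ncard_le_ncard_of_injOn (fun p => (m + 1 - p.1, n + 1 - p.2)) (fun p hp => (h.rot_up.1 hp).2) (inj.mono fun p hp => hp.1) h.fin_lo
  simp only [cnt]; omega

end

end

section

section
variable {m n m' n' : ℕ} {Y Z : Set (ℕ × ℕ)} (K : Type) [Field K]

/-- row prefix sums -/
def PA (a : Fac → ℤ) (r : ℕ) : ℤ := ∑ i ∈ Finset.range r, a (.row (i + 1))
/-- column prefix sums -/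
def PB (a : Fac → ℤ) (r : ℕ) : ℤ := ∑ i ∈ Finset.range r, a (.col (i + 1))
/-- total defect -/
def DD (m n : ℕ) (a : Fac → ℤ) : ℤ := PA a m - PB a n
/-- SW defect -/
def dd (m : ℕ) (a : Fac → ℤ) : Fac → ℤ
  | .up c d => a (.up c d) + PA a m - PA a c - PB a d
  | .lo p q => PA a m - PA a (p - 1) - a (.lo p q) - PB a (q - 1)
  | _ => 0
/-- canonical defect -/
def de (m : ℕ) : Fac → ℤ
  | .up c d => m + 1 - c - d
  | .lo c d => m + 1 - c - d
  | _ => 0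
/-- corners -/
def isC : Fac → Prop
  | .up _ _ => True
  | .lo _ _ => True
  | _ => False

lemma PA_succ (a : Fac → ℤ) (r : ℕ) : PA a (r + 1) = PA a r + a (.row (r + 1)) := Finset.sum_range_succ _ _
lemma PB_succ (a : Fac → ℤ) (r : ℕ) : PB a (r + 1) = PB a r + a (.col (r + 1)) := Finset.sum_range_succ _ _
lemma PA_zero (a : Fac → ℤ) : PA a 0 = 0 := rfl
lemma PB_zero (a : Fac → ℤ) : PB a 0 = 0 := rfl

lemma isC_T {f : Fac} (hf : isC f) : isC (tT f) := by cases f <;> simp_all [isC, tT]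
lemma isC_R {f : Fac} (hf : isC f) : isC (tR m n f) := by cases f <;> simp_all [isC, tR]
lemma isC_S {c d : ℕ} {f : Fac} (hf : isC f) : isC (tS c d f) := by cases f <;> simp_all [isC, tS]

lemma DD_T (a : Fac → ℤ) : DD n m (a ∘ tT) = - DD m n a := by
  have h1 : PA (a ∘ tT) n = PB a n := rfl
  have h2 : PB (a ∘ tT) m = PA a m := rfl
  simp only [DD, h1, h2]; ring

lemma dd_T (a : Fac → ℤ) {f : Fac} (hf : isC f) : dd n (a ∘ tT) f = dd m a (tT f) - DD m n a := by
  have h1 : PA (a ∘ tT) = PB a := rfl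
  have h2 : PB (a ∘ tT) = PA a := rfl
  cases f with
  | row i => exact hf.elim
  | col i => exact hf.elim
  | up c d => simp only [dd, DD, tT, h1, h2, Function.comp]; ring
  | lo c d => simp only [dd, DD, tT, h1, h2, Function.comp]; ring

lemma de_T {f : Fac} (hf : isC f) : de n f = de m (tT f) - ((m : ℤ) - n) := by
  cases f with
  | row i => exact hf.elim
  | col i => exact hf.elim
  | up c d => simp only [de, tT]; ring
  | lo c d => simp only [de, tT]; ring

lemma PA_R (a : Fac → ℤ) {r : ℕ} (hr : r ≤ m) : PA (a ∘ tR m n) r = PA a m - PA a (m - r) := by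
  induction r with
  | zero => simp [PA_zero]
  | succ r ih =>
    rw [PA_succ, ih (by omega)]
    have := PA_succ a (m - (r + 1))
    rw [show m - (r + 1) + 1 = m - r by omega] at this
    simp only [Function.comp, tR, this, show m + 1 - (r + 1) = m - r by omega]; ring
lemma PB_R (a : Fac → ℤ) {r : ℕ} (hr : r ≤ n) : PB (a ∘ tR m n) r = PB a n - PB a (n - r) := by
  induction r with
  | zero => simp [PB_zero]
  | succ r ih =>
    rw [PB_succ, ih (by omega)]
    have := PB_succ a (n - (r + 1))
    rw [show n - (r + 1) + 1 = n - r by omega] at this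
    simp only [Function.comp, tR, this, show n + 1 - (r + 1) = n - r by omega]; ring

lemma DD_R (a : Fac → ℤ) : DD m n (a ∘ tR m n) = DD m n a := by
  simp [DD, PA_R a le_rfl, PB_R a le_rfl, PA_zero, PB_zero]

lemma Lad.dd_R (h : Lad m n Y) (a : Fac → ℤ) {f : Fac} (hf : isC f) (hv : Val m n Y f) :
    dd m (a ∘ tR m n) f = DD m n a - dd m a (tR m n f) := by
  cases f with
  | row i => exact hf.elim
  | col i => exact hf.elim
  | up c d =>
    have := h.up_grid hv
    simp only [dd, DD, PA_R a le_rfl, PA_R a this.2.1.le, PB_R a this.2.2.2.le, Function.comp, tR, show m + 1 - c - 1 = m - c by omega,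
      show n + 1 - d - 1 = n - d by omega, Nat.sub_self, PA_zero]; ring
  | lo c d =>
    have := h.lo_grid hv
    simp only [dd, DD, PA_R a le_rfl, PA_R a (show c - 1 ≤ m by omega), PB_R a (show d - 1 ≤ n by omega), Function.comp, tR, show m - (c - 1) = m + 1 - c by omega,
      show n - (d - 1) = n + 1 - d by omega, Nat.sub_self, PA_zero]; ring

lemma Lad.de_R (h : Lad m n Y) {f : Fac} (hf : isC f) (hv : Val m n Y f) :
    de m f = ((m : ℤ) - n) - de m (tR m n f) := by
  cases f with
  | row i => exact hf.elim
  | col i => exact hf.elim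
  | up c d => have := h.up_grid hv; simp only [de, tR]; omega
  | lo c d => have := h.lo_grid hv; simp only [de, tR]; omega

lemma PA_S (a : Fac → ℤ) {c d r : ℕ} (hc : 1 ≤ c) (hr : 1 ≤ r) :
    PA (a ∘ tS c d) r = a (.up c d) + PA a (r + (c - 1)) - PA a c := by
  induction r with
  | zero => omega
  | succ r ih =>
    rw [PA_succ]
    rcases Nat.eq_zero_or_pos r with rfl | h0
    · simp [PA_zero, tS, show 1 + (c - 1) = c by omega]
    · rw [ih h0, show r + 1 + (c - 1) = r + (c - 1) + 1 by omega, PA_succ]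
      simp only [Function.comp, tS]
      rw [if_neg (by omega), show r + 1 + (c - 1) = r + (c - 1) + 1 by omega]; ring
lemma PB_S (a : Fac → ℤ) (c d r : ℕ) : PB (a ∘ tS c d) r = PB a r := rfl

lemma DD_S (a : Fac → ℤ) {c d : ℕ} (hc : 1 ≤ c) (hm : c ≤ m) : DD (m + 1 - c) d (a ∘ tS c d) = dd m a (.up c d) := by
  simp only [DD, dd, PA_S a hc (show 1 ≤ m + 1 - c by omega), PB_S, show m + 1 - c + (c - 1) = m by omega]

lemma Lad.dd_S (h : Lad m n Y) (a : Fac → ℤ) {c d : ℕ} (hu : IsUpperCorner Y (c, d)) {f : Fac} (hf : isC f)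
    (hv : Val (m + 1 - c) d (swZ Y c d) f) : dd (m + 1 - c) (a ∘ tS c d) f = dd m a (tS c d f) := by
  have g := h.up_grid hu
  cases f with
  | row i => exact hf.elim
  | col i => exact hf.elim
  | up p q =>
    have := (h.swL hu).up_grid hv
    simp only [dd, tS, PB_S, PA_S a (show 1 ≤ c by omega) (show 1 ≤ m + 1 - c by omega), PA_S a (show 1 ≤ c by omega) (show 1 ≤ p by omega),
      show m + 1 - c + (c - 1) = m by omega, Function.comp]; ring
  | lo p q =>
    have := (h.swL hu).lo_grid hv
    simp only [dd, tS, PB_S, PA_S a (show 1 ≤ c by omega) (show 1 ≤ m + 1 - c by omega), PA_S a (show 1 ≤ c by omega) (show 1 ≤ p - 1 by omega),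
      show m + 1 - c + (c - 1) = m by omega, show p + (c - 1) - 1 = p - 1 + (c - 1) by omega, Function.comp]; ring

lemma Lad.de_S (h : Lad m n Y) {c d : ℕ} (hu : IsUpperCorner Y (c, d)) (f : Fac) (hf : isC f) :
    de (m + 1 - c) f = de m (tS c d f) := by
  have g := h.up_grid hu
  cases f with
  | row i => exact hf.elim
  | col i => exact hf.elim
  | up p q => simp only [de, tS]; omega
  | lo p q => simp only [de, tS]; omega

/-- defects determine the class -/
lemma Lad.cls (h : Lad m n Y) (a b : Fac → ℤ) (hD : DD m n a = DD m n b) (hd : ∀ f, Val m n Y f → isC f → dd m a f = dd m b f) :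
    ∃ μ : LM m n, ∀ f, Val m n Y f → b f = a f + wt m n f μ := by
  refine ⟨⟨(fun r => PA b (min r m) - PA a (min r m), fun r => PB b (min r n) - PB a (min r n)), ?_⟩, ?_⟩
  · simp only [DD] at hD
    refine ⟨by simp [PA_zero], by simp [PB_zero], fun r hr => ?_, fun r hr => ?_, ?_⟩
    · simp only [min_eq_right hr, min_self]
    · simp only [min_eq_right hr, min_self]
    · simp only [min_self]; omega
  · intro f hf
    cases f with
    | row i =>
      simp only [Val] at hf
      simp only [wt, AddMonoidHom.sub_apply, eA, AddMonoidHom.coe_mk, ZeroHom.coe_mk, min_eq_left hf.2, min_eq_left (show i - 1 ≤ m by omega)]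
      have h1 := PA_succ a (i - 1)
      have h2 := PA_succ b (i - 1)
      rw [show i - 1 + 1 = i by omega] at h1 h2
      omega
    | col i =>
      simp only [Val] at hf
      simp only [wt, AddMonoidHom.sub_apply, eB, AddMonoidHom.coe_mk, ZeroHom.coe_mk, min_eq_left hf.2, min_eq_left (show i - 1 ≤ n by omega)]
      have h1 := PB_succ a (i - 1)
      have h2 := PB_succ b (i - 1)
      rw [show i - 1 + 1 = i by omega] at h1 h2
      omega
    | up c d =>
      have g := h.up_grid hf
      have := hd _ hf trivial
      simp only [dd] at this
      simp only [wt, AddMonoidHom.sub_apply, AddMonoidHom.add_apply, eA, eB, AddMonoidHom.coe_mk, ZeroHom.coe_mk, min_self, min_eq_left g.2.1.le, min_eq_left g.2.2.2.le]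
      omega
    | lo c d =>
      have g := h.lo_grid hf
      have := hd _ hf trivial
      simp only [dd] at this
      simp only [wt, AddMonoidHom.sub_apply, AddMonoidHom.add_apply, eA, eB, AddMonoidHom.coe_mk, ZeroHom.coe_mk, min_self, min_eq_left (show c - 1 ≤ m by omega), min_eq_left (show d - 1 ≤ n by omega)]
      omega

/-- equivalent data have equal defects -/
lemma Lad.cls' (h : Lad m n Y) (a b : Fac → ℤ) (μ : LM m n) (hμ : ∀ f, Val m n Y f → b f = a f + wt m n f μ) :
    DD m n a = DD m n b ∧ ∀ f, Val m n Y f → isC f → dd m a f = dd m b f := by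
  have hA : ∀ r ≤ m, PA b r = PA a r + eA m n r μ := by
    intro r
    induction r with
    | zero => intro _; simp [PA_zero, eA_zero]
    | succ r ih =>
      intro hr
      rw [PA_succ, PA_succ, ih (by omega), hμ (.row (r+1)) ⟨by omega, hr⟩]
      simp [wt]; ring
  have hB : ∀ r ≤ n, PB b r = PB a r + eB m n r μ := by
    intro r
    induction r with
    | zero => intro _; simp [PB_zero, eB_zero]
    | succ r ih =>
      intro hr
      rw [PB_succ, PB_succ, ih (by omega), hμ (.col (r+1)) ⟨by omega, hr⟩]
      simp [wt]; ring
  refine ⟨?_, fun f hf hc => ?_⟩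
  · rw [DD, DD, hA m le_rfl, hB n le_rfl, eAB]; ring
  · cases f with
    | row i => exact hc.elim
    | col i => exact hc.elim
    | up c d =>
      have g := h.up_grid hf
      simp only [dd, hA m le_rfl, hA c g.2.1.le, hB d g.2.2.2.le, hμ _ hf, wt, AddMonoidHom.sub_apply, AddMonoidHom.add_apply]; ring
    | lo c d =>
      have g := h.lo_grid hf
      simp only [dd, hA m le_rfl, hA (c-1) (by omega), hB (d-1) (by omega), hμ _ hf, wt, AddMonoidHom.sub_apply, AddMonoidHom.add_apply]; ring

lemma Lad.fin_reg (h : Lad m n Y) [Fact (Lad m n Y)] (a : Fac → ℤ) (hD : DD m n a = 0) (hd : ∀ f, Val m n Y f → isC f → dd m a f = 0) :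
    Nonempty (LadderRing K 2 Y ≃ₗ[LadderRing K 2 Y] Mon K (LadderRing K 2 Y) (box (wY m n Y) fun f => a f.1)) := by
  have z : ∀ f, Val m n Y f → isC f → dd m (fun _ => 0) f = 0 := by
    intro f _ hf
    cases f <;> simp_all [isC, dd, PA, PB]
  obtain ⟨μ, hμ⟩ := h.cls (fun _ => 0) a (by rw [hD]; simp [DD, PA, PB]) (fun f h1 h2 => by rw [z f h1 h2, hd f h1 h2])
  exact ⟨(h.mr K).self.trans ((h.mr K).trans μ (fun f => hμ f.1 f.2))⟩

lemma Lad.of_reg (h : Lad m n Y) [Fact (Lad m n Y)] (a : Fac → ℤ)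
    (e : LadderRing K 2 Y ≃ₗ[LadderRing K 2 Y] Mon K (LadderRing K 2 Y) (box (wY m n Y) fun f => a f.1)) :
    DD m n a = 0 ∧ ∀ f, Val m n Y f → isC f → dd m a f = 0 := by
  haveI : IsDomain (AddMonoidAlgebra K (LM m n)) := dom_L _ _
  haveI := h.finFct
  obtain ⟨μ, hμ⟩ := (h.mr K).iso ((h.mr K).self.symm.trans e)
  have := h.cls' (fun _ => 0) a μ (fun f hf => hμ ⟨f, hf⟩)
  refine ⟨by rw [← this.1]; simp [DD, PA, PB], fun f h1 h2 => ?_⟩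
  rw [← this.2 f h1 h2]
  cases f <;> simp_all [isC, dd, PA, PB]

end

end

section

section
variable {m n m' n' : ℕ} {Y Z : Set (ℕ × ℕ)} (K : Type) [Field K]

/-- the corner-free case -/
def SegH : Prop := ∀ (m n : ℕ) (Y : Set (ℕ × ℕ)) (h : Lad m n Y), (∀ f, Val m n Y f → ¬ isC f) → ∀ a, Sd K h a → Fi K h a → DD m n a = (m : ℤ) - n

lemma fi_up (N : ℕ) (ih : ∀ (m n : ℕ) (Y : Set (ℕ × ℕ)) (h : Lad m n Y), m + n < N → ∀ a, Sd K h a → Fi K h a → DD m n a = (m : ℤ) - n)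
    (h : Lad m n Y) (hN : m + n ≤ N) (a : Fac → ℤ) (hs : Sd K h a) (hf : Fi K h a) {c d : ℕ} (hu : IsUpperCorner Y (c, d)) :
    dd m a (.up c d) = de m (.up c d) := by
  have g := h.up_grid hu
  have h1 := ih _ _ _ (h.swL hu) (by omega) _ ((h.pieceS K hu a).1 hs) ((h.pieceS K hu a).2 hf)
  rw [DD_S a (by omega) (by omega)] at h1
  rw [h1]; simp only [de]; omega

lemma fi_D (hseg : SegH K) : ∀ (N m n : ℕ) (Y : Set (ℕ × ℕ)) (h : Lad m n Y), m + n < N → ∀ a, Sd K h a → Fi K h a → DD m n a = (m : ℤ) - n := by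
  intro N
  induction N with
  | zero => intro m n Y h hN; omega
  | succ N ih =>
    have key : ∀ (m n : ℕ) (Y : Set (ℕ × ℕ)) (h : Lad m n Y), m + n ≤ N → ∀ a, Sd K h a → Fi K h a →
        ∀ c d, IsUpperCorner Y (c, d) → DD m n a = (m : ℤ) - n := by
      intro m n Y h hN a hs hf c d hu
      have h1 := fi_up K N ih h hN a hs hf hu
      have h2 := fi_up K N ih h.tr (by omega) _ ((h.pieceT K a).1 hs) ((h.pieceT K a).2 hf) (up_tr.2 hu)
      rw [dd_T (m := m) a (f := .up d c) trivial, de_T (m := m) (f := .up d c) trivial] at h2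
      simp only [tT] at h2
      omega
    intro m n Y h hN a hs hf
    by_cases hc : ∃ f, Val m n Y f ∧ isC f
    · obtain ⟨f, h1, h2⟩ := hc
      cases f with
      | row i => exact h2.elim
      | col i => exact h2.elim
      | up c d => exact key m n Y h (by omega) a hs hf c d h1
      | lo c d =>
        rw [← DD_R]
        exact key m n _ h.rot (by omega) _ ((h.pieceR K a).1 hs) ((h.pieceR K a).2 hf) _ _ (h.tR_val' (f := .lo c d) h1)
    · push Not at hc
      exact hseg m n Y h hc a hs hf

lemma fi_all (hseg : SegH K) (h : Lad m n Y) (a : Fac → ℤ) (hs : Sd K h a) (hf : Fi K h a) :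
    DD m n a = (m : ℤ) - n ∧ ∀ f, Val m n Y f → isC f → dd m a f = de m f := by
  have hD := fi_D K hseg (m + n + 1) m n Y h (by omega) a hs hf
  refine ⟨hD, fun f h1 h2 => ?_⟩
  cases f with
  | row i => exact h2.elim
  | col i => exact h2.elim
  | up c d => exact fi_up K (m + n) (fi_D K hseg (m + n)) h le_rfl a hs hf h1
  | lo c d =>
    have h3 := h.tR_val' h1
    have := fi_up K (m + n) (fi_D K hseg (m + n)) h.rot le_rfl _ ((h.pieceR K a).1 hs) ((h.pieceR K a).2 hf) h3
    rw [h.rot.dd_R a (f := .up _ _) trivial h3, h.rot.de_R (f := .up _ _) trivial h3] at this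
    have e := h.val_grid h1
    simp only [tR] at e
    simp only [tR, e] at this
    omega

/-- induction hypothesis -/
def HI (N : ℕ) : Prop := ∀ (m n : ℕ) (Z : Set (ℕ × ℕ)) (h : Lad m n Z), NC Z → cnt Z < N → ∀ a, Sd K h a →
  (DD m n a = 0 ∧ ∀ f, Val m n Z f → isC f → dd m a f = 0) ∨
  (DD m n a = (m : ℤ) - n ∧ ∀ f, Val m n Z f → isC f → dd m a f = de m f)

/-- corners SW of an upper corner -/
def inS (c d : ℕ) : Fac → Prop
  | .up _ q => q ≤ d
  | .lo p _ => c < p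
  | _ => False

/-- corners NE of an upper corner -/
def inN (c d : ℕ) : Fac → Prop
  | .up p _ => p ≤ c
  | .lo _ q => d < q
  | _ => False

variable {N : ℕ}

lemma nestS (hi : HI K N) (h : Lad m n Y) (hn : NC Y) (hN : cnt Y ≤ N) (a : Fac → ℤ) (hs : Sd K h a) {c d : ℕ} (hu : IsUpperCorner Y (c, d)) :
    ∃ ε : ℤ, (ε = 0 ∨ ε = 1) ∧ ∀ f, Val m n Y f → inS c d f → dd m a f = ε * de m f := by
  have g := h.up_grid hu
  have key : ∃ ε : ℤ, (ε = 0 ∨ ε = 1) ∧ dd m a (.up c d) = ε * de m (.up c d) ∧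
      ∀ f, Val (m + 1 - c) d (swZ Y c d) f → isC f → dd m a (tS c d f) = ε * de m (tS c d f) := by
    have hc : ((m + 1 - c : ℕ) : ℤ) - d = de m (.up c d) := by simp only [de]; omega
    rcases hi _ _ _ (h.swL hu) (h.sw_nc hu hn) (lt_of_lt_of_le (h.sw_cnt hu) hN) _ ((h.pieceS K hu a).1 hs) with ⟨h1, h2⟩ | ⟨h1, h2⟩
    · refine ⟨0, Or.inl rfl, ?_, fun f hf h3 => ?_⟩
      · rw [DD_S a (by omega) (by omega)] at h1; simp [h1]
      · have := h2 f hf h3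
        rw [h.dd_S a hu h3 hf] at this; simp [this]
    · refine ⟨1, Or.inr rfl, ?_, fun f hf h3 => ?_⟩
      · rw [DD_S a (by omega) (by omega)] at h1; rw [h1, hc]; simp
      · have := h2 f hf h3
        rw [h.dd_S a hu h3 hf, h.de_S hu f h3] at this; simp [this]
  obtain ⟨ε, h0, h1, h2⟩ := key
  refine ⟨ε, h0, fun f hf hS => ?_⟩
  cases f with
  | row i => exact hS.elim
  | col i => exact hS.elim
  | up p q =>
    simp only [inS] at hS
    rcases h.up_up hu hf with ⟨k1, k2⟩ | ⟨k1, k2⟩ | ⟨rfl, rfl⟩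
    · have e : p - (c - 1) + (c - 1) = p := by omega
      have := h2 (.up (p - (c - 1)) q) ((h.sw_up hu).2 ⟨by omega, k2, by rw [e]; exact hf⟩) trivial
      simpa only [tS, e] using this
    · omega
    · exact h1
  | lo p q =>
    simp only [inS] at hS
    have e : p - (c - 1) + (c - 1) = p := by omega
    have := h2 (.lo (p - (c - 1)) q) ((h.sw_lo hu).2 ⟨by omega, by rw [e]; exact hf⟩) trivial
    simpa only [tS, e] using this

lemma nestN (hi : HI K N) (h : Lad m n Y) (hn : NC Y) (hN : cnt Y ≤ N) (a : Fac → ℤ) (hs : Sd K h a) {c d : ℕ} (hu : IsUpperCorner Y (c, d)) :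
    ∃ ε : ℤ, (ε = 0 ∨ ε = 1) ∧ ∀ f, Val m n Y f → inN c d f → DD m n a - dd m a f = ε * ((m : ℤ) - n - de m f) := by
  obtain ⟨ε, h0, h1⟩ := nestS K hi h.tr (tr_nc hn) (h.tr_cnt_le.trans hN) _ ((h.pieceT K a).1 hs) (up_tr.2 hu)
  refine ⟨ε, h0, fun f hf hS => ?_⟩
  have hc : isC f := by cases f <;> simp_all [inN, isC]
  have := h1 (tT f) (tT_val' hf) (by cases f <;> exact hS)
  rw [dd_T (m := m) a (isC_T hc), de_T (m := m) (isC_T hc), tT_tT] at this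
  linear_combination -this

lemma nestR (hi : HI K N) (h : Lad m n Y) (hn : NC Y) (hN : cnt Y ≤ N) (a : Fac → ℤ) (hs : Sd K h a) {c d : ℕ} (hu : IsLowerCorner Y (c, d)) :
    ∃ ε : ℤ, (ε = 0 ∨ ε = 1) ∧ ∀ p q, IsLowerCorner Y (p, q) → d ≤ q → DD m n a - dd m a (.lo p q) = ε * ((m : ℤ) - n - de m (.lo p q)) := by
  have h3 := h.tR_val' (f := .lo c d) hu
  obtain ⟨ε, h0, h1⟩ := nestS K hi h.rot (h.rot_nc hn) (h.rot_cnt_le.trans hN) _ ((h.pieceR K a).1 hs) h3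
  refine ⟨ε, h0, fun p q hf hS => ?_⟩
  have hv := h.tR_val' (f := .lo p q) hf
  have := h1 _ hv (by simp only [tR, inS]; omega)
  rwa [h.rot.dd_R a (isC_R (f := .lo p q) trivial) hv, h.rot.de_R (isC_R (f := .lo p q) trivial) hv, h.val_grid (f := .lo p q) hf] at this

lemma nestRT (hi : HI K N) (h : Lad m n Y) (hn : NC Y) (hN : cnt Y ≤ N) (a : Fac → ℤ) (hs : Sd K h a) {c d : ℕ} (hu : IsLowerCorner Y (c, d)) :
    ∃ ε : ℤ, (ε = 0 ∨ ε = 1) ∧ ∀ p q, IsLowerCorner Y (p, q) → c ≤ p → dd m a (.lo p q) = ε * (de m (.lo p q)) := by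
  have h3 := h.tR_val' (f := .lo c d) hu
  obtain ⟨ε, h0, h1⟩ := nestN K hi h.rot (h.rot_nc hn) (h.rot_cnt_le.trans hN) _ ((h.pieceR K a).1 hs) h3
  refine ⟨ε, h0, fun p q hf hS => ?_⟩
  have hv := h.tR_val' (f := .lo p q) hf
  have := h1 _ hv (by simp only [tR, inN]; omega)
  rw [h.rot.dd_R a (isC_R (f := .lo p q) trivial) hv, h.rot.de_R (isC_R (f := .lo p q) trivial) hv, h.val_grid (f := .lo p q) hf, DD_R] at this
  linear_combination this

/-- the global bits -/
lemma bits (hi : HI K N) (h : Lad m n Y) (hn : NC Y) (hN : cnt Y ≤ N) (a : Fac → ℤ) (hs : Sd K h a)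
    (hU : ∃ p, IsUpperCorner Y p) (hL : ∃ p, IsLowerCorner Y p) :
    ∃ s t s' t' : ℤ, (s = 0 ∨ s = 1) ∧ (t = 0 ∨ t = 1) ∧ (s' = 0 ∨ s' = 1) ∧ (t' = 0 ∨ t' = 1) ∧
      (∀ c d, IsUpperCorner Y (c, d) → dd m a (.up c d) = s * de m (.up c d) ∧ DD m n a - dd m a (.up c d) = t * ((m : ℤ) - n - de m (.up c d))) ∧
      (∀ c d, IsLowerCorner Y (c, d) → dd m a (.lo c d) = s' * de m (.lo c d) ∧ DD m n a - dd m a (.lo c d) = t' * ((m : ℤ) - n - de m (.lo c d))) := by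
  obtain ⟨⟨c1, d1⟩, u1, m1⟩ := Set.exists_max_image {p | IsUpperCorner Y p} (fun p => p.2) h.fin_up hU
  obtain ⟨⟨c2, d2⟩, u2, m2⟩ := Set.exists_max_image {p | IsUpperCorner Y p} (fun p => p.1) h.fin_up hU
  obtain ⟨⟨c3, d3⟩, u3, m3⟩ := Set.exists_min_image {p | IsLowerCorner Y p} (fun p => p.2) h.fin_lo hL
  obtain ⟨⟨c4, d4⟩, u4, m4⟩ := Set.exists_min_image {p | IsLowerCorner Y p} (fun p => p.1) h.fin_lo hL
  obtain ⟨s, s0, hs1⟩ := nestS K hi h hn hN a hs u1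
  obtain ⟨t, t0, ht1⟩ := nestN K hi h hn hN a hs u2
  obtain ⟨t', t0', ht1'⟩ := nestR K hi h hn hN a hs u3
  obtain ⟨s', s0', hs1'⟩ := nestRT K hi h hn hN a hs u4
  exact ⟨s, t, s', t', s0, t0, s0', t0', fun c d hu => ⟨hs1 (.up c d) hu (m1 _ hu), ht1 (.up c d) hu (m2 _ hu)⟩,
    fun c d hu => ⟨hs1' c d hu (m4 _ hu), ht1' c d hu (m3 _ hu)⟩⟩

end

end

section

section
variable {m n : ℕ} {Y : Set (ℕ × ℕ)}

/-- same class -/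
def Same (m n : ℕ) (Y : Set (ℕ × ℕ)) (a b : Fac → ℤ) : Prop :=
  DD m n a = DD m n b ∧ ∀ f, Val m n Y f → isC f → dd m a f = dd m b f

lemma pigeon {P : Fin 5 → Fin 5 → Prop} (s t : Fin 5 → ℤ) (hs : ∀ i, s i = 0 ∨ s i = 1) (ht : ∀ i, t i = 0 ∨ t i = 1)
    (H : ∀ i j, s i = s j → t i = t j → P i j) : ∃ i j, i ≠ j ∧ P i j := by
  obtain ⟨i, j, h1, h2⟩ := Fintype.exists_ne_map_eq_of_card_lt
    (fun i : Fin 5 => ((decide (s i = 0) : Bool), (decide (t i = 0) : Bool))) (by simp)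
  simp only [Prod.mk.injEq, decide_eq_decide] at h2
  refine ⟨i, j, h1, H i j ?_ ?_⟩
  · rcases hs i with h | h <;> rcases hs j with h' | h' <;> simp_all
  · rcases ht i with h | h <;> rcases ht j with h' | h' <;> simp_all

variable (K : Type) [Field K]

/-- the exceptional case is impossible -/
def KillH : Prop := ∀ (n : ℕ) (Y : Set (ℕ × ℕ)) (h : Lad n n Y) (e : ℤ) (a : Fac → ℤ), 1 ≤ e →
  (∀ c d, IsUpperCorner Y (c, d) → de n (.up c d) = - e ∧ dd n a (.up c d) = - e) →
  (∀ c d, IsLowerCorner Y (c, d) → de n (.lo c d) = e ∧ dd n a (.lo c d) = 0) →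
  DD n n a = - e → ¬ Sd K h a

variable {N : ℕ}

lemma final1 (hi : HI K N) (h : Lad m n Y) (hn : NC Y) (hN : cnt Y ≤ N) (a : Fin 5 → Fac → ℤ) (hs : ∀ i, Sd K h (a i))
    (hU : ∃ p, IsUpperCorner Y p)
    (hF : ∀ p q c d, IsLowerCorner Y (p, q) → IsUpperCorner Y (c, d) → c < p ∨ d < q) :
    ∃ i j, i ≠ j ∧ Same m n Y (a i) (a j) := by
  obtain ⟨⟨c, d⟩, hu⟩ := hU
  choose s s0 s1 using fun i => nestS K hi h hn hN (a i) (hs i) hu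
  choose t t0 t1 using fun i => nestN K hi h hn hN (a i) (hs i) hu
  refine pigeon s t s0 t0 fun i j e1 e2 => ?_
  have hD : DD m n (a i) = DD m n (a j) := by
    have h1 := s1 i (.up c d) hu (le_refl d)
    have h2 := s1 j (.up c d) hu (le_refl d)
    have h3 := t1 i (.up c d) hu (le_refl c)
    have h4 := t1 j (.up c d) hu (le_refl c)
    rw [e1] at h1; rw [e2] at h3
    linarith
  refine ⟨hD, fun f hf hc => ?_⟩
  have : inS c d f ∨ inN c d f := by
    cases f with
    | row i => exact hc.elim
    | col i => exact hc.elim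
    | up p q => simp only [inS, inN]; rcases h.up_up hu hf with k | k | k <;> omega
    | lo p q => exact hF p q c d hf hu
  rcases this with k | k
  · rw [s1 i f hf k, s1 j f hf k, e1]
  · have h3 := t1 i f hf k
    have h4 := t1 j f hf k
    rw [e2] at h3
    linarith

lemma final2 (hi : HI K N) (hk : KillH K) (h : Lad m n Y) (hn : NC Y) (hN : cnt Y ≤ N) (a : Fin 5 → Fac → ℤ) (hs : ∀ i, Sd K h (a i))
    {p q c d : ℕ} (hl : IsLowerCorner Y (p, q)) (hu : IsUpperCorner Y (c, d)) (hpc : p ≤ c) (hqd : q ≤ d) :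
    ∃ i j, i ≠ j ∧ Same m n Y (a i) (a j) := by
  have hf : de m (.up c d) < de m (.lo p q) := by
    have : ¬ (p = c ∧ q = d) := by rintro ⟨rfl, rfl⟩; exact hn _ ⟨hl, hu⟩
    simp only [de]; omega
  choose s t s' t' s0 t0 s0' t0' H H' using fun i => bits K hi h hn hN (a i) (hs i) ⟨_, hu⟩ ⟨_, hl⟩
  by_cases hmn : (m : ℤ) - n = 0
  · by_cases h0 : ∀ i, DD m n (a i) = 0
    · refine pigeon s s' s0 s0' fun i j e1 e2 => ⟨by rw [h0, h0], fun f hf hc => ?_⟩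
      cases f with
      | row i => exact hc.elim
      | col i => exact hc.elim
      | up p q => rw [(H i p q hf).1, (H j p q hf).1, e1]
      | lo p q => rw [(H' i p q hf).1, (H' j p q hf).1, e2]
    · exfalso
      push Not at h0
      obtain ⟨i, h0⟩ := h0
      have hmn' : m = n := by omega
      subst hmn'
      have hu1 := H i c d hu
      have hl1 := H' i p q hl
      have hH := H i
      have hH' := H' i
      have si := s0 i
      have ti := t0 i
      have si' := s0' i
      have ti' := t0' i
      generalize s i = s at *
      generalize t i = t at *
      generalize s' i = s' at *
      generalize t' i = t' at *
      have hA := hs i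
      generalize a i = a at *
      by_cases hD : DD m m a < 0
      · refine hk m Y h (- DD m m a) a (by omega) (fun c' d' hu' => ?_) (fun p' q' hl' => ?_) (by omega) hA
        · have hu2 := hH c' d' hu'
          rcases si with rfl | rfl <;> rcases ti with rfl | rfl <;> rcases si' with rfl | rfl <;> rcases ti' with rfl | rfl <;> omega
        · have hu2 := hH' p' q' hl'
          rcases si with rfl | rfl <;> rcases ti with rfl | rfl <;> rcases si' with rfl | rfl <;> rcases ti' with rfl | rfl <;> omega
      · refine hk m _ h.tr (DD m m a) (a ∘ tT) (by omega) (fun c' d' hu' => ?_) (fun p' q' hl' => ?_) (by rw [DD_T (m := m) (n := m)]) ((h.pieceT K a).1 hA)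
        · have hu2 := hH d' c' (up_tr.1 hu')
          have e1 := dd_T (m := m) (n := m) a (f := .up c' d') trivial
          have e2 := de_T (m := m) (n := m) (f := .up c' d') trivial
          simp only [tT] at e1 e2
          rcases si with rfl | rfl <;> rcases ti with rfl | rfl <;> rcases si' with rfl | rfl <;> rcases ti' with rfl | rfl <;> omega
        · have hu2 := hH' q' p' (lo_tr.1 hl')
          have e1 := dd_T (m := m) (n := m) a (f := .lo p' q') trivial
          have e2 := de_T (m := m) (n := m) (f := .lo p' q') trivial
          simp only [tT] at e1 e2
          rcases si with rfl | rfl <;> rcases ti with rfl | rfl <;> rcases si' with rfl | rfl <;> rcases ti' with rfl | rfl <;> omega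
  · refine pigeon s t s0 t0 fun i j e1 e2 => ?_
    have hu1 := H i c d hu
    have hu2 := H j c d hu
    rw [← e1, ← e2] at hu2
    have hD : DD m n (a i) = DD m n (a j) := by linarith
    refine ⟨hD, fun f hf hc => ?_⟩
    cases f with
    | row i => exact hc.elim
    | col i => exact hc.elim
    | up p q => rw [(H i p q hf).1, (H j p q hf).1, e1]
    | lo p' q' =>
      have h1 := H' i p' q' hf
      have h2 := H' j p' q' hf
      have h3 := H' i p q hl
      have h4 := H' j p q hl
      have si := s0 i
      have ti := t0 i
      have si' := s0' i
      have ti' := t0' i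
      have sj' := s0' j
      have tj' := t0' j
      clear H H'
      generalize s i = s at *
      generalize t i = t at *
      generalize s' i = s1 at *
      generalize t' i = t1 at *
      generalize s' j = s2 at *
      generalize t' j = t2 at *
      rcases si with rfl | rfl <;> rcases ti with rfl | rfl <;> rcases si' with rfl | rfl <;> rcases ti' with rfl | rfl <;>
        rcases sj' with rfl | rfl <;> rcases tj' with rfl | rfl <;> omega

end

end

section

section
variable {R : Type} [CommRing R]

lemma regI_inf (l : List R) : ∀ {I₁ I₂ : Ideal R}, RegI I₁ l → RegI I₂ l → RegI (I₁ ⊔ I₂) l → RegI (I₁ ⊓ I₂) l := by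
  induction l with
  | nil => intros; trivial
  | cons x l ih =>
    intro I₁ I₂ h1 h2 h3
    refine ⟨fun r hr => ⟨h1.1 r hr.1, h2.1 r hr.2⟩, ?_⟩
    have e : I₁ ⊓ I₂ ⊔ Ideal.span {x} = (I₁ ⊔ Ideal.span {x}) ⊓ (I₂ ⊔ Ideal.span {x}) := by
      apply le_antisymm
      · exact le_inf (sup_le_sup_right inf_le_left _) (sup_le_sup_right inf_le_right _)
      · rintro r ⟨hr1, hr2⟩
        obtain ⟨i1, k1, _, c1, rfl⟩ := Submodule.mem_sup.1 hr1
        obtain ⟨a, rfl⟩ := Ideal.mem_span_singleton'.1 c1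
        obtain ⟨i2, k2, _, c2, e2⟩ := Submodule.mem_sup.1 hr2
        obtain ⟨b, rfl⟩ := Ideal.mem_span_singleton'.1 c2
        have : x * (b - a) ∈ I₁ ⊔ I₂ := Submodule.mem_sup.2 ⟨i1, k1, -i2, I₂.neg_mem k2, by linear_combination -e2⟩
        obtain ⟨j1, l1, j2, l2, e3⟩ := Submodule.mem_sup.1 (h3.1 _ this)
        refine Submodule.mem_sup.2 ⟨i1 - x * j1, ⟨I₁.sub_mem k1 (I₁.mul_mem_left _ l1), ?_⟩, (j1 + a) * x,
          Ideal.mem_span_singleton'.2 ⟨_, rfl⟩, by ring⟩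
        have : i1 - x * j1 = i2 + x * j2 := by linear_combination -e2 - x * e3
        rw [this]
        exact I₂.add_mem k2 (I₂.mul_mem_left _ l2)
    rw [e]
    refine ih h1.2 h2.2 ?_
    have : I₁ ⊔ Ideal.span {x} ⊔ (I₂ ⊔ Ideal.span {x}) = I₁ ⊔ I₂ ⊔ Ideal.span {x} := by
      rw [sup_sup_sup_comm, sup_idem]
    rw [this]; exact h3.2

lemma regI_colon (l : List R) : ∀ {J I : Ideal R} {s : R}, (∀ r, r * s ∈ I ↔ r ∈ J) → RegI (I ⊔ Ideal.span {s}) l → RegI J l → RegI I l := by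
  induction l with
  | nil => intros; trivial
  | cons x l ih =>
    intro J I s h1 h2 h3
    refine ⟨fun r hr => ?_, ?_⟩
    · have := h2.1 r (Submodule.mem_sup_left hr)
      obtain ⟨k, hk, _, c1, rfl⟩ := Submodule.mem_sup.1 this
      obtain ⟨a, rfl⟩ := Ideal.mem_span_singleton'.1 c1
      refine I.add_mem hk ((h1 a).2 (h3.1 a ((h1 _).1 ?_)))
      have := I.sub_mem hr (I.mul_mem_left x hk)
      convert this using 1; ring
    · refine ih (J := J ⊔ Ideal.span {x}) (s := s) (fun t => ⟨fun ht => ?_, fun ht => ?_⟩) ?_ h3.2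
      · obtain ⟨k, hk, _, c1, e⟩ := Submodule.mem_sup.1 ht
        obtain ⟨b, rfl⟩ := Ideal.mem_span_singleton'.1 c1
        have : x * b ∈ I ⊔ Ideal.span {s} := Submodule.mem_sup.2 ⟨-k, I.neg_mem hk, t * s, Ideal.mem_span_singleton'.2 ⟨_, rfl⟩, by linear_combination -e⟩
        obtain ⟨k', hk', _, c2, e2⟩ := Submodule.mem_sup.1 (h2.1 _ this)
        obtain ⟨c, rfl⟩ := Ideal.mem_span_singleton'.1 c2
        have : t - c * x ∈ J := (h1 _).1 (by
          have : (t - c * x) * s = k + x * k' := by linear_combination -e - x * e2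
          rw [this]; exact I.add_mem hk (I.mul_mem_left _ hk'))
        exact Submodule.mem_sup.2 ⟨_, this, c * x, Ideal.mem_span_singleton'.2 ⟨_, rfl⟩, by ring⟩
      · obtain ⟨k, hk, _, c1, rfl⟩ := Submodule.mem_sup.1 ht
        obtain ⟨b, rfl⟩ := Ideal.mem_span_singleton'.1 c1
        exact Submodule.mem_sup.2 ⟨k * s, (h1 k).2 hk, b * s * x, Ideal.mem_span_singleton'.2 ⟨_, rfl⟩, by ring⟩
      · rw [sup_right_comm]; exact h2.2

lemma regI_step {l : List R} {I₁ I₂ : Ideal R} {y : R} (h1 : RegI I₁ (y :: l)) (h2 : RegI I₂ (y :: l))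
    (h3 : RegI (I₁ ⊔ I₂) l) (hy : y ∈ I₁ ⊔ I₂) : RegI (I₁ ⊓ I₂) (y :: l) := by
  refine ⟨fun r hr => ⟨h1.1 r hr.1, h2.1 r hr.2⟩, ?_⟩
  obtain ⟨j1, hj1, s, hs, e⟩ := Submodule.mem_sup.1 hy
  have hK : I₁ ⊓ I₂ ⊔ Ideal.span {y} ⊔ Ideal.span {s} = (I₁ ⊔ Ideal.span {y}) ⊓ (I₂ ⊔ Ideal.span {y}) := by
    apply le_antisymm
    · refine sup_le (le_inf (sup_le_sup_right inf_le_left _) (sup_le_sup_right inf_le_right _)) ?_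
      rw [Ideal.span_singleton_le_iff_mem]
      exact ⟨Submodule.mem_sup.2 ⟨-j1, I₁.neg_mem hj1, y, Ideal.mem_span_singleton_self y, by linear_combination -e⟩,
        Submodule.mem_sup_left hs⟩
    · rintro r ⟨hr1, hr2⟩
      obtain ⟨i1, k1, _, c1, rfl⟩ := Submodule.mem_sup.1 hr1
      obtain ⟨a, rfl⟩ := Ideal.mem_span_singleton'.1 c1
      obtain ⟨i2, k2, _, c2, e2⟩ := Submodule.mem_sup.1 hr2
      obtain ⟨b, rfl⟩ := Ideal.mem_span_singleton'.1 c2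
      refine Submodule.mem_sup.2 ⟨i1 - (b - a) * j1 + b * y, Submodule.mem_sup.2 ⟨_, ⟨I₁.sub_mem k1 (I₁.mul_mem_left _ hj1), ?_⟩,
        b * y, Ideal.mem_span_singleton'.2 ⟨_, rfl⟩, rfl⟩, (a - b) * s, Ideal.mem_span_singleton'.2 ⟨_, rfl⟩, by linear_combination (a - b) * e⟩
      have : i1 - (b - a) * j1 = i2 + (b - a) * s := by linear_combination -e2 - (b - a) * e
      rw [this]
      exact I₂.add_mem k2 (I₂.mul_mem_left _ hs)
  refine regI_colon l (J := I₁ ⊔ I₂) (s := s) (fun t => ⟨fun ht => ?_, fun ht => ?_⟩) ?_ h3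
  · obtain ⟨w, hw, _, c1, e2⟩ := Submodule.mem_sup.1 ht
    obtain ⟨a, rfl⟩ := Ideal.mem_span_singleton'.1 c1
    have ha : a ∈ I₂ := h2.1 a (by
      have := I₂.sub_mem (I₂.mul_mem_left t hs) hw.2
      convert this using 1; linear_combination e2)
    have hb : t - a ∈ I₁ := h1.1 _ (by
      have := I₁.add_mem (I₁.mul_mem_left t hj1) hw.1
      convert this using 1; linear_combination -t * e - e2)
    exact Submodule.mem_sup.2 ⟨_, hb, a, ha, by ring⟩
  · obtain ⟨t1, ht1, t2, ht2, rfl⟩ := Submodule.mem_sup.1 ht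
    refine Submodule.mem_sup.2 ⟨t1 * s - t2 * j1, Ideal.sub_mem _ ⟨I₁.mul_mem_right _ ht1, I₂.mul_mem_left _ hs⟩
      ⟨I₁.mul_mem_left _ hj1, I₂.mul_mem_right _ ht2⟩, t2 * y, Ideal.mem_span_singleton'.2 ⟨_, rfl⟩, by linear_combination -t2 * e⟩
  · rw [hK]
    refine regI_inf l h1.2 h2.2 ?_
    have : I₁ ⊔ Ideal.span {y} ⊔ (I₂ ⊔ Ideal.span {y}) = I₁ ⊔ I₂ := by
      rw [sup_sup_sup_comm, sup_idem]
      exact sup_eq_left.2 ((Ideal.span_singleton_le_iff_mem _).2 hy)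
    rw [this]; exact h3

end

end

section

section
variable {m n : ℕ} {Y : Set (ℕ × ℕ)}

/-- faces of the cone -/
def Fc (p q : ℕ) (x : LM m n) : Prop := eA m n (p - 1) x = 0 ∧ eB m n q x = eA m n m x

lemma Fc_add {p q : ℕ} {x y : LM m n} (hx : x ∈ Cone m n Y) (hy : y ∈ Cone m n Y) : Fc p q (x + y) ↔ Fc p q x ∧ Fc p q y := by
  have h1 := cone_A hx (p - 1)
  have h2 := cone_A hy (p - 1)
  have h3 := cone_B hx q
  have h4 := cone_B hy q
  simp only [Fc, map_add]; omega

lemma Fc_edge {i j : ℕ} (g : 1 ≤ i ∧ i ≤ m ∧ 1 ≤ j ∧ j ≤ n) {p q : ℕ} : Fc p q (edge m n (i, j)) ↔ p ≤ i ∧ j ≤ q := by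
  simp only [Fc, eA_edge g, eB_edge g]
  split_ifs <;> simp <;> omega

variable (K : Type) [Field K]

lemma cone_add {x y : LM m n} (hx : x ∈ Cone m n Y) (hy : y ∈ Cone m n Y) : x + y ∈ Cone m n Y := by
  intro f
  have h1 := hx f
  have h2 := hy f
  simp only [Pi.zero_apply, map_add] at *
  omega

/-- face ideals -/
noncomputable def JF (h : Lad m n Y) (p q : ℕ) : Ideal (LadderRing K 2 Y) where
  carrier := {r | SuppIn (phi K h r) {x | ¬ Fc p q x}}
  zero_mem' := by simp only [Set.mem_setOf_eq, map_zero]; exact SuppIn.zero _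
  add_mem' ha hb := by simp only [Set.mem_setOf_eq, map_add] at *; exact ha.add hb
  smul_mem' c x hx := by
    simp only [Set.mem_setOf_eq, smul_eq_mul, map_mul] at *
    have h1 := (h.phi_range K _).1 ⟨c, rfl⟩
    have h2 := (h.phi_range K _).1 ⟨x, rfl⟩
    have h3 : SuppIn (phi K h x) {y | y ∈ Cone m n Y ∧ ¬ Fc p q y} := fun y hy => ⟨h2 y hy, hx y hy⟩
    refine h1.mul h3 fun a ha b hb => ?_
    simp only [Set.mem_setOf_eq]
    rw [Fc_add ha hb.1]
    exact fun hh => hb.2 hh.2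

variable {K}
lemma mem_JF {h : Lad m n Y} {p q : ℕ} {r : LadderRing K 2 Y} : r ∈ JF K h p q ↔ ∀ x, (phi K h r).coeff x ≠ 0 → ¬ Fc p q x := Iff.rfl

lemma mem_of_mono (h : Lad m n Y) {r : LadderRing K 2 Y} {I : Ideal (LadderRing K 2 Y)}
    (H : ∀ x, (phi K h r).coeff x ≠ 0 → x ∈ Cone m n Y → ∀ r', phi K h r' = chi x → r' ∈ I) : r ∈ I := by
  classical
  have hC : ∀ x, (phi K h r).coeff x ≠ 0 → x ∈ Cone m n Y := (h.phi_range K _).1 ⟨r, rfl⟩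
  have h1 : ∀ x : LM m n, ∃ r', (phi K h r).coeff x ≠ 0 → phi K h r' = chi x := by
    intro x
    by_cases hx : (phi K h r).coeff x ≠ 0
    · obtain ⟨r', hr'⟩ := (h.phi_range K (chi x)).2 (SuppIn.single (hC x hx))
      exact ⟨r', fun _ => hr'⟩
    · exact ⟨0, fun h => absurd h hx⟩
  choose g hg using h1
  have h0 : (0 : LM m n) ∈ Cone m n Y := by simp [Cone, box]
  choose k hk using fun c : K => (h.phi_range K (AddMonoidAlgebra.single 0 c)).2 (SuppIn.single h0)
  have : r = ∑ x ∈ (phi K h r).coeff.support, k ((phi K h r).coeff x) * g x := by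
    apply h.phi_inj K
    rw [map_sum]
    conv_lhs => rw [L_sum (phi K h r)]
    refine Finset.sum_congr rfl fun x hx => ?_
    rw [map_mul, hk, hg x (Finsupp.mem_support_iff.1 hx)]
    simp [chi]
  rw [this]
  refine I.sum_mem fun x hx => I.mul_mem_left _ ?_
  have hx := Finsupp.mem_support_iff.1 hx
  exact H x hx (hC x hx) _ (hg x hx)

lemma chi_JF {h : Lad m n Y} {p q : ℕ} {r : LadderRing K 2 Y} {x : LM m n} (hr : phi K h r = chi x) : r ∈ JF K h p q ↔ ¬ Fc p q x := by
  change SuppIn (phi K h r) {x | ¬ Fc p q x} ↔ _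
  rw [hr]
  exact SuppIn.single_iff

/-- the generator at a position -/
lemma exists_x (K : Type) [Field K] (h : Lad m n Y) {p q : ℕ} (hp : (p, q) ∈ Y) : ∃ r, phi K h r = chi (edge m n (p, q)) :=
  (h.phi_range K _).2 (SuppIn.single (h.edge_cone hp))

lemma JF_mono {h : Lad m n Y} {p q p' q' : ℕ} (hp : p ≤ p') (hq : q' ≤ q) : JF K h p q ≤ JF K h p' q' := by
  intro r hr x hx hF
  have hC : x ∈ Cone m n Y := (h.phi_range K _).1 ⟨r, rfl⟩ x hx
  refine hr x hx ⟨?_, ?_⟩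
  · have h1 := cone_monoA hC (show p - 1 ≤ p' - 1 by omega)
    have h2 := cone_A hC (p - 1)
    have := hF.1
    simp only at h1; omega
  · have h1 := cone_monoB hC hq
    have h2 := cone_B hC q
    have := hF.2
    simp only at h1; omega

lemma x_reg {h : Lad m n Y} {p q : ℕ} (hp : (p, q) ∈ Y) {r s : LadderRing K 2 Y} (hr : phi K h r = chi (edge m n (p, q))) (hs : r * s ∈ JF K h p q) :
    s ∈ JF K h p q := by
  have hs : SuppIn (phi K h (r * s)) _ := hs
  rw [map_mul, hr, chi_supp] at hs
  intro x hx hF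
  have hC : x ∈ Cone m n Y := (h.phi_range K _).1 ⟨s, rfl⟩ x hx
  exact hs x hx ((Fc_add (h.edge_cone hp) hC).2 ⟨(Fc_edge (h.grid hp)).2 ⟨le_rfl, le_rfl⟩, hF⟩)

/-- monomials with a given leading pair are multiples of `x_pq` -/
lemma x_dvd {h : Lad m n Y} {p q : ℕ} {r s : LadderRing K 2 Y} (hr : phi K h r = chi (edge m n (p, q)))
    {x : LM m n} (hx : x ∈ Cone m n Y) (hs : phi K h s = chi x) (hF : FL x p q) : s ∈ Ideal.span {r} := by
  obtain ⟨t, ht⟩ := (h.phi_range K _).2 (SuppIn.single (K := K) (c := 1) (h.FL_sub hx hF))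
  refine Ideal.mem_span_singleton'.2 ⟨t, h.phi_inj K ?_⟩
  rw [map_mul, hr, hs, ht]
  change chi _ * chi _ = chi _
  rw [chi_mul, sub_add_cancel]

lemma x_mem1 {h : Lad m n Y} {p q : ℕ} (hp : (p, q) ∈ Y) {r : LadderRing K 2 Y} (hr : phi K h r = chi (edge m n (p, q))) : r ∈ JF K h (p + 1) q := by
  rw [chi_JF hr, Fc_edge (h.grid hp)]; omega
lemma x_mem2 {h : Lad m n Y} {p q : ℕ} (hp : (p, q) ∈ Y) {r : LadderRing K 2 Y} (hr : phi K h r = chi (edge m n (p, q))) : r ∈ JF K h p (q - 1) := by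
  have := h.grid hp
  rw [chi_JF hr, Fc_edge (h.grid hp)]; omega

lemma J_both {h : Lad m n Y} {p q : ℕ} (hp : (p, q) ∈ Y) {r : LadderRing K 2 Y} (hr : phi K h r = chi (edge m n (p, q))) :
    JF K h p q ⊔ Ideal.span {r} = JF K h (p + 1) q ⊓ JF K h p (q - 1) := by
  have g := h.grid hp
  apply le_antisymm
  · refine sup_le (le_inf (JF_mono (by omega) le_rfl) (JF_mono le_rfl (by omega))) ?_
    rw [Ideal.span_singleton_le_iff_mem]
    exact ⟨x_mem1 hp hr, x_mem2 hp hr⟩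
  · rintro s ⟨h1, h2⟩
    refine mem_of_mono h fun x hx hC r' hr' => ?_
    by_cases hF : Fc p q x
    · refine Submodule.mem_sup_right (x_dvd hr hC hr' ?_)
      have k1 := h1 x hx
      have k2 := h2 x hx
      simp only [Fc, Nat.add_sub_cancel, not_and] at k1 k2 hF
      have k3 := cone_A hC p
      have k4 := cone_B hC (q - 1)
      exact ⟨by omega, by omega, by omega, by omega, hF.1, lt_of_le_of_ne k3.1 fun e => k1 e.symm hF.2, hF.2, lt_of_le_of_ne k4.2 fun e => k2 hF.1 e⟩
    · exact Submodule.mem_sup_left ((chi_JF hr').2 hF)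

lemma J_sup {h : Lad m n Y} {p q : ℕ} : JF K h (p + 1) q ⊔ JF K h p (q - 1) = JF K h (p + 1) (q - 1) := by
  apply le_antisymm
  · exact sup_le (JF_mono le_rfl (by omega)) (JF_mono (by omega) le_rfl)
  · intro s hs
    refine mem_of_mono h fun x hx hC r' hr' => ?_
    have := hs x hx
    simp only [Fc, Nat.add_sub_cancel, not_and] at this
    by_cases h1 : eA m n p x = 0
    · exact Submodule.mem_sup_right ((chi_JF hr').2 fun hF => this h1 hF.2)
    · exact Submodule.mem_sup_left ((chi_JF hr').2 fun hF => h1 hF.1)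

lemma J_two {h : Lad m n Y} {p q : ℕ} (hp : (p, q) ∈ Y) (hno : (p + 1, q) ∉ Y) {r : LadderRing K 2 Y} (hr : phi K h r = chi (edge m n (p, q))) :
    JF K h p q ⊔ Ideal.span {r} = JF K h p (q - 1) := by
  have g := h.grid hp
  rw [J_both hp hr]
  refine inf_eq_right.2 fun s hs => ?_
  intro x hx hF
  have hC : x ∈ Cone m n Y := (h.phi_range K _).1 ⟨s, rfl⟩ x hx
  have h2 := hs x hx
  simp only [Fc, Nat.add_sub_cancel, not_and] at hF h2
  have k3 := cone_monoA hC (show p - 1 ≤ p by omega)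
  have k5 := cone_A hC (p - 1)
  have k4 := cone_B hC (q - 1)
  simp only at k3
  have h3 := h2 (by omega)
  obtain ⟨p', q', f⟩ := exists_FL hC (by omega)
  have e1 : p < p' := by
    by_contra hcon
    have := cone_monoA hC (not_lt.1 hcon)
    have := f.a1
    simp only at *; omega
  have e2 : q' = q := by
    rcases lt_trichotomy q' q with k | k | k
    · have := cone_monoB hC (show q' ≤ q - 1 by omega)
      have := f.b0
      simp only at *; omega
    · exact k
    · have := cone_monoB hC (show q ≤ q' - 1 by omega)
      have := f.b1
      simp only at *; omega
  subst e2
  exact hno (h.col hp (h.FL_mem hC f) (by omega) (by omega))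

lemma J_one {h : Lad m n Y} {p q : ℕ} (hp : (p, q) ∈ Y) (hno : (p, q - 1) ∉ Y) {r : LadderRing K 2 Y} (hr : phi K h r = chi (edge m n (p, q))) :
    JF K h p q ⊔ Ideal.span {r} = JF K h (p + 1) q := by
  have g := h.grid hp
  rw [J_both hp hr]
  refine inf_eq_left.2 fun s hs => ?_
  intro x hx hF
  have hC : x ∈ Cone m n Y := (h.phi_range K _).1 ⟨s, rfl⟩ x hx
  have h2 := hs x hx
  simp only [Fc, Nat.add_sub_cancel, not_and] at hF h2
  have k3 := cone_monoB hC (show q - 1 ≤ q by omega)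
  have k5 := cone_B hC q
  have k4 := cone_A hC p
  simp only at k3
  have h3 : eA m n p x ≠ 0 := fun e => h2 e (by omega)
  obtain ⟨p', q', f⟩ := exists_FL hC (by omega)
  have e1 : q' < q := by
    by_contra hcon
    have := cone_monoB hC (show q - 1 ≤ q' - 1 by omega)
    have := f.b1
    simp only at *; omega
  have e2 : p' = p := by
    rcases lt_trichotomy p' p with k | k | k
    · have := cone_monoA hC (show p' ≤ p - 1 by omega)
      have := f.a1
      simp only at *; omega
    · exact k
    · have := cone_monoA hC (show p ≤ p' - 1 by omega)
      have := f.a0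
      simp only at *; omega
  subst e2
  exact hno (h.row (h.FL_mem hC f) hp (by omega) (by omega))

end

end

section

section
variable {m n : ℕ} {Y : Set (ℕ × ℕ)} {K : Type} [Field K]

open Classical in
/-- the positions of a diagonal -/
noncomputable def dg (h : Lad m n Y) (s : ℕ) : Finset (ℕ × ℕ) :=
  (Set.finite_coe_iff.1 h.finY).toFinset.filter fun p => p.1 + n = p.2 + s

lemma mem_dg {h : Lad m n Y} {s i j : ℕ} : (i, j) ∈ dg h s ↔ (i, j) ∈ Y ∧ i + n = j + s := by simp [dg]

lemma exists_th (K : Type) [Field K] (h : Lad m n Y) (s : ℕ) : ∃ r, phi K h r = ∑ p ∈ dg h s, chi (edge m n p) := by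
  refine (h.phi_range K _).2 (SuppIn.sum _ _ fun ⟨i, j⟩ hp => SuppIn.single (h.edge_cone (mem_dg.1 hp).1))

/-- diagonal sums -/
noncomputable def th (K : Type) [Field K] (h : Lad m n Y) (s : ℕ) : LadderRing K 2 Y := (exists_th K h s).choose
lemma th_spec (h : Lad m n Y) (s : ℕ) : phi K h (th K h s) = ∑ p ∈ dg h s, chi (edge m n p) := (exists_th K h s).choose_spec

/-- list of diagonal sums -/
noncomputable def thl (K : Type) [Field K] (h : Lad m n Y) : ℕ → ℕ → List (LadderRing K 2 Y)
  | _, 0 => []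
  | s, k + 1 => th K h s :: thl K h (s + 1) k

lemma thl_length (h : Lad m n Y) (k : ℕ) : ∀ s, (thl K h s k).length = k := by
  induction k with
  | zero => intro s; rfl
  | succ k ih => intro s; simp [thl, ih]

lemma mem_thl (h : Lad m n Y) (k : ℕ) : ∀ s x, x ∈ thl K h s k → ∃ t, s ≤ t ∧ t < s + k ∧ x = th K h t := by
  induction k with
  | zero => intro s x hx; simp [thl] at hx
  | succ k ih =>
    intro s x hx
    rcases List.mem_cons.1 hx with rfl | hx
    · exact ⟨s, le_rfl, by omega, rfl⟩
    · obtain ⟨t, h1, h2, h3⟩ := ih _ _ hx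
      exact ⟨t, by omega, by omega, h3⟩

lemma th_sub {h : Lad m n Y} {p q s : ℕ} (hp : (p, q) ∈ Y) (hs : p + n = q + s) {r : LadderRing K 2 Y} (hr : phi K h r = chi (edge m n (p, q))) :
    th K h s - r ∈ JF K h p q := by
  classical
  change SuppIn (phi K h (th K h s - r)) _
  rw [map_sub, th_spec, hr, ← Finset.add_sum_erase _ _ (mem_dg.2 ⟨hp, hs⟩), add_sub_cancel_left]
  refine SuppIn.sum _ _ fun ⟨i, j⟩ hij => SuppIn.single ?_
  rw [Finset.mem_erase, mem_dg, Ne, Prod.mk.injEq] at hij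
  rw [Set.mem_setOf_eq, Fc_edge (h.grid hij.2.1)]
  omega

lemma th_mem {h : Lad m n Y} {p q s : ℕ} (hs : q + s < p + n) : th K h s ∈ JF K h p q := by
  change SuppIn (phi K h (th K h s)) _
  rw [th_spec]
  refine SuppIn.sum _ _ fun ⟨i, j⟩ hij => SuppIn.single ?_
  rw [mem_dg] at hij
  rw [Set.mem_setOf_eq, Fc_edge (h.grid hij.1)]
  omega

lemma Lad.next (h : Lad m n Y) {p q : ℕ} (hp : (p, q) ∈ Y) (hne : ¬ (p = m ∧ q = 1)) : (p + 1, q) ∈ Y ∨ (p, q - 1) ∈ Y := by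
  have g := h.grid hp
  by_cases hm : p < m
  · obtain ⟨j, j', h0, h1, h2, h3, h4⟩ := h.c1 p (by omega) hm
    rcases lt_trichotomy q j with k | k | k
    · exact Or.inl (h.sq hp h3 (by omega) (by omega)).2
    · subst k; exact Or.inl h3
    · exact Or.inr (h.row h1 hp (by omega) (by omega))
  · have : p = m := by omega
    subst this
    exact Or.inr (h.row h.sw hp (by omega) (by omega))

lemma reg_aux (h : Lad m n Y) (k : ℕ) : ∀ p q, (p, q) ∈ Y → m + q = p + k → RegI (JF K h p q) (thl K h (p + n - q) k) := by
  induction k using Nat.strong_induction_on with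
  | _ k ih =>
  intro p q hp hk
  have g := h.grid hp
  obtain ⟨k, rfl⟩ : ∃ k', k = k' + 1 := ⟨k - 1, by omega⟩
  obtain ⟨r, hr⟩ := exists_x K h hp
  have hs := th_sub (s := p + n - q) hp (by omega) hr
  refine ⟨fun t ht => x_reg hp hr (s := t) ?_, ?_⟩
  · have := (JF K h p q).sub_mem ht ((JF K h p q).mul_mem_right t hs)
    convert this using 1; ring
  · have e : JF K h p q ⊔ Ideal.span {th K h (p + n - q)} = JF K h p q ⊔ Ideal.span {r} := by
      apply le_antisymm
      · refine sup_le le_sup_left ((Ideal.span_singleton_le_iff_mem _).2 (Submodule.mem_sup.2 ⟨_, hs, r, Ideal.mem_span_singleton_self r, by ring⟩))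
      · refine sup_le le_sup_left ((Ideal.span_singleton_le_iff_mem _).2 (Submodule.mem_sup.2 ⟨_, (JF K h p q).neg_mem hs, _, Ideal.mem_span_singleton_self _, by ring⟩))
    rw [e]
    by_cases hlast : p = m ∧ q = 1
    · have : k = 0 := by omega
      subst this; trivial
    by_cases h1 : (p + 1, q) ∈ Y
    · have r1 := ih k (by omega) (p + 1) q h1 (by omega)
      rw [show p + 1 + n - q = p + n - q + 1 by omega] at r1
      by_cases h2 : (p, q - 1) ∈ Y
      · have g1 := h.grid h1
        have g2 := h.grid h2
        have r2 := ih k (by omega) p (q - 1) h2 (by omega)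
        rw [show p + n - (q - 1) = p + n - q + 1 by omega] at r2
        obtain ⟨k, rfl⟩ : ∃ k', k = k' + 1 := ⟨k - 1, by omega⟩
        have r3 := ih k (by omega) (p + 1) (q - 1) (h.sq h2 h1 (by omega) (by omega)).2 (by omega)
        rw [show p + 1 + n - (q - 1) = p + n - q + 1 + 1 by omega, ← J_sup] at r3
        rw [J_both hp hr]
        refine regI_step r1 r2 r3 ?_
        rw [J_sup]
        exact th_mem (by omega)
      · rw [J_one hp h2 hr]; exact r1
    · have h2 := (h.next hp hlast).resolve_left h1
      have g2 := h.grid h2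
      have r2 := ih k (by omega) p (q - 1) h2 (by omega)
      rw [show p + n - (q - 1) = p + n - q + 1 by omega] at r2
      rw [J_two hp h1 hr]; exact r2

lemma Lad.regl (K : Type) [Field K] (h : Lad m n Y) : RegI ⊥ (thl K h 1 (m + n - 1)) := by
  have := reg_aux (K := K) h (m + n - 1) 1 n h.ne (by have := h.hm; omega)
  rw [show 1 + n - n = 1 by omega] at this
  have e : JF K h 1 n = ⊥ := by
    rw [eq_bot_iff]
    intro r hr
    rw [Ideal.mem_bot]
    apply h.phi_inj K
    rw [map_zero]
    ext x
    by_contra hx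
    exact hr x hx ⟨eA_zero x, eAB x⟩
  rwa [e] at this

/-- every diagonal meets the ladder -/
lemma Lad.diag (h : Lad m n Y) (k : ℕ) : k + 1 < m + n → ∃ p q, (p, q) ∈ Y ∧ p + n = q + (k + 1) := by
  induction k with
  | zero => exact fun _ => ⟨1, n, h.ne, by omega⟩
  | succ k ih =>
    intro hk
    obtain ⟨p, q, h1, h2⟩ := ih (by omega)
    have g := h.grid h1
    rcases h.next h1 (by omega) with h3 | h3
    · exact ⟨_, _, h3, by omega⟩
    · have g := h.grid h3
      exact ⟨_, _, h3, by omega⟩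

lemma Lad.thl_deg (h : Lad m n Y) (x : LadderRing K 2 Y) (hx : x ∈ thl K h 1 (m + n - 1)) :
    SuppIn (phi K h x) {y | eA m n m y = 1} ∧ phi K h x ≠ 0 := by
  obtain ⟨t, h1, h2, rfl⟩ := mem_thl h _ _ _ hx
  constructor
  · rw [th_spec]
    refine SuppIn.sum _ _ fun ⟨i, j⟩ hij => SuppIn.single ?_
    have g := h.grid (mem_dg.1 hij).1
    rw [Set.mem_setOf_eq, eA_edge g, if_pos (by omega)]
  · obtain ⟨p, q, h3, h4⟩ := h.diag (t - 1) (by omega)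
    obtain ⟨r, hr⟩ := exists_x K h h3
    have h5 := th_sub (s := t) h3 (by omega) hr
    intro h0
    have : r ∈ JF K h p q := by
      have h6 : th K h t = 0 := h.phi_inj K (by rw [h0, map_zero])
      rw [h6, zero_sub] at h5
      exact (JF K h p q).neg_mem_iff.1 h5
    rw [chi_JF hr, Fc_edge (h.grid h3)] at this
    exact this ⟨le_rfl, le_rfl⟩

end

end

section

section A
variable {K : Type} [Field K] {M : Type} [AddCommGroup M]
local notation "L" => AddMonoidAlgebra K M
variable {R : Type} [CommRing R] [Algebra R (AddMonoidAlgebra K M)] {ι : Type}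
    {w : ι → M →+ ℤ}

lemma le_extI (l : List R) : ∀ J : Ideal R, J ≤ extI J l := by
  induction l with
  | nil => intro J; exact le_rfl
  | cons x l ih => intro J; exact le_sup_left.trans (ih _)
lemma mem_extI (l : List R) : ∀ J : Ideal R, ∀ x ∈ l, x ∈ extI J l := by
  induction l with
  | nil => intro J x hx; simp at hx
  | cons y l ih =>
    intro J x hx
    rcases List.mem_cons.1 hx with rfl | hx
    · exact le_extI l _ (Submodule.mem_sup_right (Ideal.mem_span_singleton_self _))
    · exact ih _ x hx

/-- degree filtration -/
noncomputable def MR.Dg (h : MR K M R w) {deg : M →+ ℤ} (hd : Gd w deg) (N : ℤ) : Ideal R where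
  carrier := {r | SuppIn (algebraMap R L r) {m | N ≤ deg m}}
  zero_mem' := by simp only [Set.mem_setOf_eq, map_zero]; exact SuppIn.zero _
  add_mem' ha hb := by simp only [Set.mem_setOf_eq, map_add] at *; exact ha.add hb
  smul_mem' c x hx := by
    simp only [Set.mem_setOf_eq, smul_eq_mul, map_mul] at *
    refine (h.supp c).mul hx fun a ha b hb => ?_
    have := hd.nonneg a ha
    simp only [Set.mem_setOf_eq, map_add] at *
    omega

lemma MR.Dg_split (h : MR K M R w) {deg : M →+ ℤ} (hd : Gd w deg) (r : R) :
    ∃ (c : K) (s t : R), r = s + t ∧ algebraMap R L s = AddMonoidAlgebra.single 0 c ∧ t ∈ h.Dg hd 1 := by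
  obtain ⟨s, hs⟩ := (h.range (AddMonoidAlgebra.single 0 ((algebraMap R L r).coeff 0))).2 (SuppIn.single (by simp [box]))
  refine ⟨_, s, r - s, by ring, hs, ?_⟩
  intro m hm
  have hm' : m ∈ box w 0 := h.supp _ m hm
  have h0 := hd.nonneg m hm'
  by_contra hcon
  simp only [Set.mem_setOf_eq] at hcon
  have : m = 0 := hd.zero m hm' (by omega)
  subst this
  apply hm
  rw [map_sub, hs]
  simp [AddMonoidAlgebra.coeff_single]

lemma MR.gor [IsDomain L] [Finite ι] [IsNoetherianRing R] (h : MR K M R w) {deg : M →+ ℤ} (hd : Gd w deg)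
    (hR : FID R R) (l : List R) (hl : RegI ⊥ l)
    (hl1 : ∀ x ∈ l, SuppIn (algebraMap R L x) {m | deg m = 1} ∧ algebraMap R L x ≠ 0) (σ : ℕ)
    (hσ : ∀ j > σ, PowerSeries.coeff (R := ℤ) j
      (cs w deg 0 0 * (1 - PowerSeries.X : PowerSeries ℤ) ^ l.length) = 0) :
    PowerSeries.coeff (R := ℤ) σ (cs w deg 0 0 * (1 - PowerSeries.X : PowerSeries ℤ) ^ l.length) ≤ 1 := by
  set R0 := Mon K R (box w 0) with hR0
  set J := extI ⊥ l with hJ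
  have hfinR : ∀ d, Module.Finite K (h.gr deg R0 d) := fun d => h.gr_finite deg 0 d (hd.fin 0 d)
  have hRg : Hg deg R0 := h.hg_box deg 0
  have eR : J • R0 = exl R0 ⊥ l := by rw [hJ, extI_smul, Submodule.bot_smul]
  have sR : h.hs deg R0 (J • R0) 0 = cs w deg 0 0 * (1 - PowerSeries.X) ^ l.length := by
    rw [eR, h.hs_list deg hRg 0 ?_ hfinR l (Hg.bot deg) bot_le hl1 ?_, h.hs_bot hd]
    · intro f hf
      ext m
      by_contra hm
      have h1 : 0 ≤ deg m := hd.nonneg m ((h.mem_box f).1 hf.1 m hm)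
      have h2 : deg m = 0 - 1 := hf.2 m hm
      omega
    · have := RegI.regL h l hl
      rwa [Submodule.bot_smul] at this
  rw [← sR] at hσ ⊢
  have fz : ∀ (X : Submodule R L) (d : ℤ), Module.finrank K (h.gr deg X (0 + d)) =
      Module.finrank K (h.gr deg X d) := fun X d => by rw [zero_add]
  simp only [MR.hs, PowerSeries.coeff_mk, fz] at hσ ⊢
  have gle : ∀ (X : Submodule R L) (d : ℤ), h.gr deg (J • X) d ≤ h.gr deg X d :=
    fun X d f hf => ⟨Submodule.smul_le_right hf.1, hf.2⟩
  have hA : ∀ j > (σ : ℤ), ∀ r : R, SuppIn (algebraMap R L r) {m | deg m = j} → r ∈ J := by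
    intro j hj r hr
    have h1 := hσ j.toNat (by omega)
    rw [Int.toNat_of_nonneg (by omega)] at h1
    have h2 : h.gr deg (J • R0) j = h.gr deg R0 j := by
      have := hfinR j
      exact Submodule.eq_of_le_of_finrank_eq (gle _ _) (by omega)
    have h3 : algebraMap R L r ∈ h.gr deg R0 j := ⟨(h.mem_box _).2 (h.supp r), hr⟩
    rw [← h2] at h3
    exact (h.mem_J J r).1 h3.1
  have hB : h.Dg hd (σ + 1) ≤ J := by
    intro r hr
    rw [← h.mem_J J r]
    refine mem_of_comps (deg := deg) fun k => ?_
    obtain ⟨s, hs⟩ := h.rcomp deg r k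
    rw [← hs, h.mem_J]
    by_cases hk : k > σ
    · exact hA k hk s (by rw [hs]; exact comp_supp _ _ _)
    · have : s = 0 := h.inj (by
        rw [hs, map_zero]
        ext m
        by_contra hm
        have h1 := comp_supp deg k _ m hm
        have h2 := comp_suppIn deg k hr m hm
        simp only [Set.mem_setOf_eq] at h1 h2
        omega)
      rw [this]; exact J.zero_mem
  have hmax : (h.Dg hd 1).IsMaximal := by
    rw [Ideal.isMaximal_iff]
    constructor
    · intro h1
      have h1 : SuppIn (algebraMap R L 1) {m | 1 ≤ deg m} := h1
      have := h1 0 (by simp [AddMonoidAlgebra.coeff_single, AddMonoidAlgebra.one_def])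
      simp at this
    · intro I r hI hr hrI
      obtain ⟨c, s, t, e, hs, ht⟩ := h.Dg_split hd r
      have hc : c ≠ 0 := by
        rintro rfl
        have : s = 0 := h.inj (by rw [hs, map_zero]; simp)
        rw [e, this, zero_add] at hr
        exact hr ht
      obtain ⟨s', hs'⟩ := (h.range (AddMonoidAlgebra.single 0 c⁻¹)).2 (SuppIn.single (by simp [box]))
      have h1 : s' * s = 1 := h.inj (by
        rw [map_mul, hs, hs', map_one, AddMonoidAlgebra.single_mul_single, inv_mul_cancel₀ hc, add_zero]; rfl)
      rw [← h1]
      refine I.mul_mem_left _ ?_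
      have := I.sub_mem hrI (hI ht)
      rwa [e, add_sub_cancel_right] at this
  have hpow : ∀ N : ℕ, h.Dg hd 1 ^ N ≤ h.Dg hd N := by
    intro N
    induction N with
    | zero => intro r _ m hm; simpa using hd.nonneg m (h.supp r m hm)
    | succ N ih =>
      rw [pow_succ]
      refine Ideal.mul_le.2 fun r hr s hs => ?_
      change SuppIn (algebraMap R L (r * s)) _
      rw [map_mul]
      refine SuppIn.mul (ih hr) hs fun a ha b hb => ?_
      simp only [Set.mem_setOf_eq, map_add] at *
      push_cast; omega
  have hsoc : ∀ u : R, SuppIn (algebraMap R L u) {m | deg m = σ} → ∀ r ∈ h.Dg hd 1, r * u ∈ J := by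
    intro u hu r hr
    apply hB
    change SuppIn (algebraMap R L (r * u)) _
    rw [map_mul]
    refine SuppIn.mul hr hu fun a ha b hb => ?_
    simp only [Set.mem_setOf_eq, map_add] at *
    omega
  by_cases hex : ∃ u : R, SuppIn (algebraMap R L u) {m | deg m = σ} ∧ u ∉ J
  · obtain ⟨u, hu, huJ⟩ := hex
    have key : h.gr deg R0 σ ≤ h.gr deg (J • R0) σ ⊔ Submodule.span K {algebraMap R L u} := by
      intro f hf
      obtain ⟨v, rfl⟩ := (h.range f).2 ((h.mem_box _).1 hf.1)
      obtain ⟨a, ha⟩ := fidR hR l hl _ hmax (σ + 1) (by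
        refine (hpow _).trans (le_trans (le_of_eq ?_) hB); push_cast; rfl) u v huJ (hsoc u hu) (hsoc v hf.2) (fun x hx => by
          refine (hl1 x hx).1.mono fun m hm => ?_
          exact le_of_eq (Eq.symm hm)) (mem_extI l _)
      obtain ⟨c, s, t, e, hs, ht⟩ := h.Dg_split hd a
      have h1 : v - s * u ∈ J := by
        have := J.add_mem ha (hsoc u hu t ht)
        rw [e] at this
        convert this using 1; ring
      have h2 : algebraMap R L (s * u) = c • algebraMap R L u := by
        rw [map_mul, hs]
        ext m
        simp
      refine Submodule.mem_sup.2 ⟨algebraMap R L (v - s * u), ⟨(h.mem_J J _).2 h1, ?_⟩, c • algebraMap R L u, Submodule.smul_mem _ _ (Submodule.mem_span_singleton_self _), ?_⟩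
      · rw [map_sub, h2]; exact hf.2.sub (hu.smul c)
      · rw [map_sub, h2]; abel
    have := hfinR σ
    have hf1 : Module.Finite K (h.gr deg (J • R0) σ) := Module.Finite.of_injective (Submodule.inclusion (gle R0 σ)) (Submodule.inclusion_injective _)
    have h1 := Submodule.finrank_mono key
    have h2 := Submodule.finrank_add_le_finrank_add_finrank (h.gr deg (J • R0) σ) (Submodule.span K {algebraMap R L u})
    have h3 : Module.finrank K (Submodule.span K {algebraMap R L u}) ≤ 1 := (finrank_span_le_card (R := K) ({algebraMap R L u} : Set L)).trans (by simp)
    omega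
  · push Not at hex
    have : h.gr deg R0 σ = h.gr deg (J • R0) σ := by
      refine le_antisymm (fun f hf => ⟨?_, hf.2⟩) (gle _ _)
      obtain ⟨v, rfl⟩ := (h.range f).2 ((h.mem_box _).1 hf.1)
      exact (h.mem_J J v).2 (hex v hf.2)
    rw [this]; simp

end A

end

section

section A
open PowerSeries

lemma coeff_oneX (f : PowerSeries ℤ) (j : ℕ) : coeff (j + 1) ((1 - X) * f) = coeff (j + 1) f - coeff j f := by
  rw [sub_mul, one_mul, map_sub, coeff_succ_X_mul]
lemma coeff_oneX0 (f : PowerSeries ℤ) : coeff 0 ((1 - X) * f) = coeff 0 f := by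
  simp [sub_mul]

/-- product series -/
noncomputable def sgr (p q s t : ℕ) : PowerSeries ℤ := mk fun d => (Nat.multichoose p (d + s) * Nat.multichoose q (d + t) : ℕ)

lemma sgr_comm (p q s t : ℕ) : sgr p q s t = sgr q p t s := by
  ext d; simp [sgr, mul_comm]

lemma mc_inv (N : ℕ) : (mk fun d => (Nat.multichoose N d : ℤ)) * (1 - X) ^ N = 1 := by
  induction N with
  | zero =>
    ext d; rw [pow_zero, mul_one]; cases d <;> simp [coeff_one]
  | succ N ih =>
    suffices e : (1 - X) * (mk fun d => (Nat.multichoose (N + 1) d : ℤ)) = mk fun d => (Nat.multichoose N d : ℤ) by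
      refine Eq.trans ?_ ih; rw [← e]; ring
    ext d
    cases d with
    | zero => rw [coeff_oneX0]; simp
    | succ d => rw [coeff_oneX]; simp [Nat.multichoose_succ_succ]

lemma sgr_rec (p q k : ℕ) : (1 - X) * sgr (p + 1) (q + 1) 0 k = sgr p (q + 1) 0 k + sgr (p + 1) q 0 k - sgr p q 0 k := by
  ext d
  cases d with
  | zero => rw [coeff_oneX0]; simp [sgr]
  | succ d =>
    rw [coeff_oneX]
    have : d + 1 + k = (d + k) + 1 := by ring
    simp only [sgr, add_zero, map_sub, map_add, coeff_mk, this, Nat.multichoose_succ_succ]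
    push_cast; ring

lemma sgr_one (p k : ℕ) : sgr p 1 0 k * (1 - X) ^ p = 1 := by
  refine Eq.trans ?_ (mc_inv p); congr 1; ext d; simp [sgr]

lemma sgr_base (k q : ℕ) : sgr (k + 1) (q + 1) 0 k * (1 - X) ^ (k + 1 + q) = C ((q + k).choose k : ℤ) := by
  have : sgr (k + 1) (q + 1) 0 k = C ((q + k).choose k : ℤ) * mk fun d => (Nat.multichoose (k + 1 + q) d : ℤ) := by
    ext d
    rw [coeff_C_mul]
    simp only [sgr, coeff_mk, add_zero, Nat.multichoose_eq]
    rw [show k + 1 + d - 1 = k + d by omega, show q + 1 + (d + k) - 1 = q + k + d by omega, show k + 1 + q + d - 1 = q + k + d by omega]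
    norm_cast
    have := Nat.choose_mul (n := q + k + d) (k := d + k) (s := d) (by omega)
    rw [show q + k + d - d = q + k by omega, show d + k - d = k by omega] at this
    rw [add_comm k d]; linarith
  rw [this, mul_assoc, mc_inv, mul_one]

lemma sgr_coeff (k : ℕ) : ∀ N t q j : ℕ, t + q ≤ N →
    coeff (R := ℤ) j (sgr (t + k + 1) (q + 1) 0 k * (1 - X) ^ (t + k + 1 + q)) = ((t.choose j * (q + k).choose (j + k) : ℕ) : ℤ) := by
  intro N
  induction N with
  | zero =>
    intro t q j h
    obtain ⟨rfl, rfl⟩ : t = 0 ∧ q = 0 := by omega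
    have := sgr_base k 0
    simp only [zero_add] at this ⊢
    rw [this, coeff_C]
    cases j <;> simp
  | succ N ih =>
    intro t q j h
    rcases q with _ | q
    · rw [add_zero, zero_add, sgr_one, coeff_one]
      cases j with
      | zero => simp
      | succ j => rw [Nat.choose_eq_zero_of_lt (show 0 + k < j + 1 + k by omega)]; simp
    rcases t with _ | t
    · rw [zero_add, sgr_base, coeff_C]
      cases j <;> simp
    have e : sgr (t + 1 + k + 1) (q + 1 + 1) 0 k * (1 - X) ^ (t + 1 + k + 1 + (q + 1)) =
        sgr (t + k + 1) (q + 1 + 1) 0 k * (1 - X) ^ (t + k + 1 + (q + 1)) + sgr (t + 1 + k + 1) (q + 1) 0 k * (1 - X) ^ (t + 1 + k + 1 + q)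
        - (1 - X) * (sgr (t + k + 1) (q + 1) 0 k * (1 - X) ^ (t + k + 1 + q)) := by
      have := sgr_rec (t + k + 1) (q + 1) k
      rw [show t + 1 + k + 1 = t + k + 1 + 1 by ring]
      linear_combination (1 - X) ^ (t + k + 1 + 1 + q) * this
    rw [e, map_sub, map_add, ih t (q + 1) j (by omega), ih (t + 1) q j (by omega)]
    cases j with
    | zero => 
      rw [coeff_oneX0, ih t q 0 (by omega)]; simp
    | succ j =>
      rw [coeff_oneX, ih t q _ (by omega), ih t q _ (by omega)]
      rw [show q + 1 + k = (q + k) + 1 by ring, show j + 1 + k = (j + k) + 1 by ring]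
      simp only [Nat.choose_succ_succ]
      push_cast; ring

lemma cmul (r a b : ℕ) : (r + a + b).choose r ≤ (r + a).choose r * (r + b).choose r ∧ (1 ≤ a → 1 ≤ b → 1 ≤ r → (r + a + b).choose r < (r + a).choose r * (r + b).choose r) := by
  induction r with
  | zero => simp
  | succ r ih =>
    have h1 := Nat.add_one_mul_choose_eq (r + a) r
    have h2 := Nat.add_one_mul_choose_eq (r + b) r
    have h3 := Nat.add_one_mul_choose_eq (r + a + b) r
    rw [show r + 1 + a = r + a + 1 by ring, show r + 1 + b = r + b + 1 by ring, show r + a + 1 + b = r + a + b + 1 by ring]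
    set x := (r + a + 1).choose (r + 1)
    set y := (r + b + 1).choose (r + 1)
    set z := (r + a + b + 1).choose (r + 1)
    set x' := (r + a).choose r
    set y' := (r + b).choose r
    set z' := (r + a + b).choose r
    have e1 : (r + 1) * (r + 1) * (x * y) = (r + a + 1) * (r + b + 1) * (x' * y') := by
      calc _ = (x * (r + 1)) * (y * (r + 1)) := by ring
        _ = _ := by rw [← h1, ← h2]; ring
    have e2 : (r + 1) * (r + 1) * z = (r + 1) * (r + a + b + 1) * z' := by
      calc _ = (r + 1) * (z * (r + 1)) := by ring
        _ = _ := by rw [← h3]; ring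
    have hz : 0 < z' := Nat.choose_pos (by omega)
    constructor
    · refine Nat.le_of_mul_le_mul_left (c := (r + 1) * (r + 1)) ?_ (by positivity)
      rw [e1, e2]
      exact Nat.mul_le_mul (by nlinarith) ih.1
    · intro ha hb _
      refine Nat.lt_of_mul_lt_mul_left (a := (r + 1) * (r + 1)) ?_
      rw [e1, e2]
      calc _ < (r + a + 1) * (r + b + 1) * z' := Nat.mul_lt_mul_of_pos_right (by nlinarith) hz
        _ ≤ _ := Nat.mul_le_mul le_rfl ih.1

/-- numerical Segre -/
lemma seg_num {m n s t : ℕ} (hm : 2 ≤ m) (hmn : m ≤ n) (h0 : s = 0 ∨ t = 0) (h1 : s ≠ t)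
    (hV : ((n - 1).choose (m - 1) : ℤ) = (Nat.multichoose m s * Nat.multichoose n t : ℕ) * coeff (m - 1) (sgr m n s t * (1 - X) ^ (m + n - 1))) :
    s = t + (n - m) := by
  have hpos : 0 < (n - 1).choose (m - 1) := Nat.choose_pos (by omega)
  have hdvd : Nat.multichoose m s * Nat.multichoose n t ≤ (n - 1).choose (m - 1) := by
    apply Nat.le_of_dvd hpos
    exact_mod_cast Dvd.intro _ hV.symm
  rcases h0 with rfl | rfl
  · exfalso
    rcases Nat.lt_or_ge t m with h | h
    · have := sgr_coeff t _ (m - 1 - t) (n - 1) (m - 1) le_rfl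
      rw [show m - 1 - t + t + 1 = m by omega, show n - 1 + 1 = n by omega, show m + (n - 1) = m + n - 1 by omega] at this
      rw [this, Nat.choose_eq_zero_of_lt (show m - 1 - t < m - 1 by omega)] at hV
      simp at hV; omega
    · rw [Nat.multichoose_zero_right, one_mul, Nat.multichoose_eq] at hdvd
      have h3 : (n + m - 1).choose m ≤ (n + t - 1).choose t := by
        rw [← Nat.choose_symm (show m ≤ n + m - 1 by omega), ← Nat.choose_symm (show t ≤ n + t - 1 by omega),
          show n + m - 1 - m = n - 1 by omega, show n + t - 1 - t = n - 1 by omega]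
        exact Nat.choose_le_choose _ (by omega)
      have h4 : (n + m - 2).choose (m - 1) + (n + m - 2).choose m = (n + m - 1).choose m := by
        have := Nat.choose_succ_succ (n + m - 2) (m - 1)
        simp only [Nat.succ_eq_add_one] at this
        rw [show n + m - 2 + 1 = n + m - 1 by omega, show m - 1 + 1 = m by omega] at this
        omega
      have h5 : (n - 1).choose (m - 1) ≤ (n + m - 2).choose (m - 1) := Nat.choose_le_choose _ (by omega)
      have h6 : 0 < (n + m - 2).choose m := Nat.choose_pos (by omega)
      omega
  · rw [zero_add]
    have hlow : Nat.multichoose m s = (m - 1 + s).choose (m - 1) := by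
      rw [Nat.multichoose_eq, ← Nat.choose_symm (by omega)]; congr 1 <;> omega
    rcases Nat.lt_or_ge s n with h | h
    · have := sgr_coeff s _ (n - 1 - s) (m - 1) (m - 1) le_rfl
      rw [show n - 1 - s + s + 1 = n by omega, show m - 1 + 1 = m by omega, show n + (m - 1) = m + n - 1 by omega, sgr_comm] at this
      rw [this, Nat.choose_self, mul_one, Nat.multichoose_zero_right, mul_one, hlow] at hV
      norm_cast at hV
      rcases Nat.lt_or_ge (n - m) s with h2 | h2
      · rw [Nat.choose_eq_zero_of_lt (show n - 1 - s < m - 1 by omega)] at hV; omega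
      · by_contra hne
        have := (cmul (m - 1) s (n - m - s)).2 (by omega) (by omega) (by omega)
        rw [show m - 1 + s + (n - m - s) = n - 1 by omega, show m - 1 + (n - m - s) = n - 1 - s by omega] at this
        omega
    · exfalso
      rw [Nat.multichoose_zero_right, mul_one, hlow] at hdvd
      have h5 : n.choose (m - 1) ≤ (m - 1 + s).choose (m - 1) := Nat.choose_le_choose _ (by omega)
      have h4 := Nat.choose_succ_succ (n - 1) (m - 2)
      simp only [Nat.succ_eq_add_one] at h4
      rw [show n - 1 + 1 = n by omega, show m - 2 + 1 = m - 1 by omega] at h4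
      have h6 : 0 < (n - 1).choose (m - 2) := Nat.choose_pos (by omega)
      omega
end A

end

section

section A
open PowerSeries
variable {m n : ℕ} {Y : Set (ℕ × ℕ)} (K : Type) [Field K]

/-- the numerator series of a monomial module -/
noncomputable def hnum (m n : ℕ) (Y : Set (ℕ × ℕ)) (a : Fac → ℤ) (δ : ℤ) : PowerSeries ℤ :=
  cs (wY m n Y) (eA m n m) (fun f => a f.1) δ * (1 - X) ^ (m + n - 1)

lemma Lad.Vl (h : Lad m n Y) (a : Fac → ℤ) (hs : Sd K h a) (δ : ℤ)
    (hδ : ∀ x ∈ box (wY m n Y) (fun f => a f.1), δ ≤ eA m n m x)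
    (hδ' : ∃ x ∈ box (wY m n Y) (fun f => a f.1), eA m n m x = δ) (σ : ℕ)
    (hσ : ∀ j > σ, coeff j (hnum m n Y (fun _ => 0) 0) = 0) :
    coeff σ (hnum m n Y (fun _ => 0) 0) =
      ({x | x ∈ box (wY m n Y) (fun f => a f.1) ∧ eA m n m x = δ}.ncard : ℤ) * coeff σ (hnum m n Y a δ) := by
  haveI i1 : Fact (Lad m n Y) := ⟨h⟩
  haveI := h.noeth K
  haveI := h.finFct
  haveI : IsDomain (AddMonoidAlgebra K (LM m n)) := dom_L _ _
  have hl : (thl K h 1 (m + n - 1)).length = m + n - 1 := thl_length h _ _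
  have := (MR.V (h.mr K) h.gd (fun f => a f.1) hs (thl K h 1 (m + n - 1)) (Lad.regl K h)
    (fun x hx => h.thl_deg x hx) δ hδ hδ' σ (by rw [hl]; exact hσ)).2
  rw [hl] at this; exact this

lemma Lad.gl (h : Lad m n Y) (a : Fac → ℤ) (hD : DD m n a = 0) (hd : ∀ f, Val m n Y f → isC f → dd m a f = 0)
    (hf : Fi K h a) (σ : ℕ) (hσ : ∀ j > σ, coeff j (hnum m n Y (fun _ => 0) 0) = 0) :
    coeff σ (hnum m n Y (fun _ => 0) 0) ≤ 1 := by
  haveI i1 : Fact (Lad m n Y) := ⟨h⟩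
  haveI := h.noeth K
  haveI := h.finFct
  haveI : IsDomain (AddMonoidAlgebra K (LM m n)) := dom_L _ _
  have hl : (thl K h 1 (m + n - 1)).length = m + n - 1 := thl_length h _ _
  obtain ⟨e⟩ := h.fin_reg K a hD hd
  have := MR.gor (h.mr K) h.gd (FID.congr e.symm hf) (thl K h 1 (m + n - 1)) (Lad.regl K h)
    (fun x hx => h.thl_deg x hx) σ (by rw [hl]; exact hσ)
  rw [hl] at this; exact this

lemma Lad.Sd_cls (h : Lad m n Y) (a b : Fac → ℤ) (hD : DD m n a = DD m n b)
    (hd : ∀ f, Val m n Y f → isC f → dd m a f = dd m b f) (hs : Sd K h a) : Sd K h b := by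
  haveI i1 : Fact (Lad m n Y) := ⟨h⟩
  obtain ⟨μ, hμ⟩ := h.cls a b hD hd
  exact SD.congr ((h.mr K).trans μ (fun f => hμ f.1 f.2)) hs

/-- normal form -/
def nf (D : ℤ) : Fac → ℤ
  | .row _ => 0
  | .col j => if j = 1 then -D else 0
  | .up _ _ => 0
  | .lo _ _ => D

lemma PA_nf (D : ℤ) (r : ℕ) : PA (nf D) r = 0 := Finset.sum_eq_zero fun _ _ => rfl
lemma PB_nf (D : ℤ) (r : ℕ) (hr : 1 ≤ r) : PB (nf D) r = -D := by
  induction r, hr using Nat.le_induction with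
  | base => simp [PB, nf]
  | succ r hr ih => rw [PB_succ, ih]; simp [nf]; omega
lemma DD_nf (D : ℤ) (hn : 1 ≤ n) : DD m n (nf D) = D := by rw [DD, PA_nf, PB_nf _ _ hn]; ring

/-- prefix sums -/
def pre {p : ℕ} (u : Fin p → ℕ) (r : ℕ) : ℕ := ∑ i ∈ Finset.range r, if h : i < p then u ⟨i, h⟩ else 0

lemma pre_zero {p : ℕ} (u : Fin p → ℕ) : pre u 0 = 0 := rfl
lemma pre_succ {p : ℕ} (u : Fin p → ℕ) (i : Fin p) : pre u (i + 1) = pre u i + u i := by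
  rw [pre, Finset.sum_range_succ, dif_pos i.2]; rfl
lemma pre_ge {p : ℕ} (u : Fin p → ℕ) (r : ℕ) (h : p ≤ r) : pre u r = ∑ i, u i := by
  induction r, h using Nat.le_induction with
  | base => rw [pre, Finset.sum_range]; simp
  | succ r hr ih => rw [← ih, pre, Finset.sum_range_succ, dif_neg (by omega)]; rfl
lemma pre_diff {p : ℕ} (A : ℕ → ℤ) (h0 : A 0 = 0) (h : ∀ i < p, A i ≤ A (i + 1)) :
    ∀ r ≤ p, (pre (fun i : Fin p => (A (i + 1) - A i).toNat) r : ℤ) = A r := by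
  intro r
  induction r with
  | zero => intro _; simp [pre_zero, h0]
  | succ r ih =>
    intro hr
    have := pre_succ (fun i : Fin p => (A (i + 1) - A i).toNat) ⟨r, hr⟩
    have h1 := h r hr
    have h2 := ih (by omega)
    simp only at this
    omega

lemma card_tup (p d : ℕ) : Nat.card {P : Fin p → ℕ // ∑ i, P i = d} = Nat.multichoose p d := by
  rw [← Nat.card_congr (Sym.equivNatSumOfFintype (Fin p) d), Nat.card_eq_fintype_card, Sym.card_sym_eq_multichoose]; simp

lemma mem_nf {D : ℤ} (hno : ∀ f, Val m n Y f → ¬ isC f) {x : LM m n} :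
    x ∈ box (wY m n Y) (fun f => nf D f.1) ↔ (∀ i < m, eA m n i x ≤ eA m n (i + 1) x) ∧
      ∀ j < n, eB m n j x - (if j = 0 then D else 0) ≤ eB m n (j + 1) x := by
  constructor
  · intro hx
    refine ⟨fun i hi => ?_, fun j hj => ?_⟩
    · have := hx ⟨.row (i + 1), by omega, hi⟩
      simp [wY, wt, nf] at this; omega
    · have := hx ⟨.col (j + 1), by omega, hj⟩
      simp [wY, wt, nf] at this; split_ifs at * <;> omega
  · rintro ⟨h1, h2⟩ ⟨f, hf⟩
    cases f with
    | row i =>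
      obtain ⟨h3, h4⟩ := hf
      obtain ⟨i, rfl⟩ : ∃ k, i = k + 1 := ⟨i - 1, by omega⟩
      have := h1 i h4; simp [wY, wt, nf]; omega
    | col i =>
      obtain ⟨h3, h4⟩ := hf
      obtain ⟨i, rfl⟩ : ∃ k, i = k + 1 := ⟨i - 1, by omega⟩
      have := h2 i h4; simp [wY, wt, nf]; split_ifs at * <;> omega
    | up c d => exact (hno _ hf trivial).elim
    | lo c d => exact (hno _ hf trivial).elim

lemma count_nf (hn : 1 ≤ n) {D : ℤ} (hno : ∀ f, Val m n Y f → ¬ isC f) {s t : ℕ} (hst : (s : ℤ) + D = t) (d : ℕ) :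
    {x | x ∈ box (wY m n Y) (fun f => nf D f.1) ∧ eA m n m x = s + d}.ncard = Nat.multichoose m (d + s) * Nat.multichoose n (d + t) := by
  rw [← card_tup, ← card_tup, ← Nat.card_prod, ← Nat.card_coe_set_eq]
  symm
  let g : {P : Fin m → ℕ // ∑ i, P i = d + s} × {P : Fin n → ℕ // ∑ i, P i = d + t} → LM m n := fun u =>
    ⟨(fun r => pre u.1.1 r, fun r => pre u.2.1 r - if r = 0 then 0 else D), by
      refine ⟨rfl, by simp [pre_zero], fun r hr => ?_, fun r hr => ?_, ?_⟩
      · simp only [pre_ge _ _ hr, pre_ge _ m le_rfl]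
      · simp only [pre_ge _ _ hr, pre_ge _ n le_rfl]
        simp only [ge_iff_le] at hr
        rw [if_neg (by omega), if_neg (by omega)]
      · simp only [pre_ge _ m le_rfl, pre_ge _ n le_rfl, u.1.2, u.2.2]
        rw [if_neg (by omega)]; push_cast; omega⟩
  have gA : ∀ u r, eA m n r (g u) = pre u.1.1 r := fun _ _ => rfl
  have gB : ∀ u r, eB m n r (g u) = pre u.2.1 r - if r = 0 then 0 else D := fun _ _ => rfl
  refine Nat.card_eq_of_bijective (fun u => ⟨g u, ?_, ?_⟩) ⟨?_, ?_⟩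
  · refine (mem_nf hno).2 ⟨fun i hi => ?_, fun j hj => ?_⟩
    · have := pre_succ u.1.1 ⟨i, hi⟩; simp only at this; rw [gA, gA, this]; push_cast; omega
    · have := pre_succ u.2.1 ⟨j, hj⟩; simp only at this; rw [gB, gB, this, if_neg (by omega : ¬ j + 1 = 0)]; push_cast; split_ifs <;> omega
  · rw [gA, pre_ge _ _ le_rfl, u.1.2]; push_cast; ring
  · intro u v huv
    have e : g u = g v := congrArg Subtype.val huv
    refine Prod.ext (Subtype.ext (funext fun i => ?_)) (Subtype.ext (funext fun i => ?_))
    · have h1 := pre_succ u.1.1 i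
      have h2 := pre_succ v.1.1 i
      have h3 := congrArg (eA m n i) e
      have h4 := congrArg (eA m n (i + 1)) e
      rw [gA, gA] at h3 h4; omega
    · have h1 := pre_succ u.2.1 i
      have h2 := pre_succ v.2.1 i
      have h3 := congrArg (eB m n i) e
      have h4 := congrArg (eB m n (i + 1)) e
      rw [gB, gB] at h3 h4; omega
  · rintro ⟨x, hx, hd⟩
    obtain ⟨h1, h2⟩ := (mem_nf hno).1 hx
    have pA := pre_diff (p := m) (fun r => eA m n r x) (eA_zero x) h1
    have pB := pre_diff (p := n) (fun r => eB m n r x + if r = 0 then 0 else D) (by simp [eB_zero]) (fun i hi => by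
      have := h2 i hi; split_ifs at * <;> omega)
    refine ⟨(⟨fun i => (eA m n (i + 1) x - eA m n i x).toNat, ?_⟩,
      ⟨fun i => ((eB m n (i + 1) x + if (i : ℕ) + 1 = 0 then 0 else D) - (eB m n i x + if (i : ℕ) = 0 then 0 else D)).toNat, ?_⟩),
      Subtype.ext (lm_ext (fun r hr => ?_) (fun r hr => ?_))⟩
    · have := pA m le_rfl; rw [pre_ge _ _ le_rfl] at this; apply Int.ofNat.inj; refine Eq.trans this ?_; simp only [Int.ofNat_eq_natCast, Nat.cast_add]; omega
    · have := pB n le_rfl; rw [pre_ge _ _ le_rfl, if_neg (by omega), eAB] at this; apply Int.ofNat.inj; refine Eq.trans this ?_; simp only [Int.ofNat_eq_natCast, Nat.cast_add]; omega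
    · rw [gA]; exact pA r hr
    · rw [gB]; simp only; rw [pB r hr]; ring

lemma nf_zero : nf 0 = fun _ => 0 := by funext f; cases f <;> simp [nf]

lemma hn_nf (hn1 : 1 ≤ n) {D : ℤ} (hno : ∀ f, Val m n Y f → ¬ isC f) {s t : ℕ} (hst : (s : ℤ) + D = t) :
    hnum m n Y (nf D) s = sgr m n s t * (1 - X) ^ (m + n - 1) := by
  rw [hnum, sgr]; congr 1; ext d
  rw [cs, coeff_mk, coeff_mk, count_nf hn1 hno hst]

lemma seg_aux (h : Lad m n Y) (hno : ∀ f, Val m n Y f → ¬ isC f) (a : Fac → ℤ) (hs : Sd K h a) (hf : Fi K h a) (hmn : m ≤ n) :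
    DD m n a = (m : ℤ) - n := by
  have hm := h.hm
  have z : ∀ j, coeff j (hnum m n Y (fun _ => 0) 0) = (((m - 1).choose j * (n - 1).choose j : ℕ) : ℤ) := by
    intro j
    have e := hn_nf (D := 0) (s := 0) (t := 0) (by omega) hno (by simp)
    rw [nf_zero] at e
    have := sgr_coeff 0 _ (m - 1) (n - 1) j le_rfl
    rw [show m - 1 + 0 + 1 = m by omega, show n - 1 + 1 = n by omega, show m + (n - 1) = m + n - 1 by omega] at this
    have e' : hnum m n Y (fun _ => 0) 0 = _ := e
    rw [e', this]; rfl
  have hσ : ∀ j > m - 1, coeff j (hnum m n Y (fun _ => 0) 0) = 0 := fun j hj => by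
    rw [z, Nat.choose_eq_zero_of_lt hj]; simp
  have hσ1 : coeff (m - 1) (hnum m n Y (fun _ => 0) 0) = ((n - 1).choose (m - 1) : ℤ) := by rw [z]; simp
  by_cases hD0 : DD m n a = 0
  · have := h.gl K a hD0 (fun f h1 h2 => (hno f h1 h2).elim) hf _ hσ
    rw [hσ1] at this
    by_contra hne
    have h4 := Nat.choose_succ_succ (n - 2) (m - 2)
    simp only [Nat.succ_eq_add_one] at h4
    rw [show n - 2 + 1 = n - 1 by omega, show m - 2 + 1 = m - 1 by omega] at h4
    have h6 : 0 < (n - 2).choose (m - 2) := Nat.choose_pos (by omega)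
    have h7 : 0 < (n - 2).choose (m - 1) := Nat.choose_pos (by omega)
    omega
  obtain ⟨s, t, hst, h0⟩ : ∃ s t : ℕ, (s : ℤ) + DD m n a = t ∧ (s = 0 ∨ t = 0) := by
    rcases le_total 0 (DD m n a) with h | h
    · exact ⟨0, (DD m n a).toNat, by simp; omega, Or.inl rfl⟩
    · exact ⟨(- DD m n a).toNat, 0, by simp; omega, Or.inr rfl⟩
  set D := DD m n a with hDdef
  have hs' : Sd K h (nf D) := h.Sd_cls K a _ (by rw [DD_nf _ (by omega)]) (fun f h1 h2 => (hno f h1 h2).elim) hs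
  have cnt0 := count_nf (Y := Y) (by omega : 1 ≤ n) hno hst 0
  simp only [Nat.cast_zero, add_zero, zero_add] at cnt0
  have hpos : 0 < Nat.multichoose m s * Nat.multichoose n t := by
    rw [Nat.multichoose_eq, Nat.multichoose_eq]
    exact Nat.mul_pos (Nat.choose_pos (by omega)) (Nat.choose_pos (by omega))
  have V := h.Vl K (nf D) hs' s (fun x hx => ?_) ?_ _ hσ
  · rw [hσ1, cnt0, hn_nf (by omega) hno hst] at V
    have := seg_num hm hmn h0 (by omega) V
    omega
  · obtain ⟨h1, h2⟩ := (mem_nf hno).1 hx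
    have a1 : ∀ r ≤ m, 0 ≤ eA m n r x := by
      intro r
      induction r with
      | zero => intro _; rw [eA_zero]
      | succ r ih => intro hr; have := ih (by omega); have := h1 r (by omega); omega
    have a2 : ∀ r, 1 ≤ r → r ≤ n → -D ≤ eB m n r x := by
      intro r hr
      induction r, hr using Nat.le_induction with
      | base => intro _; have := h2 0 (by omega); simp [eB_zero] at this; exact this
      | succ r hr ih => intro h3; have := ih (by omega); have := h2 r (by omega); rw [if_neg (by omega)] at this; omega
    have := a1 m le_rfl
    have := a2 n (by omega) le_rfl
    rw [eAB] at this
    omega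
  · rw [← cnt0] at hpos
    obtain ⟨x, hx⟩ := Set.nonempty_of_ncard_ne_zero hpos.ne'
    exact ⟨x, hx.1, hx.2⟩

theorem segH : SegH K := by
  intro m n Y h hno a hs hf
  rcases le_total m n with hmn | hmn
  · exact seg_aux K h hno a hs hf hmn
  · have := seg_aux K h.tr (fun f hf hc => hno _ (tT_val hf) (isC_T hc)) _ ((h.pieceT K a).1 hs) ((h.pieceT K a).2 hf) hmn
    rw [DD_T] at this; omega
end A

end

section

section A
open PowerSeries
variable {m n : ℕ} {Y : Set (ℕ × ℕ)} (K : Type) [Field K]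

lemma cmA {x : LM m n} (h : x ∈ Cone m n Y) {r s : ℕ} (hr : r ≤ s) : eA m n r x ≤ eA m n s x := cone_monoA h hr
lemma cmB {x : LM m n} (h : x ∈ Cone m n Y) {r s : ℕ} (hr : r ≤ s) : eB m n r x ≤ eB m n s x := cone_monoB h hr

/-- graded piece of a face -/
def fset (m n : ℕ) (Y : Set (ℕ × ℕ)) (p q : ℕ) (d : ℤ) : Set (LM m n) := {x | x ∈ Cone m n Y ∧ Fc p q x ∧ eA m n m x = d}

/-- Hilbert series of a face -/
noncomputable def fs (m n : ℕ) (Y : Set (ℕ × ℕ)) (p q : ℕ) : PowerSeries ℤ := mk fun d => ((fset m n Y p q d).ncard : ℤ)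

lemma Lad.fset_fin (h : Lad m n Y) (p q : ℕ) (d : ℤ) : (fset m n Y p q d).Finite :=
  (h.gd.fin 0 d).subset fun _ hx => ⟨hx.1, hx.2.2⟩

lemma fset_sub1 (p q : ℕ) (d : ℤ) : fset m n Y (p + 1) q d ⊆ fset m n Y p q d := by
  rintro x ⟨h1, h2, h3⟩
  refine ⟨h1, ⟨?_, h2.2⟩, h3⟩
  have h4 := cmA h1 (show p - 1 ≤ p + 1 - 1 by omega)
  have := cone_A h1 (p - 1)
  have := h2.1; omega
lemma fset_sub2 (p q : ℕ) (d : ℤ) : fset m n Y p (q - 1) d ⊆ fset m n Y p q d := by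
  rintro x ⟨h1, h2, h3⟩
  refine ⟨h1, ⟨h2.1, ?_⟩, h3⟩
  have h4 := cmB h1 (show q - 1 ≤ q by omega)
  have := cone_B h1 q
  have := h2.2; omega

lemma fset_inter (p q : ℕ) (d : ℤ) : fset m n Y (p + 1) q d ∩ fset m n Y p (q - 1) d = fset m n Y (p + 1) (q - 1) d := by
  apply Set.Subset.antisymm
  · rintro x ⟨⟨h1, h2, h3⟩, ⟨_, h5, _⟩⟩
    exact ⟨h1, ⟨h2.1, h5.2⟩, h3⟩
  · intro x hx
    exact ⟨fset_sub2 _ _ _ hx, fset_sub1 _ _ _ hx⟩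

lemma fset_FL (g : 1 ≤ p ∧ p ≤ m ∧ 1 ≤ q ∧ q ≤ n) {d : ℤ} {x : LM m n} :
    x ∈ fset m n Y p q d \ (fset m n Y (p + 1) q d ∪ fset m n Y p (q - 1) d) ↔ x ∈ Cone m n Y ∧ FL x p q ∧ eA m n m x = d := by
  constructor
  · rintro ⟨⟨h1, h2, h3⟩, h4⟩
    refine ⟨h1, ⟨g.1, g.2.1, g.2.2.1, g.2.2.2, h2.1, ?_, h2.2, ?_⟩, h3⟩
    · have := cone_A h1 p
      refine lt_of_le_of_ne this.1 fun hh => h4 (Or.inl ⟨h1, ⟨hh.symm, h2.2⟩, h3⟩)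
    · have := cone_B h1 (q - 1)
      refine lt_of_le_of_ne this.2 fun hh => h4 (Or.inr ⟨h1, ⟨h2.1, hh⟩, h3⟩)
  · rintro ⟨h1, h2, h3⟩
    refine ⟨⟨h1, ⟨h2.a0, h2.b0⟩, h3⟩, ?_⟩
    rintro (⟨_, h4, _⟩ | ⟨_, h4, _⟩)
    · have := h4.1; have := h2.a1; simp only [Nat.add_sub_cancel] at *; omega
    · have := h4.2; have := h2.b1; omega

lemma Lad.fset_shift (h : Lad m n Y) {p q : ℕ} (hp : (p, q) ∈ Y) (d : ℤ) :
    (fset m n Y p q d \ (fset m n Y (p + 1) q d ∪ fset m n Y p (q - 1) d)).ncard = (fset m n Y p q (d - 1)).ncard := by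
  have g := h.grid hp
  symm
  have e : (fun x => x + edge m n (p, q)) '' fset m n Y p q (d - 1) = fset m n Y p q d \ (fset m n Y (p + 1) q d ∪ fset m n Y p (q - 1) d) := by
    ext x
    rw [fset_FL g]
    constructor
    · rintro ⟨y, ⟨h1, h2, h3⟩, rfl⟩
      refine ⟨cone_add h1 (h.edge_cone hp), ⟨g.1, g.2.1, g.2.2.1, g.2.2.2, ?_, ?_, ?_, ?_⟩, ?_⟩ <;>
        simp only [map_add, eA_edge g, eB_edge g]
      · rw [h2.1, if_neg (by omega)]; rfl
      · have := cone_A h1 p; rw [if_pos le_rfl]; omega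
      · rw [h2.2, if_pos le_rfl, if_pos g.2.1]
      · have := cone_B h1 (q - 1); rw [if_neg (by omega), if_pos g.2.1]; omega
      · rw [h3, if_pos g.2.1]; ring
    · rintro ⟨h1, h2, h3⟩
      refine ⟨x - edge m n (p, q), ⟨h.FL_sub h1 h2, ⟨?_, ?_⟩, ?_⟩, by simp⟩ <;> simp only [map_sub, eA_edge g, eB_edge g]
      · rw [h2.a0, if_neg (by omega)]; rfl
      · rw [h2.b0, if_pos le_rfl, if_pos g.2.1]
      · rw [h3, if_pos g.2.1]
  rw [← e, Set.ncard_image_of_injective _ (add_left_injective _)]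

lemma Lad.fs_rec (h : Lad m n Y) {p q : ℕ} (hp : (p, q) ∈ Y) :
    (1 - X) * fs m n Y p q = fs m n Y (p + 1) q + fs m n Y p (q - 1) - fs m n Y (p + 1) (q - 1) := by
  have key : ∀ d : ℤ, (fset m n Y p q d).ncard + (fset m n Y (p + 1) (q - 1) d).ncard =
      (fset m n Y p q (d - 1)).ncard + ((fset m n Y (p + 1) q d).ncard + (fset m n Y p (q - 1) d).ncard) := by
    intro d
    have h1 := Set.ncard_sdiff_add_ncard_of_subset (Set.union_subset (fset_sub1 p q d) (fset_sub2 (m := m) (n := n) (Y := Y) p q d)) (h.fset_fin p q d)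
    have h2 := Set.ncard_union_add_ncard_inter _ _ (h.fset_fin (p + 1) q d) (h.fset_fin p (q - 1) d)
    rw [h.fset_shift hp] at h1
    rw [fset_inter] at h2
    omega
  ext d
  cases d with
  | zero =>
    rw [coeff_oneX0]
    have := key 0
    have h0 : fset m n Y p q (0 - 1) = ∅ := by
      ext x; simp only [fset, Set.mem_setOf_eq, Set.mem_empty_iff_false, iff_false]
      rintro ⟨h1, -, h3⟩
      have := cone_A h1 m; omega
    rw [h0, Set.ncard_empty] at this
    simp only [fs, map_sub, map_add, coeff_mk, Nat.cast_zero]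
    omega
  | succ d =>
    rw [coeff_oneX]
    have := key (d + 1)
    rw [show (d : ℤ) + 1 - 1 = d by ring] at this
    simp only [fs, map_sub, map_add, coeff_mk, Nat.cast_succ]
    omega

lemma Lad.fs_one (h : Lad m n Y) {p q : ℕ} (hp : (p, q) ∈ Y) (hno : (p + 1, q) ∉ Y) : fs m n Y (p + 1) q = fs m n Y (p + 1) (q - 1) := by
  have g := h.grid hp
  ext d
  simp only [fs, coeff_mk]
  congr 2
  refine Set.Subset.antisymm (fun x hx => ?_) (fset_sub2 _ _ _)
  obtain ⟨h1, h2, h3⟩ := hx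
  refine ⟨h1, ⟨h2.1, ?_⟩, h3⟩
  by_contra hne
  have hq := cone_B h1 (q - 1)
  obtain ⟨p', q', hf⟩ := exists_FL h1 (fun h0 => hne (by omega))
  have hm := h.FL_mem h1 hf
  have i1 : p + 1 ≤ p' := by
    by_contra hh
    have := cmA h1 (show p' ≤ p + 1 - 1 by omega)
    have := hf.a1; have := h2.1; omega
  have i2 : q' ≤ q := by
    by_contra hh
    have := cmB h1 (show q ≤ q' - 1 by omega)
    have := hf.b1; have := h2.2; omega
  have i3 : q ≤ q' := by
    by_contra hh
    have := cmB h1 (show q' ≤ q - 1 by omega)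
    have := hf.b0; omega
  obtain rfl : q' = q := by omega
  exact hno (h.col hp hm (by omega) i1)

lemma Lad.fs_two (h : Lad m n Y) {p q : ℕ} (hp : (p, q) ∈ Y) (hno : (p, q - 1) ∉ Y) : fs m n Y p (q - 1) = fs m n Y (p + 1) (q - 1) := by
  have g := h.grid hp
  ext d
  simp only [fs, coeff_mk]
  congr 2
  refine Set.Subset.antisymm (fun x hx => ?_) (fset_sub1 _ _ _)
  obtain ⟨h1, h2, h3⟩ := hx
  refine ⟨h1, ⟨?_, h2.2⟩, h3⟩
  rw [Nat.add_sub_cancel]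
  by_contra hne
  have hq := cone_A h1 p
  obtain ⟨p', q', hf⟩ := exists_FL h1 (fun h0 => hne (by omega))
  have hm := h.FL_mem h1 hf
  have i1 : p ≤ p' := by
    by_contra hh
    have := cmA h1 (show p' ≤ p - 1 by omega)
    have := hf.a1; have := h2.1; omega
  have i2 : q' ≤ q - 1 := by
    by_contra hh
    have := cmB h1 (show q - 1 ≤ q' - 1 by omega)
    have := hf.b1; have := h2.2; omega
  have i3 : p' ≤ p := by
    by_contra hh
    have := cmA h1 (show p ≤ p' - 1 by omega)
    have := hf.a0; omega
  obtain rfl : p' = p := by omega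
  exact hno (h.row hm hp i2 (by omega))

/-- numerator of a face -/
noncomputable def fh (m n : ℕ) (Y : Set (ℕ × ℕ)) (p q : ℕ) : PowerSeries ℤ := fs m n Y p q * (1 - X) ^ (m + q - p)

lemma Lad.fh_both (h : Lad m n Y) {p q : ℕ} (hp : (p, q) ∈ Y) (h1 : (p + 1, q) ∈ Y) (h2 : (p, q - 1) ∈ Y) :
    fh m n Y p q = fh m n Y (p + 1) q + fh m n Y p (q - 1) - (1 - X) * fh m n Y (p + 1) (q - 1) := by
  have g1 := h.grid h1
  have g2 := h.grid h2
  obtain ⟨E, hE⟩ : ∃ E, m + q - p = E + 2 := ⟨m + q - p - 2, by omega⟩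
  rw [fh, fh, fh, fh, hE, show m + q - (p + 1) = E + 1 by omega, show m + (q - 1) - p = E + 1 by omega,
    show m + (q - 1) - (p + 1) = E by omega]
  linear_combination (1 - X) ^ (E + 1) * h.fs_rec hp
lemma Lad.fh_one (h : Lad m n Y) {p q : ℕ} (hp : (p, q) ∈ Y) (h1 : (p + 1, q) ∈ Y) (h2 : (p, q - 1) ∉ Y) :
    fh m n Y p q = fh m n Y (p + 1) q := by
  have g1 := h.grid h1
  obtain ⟨E, hE⟩ : ∃ E, m + q - p = E + 1 := ⟨m + q - p - 1, by omega⟩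
  rw [fh, fh, hE, show m + q - (p + 1) = E by omega]
  linear_combination (1 - X) ^ E * h.fs_rec hp + (1 - X) ^ E * h.fs_two hp h2
lemma Lad.fh_two (h : Lad m n Y) {p q : ℕ} (hp : (p, q) ∈ Y) (h1 : (p + 1, q) ∉ Y) (h2 : (p, q - 1) ∈ Y) :
    fh m n Y p q = fh m n Y p (q - 1) := by
  have g2 := h.grid h2
  have g := h.grid hp
  obtain ⟨E, hE⟩ : ∃ E, m + q - p = E + 1 := ⟨m + q - p - 1, by omega⟩
  rw [fh, fh, hE, show m + (q - 1) - p = E by omega]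
  linear_combination (1 - X) ^ E * h.fs_rec hp + (1 - X) ^ E * h.fs_one hp h1

lemma Lad.fh_base (h : Lad m n Y) : fh m n Y m 1 = 1 := by
  have hp : (m, 1) ∈ Y := h.sw
  have h1 : (m + 1, 1) ∉ Y := fun hh => by have := h.grid hh; omega
  have e : fs m n Y m 0 = 1 := by
    ext d
    rw [fs, coeff_mk, coeff_one]
    have : fset m n Y m 0 d = if d = 0 then {0} else ∅ := by
      ext x
      constructor
      · rintro ⟨h1, h2, h3⟩
        have h4 : eA m n m x = 0 := by rw [← h2.2, eB_zero]
        rw [if_pos (by omega), Set.mem_singleton_iff]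
        exact h.gd.zero x h1 h4
      · intro hx
        split_ifs at hx with h0
        · rw [Set.mem_singleton_iff] at hx
          subst hx h0
          exact ⟨fun i => by simp, ⟨map_zero _, by simp⟩, by simp⟩
        · exact hx.elim
    rw [this]; split_ifs <;> simp
  have := h.fs_rec hp
  rw [h.fs_one hp h1, show 1 - 1 = 0 from rfl, e] at this
  rw [fh, show m + 1 - m = 1 by omega]
  linear_combination this

lemma Lad.fh_van (h : Lad m n Y) : ∀ N p q : ℕ, (p, q) ∈ Y → m + q - p ≤ N → ∀ j, min (m + 1 - p) q ≤ j → coeff j (fh m n Y p q) = 0 := by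
  intro N
  induction N with
  | zero => intro p q hp hN; have := h.grid hp; omega
  | succ N ih =>
    intro p q hp hN j hj
    have g := h.grid hp
    by_cases hb : p = m ∧ q = 1
    · obtain ⟨rfl, rfl⟩ := hb
      rw [h.fh_base, coeff_one, if_neg (by omega)]
    by_cases h1 : (p + 1, q) ∈ Y
    · have g1 := h.grid h1
      have e1 := ih _ _ h1 (by omega)
      by_cases h2 : (p, q - 1) ∈ Y
      · have g2 := h.grid h2
        have e2 := ih _ _ h2 (by omega)
        have e3 := ih _ _ (h.sq h2 h1 (by omega) (by omega)).2 (by omega)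
        obtain ⟨j, rfl⟩ : ∃ i, j = i + 1 := ⟨j - 1, by omega⟩
        rw [h.fh_both hp h1 h2, map_sub, map_add, coeff_oneX, e1 _ (by omega), e2 _ (by omega), e3 _ (by omega), e3 _ (by omega)]; rfl
      · rw [h.fh_one hp h1 h2, e1 _ (by omega)]
    · rcases h.next hp hb with hh | h2
      · exact (h1 hh).elim
      have g2 := h.grid h2
      rw [h.fh_two hp h1 h2, ih _ _ h2 (by omega) _ (by omega)]

lemma Lad.fh_top (h : Lad n n Y) (hY : ∀ p q, 1 ≤ p → p ≤ n → 1 ≤ q → q ≤ n → n ≤ p + q → p + q ≤ n + 2 → (p, q) ∈ Y) :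
    ∀ q p : ℕ, 1 ≤ q → p + q = n + 1 → 1 ≤ p → coeff (q - 1) (fh n n Y p q) = 1 := by
  intro q p hq
  induction q, hq using Nat.le_induction generalizing p with
  | base => 
    intro hpq _
    obtain rfl : p = n := by omega
    rw [h.fh_base]; simp
  | succ q hq ih =>
    intro hpq hp
    have k1 := hY (p + 1) (q + 1) (by omega) (by omega) (by omega) (by omega) (by omega) (by omega)
    have k2 := hY p q (by omega) (by omega) (by omega) (by omega) (by omega) (by omega)
    have k3 := hY (p + 1) q (by omega) (by omega) (by omega) (by omega) (by omega) (by omega)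
    have k := hY p (q + 1) (by omega) (by omega) (by omega) (by omega) (by omega) (by omega)
    obtain ⟨q, rfl⟩ : ∃ i, q = i + 1 := ⟨q - 1, by omega⟩
    have e3 := ih (p + 1) (by omega) (by omega)
    simp only [Nat.add_sub_cancel] at e3
    rw [h.fh_both k k1 k2]
    simp only [Nat.add_sub_cancel]
    rw [map_sub, map_add, coeff_oneX, e3, h.fh_van _ _ _ k1 le_rfl _ (by omega), h.fh_van _ _ _ k2 le_rfl _ (by omega),
      h.fh_van _ _ _ k3 le_rfl _ (by omega)]
    rfl

lemma Lad.hnum_zero (h : Lad m n Y) : hnum m n Y (fun _ => 0) 0 = fh m n Y 1 n := by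
  rw [hnum, fh, show m + n - 1 = m + n - 1 from rfl]
  congr 1
  ext d
  rw [cs, fs, coeff_mk, coeff_mk]
  congr 2
  ext x
  constructor
  · rintro ⟨h1, h2⟩
    exact ⟨h1, ⟨eA_zero x, eAB x⟩, by rw [h2]; simp⟩
  · rintro ⟨h1, -, h3⟩
    exact ⟨h1, by rw [h3]; simp⟩

theorem killH : KillH K := by
  intro n Y h e a he hu hl hD hs
  have hn := h.hn
  have hs' : Sd K h (nf (-e)) := by
    refine h.Sd_cls K a _ (by rw [DD_nf _ (by omega), hD]) (fun f h1 h2 => ?_) hs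
    cases f with
    | row i => exact h2.elim
    | col i => exact h2.elim
    | up c d =>
      have g := h.up_grid h1
      rw [(hu c d h1).2, dd, PA_nf, PA_nf, PB_nf _ _ (by omega)]; simp [nf]
    | lo c d =>
      have g := h.lo_grid h1
      rw [(hl c d h1).2, dd, PA_nf, PA_nf, PB_nf _ _ (by omega)]; simp [nf]
  have hY : ∀ p q, 1 ≤ p → p ≤ n → 1 ≤ q → q ≤ n → n ≤ p + q → p + q ≤ n + 2 → (p, q) ∈ Y := by
    intro p q h1 h2 h3 h4 h5 h6
    by_contra hno
    rcases h.miss ⟨h1, h2, h3, h4⟩ hno with ⟨c, d, hc, i1, i2⟩ | ⟨c, d, hc, i1, i2⟩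
    · have := (hu c d hc).1; rw [de] at this; omega
    · have := (hl c d hc).1; rw [de] at this; omega
  have k1 := hY 1 n le_rfl (by omega) (by omega) le_rfl (by omega) (by omega)
  have hσ : ∀ j > n - 1, coeff j (hnum n n Y (fun _ => 0) 0) = 0 := fun j hj => by
    rw [h.hnum_zero]; exact h.fh_van _ _ _ k1 le_rfl _ (by omega)
  have ht : coeff (n - 1) (hnum n n Y (fun _ => 0) 0) = 1 := by
    rw [h.hnum_zero]; exact h.fh_top hY n 1 (by omega) (by omega) le_rfl
  have hbox : ∀ i, 1 ≤ i → i ≤ 2 → e • edge n n (i, 1) ∈ box (wY n n Y) (fun f => nf (-e) f.1) ∧ eA n n n (e • edge n n (i, 1)) = e := by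
    intro i hi hi2
    have g : 1 ≤ i ∧ i ≤ n ∧ 1 ≤ 1 ∧ 1 ≤ n := ⟨hi, by omega, le_rfl, by omega⟩
    have vA : ∀ r, eA n n r (e • edge n n (i, 1)) = if i ≤ r then e else 0 := fun r => by
      rw [map_zsmul, eA_edge g]; split_ifs <;> simp
    have vB : ∀ r, eB n n r (e • edge n n (i, 1)) = if 1 ≤ r then e else 0 := fun r => by
      rw [map_zsmul, eB_edge g]; split_ifs <;> simp
    refine ⟨?_, by rw [vA, if_pos (by omega)]⟩
    rintro ⟨f, hf⟩
    cases f with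
    | row j => 
      simp only [wY, wt, nf, AddMonoidHom.sub_apply, vA]; split_ifs <;> omega
    | col j =>
      have : 1 ≤ j := hf.1
      simp only [wY, wt, nf, AddMonoidHom.sub_apply, vB]; split_ifs <;> omega
    | up c d =>
      have g := h.up_grid hf
      simp only [wY, wt, nf, AddMonoidHom.sub_apply, AddMonoidHom.add_apply, vA, vB]; split_ifs <;> omega
    | lo c d =>
      simp only [wY, wt, nf, AddMonoidHom.sub_apply, vA, vB]; split_ifs <;> omega
  have V := h.Vl K _ hs' e (fun x hx => ?_) ⟨_, hbox 1 le_rfl (by omega)⟩ _ hσ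
  · rw [ht] at V
    have h1 : {x | x ∈ box (wY n n Y) (fun f => nf (-e) f.1) ∧ eA n n n x = e}.ncard = 1 := by
      have := Int.isUnit_iff.1 (IsUnit.of_mul_eq_one _ V.symm); omega
    obtain ⟨y, hy⟩ := Set.ncard_eq_one.1 h1
    have e1 : e • edge n n (1, 1) ∈ ({y} : Set (LM n n)) := hy ▸ hbox 1 le_rfl (by omega)
    have e2 : e • edge n n (2, 1) ∈ ({y} : Set (LM n n)) := hy ▸ hbox 2 (by omega) le_rfl
    rw [Set.mem_singleton_iff] at e1 e2
    have e3 := congrArg (eA n n 1) (e1.trans e2.symm)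
    rw [map_zsmul, map_zsmul, eA_edge ⟨le_rfl, by omega, le_rfl, by omega⟩, eA_edge ⟨by omega, by omega, le_rfl, by omega⟩] at e3
    simp at e3; omega
  · have a2 : ∀ r, 1 ≤ r → r ≤ n → e ≤ eB n n r x := by
      intro r hr
      induction r, hr using Nat.le_induction with
      | base =>
        intro _
        have := hx ⟨.col 1, le_rfl, by omega⟩
        simp [wY, wt, nf, eB_zero] at this; exact this
      | succ r hr ih =>
        intro h3
        have := hx ⟨.col (r + 1), by omega, h3⟩
        simp only [wY, wt, nf, AddMonoidHom.sub_apply, Nat.add_sub_cancel] at this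
        rw [if_neg (by omega)] at this
        have := ih (by omega); omega
    have := a2 n (by omega) le_rfl
    rwa [eAB] at this
end A

end

section

lemma main_aux (m n h κ : ℕ) (K : Type) [Field K] (hseg : SegH K) (hkill : KillH K)
    (Y : Set (ℕ × ℕ)) (hY : StdLadder m n Y) (hconn : TConnected m n 2 Y)
    (htwo : TwoSided Y)
    (hh : {p | IsLowerCorner Y p}.ncard = h) (hκ : {p | IsUpperCorner Y p}.ncard = κ)
    (hnc : ∀ p, ¬ (IsLowerCorner Y p ∧ IsUpperCorner Y p))
    (hind : ∀ m' n' : ℕ, ∀ Z : Set (ℕ × ℕ), StdLadder m' n' Z →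
      TConnected m' n' 2 Z →
      (∀ p, ¬ (IsLowerCorner Z p ∧ IsUpperCorner Z p)) →
      {p | IsLowerCorner Z p}.ncard + {p | IsUpperCorner Z p}.ncard < h + κ →
      ∀ C : ModuleCat.{0} (LadderRing K 2 Z), IsSemidualizing C →
        Nonempty (C ≅ ModuleCat.of (LadderRing K 2 Z) (LadderRing K 2 Z)) ∨
        ∃ D : ModuleCat.{0} (LadderRing K 2 Z),
          IsSemidualizing D ∧ HasFiniteInjDim D ∧ Nonempty (C ≅ D))
    (C : Fin 5 → ModuleCat.{0} (LadderRing K 2 Y))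
    (hC : ∀ i, IsSemidualizing (C i)) :
    ∃ i j, i ≠ j ∧ Nonempty (C i ≅ C j) := by
  obtain ⟨-, ⟨⟨p, q⟩, hl⟩, ⟨⟨c, d⟩, hu⟩⟩ := htwo
  have g1 := hY.1.1 _ hl.1
  have g2 := hY.1.1 _ hl.2.1
  have g3 := hY.1.1 _ hl.2.2.1
  simp only [InGrid] at g1 g2 g3
  have L : Lad m n Y := lad_of (by omega) (by omega) hY hconn
  haveI : Fact (Lad m n Y) := ⟨L⟩
  have hi : HI K (h + κ) := by
    intro m' n' Z hZ hn hc a hs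
    haveI : Fact (Lad m' n' Z) := ⟨hZ⟩
    rcases hind m' n' Z hZ.std hZ.tconn hn hc _ (isSemi_of_sd hs) with ⟨⟨e⟩⟩ | ⟨D, hD, hf, ⟨e⟩⟩
    · exact Or.inl (hZ.of_reg K a e.toLinearEquiv.symm)
    · exact Or.inr (fi_all K hseg hZ a hs (FID.congr e.toLinearEquiv.symm (fid_of_hasFID D hf)))
  haveI := L.finFct
  haveI := L.noeth K
  haveI : IsDomain (AddMonoidAlgebra K (LM m n)) := dom_L _ _
  haveI : UniqueFactorizationMonoid (AddMonoidAlgebra K (LM m n)) := ufd_L _ _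
  choose b e using fun i => (L.mr K).thm1 (sd_of_isSemi (C i) (hC i))
  classical
  let a : Fin 5 → Fac → ℤ := fun i f => if hf : Val m n Y f then b i ⟨f, hf⟩ else 0
  have hb : ∀ i, (fun f : Fct m n Y => a i f.1) = b i := fun i => funext fun f => dif_pos f.2
  have hs : ∀ i, Sd K L (a i) := by
    intro i
    have := SD.congr (e i).some (sd_of_isSemi (C i) (hC i))
    rw [← hb i] at this
    exact this
  have hN : cnt Y ≤ h + κ := by rw [cnt, hh, hκ]
  have key : ∃ i j, i ≠ j ∧ Same m n Y (a i) (a j) := by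
    by_cases hF : ∀ p q c d, IsLowerCorner Y (p, q) → IsUpperCorner Y (c, d) → c < p ∨ d < q
    · exact final1 K hi L hnc hN a hs ⟨_, hu⟩ hF
    · push Not at hF
      obtain ⟨p, q, c, d, h1, h2, h3, h4⟩ := hF
      exact final2 K hi hkill L hnc hN a hs h1 h2 h3 h4
  obtain ⟨i, j, hij, hD, hd⟩ := key
  obtain ⟨μ, hμ⟩ := L.cls _ _ hD hd
  refine ⟨i, j, hij, ⟨LinearEquiv.toModuleIso ?_⟩⟩
  have θ := (L.mr K).trans (a := fun f => a i f.1) (b := fun f => a j f.1) μ (fun f => hμ f.1 f.2)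
  rw [hb i, hb j] at θ
  exact ((e i).some.trans θ).trans (e j).some.symm

end

/-- Let `Y` be a two-sided `2`-connected ladder with `h ≥ 1` lower and
`κ ≥ 1` upper inside corners, no lower inside corner equal to an upper one. Assume that
for every `2`-connected ladder `Z` with fewer than `h + κ` inside corners, no two of
which coincide, every semidualizing `R_2(Z)`-module is isomorphic either to `R_2(Z)` or
to a semidualizing module of finite injective dimension. Then `R_2(Y)` has at most four
semidualizing modules up to isomorphism: among any five semidualizing modules, two are
isomorphic. -/
theorem twoSided_atMostFour_semidualizing (m n h κ : ℕ) (K : Type) [Field K]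
    (Y : Set (ℕ × ℕ)) (hY : StdLadder m n Y) (hconn : TConnected m n 2 Y)
    (htwo : TwoSided Y)
    (hh : {p | IsLowerCorner Y p}.ncard = h) (hκ : {p | IsUpperCorner Y p}.ncard = κ)
    (h1 : 1 ≤ h) (κ1 : 1 ≤ κ)
    (hnc : ∀ p, ¬ (IsLowerCorner Y p ∧ IsUpperCorner Y p))
    (hind : ∀ m' n' : ℕ, ∀ Z : Set (ℕ × ℕ), StdLadder m' n' Z →
      TConnected m' n' 2 Z →
      (∀ p, ¬ (IsLowerCorner Z p ∧ IsUpperCorner Z p)) →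
      {p | IsLowerCorner Z p}.ncard + {p | IsUpperCorner Z p}.ncard < h + κ →
      ∀ C : ModuleCat.{0} (LadderRing K 2 Z), IsSemidualizing C →
        Nonempty (C ≅ ModuleCat.of (LadderRing K 2 Z) (LadderRing K 2 Z)) ∨
        ∃ D : ModuleCat.{0} (LadderRing K 2 Z),
          IsSemidualizing D ∧ HasFiniteInjDim D ∧ Nonempty (C ≅ D))
    (C : Fin 5 → ModuleCat.{0} (LadderRing K 2 Y))
    (hC : ∀ i, IsSemidualizing (C i)) :
    ∃ i j, i ≠ j ∧ Nonempty (C i ≅ C j) := by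
  exact main_aux m n h κ K (segH K) (killH K) Y hY hconn htwo hh hκ hnc hind C hC

end LadderDet
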